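/- For every integer r ≥ 2 there exists n₀ = n₀(r) such that the following holds for all n ≥ n₀: every graph G on n vertices whose edges are coloured with r colours and which satisfies δ(G) ≥ n/2 + 1200·r·log n admits a partition of its vertex set into at most 10⁷·r² vertex-disjoint monochromatic cycles. -/

import Mathlib

/-!
STATEMENT 0: For every integer `r ≥ 2` there exists `n₀` such that every `r`-edge-coloured
graph on `n ≥ n₀` vertices with minimum degree at least `n/2 + 1200·r·log n` admits a
partition of its vertex set into at most `10⁷·r²` vertex-disjoint monochromatic cycles
(the empty set, single vertices and single edges count as degenerate cycles).
-/

namespace Paper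

variable {V : Type*}

/-- `S` is the vertex set of a monochromatic proper cycle of `G` under the colouring `c`. -/
def IsMonoProperCycle {r : ℕ} (G : SimpleGraph V) (c : Sym2 V → Fin r) (S : Set V) : Prop :=
  ∃ (i : Fin r) (v : V) (w : G.Walk v v), w.IsCycle ∧ (∀ e ∈ w.edges, c e = i) ∧
    S = {x | x ∈ w.support}

/-- `S` is a (possibly degenerate) monochromatic cycle: the empty set, a single vertex,
a single edge, or a monochromatic proper cycle. -/
def IsMonoCycle {r : ℕ} (G : SimpleGraph V) (c : Sym2 V → Fin r) (S : Set V) : Prop :=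
  S = ∅ ∨ (∃ v, S = {v}) ∨ (∃ u v, G.Adj u v ∧ S = {u, v}) ∨ IsMonoProperCycle G c S

/-- The vertex set of `G` can be partitioned into at most `k` vertex-disjoint
monochromatic cycles. -/
def MonoCyclePartition {r : ℕ} (G : SimpleGraph V) (c : Sym2 V → Fin r) (k : ℕ) : Prop :=
  ∃ f : Fin k → Set V,
    (∀ i j : Fin k, i ≠ j → Disjoint (f i) (f j)) ∧
    (⋃ i, f i) = Set.univ ∧
    ∀ i, IsMonoCycle G c (f i)

section Basics
open Finset
open scoped Classical
variable {V : Type*}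

/-- Number of `R`-neighbours of `v` in `T`. -/
noncomputable def dg (R : V → V → Prop) (v : V) (T : Finset V) : ℕ := (T.filter (R v)).card

/-- Number of ordered `R`-related pairs from `S` to `T`. -/
noncomputable def ed (R : V → V → Prop) (S T : Finset V) : ℕ := ∑ v ∈ S, dg R v T

variable {R : V → V → Prop}

lemma dg_mono {v : V} {T T' : Finset V} (h : T ⊆ T') : dg R v T ≤ dg R v T' :=
  card_le_card (filter_subset_filter _ h)

lemma dg_le_card (v : V) (T : Finset V) : dg R v T ≤ T.card := card_filter_le _ _

lemma dg_le_sdiff_add (v : V) (T U : Finset V) : dg R v T ≤ dg R v (T \ U) + U.card := by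
  unfold dg
  calc (T.filter (R v)).card ≤ ((T \ U).filter (R v) ∪ U).card := by
        apply card_le_card
        intro x hx
        simp only [mem_filter, mem_union, mem_sdiff] at *
        tauto
    _ ≤ _ := card_union_le _ _

lemma dg_union_le (v : V) (T U : Finset V) : dg R v (T ∪ U) ≤ dg R v T + dg R v U := by
  unfold dg
  rw [filter_union]
  exact card_union_le _ _

lemma dg_union (v : V) {T U : Finset V} (h : Disjoint T U) :
    dg R v (T ∪ U) = dg R v T + dg R v U := by
  unfold dg
  rw [filter_union, card_union_of_disjoint]
  exact disjoint_filter_filter h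

lemma dg_biUnion {ι : Type*} (v : V) (s : Finset ι) (T : ι → Finset V)
    (h : (s : Set ι).PairwiseDisjoint T) :
    dg R v (s.biUnion T) = ∑ i ∈ s, dg R v (T i) := by
  unfold dg
  rw [filter_biUnion, card_biUnion]
  intro i hi j hj hij
  exact disjoint_filter_filter (h hi hj hij)

lemma dg_rel_le {R' : V → V → Prop} (h : ∀ u v, R u v → R' u v) (v : V) (T : Finset V) :
    dg R v T ≤ dg R' v T :=
  card_le_card fun x hx => by
    simp only [mem_filter] at *
    exact ⟨hx.1, h _ _ hx.2⟩

lemma ed_mono {S S' T T' : Finset V} (hS : S ⊆ S') (hT : T ⊆ T') : ed R S T ≤ ed R S' T' :=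
  (sum_le_sum fun _ _ => dg_mono hT).trans
    (sum_le_sum_of_subset hS)

lemma ed_le_card_mul (S T : Finset V) : ed R S T ≤ S.card * T.card := by
  unfold ed
  calc _ ≤ ∑ _v ∈ S, T.card := sum_le_sum fun _ _ => dg_le_card _ _
    _ = _ := by simp

lemma ed_comm (hR : ∀ ⦃u v⦄, R u v → R v u) (S T : Finset V) : ed R S T = ed R T S := by
  unfold ed dg
  simp only [card_filter]
  rw [sum_comm]
  refine sum_congr rfl fun x _ => sum_congr rfl fun y _ => ?_
  have : R y x ↔ R x y := ⟨fun h => hR h, fun h => hR h⟩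
  simp [this]

lemma ed_union_left {S S' : Finset V} (h : Disjoint S S') (T : Finset V) :
    ed R (S ∪ S') T = ed R S T + ed R S' T := sum_union h

lemma ed_union_right (S : Finset V) {T T' : Finset V} (h : Disjoint T T') :
    ed R S (T ∪ T') = ed R S T + ed R S T' := by
  unfold ed
  rw [← sum_add_distrib]
  exact sum_congr rfl fun v _ => dg_union v h

lemma ed_biUnion_left {ι : Type*} (s : Finset ι) (S : ι → Finset V) (T : Finset V)
    (h : (s : Set ι).PairwiseDisjoint S) :
    ed R (s.biUnion S) T = ∑ i ∈ s, ed R (S i) T := sum_biUnion h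

lemma ed_biUnion_right {ι : Type*} (S : Finset V) (s : Finset ι) (T : ι → Finset V)
    (h : (s : Set ι).PairwiseDisjoint T) :
    ed R S (s.biUnion T) = ∑ i ∈ s, ed R S (T i) := by
  unfold ed
  rw [sum_comm]
  exact sum_congr rfl fun v _ => dg_biUnion v s T h

/-- Averaging: some subset of prescribed size carries at least its proportional share. -/
lemma exists_subset_sum_ge (f : V → ℝ) (X : Finset V) (s : ℕ) (hs : s ≤ X.card) :
    ∃ X' ⊆ X, X'.card = s ∧ (s : ℝ) * ∑ v ∈ X, f v ≤ X.card * ∑ v ∈ X', f v := by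
  obtain ⟨k, hk⟩ := Nat.exists_eq_add_of_le hs
  induction k generalizing X with
  | zero => exact ⟨X, subset_rfl, by omega, by rw [hk]; simp⟩
  | succ k ih =>
    have hne : X.Nonempty := card_pos.1 (by omega)
    obtain ⟨v, hv, hmin⟩ := exists_min_image X f hne
    have hc : (X.erase v).card = s + k := by rw [card_erase_of_mem hv]; omega
    obtain ⟨X', hX', hcard, hsum⟩ := ih (X.erase v) (by omega) hc
    refine ⟨X', hX'.trans (erase_subset _ _), hcard, ?_⟩
    have h1 : ∑ x ∈ X, f x = f v + ∑ x ∈ X.erase v, f x := (add_sum_erase X f hv).symm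
    have h2 : (X.card : ℝ) * f v ≤ ∑ x ∈ X, f x := by
      rw [← nsmul_eq_mul]; exact card_nsmul_le_sum _ _ _ hmin
    rw [hc] at hsum
    rw [hk] at h2 ⊢
    push_cast at *
    rcases Nat.eq_zero_or_pos (s + k) with h0 | h0
    · have hs0 : s = 0 := by omega
      subst hs0
      have : X' = ∅ := card_eq_zero.1 hcard
      simp [this]
    · have h0' : (0 : ℝ) < s + k := by exact_mod_cast h0
      have h3 : ((s : ℝ) + k) * ∑ x ∈ X, f x ≤ (s + k + 1) * ∑ x ∈ X.erase v, f x := by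
        rw [h1] at h2 ⊢
        nlinarith
      have hs0 : (0 : ℝ) ≤ s := by positivity
      have h4 : ((s : ℝ) + k) * (s * ∑ x ∈ X, f x) ≤
          ((s : ℝ) + k) * ((s + (k + 1)) * ∑ x ∈ X', f x) := by
        nlinarith [mul_le_mul_of_nonneg_left h3 hs0,
          mul_le_mul_of_nonneg_left hsum (by positivity : (0 : ℝ) ≤ s + k + 1)]
      exact le_of_mul_le_mul_left h4 h0'

/-- Averaging over sub-rectangles. -/
lemma exists_subrect_ed_ge (hR : ∀ ⦃u v⦄, R u v → R v u) (S T : Finset V) (s t : ℕ) (hs : s ≤ S.card)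
    (ht : t ≤ T.card) {ρ : ℝ} (hρ : ρ * (S.card * T.card) ≤ ed R S T) (hS : 0 < S.card)
    (hT : 0 < T.card) :
    ∃ S' ⊆ S, ∃ T' ⊆ T, S'.card = s ∧ T'.card = t ∧ ρ * (s * t) ≤ ed R S' T' := by
  obtain ⟨S', hS', hcS, h1⟩ := exists_subset_sum_ge (fun v => (dg R v T : ℝ)) S s hs
  obtain ⟨T', hT', hcT, h2⟩ := exists_subset_sum_ge (fun v => (dg R v S' : ℝ)) T t ht
  refine ⟨S', hS', T', hT', hcS, hcT, ?_⟩
  have e1 : ∑ v ∈ S, (dg R v T : ℝ) = ed R S T := by simp [ed]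
  have e2 : ∑ v ∈ S', (dg R v T : ℝ) = ed R S' T := by simp [ed]
  have e3 : ∑ v ∈ T, (dg R v S' : ℝ) = ed R S' T := by rw [ed_comm hR]; simp [ed]
  have e4 : ∑ v ∈ T', (dg R v S' : ℝ) = ed R S' T' := by rw [ed_comm hR]; simp [ed]
  rw [e1, e2] at h1
  rw [e3, e4] at h2
  have hS0 : (0 : ℝ) < S.card := by exact_mod_cast hS
  have hT0 : (0 : ℝ) < T.card := by exact_mod_cast hT
  have h5 : (s : ℝ) * (ρ * (S.card * T.card)) ≤ S.card * ed R S' T :=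
    (mul_le_mul_of_nonneg_left hρ (by positivity)).trans h1
  have h6 : (t : ℝ) * (s * (ρ * (S.card * T.card))) ≤ S.card * (T.card * ed R S' T') := by
    calc (t : ℝ) * (s * (ρ * (S.card * T.card))) ≤ t * (S.card * ed R S' T) :=
          mul_le_mul_of_nonneg_left h5 (by positivity)
      _ = S.card * (t * ed R S' T) := by ring
      _ ≤ _ := mul_le_mul_of_nonneg_left h2 (by positivity)
  have h7 : (S.card * T.card : ℝ) * (ρ * (s * t)) ≤ (S.card * T.card : ℝ) * ed R S' T' := by
    nlinarith
  exact le_of_mul_le_mul_left h7 (by positivity)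

/-- Every `q × q` sub-rectangle of `X × Y` has density at least `d`. -/
def Reg (R : V → V → Prop) (q : ℕ) (d : ℝ) (X Y : Finset V) : Prop :=
  ∀ X' ⊆ X, ∀ Y' ⊆ Y, X'.card = q → Y'.card = q → d * (q * q) ≤ ed R X' Y'

lemma Reg.subset {q : ℕ} {d : ℝ} {X Y X' Y' : Finset V} (h : Reg R q d X Y) (hX : X' ⊆ X)
    (hY : Y' ⊆ Y) : Reg R q d X' Y' :=
  fun S hS T hT => h S (hS.trans hX) T (hT.trans hY)

lemma Reg.symm {q : ℕ} {d : ℝ} {X Y : Finset V} (hR : ∀ ⦃u v⦄, R u v → R v u) (h : Reg R q d X Y) :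
    Reg R q d Y X := fun S hS T hT h1 h2 => by
  rw [ed_comm hR]; exact h T hT S hS h2 h1

/-- In a regular pair, fewer than `q` vertices have small degree into a given large set. -/
lemma Reg.card_low_lt {q : ℕ} {d : ℝ} {X Y T : Finset V} (hR : ∀ ⦃u v⦄, R u v → R v u)
    (h : Reg R q d X Y) (hq : 0 < q) (hT : T ⊆ Y) (hqT : q ≤ T.card) :
    (X.filter fun x => (dg R x T : ℝ) < d * T.card).card < q := by
  by_contra hcon
  push Not at hcon
  obtain ⟨X', hX', hc⟩ := exists_subset_card_eq hcon
  have hT0 : 0 < T.card := by omega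
  have hqr : (0 : ℝ) < q := by exact_mod_cast hq
  have hX'X : X' ⊆ X := hX'.trans (filter_subset _ _)
  have hlt : (ed R X' T : ℝ) < q * (d * T.card) := by
    unfold ed
    push_cast
    calc ∑ x ∈ X', (dg R x T : ℝ) < ∑ _x ∈ X', d * T.card := by
          apply sum_lt_sum_of_nonempty (card_pos.1 (by omega))
          intro x hx
          exact (mem_filter.1 (hX' hx)).2
      _ = _ := by rw [sum_const, hc, nsmul_eq_mul]
  obtain ⟨T', hT', hcT', h2⟩ := exists_subset_sum_ge (fun v => -(dg R v X' : ℝ)) T q hqT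
  have e3 : ∑ v ∈ T, -(dg R v X' : ℝ) = -ed R X' T := by rw [ed_comm hR]; simp [ed]
  have e4 : ∑ v ∈ T', -(dg R v X' : ℝ) = -ed R X' T' := by rw [ed_comm hR]; simp [ed]
  rw [e3, e4] at h2
  have h3 := h X' hX'X T' (hT'.trans hT) hc hcT'
  have hT0' : (0 : ℝ) < T.card := by exact_mod_cast hT0
  nlinarith [mul_le_mul_of_nonneg_left h3 hT0'.le, mul_lt_mul_of_pos_left hlt hqr]

end Basics

section Lists
open Finset
open scoped Classical
variable {V : Type*} {r : ℕ}

/-- Adjacency in colour `i`. -/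
def Rc (G : SimpleGraph V) (c : Sym2 V → Fin r) (i : Fin r) (u v : V) : Prop :=
  G.Adj u v ∧ c s(u, v) = i

lemma Rc.symm {G : SimpleGraph V} {c : Sym2 V → Fin r} {i : Fin r} ⦃u v : V⦄
    (h : Rc G c i u v) : Rc G c i v u := ⟨h.1.symm, by rw [Sym2.eq_swap]; exact h.2⟩

lemma exists_walk_of_isChain {G : SimpleGraph V} {c : Sym2 V → Fin r} {i : Fin r} (l : List V) :
    ∀ (a : V), (a :: l).IsChain (Rc G c i) →
      ∃ (z : V) (w : G.Walk a z), w.support = a :: l ∧ (∀ e ∈ w.edges, c e = i) ∧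
        z = (a :: l).getLast (by simp) := by
  induction l with
  | nil => intro a _; exact ⟨a, .nil, by simp, by simp, by simp⟩
  | cons b l ih =>
    intro a h
    rw [List.isChain_cons_cons] at h
    obtain ⟨z, w, h1, h2, h3⟩ := ih b h.2
    refine ⟨z, .cons h.1.1 w, by simp [h1], ?_, by simpa using h3⟩
    intro e he
    rw [SimpleGraph.Walk.edges_cons, List.mem_cons] at he
    rcases he with rfl | he
    · exact h.1.2
    · exact h2 e he

/-- A cyclic list of distinct vertices, consecutive ones being `R`-related. -/
def IsCyc (R : V → V → Prop) (l : List V) : Prop :=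
  l.Nodup ∧ l.IsChain R ∧ ∀ h : l ≠ [], 3 ≤ l.length → R (l.getLast h) (l.head h)

lemma IsCyc.isMonoCycle {G : SimpleGraph V} {c : Sym2 V → Fin r} {i : Fin r} {l : List V}
    (h : IsCyc (Rc G c i) l) : IsMonoCycle G c {x | x ∈ l} := by
  obtain ⟨hnd, hch, hcl⟩ := h
  match l, hnd, hch, hcl with
  | [], _, _, _ => left; simp
  | [a], _, _, _ => right; left; exact ⟨a, by simp⟩
  | [a, b], _, hch, _ =>
    right; right; left
    rw [List.isChain_cons_cons] at hch
    refine ⟨a, b, hch.1.1, ?_⟩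
    ext x; simp
  | a :: b :: d :: t, hnd, hch, hcl =>
    right; right; right
    have hclose := hcl (by simp) (by simp)
    obtain ⟨z, w, h1, h2, h3⟩ := exists_walk_of_isChain _ _ hch
    rw [← h3] at hclose
    simp only [List.head_cons] at hclose
    have hzmem : z ∈ d :: t := by
      rw [h3]; simp only [List.getLast_cons_cons]
      exact List.getLast_mem _
    refine ⟨i, z, .cons hclose.1 w, ?_, ?_, ?_⟩
    · rw [SimpleGraph.Walk.cons_isCycle_iff]
      refine ⟨by rw [SimpleGraph.Walk.isPath_def, h1]; exact hnd, ?_⟩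
      cases w with
      | nil => simp at h1
      | cons hab w' =>
        rename_i b'
        rw [SimpleGraph.Walk.support_cons, List.cons.injEq] at h1
        have hb : b' = b := by
          have := h1.2
          rw [← SimpleGraph.Walk.cons_tail_support] at this
          exact (List.cons.inj this).1
        subst hb
        rw [SimpleGraph.Walk.edges_cons, List.mem_cons, not_or]
        constructor
        · intro he
          rw [Sym2.eq_iff] at he
          simp only [List.nodup_cons] at hnd
          rcases he with ⟨h, _⟩ | ⟨h, _⟩
          · exact hnd.1 (by rw [← h]; exact List.mem_cons_of_mem _ hzmem)
          · exact hnd.2.1 (by rw [← h]; exact hzmem)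
        · intro he
          have := SimpleGraph.Walk.snd_mem_support_of_mem_edges w' he
          rw [h1.2] at this
          simp only [List.nodup_cons] at hnd
          exact hnd.1 this
    · intro e he
      rw [SimpleGraph.Walk.edges_cons, List.mem_cons] at he
      rcases he with rfl | he
      · exact hclose.2
      · exact h2 e he
    · ext x
      simp only [Set.mem_ofPred_eq, SimpleGraph.Walk.support_cons, h1]
      constructor
      · intro h; exact List.mem_cons_of_mem _ h
      · intro h
        rcases List.mem_cons.1 h with rfl | h
        · exact List.mem_cons_of_mem _ (List.mem_cons_of_mem _ hzmem)
        · exact h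

/-- `S` can be partitioned into at most `k` monochromatic cycles. -/
def CP (G : SimpleGraph V) (c : Sym2 V → Fin r) (S : Set V) (k : ℕ) : Prop :=
  ∃ L : List (Set V), L.length ≤ k ∧ L.Pairwise Disjoint ∧ (∀ T ∈ L, IsMonoCycle G c T) ∧
    ∀ x, x ∈ S ↔ ∃ T ∈ L, x ∈ T

variable {G : SimpleGraph V} {c : Sym2 V → Fin r}

lemma CP.mono {S : Set V} {k k' : ℕ} (h : CP G c S k) (hk : k ≤ k') : CP G c S k' := by
  obtain ⟨L, h1, h2⟩ := h
  exact ⟨L, h1.trans hk, h2⟩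

lemma CP.union {S T : Set V} {k l : ℕ} (h : CP G c S k) (h' : CP G c T l) (hd : Disjoint S T) :
    CP G c (S ∪ T) (k + l) := by
  obtain ⟨L, h1, h2, h3, h4⟩ := h
  obtain ⟨L', h1', h2', h3', h4'⟩ := h'
  refine ⟨L ++ L', by simp; omega, ?_, ?_, ?_⟩
  · rw [List.pairwise_append]
    refine ⟨h2, h2', fun a ha b hb => hd.mono ?_ ?_⟩
    · intro x hx; exact (h4 x).2 ⟨a, ha, hx⟩
    · intro x hx; exact (h4' x).2 ⟨b, hb, hx⟩
  · intro T hT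
    rcases List.mem_append.1 hT with h | h
    exacts [h3 T h, h3' T h]
  · intro x
    simp only [Set.mem_union, h4, h4', List.mem_append]
    constructor
    · rintro (⟨T, h, h'⟩ | ⟨T, h, h'⟩)
      exacts [⟨T, .inl h, h'⟩, ⟨T, .inr h, h'⟩]
    · rintro ⟨T, h | h, h'⟩
      exacts [.inl ⟨T, h, h'⟩, .inr ⟨T, h, h'⟩]

lemma CP.empty : CP G c ∅ 0 := ⟨[], by simp⟩

lemma IsCyc.cp {i : Fin r} {l : List V} (h : IsCyc (Rc G c i) l) : CP G c {x | x ∈ l} 1 :=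
  ⟨[{x | x ∈ l}], by simp, by simp, by simpa using h.isMonoCycle, by simp⟩

lemma CP.singleton (v : V) : CP G c {v} 1 :=
  ⟨[{v}], by simp, by simp, by simpa using .inr (.inl ⟨v, rfl⟩), by simp⟩

/-- Union of a finite indexed family of partitionable sets. -/
lemma CP.biUnion {ι : Type*} (s : Finset ι) (S : ι → Set V) (k : ι → ℕ)
    (h : ∀ i ∈ s, CP G c (S i) (k i)) (hd : (s : Set ι).PairwiseDisjoint S) :
    CP G c (⋃ i ∈ s, S i) (∑ i ∈ s, k i) := by
  induction s using Finset.induction_on with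
  | empty => simpa using CP.empty
  | insert a s ha ih =>
    rw [sum_insert ha, set_biUnion_insert]
    refine (h a (by simp)).union (ih (fun i hi => h i (by simp [hi])) ?_) ?_
    · exact hd.subset (by simp)
    · rw [Set.disjoint_iUnion₂_right]
      intro i hi
      exact hd (by simp) (by simp [hi]) (by rintro rfl; exact ha hi)

lemma CP.monoCyclePartition {k : ℕ} (h : CP G c Set.univ k) : MonoCyclePartition G c k := by
  obtain ⟨L, h1, h2, h3, h4⟩ := h
  refine ⟨fun i => L.getD i ∅, ?_, ?_, ?_⟩
  · intro i j hij
    have key : ∀ i j : ℕ, i < j → Disjoint (L.getD i ∅) (L.getD j ∅) := by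
      intro i j hij
      by_cases hj : j < L.length
      · have hi : i < L.length := by omega
        rw [List.getD_eq_getElem _ _ hi, List.getD_eq_getElem _ _ hj]
        exact List.pairwise_iff_getElem.1 h2 i j hi hj hij
      · rw [List.getD_eq_default (n := j) _ _ (by omega)]; simp
    rcases lt_or_gt_of_ne (fun h => hij (Fin.ext h) : (i : ℕ) ≠ j) with h | h
    · exact key _ _ h
    · exact (key _ _ h).symm
  · rw [Set.eq_univ_iff_forall]
    intro x
    obtain ⟨T, hT, hx⟩ := (h4 x).1 (Set.mem_univ _)
    obtain ⟨n, hn, rfl⟩ := List.mem_iff_getElem.1 hT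
    exact Set.mem_iUnion.2 ⟨⟨n, by omega⟩, by rw [List.getD_eq_getElem _ _ hn]; exact hx⟩
  · intro i
    by_cases hi : (i : ℕ) < L.length
    · simp only [List.getD_eq_getElem _ _ hi]
      exact h3 _ (List.getElem_mem _)
    · simp only [List.getD_eq_default (n := (i : ℕ)) L ∅ (by omega)]
      exact .inl rfl

end Lists

section PathLists
open Finset
open scoped Classical
variable {V : Type*} {R : V → V → Prop}

/-- `l` is a chain from `a` to `b`. -/
def Pth (R : V → V → Prop) (a b : V) (l : List V) : Prop :=
  l.IsChain R ∧ l.head? = some a ∧ l.getLast? = some b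

lemma Pth.ne_nil {a b : V} {l : List V} (h : Pth R a b l) : l ≠ [] := by
  rintro rfl; simp [Pth] at h

lemma Pth.last_mem {a b : V} {l : List V} (h : Pth R a b l) : b ∈ l :=
  List.mem_of_getLast? h.2.2

lemma Pth.single (a : V) : Pth R a a [a] := by simp [Pth]

lemma Pth.append {a b c d : V} {l l' : List V} (h : Pth R a b l) (h' : Pth R c d l')
    (hbc : R b c) : Pth R a d (l ++ l') := by
  refine ⟨h.1.append h'.1 ?_, ?_, ?_⟩
  · intro x hx y hy
    rw [h.2.2] at hx; rw [h'.2.1] at hy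
    simp only [Option.mem_def, Option.some.injEq] at hx hy
    subst hx; subst hy; exact hbc
  · rw [List.head?_append_of_ne_nil _ h.ne_nil]; exact h.2.1
  · rw [List.getLast?_append_of_ne_nil _ h'.ne_nil]; exact h'.2.2

lemma Pth.reverse (hR : ∀ ⦃u v⦄, R u v → R v u) {a b : V} {l : List V} (h : Pth R a b l) :
    Pth R b a l.reverse := by
  refine ⟨?_, by simpa using h.2.2, by simpa using h.2.1⟩
  rw [List.isChain_reverse]
  exact h.1.imp fun _ _ h => hR h

lemma Pth.getElem_zero {a b : V} {l : List V} (h : Pth R a b l) (h0 : 0 < l.length) :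
    l[0] = a := by
  have := h.2.1
  rw [List.head?_eq_getElem?, List.getElem?_eq_getElem h0] at this
  exact Option.some.inj this

lemma Pth.getElem_last {a b : V} {l : List V} (h : Pth R a b l) (h0 : l.length - 1 < l.length) :
    l[l.length - 1] = b := by
  have := h.2.2
  rw [List.getLast?_eq_getElem?, List.getElem?_eq_getElem h0] at this
  exact Option.some.inj this

lemma Pth.take {a b : V} {l : List V} (h : Pth R a b l) (i : ℕ) (hi : i < l.length) :
    Pth R a l[i] (l.take (i + 1)) := by
  refine ⟨h.1.take _, ?_, ?_⟩
  · rw [List.head?_take]; simp [h.2.1]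
  · rw [List.getLast?_take]; simp [hi]

lemma Pth.drop {a b : V} {l : List V} (h : Pth R a b l) (i : ℕ) (hi : i < l.length) :
    Pth R l[i] b (l.drop i) := by
  refine ⟨h.1.drop _, ?_, ?_⟩
  · rw [List.head?_drop]; simp [hi]
  · rw [List.getLast?_drop, if_neg (by omega)]; exact h.2.2

lemma Pth.mid {a b : V} {l : List V} (h : Pth R a b l) (i j : ℕ) (hij : i ≤ j)
    (hj : j < l.length) : Pth R l[i] l[j] ((l.drop i).take (j - i + 1)) := by
  have := (h.drop i (by omega)).take (j - i) (by simp; omega)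
  simpa [Nat.add_sub_cancel' hij] using this

lemma split_three (l : List V) (i j : ℕ) (hij : i ≤ j) :
    l = l.take (i + 1) ++ ((l.drop (i + 1)).take (j - i) ++ l.drop (j + 1)) := by
  have : l.drop (j + 1) = (l.drop (i + 1)).drop (j - i) := by
    rw [List.drop_drop]; congr 1; omega
  rw [this, List.take_append_drop, List.take_append_drop]

lemma Pth.isCyc {a b : V} {l : List V} (h : Pth R a b l) (hn : l.Nodup) (hba : R b a) :
    IsCyc R l := by
  refine ⟨hn, h.1, fun hne _ => ?_⟩
  have h1 := h.2.1
  have h2 := h.2.2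
  rw [List.head?_eq_some_head hne] at h1
  rw [List.getLast?_eq_some_getLast hne] at h2
  rw [Option.some.inj h1, Option.some.inj h2]
  exact hba

lemma Pth.mem_of_even_odd {X Y : Finset V}
    (hb : ∀ ⦃u v⦄, R u v → (u ∈ X ∧ v ∈ Y) ∨ (u ∈ Y ∧ v ∈ X)) (hXY : Disjoint X Y)
    {a b : V} {l : List V} (h : Pth R a b l) (ha : a ∈ X) (i : ℕ) (hi : i < l.length) :
    (Even i → l[i] ∈ X) ∧ (¬ Even i → l[i] ∈ Y) := by
  induction i with
  | zero => rw [h.getElem_zero hi]; simpa using ha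
  | succ i ih =>
    have h1 := ih (by omega)
    have h2 := hb (h.1.getElem i hi)
    rw [disjoint_left] at hXY
    have := @hXY l[i]
    rw [Nat.even_add_one]
    tauto

/-- Rotation closing a path into a cycle, crossing neighbours. -/
lemma Pth.close_of_lt (hR : ∀ ⦃u v⦄, R u v → R v u) {a b : V} {P : List V} (h : Pth R a b P)
    (j k : ℕ) (hj : 0 < j) (hjk : j ≤ k) (hk : k + 1 < P.length) (h1 : R a P[j])
    (h2 : R b P[k]) (h3 : R P[j - 1] P[k + 1]) :
    ∃ C x y, Pth R x y C ∧ R y x ∧ C.Perm P := by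
  obtain ⟨j, rfl⟩ := Nat.exists_eq_succ_of_ne_zero hj.ne'
  simp only [Nat.succ_eq_add_one, Nat.add_sub_cancel] at *
  have p1 := (h.take j (by omega)).reverse hR
  have p2 := h.mid (j + 1) k hjk (by omega)
  have p3 := (h.drop (k + 1) hk).reverse hR
  refine ⟨_, _, _, (p1.append p2 h1).append p3 (hR h2), hR h3, ?_⟩
  have e : k - (j + 1) + 1 = k - j := by omega
  rw [e]
  conv_rhs => rw [split_three P j k (by omega)]
  rw [List.append_assoc]
  exact (List.reverse_perm _).append ((List.Perm.refl _).append (List.reverse_perm _))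

/-- Rotation closing a path into a cycle, non-crossing neighbours. -/
lemma Pth.close_of_gt (hR : ∀ ⦃u v⦄, R u v → R v u) {a b : V} {P : List V} (h : Pth R a b P)
    (j k : ℕ) (hkj : k < j) (hj : j + 1 < P.length) (h1 : R a P[j])
    (h2 : R b P[k]) (h3 : R P[j + 1] P[k + 1]) :
    ∃ C x y, Pth R x y C ∧ R y x ∧ C.Perm P := by
  have p1 := h.take k (by omega)
  have p2 := h.mid (k + 1) j hkj (by omega)
  have p3 := (h.drop (j + 1) hj).reverse hR
  refine ⟨_, _, _, (p1.append p3 (hR h2)).append p2 h3, hR h1, ?_⟩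
  have e : j - (k + 1) + 1 = j - k := by omega
  rw [e]
  conv_rhs => rw [split_three P k j (by omega)]
  rw [List.append_assoc]
  refine (List.Perm.refl _).append (List.perm_append_comm.trans ?_)
  exact (List.Perm.refl _).append (List.reverse_perm _)

lemma exists_threshold (J K : Finset ℕ) (q : ℕ) (hJ : 2 * q ≤ J.card) (hK : 2 * q ≤ K.card) :
    ∃ t, (q ≤ (J.filter (· ≤ t)).card ∧ q ≤ (K.filter (t < ·)).card) ∨
      (q ≤ (J.filter (t < ·)).card ∧ q ≤ (K.filter (· ≤ t)).card) := by
  have hex : ∃ t, q ≤ (J.filter (· ≤ t)).card := by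
    refine ⟨J.sup id, ?_⟩
    rw [filter_true_of_mem (p := (· ≤ J.sup id)) fun j hj => le_sup (f := id) hj]
    omega
  have hJs : ∀ t, (J.filter (· ≤ t)).card + (J.filter (t < ·)).card = J.card := by
    intro t
    rw [← card_filter_add_card_filter_not (s := J) (· ≤ t)]
    simp only [not_le]
  have hKs : ∀ t, (K.filter (· ≤ t)).card + (K.filter (t < ·)).card = K.card := by
    intro t
    rw [← card_filter_add_card_filter_not (s := K) (· ≤ t)]
    simp only [not_le]
  obtain ⟨t, hq, hmin⟩ : ∃ t, q ≤ (J.filter (· ≤ t)).card ∧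
      ∀ m < t, ¬ q ≤ (J.filter (· ≤ m)).card :=
    ⟨Nat.find hex, Nat.find_spec hex, fun m => Nat.find_min hex⟩
  have hle : (J.filter (· ≤ t)).card ≤ q + 1 ∧ (0 < q → (J.filter (· ≤ t)).card ≤ q) := by
    have : (J.filter (· ≤ t)) ⊆ insert t (J.filter (· < t)) := by
      intro x hx
      simp only [mem_filter, mem_insert] at *
      rcases hx.2.lt_or_eq with h | h
      exacts [.inr ⟨hx.1, h⟩, .inl h]
    have h1 := (card_le_card this).trans (card_insert_le _ _)
    rcases Nat.eq_zero_or_pos t with h0 | h0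
    · have : J.filter (· < t) = ∅ := by rw [h0]; simp
      rw [this] at h1; simp at h1; omega
    · have h2 := hmin (t - 1) (by omega)
      have h3 : J.filter (· < t) = J.filter (· ≤ t - 1) := by
        apply filter_congr; intro x _; omega
      rw [h3] at h1; omega
  refine ⟨t, ?_⟩
  have a1 := hJs t
  have a2 := hKs t
  omega

end PathLists

section Ham
open Finset
open scoped Classical
variable {V : Type*} {R : V → V → Prop}

/-- No bipartite hole of size `q`. -/
def HoleFree (R : V → V → Prop) (q : ℕ) (X Y : Finset V) : Prop :=
  ∀ X' ⊆ X, ∀ Y' ⊆ Y, q ≤ X'.card → q ≤ Y'.card → ∃ x ∈ X', ∃ y ∈ Y', R x y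

lemma Reg.holeFree {q : ℕ} {d : ℝ} {X Y : Finset V} (h : Reg R q d X Y) (hq : 0 < q)
    (hd : 0 < d) : HoleFree R q X Y := by
  intro X' hX' Y' hY' hx hy
  obtain ⟨X'', h1, h2⟩ := exists_subset_card_eq hx
  obtain ⟨Y'', h3, h4⟩ := exists_subset_card_eq hy
  have h5 := h X'' (h1.trans hX') Y'' (h3.trans hY') h2 h4
  by_contra hcon
  push Not at hcon
  have : ed R X'' Y'' = 0 := by
    unfold ed dg
    apply sum_eq_zero
    intro x hx
    rw [card_eq_zero, filter_eq_empty_iff]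
    exact fun y hy => hcon x (h1 hx) y (h3 hy)
  rw [this] at h5
  have : (0 : ℝ) < q := by exact_mod_cast hq
  have : 0 < d * (q * q) := by positivity
  simp at h5
  linarith

lemma HoleFree.exists_matching {q D : ℕ} {X Y : Finset V}
    (hR : ∀ ⦃u v⦄, R u v → R v u) (hf : HoleFree R q X Y) (hc : X.card = Y.card)
    (hq : q ≤ D) (hX : ∀ x ∈ X, D ≤ dg R x Y) (hY : ∀ y ∈ Y, D ≤ dg R y X) :
    ∃ f : V → V, Set.BijOn f X Y ∧ ∀ x ∈ X, R x (f x) := by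
  have hall : ∀ s : Finset X, s.card ≤ (s.biUnion fun x => Y.filter (R x)).card := by
    intro s
    by_contra hcon
    push Not at hcon
    set N := s.biUnion fun x => Y.filter (R (x : V)) with hN
    have hNY : N ⊆ Y := by
      intro y hy
      rw [hN, mem_biUnion] at hy
      obtain ⟨x, _, hy⟩ := hy
      exact (mem_filter.1 hy).1
    have hsX : (s.map (Function.Embedding.subtype _)) ⊆ X := by
      intro x hx
      simp only [mem_map, Function.Embedding.coe_subtype] at hx
      obtain ⟨a, _, rfl⟩ := hx
      exact a.2
    have hscard : s.card ≤ X.card := by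
      have := card_le_card hsX
      rwa [card_map] at this
    have hsne : s.Nonempty := card_pos.1 (by omega)
    obtain ⟨x0, hx0⟩ := hsne
    have hDN : D ≤ N.card := (hX x0 x0.2).trans (card_le_card fun y hy => by
      rw [hN, mem_biUnion]; exact ⟨x0, hx0, hy⟩)
    have hYN : (Y \ N).card = Y.card - N.card := card_sdiff_of_subset hNY
    have hne : (Y \ N).Nonempty := card_pos.1 (by omega)
    obtain ⟨y, hy⟩ := hne
    have hnot : ∀ x ∈ s.map (Function.Embedding.subtype _), ∀ y ∈ Y \ N, ¬ R x y := by
      intro x hx y hy hxy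
      simp only [mem_map, Function.Embedding.coe_subtype] at hx
      obtain ⟨a, ha, rfl⟩ := hx
      rw [mem_sdiff] at hy
      exact hy.2 (by rw [hN, mem_biUnion]; exact ⟨a, ha, mem_filter.2 ⟨hy.1, hxy⟩⟩)
    have hDs : D ≤ X.card - s.card := by
      refine (hY y (mem_sdiff.1 hy).1).trans ?_
      have h1 : (X \ s.map (Function.Embedding.subtype _)).card = X.card - s.card := by
        rw [card_sdiff_of_subset hsX, card_map]
      rw [← h1]
      apply card_le_card
      intro x hx
      rw [mem_filter] at hx
      rw [mem_sdiff]
      exact ⟨hx.1, fun h => hnot x h y hy (hR hx.2)⟩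
    obtain ⟨x, hx, y, hy, hxy⟩ := hf _ hsX (Y \ N) sdiff_subset
      (by rw [card_map]; omega) (by omega)
    exact hnot x hx y hy hxy
  obtain ⟨f, hinj, hf'⟩ := (all_card_le_biUnion_card_iff_exists_injective _).1 hall
  have hfY : ∀ x : X, f x ∈ Y := fun x => (mem_filter.1 (hf' x)).1
  refine ⟨fun v => if h : v ∈ X then f ⟨v, h⟩ else v, ⟨?_, ?_, ?_⟩, ?_⟩
  · intro x hx
    simp only [mem_coe] at hx
    simp only [hx, dite_true]
    exact hfY _
  · intro x hx y hy hxy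
    simp only [mem_coe] at hx hy
    simp only [hx, hy, dite_true] at hxy
    exact congrArg Subtype.val (hinj hxy)
  · have : (X.attach.image f) = Y := by
      apply eq_of_subset_of_card_le
      · intro y hy
        obtain ⟨x, _, rfl⟩ := mem_image.1 hy
        exact hfY x
      · rw [card_image_of_injective _ hinj, card_attach, hc]
    intro y hy
    rw [mem_coe, ← this, mem_image] at hy
    obtain ⟨x, _, rfl⟩ := hy
    exact ⟨x, x.2, by simp⟩
  · intro x hx
    simp only [hx, dite_true]
    exact (mem_filter.1 (hf' ⟨x, hx⟩)).2

end Ham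

section Ham
open Finset
open scoped Classical
variable {V : Type*} {R : V → V → Prop} {X Y : Finset V} {q D : ℕ}

lemma card_image_getD {P : List V} (hn : P.Nodup) (a : V) {S : Finset ℕ} {g : ℕ → ℕ}
    (hg : ∀ j ∈ S, g j < P.length) (hinj : Set.InjOn g S) :
    (S.image fun j => P.getD (g j) a).card = S.card := by
  apply card_image_of_injOn
  intro i hi j hj hij
  simp only at hij
  rw [List.getD_eq_getElem _ _ (hg i hi), List.getD_eq_getElem _ _ (hg j hj)] at hij
  exact hinj hi hj ((List.Nodup.getElem_inj_iff hn).1 hij)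

lemma exists_close (hR : ∀ ⦃u v⦄, R u v → R v u)
    (hb : ∀ ⦃u v⦄, R u v → (u ∈ X ∧ v ∈ Y) ∨ (u ∈ Y ∧ v ∈ X)) (hXY : Disjoint X Y)
    (hf : HoleFree R q X Y) (hq : 2 * q + 1 ≤ D) (hX : ∀ x ∈ X, D ≤ dg R x Y)
    (hY : ∀ y ∈ Y, D ≤ dg R y X) {a b : V} {P : List V} (h : Pth R a b P) (hn : P.Nodup)
    (ha : a ∈ X) (hbY : b ∈ Y) (hNa : ∀ y ∈ Y, R a y → y ∈ P) (hNb : ∀ x ∈ X, R b x → x ∈ P) :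
    ∃ C x y, Pth R x y C ∧ R y x ∧ C.Perm P := by
  have hdisj := disjoint_left.1 hXY
  have halt := h.mem_of_even_odd hb hXY ha
  have hpos : 0 < P.length := List.length_pos_iff.2 h.ne_nil
  set J := (range (P.length - 1)).filter fun j => R a (P.getD j a) with hJdef
  set K := (range (P.length - 1)).filter fun j => R b (P.getD j a) with hKdef
  have hJc : 2 * q ≤ J.card := by
    have : Y.filter (R a) ⊆ (insert (P.length - 1) J).image fun j => P.getD j a := by
      intro y hy
      rw [mem_filter] at hy
      obtain ⟨i, hi, rfl⟩ := List.mem_iff_getElem.1 (hNa y hy.1 hy.2)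
      rw [mem_image]
      refine ⟨i, ?_, List.getD_eq_getElem _ _ hi⟩
      rw [mem_insert, hJdef, mem_filter, mem_range,
        List.getD_eq_getElem _ _ hi]
      have := hy.2
      by_cases h' : i < P.length - 1
      · exact .inr ⟨h', this⟩
      · left; omega
    have h1 := (card_le_card this).trans card_image_le
    have h2 := hX a ha
    have h3 := card_insert_le (P.length - 1) J
    unfold dg at h2
    omega
  have hKc : 2 * q ≤ K.card := by
    have : X.filter (R b) ⊆ K.image fun j => P.getD j a := by
      intro x hx
      rw [mem_filter] at hx
      obtain ⟨i, hi, rfl⟩ := List.mem_iff_getElem.1 (hNb x hx.1 hx.2)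
      rw [mem_image]
      refine ⟨i, ?_, List.getD_eq_getElem _ _ hi⟩
      rw [hKdef, mem_filter, mem_range, List.getD_eq_getElem _ _ hi]
      refine ⟨?_, hx.2⟩
      by_contra hcon
      have hi' : i = P.length - 1 := by omega
      subst hi'
      rw [h.getElem_last (by omega)] at hx
      exact hdisj hx.1 hbY
    have h1 := (card_le_card this).trans card_image_le
    have h2 := hY b hbY
    unfold dg at h2
    omega
  have hJ : ∀ j ∈ J, ∃ hj : j + 1 < P.length, R a P[j] ∧ ¬ Even j := by
    intro j hj
    rw [hJdef, mem_filter, mem_range] at hj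
    have hj' : j + 1 < P.length := by omega
    rw [List.getD_eq_getElem _ _ (by omega)] at hj
    refine ⟨hj', hj.2, fun he => ?_⟩
    have h1 := (halt j (by omega)).1 he
    rcases hb hj.2 with h2 | h2
    · exact hdisj h1 h2.2
    · exact hdisj ha h2.1
  have hK : ∀ k ∈ K, ∃ hk : k + 1 < P.length, R b P[k] ∧ Even k := by
    intro j hj
    rw [hKdef, mem_filter, mem_range] at hj
    have hj' : j + 1 < P.length := by omega
    rw [List.getD_eq_getElem _ _ (by omega)] at hj
    refine ⟨hj', hj.2, ?_⟩
    by_contra he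
    have h1 := (halt j (by omega)).2 he
    rcases hb hj.2 with h2 | h2
    · exact hdisj h2.1 hbY
    · exact hdisj h2.2 h1
  have hKY : ∀ S ⊆ K, (S.image fun k => P.getD (k + 1) a) ⊆ Y ∧
      (S.image fun k => P.getD (k + 1) a).card = S.card := by
    intro S hS
    refine ⟨?_, card_image_getD hn a (fun k hk => (hK k (hS hk)).1) fun i _ j _ h => by
      simpa using h⟩
    intro y hy
    obtain ⟨k, hk, rfl⟩ := mem_image.1 hy
    obtain ⟨hk1, hk2, hk3⟩ := hK k (hS hk)
    rw [List.getD_eq_getElem _ _ hk1]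
    exact (halt _ hk1).2 (by rw [Nat.even_add_one]; simpa using hk3)
  obtain ⟨t, ⟨h1, h2⟩ | ⟨h1, h2⟩⟩ := exists_threshold J K q hJc hKc
  · set J1 := J.filter (· ≤ t)
    have hJ1 : J1 ⊆ J := filter_subset _ _
    have hXs : (J1.image fun j => P.getD (j - 1) a) ⊆ X := by
      intro x hx
      obtain ⟨j, hj, rfl⟩ := mem_image.1 hx
      obtain ⟨hk1, hk2, hk3⟩ := hJ j (hJ1 hj)
      rw [List.getD_eq_getElem _ _ (by omega)]
      refine (halt _ _).1 ?_
      obtain ⟨m, rfl⟩ := Nat.not_even_iff_odd.1 hk3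
      simp
    have hXc : (J1.image fun j => P.getD (j - 1) a).card = J1.card := by
      refine card_image_getD hn a (fun k hk => ?_) fun i hi j hj h => ?_
      · have := (hJ k (hJ1 hk)).1; omega
      · obtain ⟨_, _, h3⟩ := hJ _ (hJ1 hi)
        obtain ⟨_, _, h4⟩ := hJ _ (hJ1 hj)
        obtain ⟨m, rfl⟩ := Nat.not_even_iff_odd.1 h3
        obtain ⟨m', rfl⟩ := Nat.not_even_iff_odd.1 h4
        simp at h ⊢; omega
    obtain ⟨hY1, hY2⟩ := hKY (K.filter (t < ·)) (filter_subset _ _)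
    obtain ⟨x, hx, y, hy, hxy⟩ := hf _ hXs _ hY1 (by omega) (by omega)
    obtain ⟨j, hj, rfl⟩ := mem_image.1 hx
    obtain ⟨k, hk, rfl⟩ := mem_image.1 hy
    obtain ⟨hj1, hj2, hj3⟩ := hJ j (hJ1 hj)
    obtain ⟨hk1, hk2, hk3⟩ := hK k (filter_subset _ _ hk)
    have hjt := (mem_filter.1 hj).2
    have hkt := (mem_filter.1 hk).2
    rw [List.getD_eq_getElem _ _ (by omega), List.getD_eq_getElem _ _ hk1] at hxy
    refine h.close_of_lt hR j k ?_ (by omega) hk1 hj2 hk2 hxy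
    rcases Nat.eq_zero_or_pos j with h0 | h0
    · subst h0; simp at hj3
    · exact h0
  · set J1 := J.filter (t < ·)
    have hJ1 : J1 ⊆ J := filter_subset _ _
    have hXs : (J1.image fun j => P.getD (j + 1) a) ⊆ X := by
      intro x hx
      obtain ⟨j, hj, rfl⟩ := mem_image.1 hx
      obtain ⟨hk1, hk2, hk3⟩ := hJ j (hJ1 hj)
      rw [List.getD_eq_getElem _ _ hk1]
      exact (halt _ _).1 (by rw [Nat.even_add_one]; exact hk3)
    have hXc : (J1.image fun j => P.getD (j + 1) a).card = J1.card :=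
      card_image_getD hn a (fun k hk => (hJ k (hJ1 hk)).1) fun i hi j hj h => by simpa using h
    obtain ⟨hY1, hY2⟩ := hKY (K.filter (· ≤ t)) (filter_subset _ _)
    obtain ⟨x, hx, y, hy, hxy⟩ := hf _ hXs _ hY1 (by omega) (by omega)
    obtain ⟨j, hj, rfl⟩ := mem_image.1 hx
    obtain ⟨k, hk, rfl⟩ := mem_image.1 hy
    obtain ⟨hj1, hj2, hj3⟩ := hJ j (hJ1 hj)
    obtain ⟨hk1, hk2, hk3⟩ := hK k (filter_subset _ _ hk)
    have hjt := (mem_filter.1 hj).2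
    have hkt := (mem_filter.1 hk).2
    rw [List.getD_eq_getElem _ _ hj1, List.getD_eq_getElem _ _ hk1] at hxy
    exact h.close_of_gt hR j k (by omega) hj1 hj2 hk2 hxy

/-- A path from `X` to `Y` whose complement is perfectly matched. -/
def GoodPath (R : V → V → Prop) (X Y : Finset V) (P : List V) : Prop :=
  (∃ a ∈ X, ∃ b ∈ Y, Pth R a b P) ∧ P.Nodup ∧ (∀ v ∈ P, v ∈ X ∪ Y) ∧
    ∃ f : V → V, Set.BijOn f {x | x ∈ X ∧ x ∉ P} {y | y ∈ Y ∧ y ∉ P} ∧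
      ∀ x ∈ X, x ∉ P → R x (f x)

lemma GoodPath.insert_pair {P P' : List V} {f : V → V} {x y : V}
    (hf : Set.BijOn f {x | x ∈ X ∧ x ∉ P} {y | y ∈ Y ∧ y ∉ P})
    (hfR : ∀ x ∈ X, x ∉ P → R x (f x)) (hXY : Disjoint X Y) (hx : x ∈ X) (hxP : x ∉ P)
    (hy : f x = y) (hP' : ∀ v, v ∈ P' ↔ v = x ∨ v = y ∨ v ∈ P) :
    Set.BijOn f {x | x ∈ X ∧ x ∉ P'} {y | y ∈ Y ∧ y ∉ P'} ∧ ∀ x ∈ X, x ∉ P' → R x (f x) := by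
  have hdisj := disjoint_left.1 hXY
  have hyY : y ∈ Y := by rw [← hy]; exact (hf.mapsTo ⟨hx, hxP⟩).1
  refine ⟨⟨?_, ?_, ?_⟩, ?_⟩
  · rintro v ⟨hv, hv'⟩
    rw [hP'] at hv'
    push Not at hv'
    obtain ⟨h1, h2⟩ := hf.mapsTo (x := v) ⟨hv, hv'.2.2⟩
    refine ⟨h1, ?_⟩
    rw [hP']
    rintro (h | h | h)
    · rw [h] at h1; exact hdisj hx h1
    · exact hv'.1 (hf.injOn (x₁ := v) (x₂ := x) ⟨hv, hv'.2.2⟩ ⟨hx, hxP⟩ (by rw [h, hy]))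
    · exact h2 h
  · refine hf.injOn.mono ?_
    rintro v ⟨hv, hv'⟩
    refine ⟨hv, fun h => hv' ((hP' v).2 (.inr (.inr h)))⟩
  · rintro v ⟨hv, hv'⟩
    rw [hP'] at hv'
    push Not at hv'
    obtain ⟨u, ⟨hu, huP⟩, rfl⟩ := hf.surjOn (show v ∈ {y | y ∈ Y ∧ y ∉ P} from ⟨hv, hv'.2.2⟩)
    refine ⟨u, ⟨hu, ?_⟩, rfl⟩
    rw [hP']
    rintro (h | h | h)
    · exact hv'.2.1 (by rw [h, hy])
    · rw [h] at hu; exact hdisj hu hyY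
    · exact huP h
  · intro v hv hv'
    exact hfR v hv fun h => hv' ((hP' v).2 (.inr (.inr h)))

end Ham

section Ham
open Finset
open scoped Classical
variable {V : Type*} {R : V → V → Prop} {X Y : Finset V} {q D : ℕ}

lemma Pth.rotate_to {x y c : V} {C : List V} (h : Pth R x y C) (hyx : R y x) (hc : c ∈ C) :
    ∃ C' s, Pth R s c C' ∧ R c s ∧ C'.Perm C := by
  obtain ⟨i, hi, rfl⟩ := List.mem_iff_getElem.1 hc
  by_cases hl : i + 1 < C.length
  · refine ⟨C.drop (i + 1) ++ C.take (i + 1), C[i + 1],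
      (h.drop (i + 1) hl).append (h.take i hi) hyx, h.1.getElem i hl, ?_⟩
    exact List.perm_append_comm.trans (by rw [List.take_append_drop])
  · have hi' : i = C.length - 1 := by omega
    subst hi'
    rw [h.getElem_last hi]
    exact ⟨C, x, h, hyx, List.Perm.refl _⟩

lemma GoodPath.step (hR : ∀ ⦃u v⦄, R u v → R v u)
    (hb : ∀ ⦃u v⦄, R u v → (u ∈ X ∧ v ∈ Y) ∨ (u ∈ Y ∧ v ∈ X)) (hXY : Disjoint X Y)
    (hf : HoleFree R q X Y) (hq : 2 * q + 1 ≤ D) (hX : ∀ x ∈ X, D ≤ dg R x Y)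
    (hY : ∀ y ∈ Y, D ≤ dg R y X) {P : List V} (h : GoodPath R X Y P) :
    (∃ P', GoodPath R X Y P' ∧ P.length < P'.length) ∨
      ∃ C x y, Pth R x y C ∧ R y x ∧ C.Nodup ∧ x ∈ X ∧ ∀ v, v ∈ C ↔ v ∈ X ∪ Y := by
  obtain ⟨⟨a, ha, b, hbY, hP⟩, hn, hsub, f, hfb, hfR⟩ := h
  have hdisj := disjoint_left.1 hXY
  -- a general way to extend by one matched pair
  have ext : ∀ (Q : List V) (s e x y : V), Q.Perm P → Pth R s e Q → x ∈ X → x ∉ P → f x = y →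
      (s ∈ X ∧ e ∈ Y) → (R e x ∨ R y s) → ∃ P', GoodPath R X Y P' ∧ P.length < P'.length := by
    intro Q s e x y hQP hQ hx hxP hy hse hor
    have hyY : y ∈ Y ∧ y ∉ P := by rw [← hy]; exact hfb.mapsTo (x := x) ⟨hx, hxP⟩
    have hxy : R x y := by rw [← hy]; exact hfR x hx hxP
    have hne : x ≠ y := fun h => hdisj hx (h ▸ hyY.1)
    have hQn : Q.Nodup := hQP.nodup_iff.2 hn
    have hxQ : x ∉ Q := fun h => hxP (hQP.mem_iff.1 h)
    have hyQ : y ∉ Q := fun h => hyY.2 (hQP.mem_iff.1 h)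
    have hpair : Pth R x y ([x] ++ [y]) := (Pth.single x).append (Pth.single y) hxy
    have hpn : ([x] ++ [y]).Nodup := by simp [hne]
    rcases hor with hor | hor
    · refine ⟨Q ++ ([x] ++ [y]), ⟨⟨s, hse.1, y, hyY.1, hQ.append hpair hor⟩, ?_, ?_, f, ?_⟩, ?_⟩
      · refine hQn.append hpn ?_
        intro v hv hv'
        simp at hv'
        rcases hv' with rfl | rfl
        exacts [hxQ hv, hyQ hv]
      · intro v hv
        simp only [List.mem_append, List.mem_singleton, hQP.mem_iff] at hv
        rcases hv with hv | rfl | rfl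
        exacts [hsub v hv, mem_union_left _ hx, mem_union_right _ hyY.1]
      · refine GoodPath.insert_pair hfb hfR hXY hx hxP hy fun v => ?_
        simp only [List.mem_append, List.mem_singleton, hQP.mem_iff]; tauto
      · simp [hQP.length_eq]
    · refine ⟨([x] ++ [y]) ++ Q, ⟨⟨x, hx, e, hse.2, hpair.append hQ hor⟩, ?_, ?_, f, ?_⟩, ?_⟩
      · refine hpn.append hQn ?_
        intro v hv' hv
        simp at hv'
        rcases hv' with rfl | rfl
        exacts [hxQ hv, hyQ hv]
      · intro v hv
        simp only [List.mem_append, List.mem_singleton, hQP.mem_iff] at hv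
        rcases hv with (rfl | rfl) | hv
        exacts [mem_union_left _ hx, mem_union_right _ hyY.1, hsub v hv]
      · refine GoodPath.insert_pair hfb hfR hXY hx hxP hy fun v => ?_
        simp only [List.mem_append, List.mem_singleton, hQP.mem_iff]; tauto
      · simp [hQP.length_eq]
  by_cases hNa : ∀ y ∈ Y, R a y → y ∈ P
  swap
  · push Not at hNa
    obtain ⟨y, hy, hay, hyP⟩ := hNa
    obtain ⟨x, ⟨hx, hxP⟩, hxy⟩ := hfb.surjOn (show y ∈ {y | y ∈ Y ∧ y ∉ P} from ⟨hy, hyP⟩)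
    exact .inl (ext P a b x y (List.Perm.refl _) hP hx hxP hxy ⟨ha, hbY⟩ (.inr (hR hay)))
  by_cases hNb : ∀ x ∈ X, R b x → x ∈ P
  swap
  · push Not at hNb
    obtain ⟨x, hx, hbx, hxP⟩ := hNb
    exact .inl (ext P a b x _ (List.Perm.refl _) hP hx hxP rfl ⟨ha, hbY⟩ (.inl hbx))
  obtain ⟨C, x, y, hC, hyx, hperm⟩ :=
    exists_close hR hb hXY hf hq hX hY hP hn ha hbY hNa hNb
  by_cases hall : ∀ v ∈ X ∪ Y, v ∈ P
  · right
    obtain ⟨C', s, hC', hbs, hperm'⟩ := hC.rotate_to hyx (hperm.mem_iff.2 hP.last_mem)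
    refine ⟨C', s, b, hC', hbs, (hperm'.trans hperm).nodup_iff.2 hn, ?_, fun v => ?_⟩
    · rcases hb hbs with h' | h'
      · exact absurd hbY (hdisj h'.1)
      · exact h'.2
    · rw [(hperm'.trans hperm).mem_iff]
      exact ⟨hsub v, hall v⟩
  left
  have hx' : ∃ x ∈ X, x ∉ P := by
    push Not at hall
    obtain ⟨v, hv, hvP⟩ := hall
    rcases mem_union.1 hv with hv | hv
    · exact ⟨v, hv, hvP⟩
    · obtain ⟨x, ⟨hx, hxP⟩, _⟩ := hfb.surjOn (show v ∈ {y | y ∈ Y ∧ y ∉ P} from ⟨hv, hvP⟩)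
      exact ⟨x, hx, hxP⟩
  obtain ⟨x1, hx1, hx1P⟩ := hx'
  have hedge : (∃ c ∈ X, c ∈ P ∧ ∃ y ∈ Y, y ∉ P ∧ R c y) ∨
      (∃ c ∈ Y, c ∈ P ∧ ∃ x ∈ X, x ∉ P ∧ R c x) := by
    by_cases h1 : q ≤ (X.filter (· ∈ P)).card
    · by_cases h2 : q ≤ (Y.filter (· ∉ P)).card
      · obtain ⟨c, hc, y, hy, hcy⟩ := hf _ (filter_subset _ _) _ (filter_subset _ _)
          h1 h2
        rw [mem_filter] at hc hy
        exact .inl ⟨c, hc.1, hc.2, y, hy.1, hy.2, hcy⟩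
      · right
        have h3 := hX x1 hx1
        by_contra hcon
        push Not at hcon
        have : Y.filter (R x1) ⊆ Y.filter (· ∉ P) := by
          intro y hy
          rw [mem_filter] at hy ⊢
          exact ⟨hy.1, fun hyP => hcon y hy.1 hyP x1 hx1 hx1P (hR hy.2)⟩
        have := card_le_card this
        unfold dg at h3
        omega
    · right
      have h3 := hY b hbY
      by_contra hcon
      push Not at hcon
      have : X.filter (R b) ⊆ X.filter (· ∈ P) := by
        intro y hy
        rw [mem_filter] at hy ⊢
        refine ⟨hy.1, ?_⟩
        by_contra hyP
        exact hcon b hbY hP.last_mem y hy.1 hyP hy.2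
      have := card_le_card this
      unfold dg at h3
      omega
  rcases hedge with ⟨c, hcX, hcP, y, hy, hyP, hcy⟩ | ⟨c, hcY, hcP, x, hx, hxP, hcx⟩
  · obtain ⟨C', s, hC', hcs, hperm'⟩ := hC.rotate_to hyx (hperm.mem_iff.2 hcP)
    obtain ⟨x, ⟨hx, hxP⟩, hxy⟩ := hfb.surjOn (show y ∈ {y | y ∈ Y ∧ y ∉ P} from ⟨hy, hyP⟩)
    have hs : s ∈ Y := by
      rcases hb hcs with h' | h'
      · exact h'.2
      · exact absurd h'.1 (hdisj hcX)
    exact ext C'.reverse c s x y ((List.reverse_perm _).trans (hperm'.trans hperm))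
      (hC'.reverse hR) hx hxP hxy ⟨hcX, hs⟩ (.inr (hR hcy))
  · obtain ⟨C', s, hC', hcs, hperm'⟩ := hC.rotate_to hyx (hperm.mem_iff.2 hcP)
    have hs : s ∈ X := by
      rcases hb hcs with h' | h'
      · exact absurd hcY (hdisj h'.1)
      · exact h'.2
    exact ext C' s c x _ (hperm'.trans hperm) hC' hx hxP rfl ⟨hs, hcY⟩ (.inl hcx)

lemma exists_hamCycle (hR : ∀ ⦃u v⦄, R u v → R v u)
    (hb : ∀ ⦃u v⦄, R u v → (u ∈ X ∧ v ∈ Y) ∨ (u ∈ Y ∧ v ∈ X)) (hXY : Disjoint X Y)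
    (hc : X.card = Y.card) (hne : X.Nonempty)
    (hf : HoleFree R q X Y) (hq : 2 * q + 1 ≤ D) (hX : ∀ x ∈ X, D ≤ dg R x Y)
    (hY : ∀ y ∈ Y, D ≤ dg R y X) :
    ∃ C x y, Pth R x y C ∧ R y x ∧ C.Nodup ∧ x ∈ X ∧ ∀ v, v ∈ C ↔ v ∈ X ∪ Y := by
  obtain ⟨f, hfb, hfR⟩ := hf.exists_matching hR hc (by omega) hX hY
  obtain ⟨x, hx⟩ := hne
  have hdisj := disjoint_left.1 hXY
  have hfx : f x ∈ Y := hfb.mapsTo hx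
  have h0 : GoodPath R X Y ([x] ++ [f x]) := by
    refine ⟨⟨x, hx, f x, hfx, (Pth.single x).append (Pth.single _) (hfR x hx)⟩, ?_, ?_, f, ?_⟩
    · simp only [List.cons_append, List.nil_append, List.nodup_cons, List.mem_singleton,
        List.not_mem_nil, not_false_eq_true, List.nodup_nil, and_true]
      exact fun h => hdisj hx (h ▸ hfx)
    · intro v hv
      simp only [List.cons_append, List.nil_append, List.mem_cons, List.not_mem_nil, or_false] at hv
      rcases hv with rfl | rfl
      exacts [mem_union_left _ hx, mem_union_right _ hfx]
    · refine GoodPath.insert_pair (P := []) (by simpa using hfb) (by simpa using hfR) hXY hx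
        (by simp) rfl fun v => by simp
  have key : ∀ k (P : List V), GoodPath R X Y P → (X ∪ Y).card + 1 ≤ P.length + k →
      ∃ C x y, Pth R x y C ∧ R y x ∧ C.Nodup ∧ x ∈ X ∧ ∀ v, v ∈ C ↔ v ∈ X ∪ Y := by
    intro k
    induction k with
    | zero =>
      intro P hP hk
      exfalso
      have h1 : P.toFinset ⊆ X ∪ Y := by
        intro v hv
        exact hP.2.2.1 v (List.mem_toFinset.1 hv)
      have h2 := card_le_card h1
      rw [List.toFinset_card_of_nodup hP.2.1] at h2
      omega
    | succ k ih =>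
      intro P hP hk
      rcases hP.step hR hb hXY hf hq hX hY with ⟨P', hP', hlt⟩ | h
      · exact ih P' hP' (by omega)
      · exact h
  exact key _ _ h0 (Nat.le_add_left _ _)

lemma hamPath_of_cycle
    (hb : ∀ ⦃u v⦄, R u v → (u ∈ X ∧ v ∈ Y) ∨ (u ∈ Y ∧ v ∈ X)) (hXY : Disjoint X Y)
    {C : List V} {x y x0 y0 : V} (hC : Pth R x y C) (hyx : R y x) (hn : C.Nodup) (hx : x ∈ X)
    (hCm : ∀ v ∈ X ∪ Y, v ∈ C) {R' : V → V → Prop} (hRR : ∀ u v, R u v → R' u v)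
    (hR' : ∀ ⦃u v⦄, R' u v → R' v u)
    (hf : HoleFree R q X Y) (hx0 : q + 1 ≤ dg R' x0 Y) (hy0 : q ≤ dg R' y0 X) :
    ∃ P, P.Perm C ∧ Pth R' x0 y0 ([x0] ++ P ++ [y0]) := by
  have hdisj := disjoint_left.1 hXY
  have halt := hC.mem_of_even_odd hb hXY hx
  have hyY : y ∈ Y := by
    rcases hb hyx with h | h
    · exact absurd h.2 (hdisj hx)
    · exact h.1
  set J := (range (C.length - 1)).filter fun j => R' x0 (C.getD j x) ∧ ¬ Even j with hJdef
  set K := (range (C.length - 1)).filter fun j => R' y0 (C.getD j x) ∧ Even j with hKdef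
  have hJc : q ≤ J.card := by
    have : Y.filter (R' x0) ⊆ (insert (C.length - 1) J).image fun j => C.getD j x := by
      intro y hy
      rw [mem_filter] at hy
      obtain ⟨i, hi, rfl⟩ := List.mem_iff_getElem.1 (hCm y (mem_union_right _ hy.1))
      rw [mem_image]
      refine ⟨i, ?_, List.getD_eq_getElem _ _ hi⟩
      rw [mem_insert, hJdef, mem_filter, mem_range,
        List.getD_eq_getElem _ _ hi]
      by_cases h' : i < C.length - 1
      · exact .inr ⟨h', hy.2, fun he => hdisj ((halt i hi).1 he) hy.1⟩
      · left; omega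
    have h1 := (card_le_card this).trans card_image_le
    have h3 := card_insert_le (C.length - 1) J
    unfold dg at hx0
    omega
  have hKc : q ≤ K.card := by
    have : X.filter (R' y0) ⊆ K.image fun j => C.getD j x := by
      intro x' hx'
      rw [mem_filter] at hx'
      obtain ⟨i, hi, rfl⟩ := List.mem_iff_getElem.1 (hCm x' (mem_union_left _ hx'.1))
      rw [mem_image]
      refine ⟨i, ?_, List.getD_eq_getElem _ _ hi⟩
      rw [hKdef, mem_filter, mem_range, List.getD_eq_getElem _ _ hi]
      refine ⟨?_, hx'.2, ?_⟩
      · by_contra hcon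
        have hi' : i = C.length - 1 := by omega
        subst hi'
        rw [hC.getElem_last (by omega)] at hx'
        exact hdisj hx'.1 hyY
      · by_contra he
        exact hdisj hx'.1 ((halt i hi).2 he)
    have h1 := (card_le_card this).trans card_image_le
    unfold dg at hy0
    omega
  have hJ : ∀ j ∈ J, ∃ hj : j + 1 < C.length, R' x0 C[j] ∧ ¬ Even j := by
    intro j hj
    rw [hJdef, mem_filter, mem_range] at hj
    have hj' : j + 1 < C.length := by omega
    rw [List.getD_eq_getElem _ _ (by omega)] at hj
    exact ⟨hj', hj.2⟩
  have hK : ∀ k ∈ K, ∃ hk : k + 1 < C.length, R' y0 C[k] ∧ Even k := by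
    intro j hj
    rw [hKdef, mem_filter, mem_range] at hj
    have hj' : j + 1 < C.length := by omega
    rw [List.getD_eq_getElem _ _ (by omega)] at hj
    exact ⟨hj', hj.2⟩
  have hJX : (J.image fun k => C.getD (k + 1) x) ⊆ X := by
    intro y hy
    obtain ⟨k, hk, rfl⟩ := mem_image.1 hy
    obtain ⟨hk1, hk2, hk3⟩ := hJ k hk
    rw [List.getD_eq_getElem _ _ hk1]
    exact (halt _ hk1).1 (by rw [Nat.even_add_one]; exact hk3)
  have hKY : (K.image fun k => C.getD (k + 1) x) ⊆ Y := by
    intro y hy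
    obtain ⟨k, hk, rfl⟩ := mem_image.1 hy
    obtain ⟨hk1, hk2, hk3⟩ := hK k hk
    rw [List.getD_eq_getElem _ _ hk1]
    exact (halt _ hk1).2 (by rw [Nat.even_add_one]; simpa using hk3)
  have hJcc : (J.image fun k => C.getD (k + 1) x).card = J.card :=
    card_image_getD hn x (fun k hk => (hJ k hk).1) fun i _ j _ h => by simpa using h
  have hKcc : (K.image fun k => C.getD (k + 1) x).card = K.card :=
    card_image_getD hn x (fun k hk => (hK k hk).1) fun i _ j _ h => by simpa using h
  obtain ⟨x1, hx1, y1, hy1, hxy⟩ := hf _ hJX _ hKY (by omega) (by omega)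
  obtain ⟨j, hj, rfl⟩ := mem_image.1 hx1
  obtain ⟨k, hk, rfl⟩ := mem_image.1 hy1
  obtain ⟨hj1, hj2, hj3⟩ := hJ j hj
  obtain ⟨hk1, hk2, hk3⟩ := hK k hk
  rw [List.getD_eq_getElem _ _ hj1, List.getD_eq_getElem _ _ hk1] at hxy
  have hC' : Pth R' x y C := ⟨hC.1.imp hRR, hC.2⟩
  have hjk : j ≠ k := by rintro rfl; exact hj3 hk3
  have hxy' := hRR _ _ hxy
  have hyx' := hRR _ _ hyx
  rcases lt_or_gt_of_ne hjk with h | h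
  · have p1 := ((hC'.drop (k + 1) hk1).append (hC'.take j (by omega)) hyx').reverse hR'
    have p2 := hC'.mid (j + 1) k h (by omega)
    have p3 := p1.append p2 (hR' hxy')
    refine ⟨_, ?_, ((Pth.single x0).append p3 hj2).append (Pth.single y0) (hR' hk2)⟩
    have e : k - (j + 1) + 1 = k - j := by omega
    rw [e]
    conv_rhs => rw [split_three C j k (by omega)]
    refine ((List.reverse_perm _).append (List.Perm.refl _)).trans ?_
    rw [← List.append_assoc (C.take (j + 1))]
    refine List.perm_append_comm.trans ?_
    rw [← List.append_assoc]
    refine List.perm_append_comm.trans ?_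
    rw [← List.append_assoc]
  · have p1 := (hC'.drop (j + 1) hj1).append (hC'.take k (by omega)) hyx'
    have p2 := (hC'.mid (k + 1) j h (by omega)).reverse hR'
    have p3 := p2.append p1 (hR' hxy')
    refine ⟨_, ?_, ((Pth.single x0).append p3 hj2).append (Pth.single y0) (hR' hk2)⟩
    have e : j - (k + 1) + 1 = j - k := by omega
    rw [e]
    conv_rhs => rw [split_three C k j (by omega)]
    refine ((List.reverse_perm _).append (List.Perm.refl _)).trans ?_
    rw [← List.append_assoc]
    exact List.perm_append_comm

lemma dg_le_dg_of {R' : V → V → Prop} {v : V} {T : Finset V} (h : ∀ y ∈ T, R v y → R' v y) :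
    dg R v T ≤ dg R' v T := by
  unfold dg
  refine card_le_card fun y hy => ?_
  rw [mem_filter] at hy ⊢
  exact ⟨hy.1, h y hy.1 hy.2⟩

/-- Hamiltonian path with prescribed ends in a balanced hole-free bipartite graph. -/
theorem exists_hamPath (hR : ∀ ⦃u v⦄, R u v → R v u) (hXY : Disjoint X Y)
    (hc : X.card = Y.card) {x0 y0 : V} (hx0 : x0 ∈ X) (hy0 : y0 ∈ Y) (hf : HoleFree R q X Y)
    (hq : 2 * q + 2 ≤ D) (hX : ∀ x ∈ X, D ≤ dg R x Y) (hY : ∀ y ∈ Y, D ≤ dg R y X) :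
    ∃ P, P.Nodup ∧ Pth R x0 y0 P ∧ ∀ v, v ∈ P ↔ v ∈ X ∪ Y := by
  have hdisj := disjoint_left.1 hXY
  set X1 := X.erase x0 with hX1
  set Y1 := Y.erase y0 with hY1
  set R1 : V → V → Prop := fun u v => R u v ∧ ((u ∈ X1 ∧ v ∈ Y1) ∨ (u ∈ Y1 ∧ v ∈ X1)) with hR1
  have hd1 : Disjoint X1 Y1 := hXY.mono (erase_subset _ _) (erase_subset _ _)
  have hdgY : ∀ v, dg R v Y ≤ dg R v Y1 + 1 := by
    intro v
    have := dg_le_sdiff_add (R := R) v Y {y0}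
    rwa [sdiff_singleton_eq_erase, card_singleton] at this
  have hdgX : ∀ v, dg R v X ≤ dg R v X1 + 1 := by
    intro v
    have := dg_le_sdiff_add (R := R) v X {x0}
    rwa [sdiff_singleton_eq_erase, card_singleton] at this
  have hR1s : ∀ ⦃u v⦄, R1 u v → R1 v u := fun u v h => ⟨hR h.1, by tauto⟩
  have hf1 : HoleFree R1 q X1 Y1 := by
    intro X' hX' Y' hY' h1 h2
    obtain ⟨x, hx, y, hy, hxy⟩ := hf X' (hX'.trans (erase_subset _ _)) Y'
      (hY'.trans (erase_subset _ _)) h1 h2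
    exact ⟨x, hx, y, hy, hxy, .inl ⟨hX' hx, hY' hy⟩⟩
  have hdX : ∀ x ∈ X1, D - 1 ≤ dg R1 x Y1 := by
    intro x hx
    have h1 := hX x (mem_of_mem_erase hx)
    have h2 := hdgY x
    have h3 : dg R x Y1 ≤ dg R1 x Y1 :=
      dg_le_dg_of fun y hy h => ⟨h, .inl ⟨hx, hy⟩⟩
    omega
  have hdY : ∀ y ∈ Y1, D - 1 ≤ dg R1 y X1 := by
    intro x hx
    have h1 := hY x (mem_of_mem_erase hx)
    have h2 := hdgX x
    have h3 : dg R x X1 ≤ dg R1 x X1 :=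
      dg_le_dg_of fun y hy h => ⟨h, .inr ⟨hx, hy⟩⟩
    omega
  have hc1 : X1.card = Y1.card := by
    rw [card_erase_of_mem hx0, card_erase_of_mem hy0, hc]
  have hne : X1.Nonempty := by
    rw [← card_pos, hc1]
    have h1 := hX x0 hx0
    have h2 := hdgY x0
    have h3 := dg_le_card (R := R) x0 Y1
    omega
  obtain ⟨C, x, y, hC, hyx, hn, hx, hCm⟩ := exists_hamCycle hR1s (fun u v h => h.2) hd1 hc1 hne hf1
    (D := D - 1) (by omega) hdX hdY
  obtain ⟨P, hPC, hP⟩ := hamPath_of_cycle (x0 := x0) (y0 := y0) (fun u v h => h.2) hd1 hC hyx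
    hn hx (fun v hv => (hCm v).2 hv) (R' := R) (fun u v h => h.1) hR hf1
    (by have := hX x0 hx0; have := hdgY x0; omega) (by have := hY y0 hy0; have := hdgX y0; omega)
  refine ⟨_, ?_, hP, ?_⟩
  · have h1 : x0 ∉ P := by
      rw [hPC.mem_iff, hCm, mem_union, hX1, hY1]
      simp only [mem_erase, ne_eq, not_true_eq_false, false_and, false_or]
      exact fun h => hdisj hx0 h.2
    have h2 : y0 ∉ P := by
      rw [hPC.mem_iff, hCm, mem_union, hX1, hY1]
      simp only [mem_erase, ne_eq, not_true_eq_false, false_and, or_false]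
      exact fun h => hdisj h.2 hy0
    have h3 : x0 ≠ y0 := fun h => hdisj hx0 (h ▸ hy0)
    rw [List.append_assoc, List.singleton_append, List.nodup_cons, List.nodup_append]
    refine ⟨by simp [h1, h3], hPC.nodup_iff.2 hn, by simp, ?_⟩
    intro a ha b hb
    simp only [List.mem_singleton] at hb
    rintro rfl
    exact h2 (hb ▸ ha)
  · intro v
    simp only [List.mem_append, List.mem_singleton, hPC.mem_iff, hCm, mem_union, hX1, hY1,
      mem_erase]
    constructor
    · rintro ((rfl | h) | rfl) <;> tauto
    · intro h
      by_cases e1 : v = x0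
      · tauto
      · by_cases e2 : v = y0 <;> tauto

end Ham

section Regularize
open Finset
open scoped Classical

lemma density_increment {V : Type*} {R : V → V → Prop} (hR : ∀ ⦃u v⦄, R u v → R v u)
    {X Y X1 Y1 : Finset V} {m q : ℕ} {ρ : ℝ} (hX : X.card = m) (hY : Y.card = m) (hX1 : X1 ⊆ X)
    (hY1 : Y1 ⊆ Y) (hcX : X1.card = q) (hcY : Y1.card = q) (hq : 0 < q) (hqm : 2 * q ≤ m)
    (hρ : ρ * (m * m) ≤ ed R X Y) (hlow : (ed R X1 Y1 : ℝ) < ρ / 2 * (q * q)) :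
    ∃ X' ⊆ X, ∃ Y' ⊆ Y, X'.card = q ∧ Y'.card = q ∧
      ρ * (1 + q * q / (2 * (m * m))) * (q * q) ≤ ed R X' Y' := by
  set γ : ℝ := q * q / (2 * (m * m)) with hγ
  have hq0 : (0 : ℝ) < q := by exact_mod_cast hq
  have hm0 : (0 : ℝ) < m := by exact_mod_cast (by omega : 0 < m)
  have hqm' : (2 * q : ℝ) ≤ m := by exact_mod_cast hqm
  have hρ0 : 0 < ρ := by
    by_contra h
    have : ρ / 2 * (q * q) ≤ 0 := by
      apply mul_nonpos_of_nonpos_of_nonneg <;> [linarith; positivity]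
    have h2 : (0 : ℝ) ≤ ed R X1 Y1 := by positivity
    linarith
  have hcX' : (X \ X1).card = m - q := by rw [card_sdiff_of_subset hX1, hX, hcX]
  have hcY' : (Y \ Y1).card = m - q := by rw [card_sdiff_of_subset hY1, hY, hcY]
  have hsum : ed R X Y = ed R X (Y \ Y1) + (ed R (X \ X1) Y1 + ed R X1 Y1) := by
    conv_lhs => rw [← sdiff_union_of_subset hY1]
    rw [ed_union_right _ sdiff_disjoint]
    congr 1
    conv_lhs => rw [← sdiff_union_of_subset hX1]
    rw [ed_union_left sdiff_disjoint]
  have hsum' : (ed R X Y : ℝ) = ed R X (Y \ Y1) + (ed R (X \ X1) Y1 + ed R X1 Y1) := by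
    exact_mod_cast hsum
  have hcast : ((m - q : ℕ) : ℝ) = m - q := by push_cast [Nat.cast_sub (by omega : q ≤ m)]; ring
  have key : ρ * (1 + γ) * (m * (m - q)) ≤ ed R X (Y \ Y1) ∨
      ρ * (1 + γ) * ((m - q) * q) ≤ ed R (X \ X1) Y1 := by
    by_contra hcon
    push Not at hcon
    have e : γ * (2 * (m * m)) = q * q := by rw [hγ]; field_simp
    have hγ0 : 0 ≤ γ := by positivity
    have h1 : ρ * (m * m) < ρ * ((1 + γ) * (m * m - q * q) + q * q / 2) := by
      nlinarith [hcon.1, hcon.2]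
    have h2 := lt_of_mul_lt_mul_left h1 hρ0.le
    nlinarith [mul_nonneg hγ0 (mul_pos hq0 hq0).le]
  rcases key with h | h
  · obtain ⟨S', hS', T', hT', h1, h2, h3⟩ := exists_subrect_ed_ge hR X (Y \ Y1) q q (by omega)
      (by omega) (ρ := ρ * (1 + γ)) (by rw [hX, hcY', hcast]; exact h) (by omega) (by omega)
    exact ⟨S', hS', T', hT'.trans sdiff_subset, h1, h2, h3⟩
  · obtain ⟨S', hS', T', hT', h1, h2, h3⟩ := exists_subrect_ed_ge hR (X \ X1) Y1 q q (by omega)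
      (by omega) (ρ := ρ * (1 + γ)) (by rw [hcX', hcY, hcast]; exact h) (by omega) (by omega)
    exact ⟨S', hS'.trans sdiff_subset, T', hT'.trans hY1, h1, h2, h3⟩

/-- One step of the simultaneous regularisation, with a budget of `k` further increments. -/
lemma regularize_aux (ι : Type) [Fintype ι] {δ ε : ℝ} (hδ : 0 < δ) (hε : 0 < ε) (hε2 : ε ≤ 1 / 2)
    (k : ℕ) : ∃ c : ℝ, 0 < c ∧ c ≤ 1 ∧ ∀ {V : Type} (R : ι → V → V → Prop)
      (_ : ∀ a, ∀ ⦃u v⦄, R a u v → R a v u) (X Y : ι → Finset V) (m : ℕ),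
      1 ≤ c * m → (∀ a, (X a).card = m) → (∀ a, (Y a).card = m) →
      (∀ a, δ * (m * m) ≤ ed (R a) (X a) (Y a)) →
      (Fintype.card ι - k * (δ * ε ^ 2 / 8)) * (m * m) < ∑ a, (ed (R a) (X a) (Y a) : ℝ) →
      ∃ (m' q : ℕ) (X' Y' : ι → Finset V), (∀ a, X' a ⊆ X a) ∧ (∀ a, Y' a ⊆ Y a) ∧
        (∀ a, (X' a).card = m') ∧ (∀ a, (Y' a).card = m') ∧ c * m ≤ m' ∧ 0 < q ∧ q ≤ ε * m' ∧
        ∀ a, Reg (R a) q (δ / 2) (X' a) (Y' a) := by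
  induction k with
  | zero =>
    refine ⟨1, one_pos, le_rfl, ?_⟩
    intro V R hR X Y m hm hX hY hd hlt
    exfalso
    have : ∑ a, (ed (R a) (X a) (Y a) : ℝ) ≤ ∑ _a : ι, (m * m : ℝ) := by
      refine sum_le_sum fun a _ => ?_
      have := ed_le_card_mul (R := R a) (X a) (Y a)
      rw [hX, hY] at this
      exact_mod_cast this
    rw [sum_const, nsmul_eq_mul, card_univ] at this
    simp only [Nat.cast_zero, zero_mul, sub_zero] at hlt
    linarith
  | succ k ih =>
    obtain ⟨c, hc, hc1, ih⟩ := ih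
    refine ⟨c * (ε / 2), by positivity, by nlinarith, ?_⟩
    intro V R hR X Y m hm hX hY hd hlt
    have hm0 : (0 : ℝ) ≤ m := by positivity
    have hmε : 1 ≤ ε / 2 * m := by nlinarith [mul_nonneg hε.le hm0]
    have hmpos : (0 : ℝ) < m := by
      rcases hm0.eq_or_lt with h | h
      · rw [← h] at hmε; norm_num at hmε
      · exact h
    set q := ⌊ε * m⌋₊ with hq
    have hqle : (q : ℝ) ≤ ε * m := Nat.floor_le (by positivity)
    have hqge : ε / 2 * m ≤ q := by
      have := Nat.lt_floor_add_one (ε * m)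
      rw [← hq] at this
      linarith
    have hq1 : 0 < q := by
      have : (0 : ℝ) < q := by linarith
      exact_mod_cast this
    have hqm : 2 * q ≤ m := by
      have : (2 * q : ℝ) ≤ m := by nlinarith
      exact_mod_cast this
    by_cases hall : ∀ a, Reg (R a) q (δ / 2) (X a) (Y a)
    · refine ⟨m, q, X, Y, fun _ => subset_rfl, fun _ => subset_rfl, hX, hY, ?_, hq1, hqle, hall⟩
      have : c * (ε / 2) ≤ 1 := by nlinarith
      nlinarith
    · simp only [not_forall] at hall
      obtain ⟨a0, ha0⟩ := hall
      unfold Reg at ha0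
      push Not at ha0
      obtain ⟨X1, hX1, Y1, hY1, hcX1, hcY1, hlow⟩ := ha0
      have hmm : (0 : ℝ) < m * m := by positivity
      have hq0 : (0 : ℝ) < q := by exact_mod_cast hq1
      set ρ : ι → ℝ := fun a => ed (R a) (X a) (Y a) / (m * m) with hρ
      have hρe : ∀ a, ρ a * (m * m) = ed (R a) (X a) (Y a) := fun a => by
        rw [hρ]; field_simp
      have hρδ : ∀ a, δ ≤ ρ a := fun a => by
        rw [hρ]; simp only; rw [le_div_iff₀ hmm]; exact hd a
      have hstep : ∀ a, ∃ X' ⊆ X a, ∃ Y' ⊆ Y a, X'.card = q ∧ Y'.card = q ∧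
          (ρ a + if a = a0 then δ * ε ^ 2 / 8 else 0) * (q * q) ≤ ed (R a) X' Y' := by
        intro a
        by_cases haa : a = a0
        · subst haa
          obtain ⟨X', h1, Y', h2, h3, h4, h5⟩ := density_increment (hR a) (hX a) (hY a) hX1 hY1
            hcX1 hcY1 hq1 hqm (hρe a).le (hlow.trans_le (by
              have := hρδ a
              nlinarith [mul_pos hq0 hq0]))
          refine ⟨X', h1, Y', h2, h3, h4, le_trans ?_ h5⟩
          rw [if_pos rfl]
          refine mul_le_mul_of_nonneg_right ?_ (by positivity)
          have h6 : ε ^ 2 / 8 ≤ q * q / (2 * (m * m)) := by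
            rw [div_le_div_iff₀ (by norm_num) (by positivity)]
            nlinarith [mul_le_mul hqge hqge (by positivity) hq0.le]
          have h7 := mul_le_mul (hρδ a) h6 (by positivity) (hδ.le.trans (hρδ a))
          linarith
        · obtain ⟨S', hS', T', hT', h1, h2, h3⟩ := exists_subrect_ed_ge (hR a) (X a) (Y a) q q
            (by rw [hX]; omega) (by rw [hY]; omega) (ρ := ρ a) (by rw [hX, hY]; exact (hρe a).le)
            (by rw [hX]; omega) (by rw [hY]; omega)
          exact ⟨S', hS', T', hT', h1, h2, by rw [if_neg haa, add_zero]; exact h3⟩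
      choose X' hX' Y' hY' hcX' hcY' hed using hstep
      have hge : ∀ a, ρ a * (q * q) ≤ ed (R a) (X' a) (Y' a) := fun a => by
        refine le_trans (mul_le_mul_of_nonneg_right ?_ (by positivity)) (hed a)
        split_ifs
        · have : 0 < δ * ε ^ 2 / 8 := by positivity
          linarith
        · linarith
      obtain ⟨m', q', X'', Y'', i1, i2, i3, i4, i5, i6, i7, i8⟩ := ih R hR X' Y' q (by nlinarith)
        hcX' hcY' (fun a => le_trans (mul_le_mul_of_nonneg_right (hρδ a) (by positivity)) (hge a)) (by
          have hs : ∑ a, (ρ a + if a = a0 then δ * ε ^ 2 / 8 else 0) * (q * q : ℝ) ≤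
              ∑ a, (ed (R a) (X' a) (Y' a) : ℝ) := sum_le_sum fun a _ => hed a
          rw [← sum_mul, sum_add_distrib, sum_ite_eq' univ a0,
            if_pos (mem_univ _)] at hs
          refine lt_of_lt_of_le (mul_lt_mul_of_pos_right ?_ (by positivity)) hs
          have : (∑ a, ρ a) * (m * m) = ∑ a, (ed (R a) (X a) (Y a) : ℝ) := by
            rw [sum_mul]; exact sum_congr rfl fun a _ => hρe a
          rw [← this] at hlt
          have h9 := lt_of_mul_lt_mul_right hlt hmm.le
          push_cast at h9
          linarith)
      refine ⟨m', q', X'', Y'', fun a => (i1 a).trans (hX' a), fun a => (i2 a).trans (hY' a), i3, i4,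
        le_trans ?_ i5, i6, i7, i8⟩
      nlinarith

/-- Simultaneous regularisation of finitely many dense squares. -/
theorem exists_regular_family (ι : Type) [Fintype ι] {δ ε : ℝ} (hδ : 0 < δ) (hε : 0 < ε)
    (hε2 : ε ≤ 1 / 2) : ∃ c : ℝ, 0 < c ∧ c ≤ 1 ∧ ∀ {V : Type} (R : ι → V → V → Prop)
      (_ : ∀ a, ∀ ⦃u v⦄, R a u v → R a v u) (X Y : ι → Finset V) (m : ℕ),
      1 ≤ c * m → (∀ a, (X a).card = m) → (∀ a, (Y a).card = m) →
      (∀ a, δ * (m * m) ≤ ed (R a) (X a) (Y a)) →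
      ∃ (m' q : ℕ) (X' Y' : ι → Finset V), (∀ a, X' a ⊆ X a) ∧ (∀ a, Y' a ⊆ Y a) ∧
        (∀ a, (X' a).card = m') ∧ (∀ a, (Y' a).card = m') ∧ c * m ≤ m' ∧ 0 < q ∧ q ≤ ε * m' ∧
        ∀ a, Reg (R a) q (δ / 2) (X' a) (Y' a) := by
  obtain ⟨k, hk⟩ := exists_nat_gt ((Fintype.card ι : ℝ) / (δ * ε ^ 2 / 8))
  obtain ⟨c, hc, hc1, h⟩ := regularize_aux ι hδ hε hε2 k
  refine ⟨c, hc, hc1, fun R hR X Y m hm hX hY hd => h R hR X Y m hm hX hY hd ?_⟩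
  rw [div_lt_iff₀ (by positivity)] at hk
  have hm0 : (0 : ℝ) < m := by
    rcases (Nat.cast_nonneg m : (0 : ℝ) ≤ m).eq_or_lt with h | h
    · rw [← h] at hm; norm_num at hm
    · exact h
  refine lt_of_lt_of_le (mul_neg_of_neg_of_pos (by linarith) (by positivity)) ?_
  positivity

/-- Removing exactly `q` vertices from each side of a regular pair leaves large minimum degrees. -/
lemma Reg.clean {V : Type*} {R : V → V → Prop} (hR : ∀ ⦃u v⦄, R u v → R v u) {X Y : Finset V}
    {m q : ℕ} {d : ℝ} (h : Reg R q d X Y) (hX : X.card = m) (hY : Y.card = m) (hq : 0 < q)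
    (hqm : q ≤ m) : ∃ X' ⊆ X, ∃ Y' ⊆ Y, X'.card = m - q ∧ Y'.card = m - q ∧
      (∀ x ∈ X', d * m - q ≤ dg R x Y') ∧ (∀ y ∈ Y', d * m - q ≤ dg R y X') := by
  have key : ∀ {X Y : Finset V}, Reg R q d X Y → X.card = m → Y.card = m →
      ∃ X' ⊆ X, X'.card = m - q ∧ ∀ x ∈ X', d * m ≤ dg R x Y := by
    intro X Y h hX hY
    have h1 := h.card_low_lt hR hq subset_rfl (by omega)
    obtain ⟨D, hD1, hD2, hD⟩ := exists_subsuperset_card_eq (n := q)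
      (filter_subset (fun x => (dg R x Y : ℝ) < d * Y.card) X) h1.le (by omega)
    refine ⟨X \ D, sdiff_subset, by rw [card_sdiff_of_subset hD2, hX, hD], ?_⟩
    intro x hx
    rw [mem_sdiff] at hx
    by_contra hcon
    push Not at hcon
    exact hx.2 (hD1 (mem_filter.2 ⟨hx.1, by rw [hY]; exact hcon⟩))
  obtain ⟨X', hX', hcX, hdX⟩ := key h hX hY
  obtain ⟨Y', hY', hcY, hdY⟩ := key (h.symm hR) hY hX
  have aux : ∀ {Z Z' : Finset V}, Z' ⊆ Z → Z.card = m → Z'.card = m - q → ∀ x,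
      d * m ≤ dg R x Z → d * m - q ≤ dg R x Z' := by
    intro Z Z' hZ hc hc' x hx
    have h1 := dg_le_sdiff_add (R := R) x Z (Z \ Z')
    rw [Finset.sdiff_sdiff_eq_self hZ, card_sdiff_of_subset hZ, hc, hc'] at h1
    have h2 : (dg R x Z : ℝ) ≤ dg R x Z' + q := by
      exact_mod_cast h1.trans (by omega)
    linarith
  exact ⟨X', hX', Y', hY', hcX, hcY, fun x hx => aux hY' hY hcY x (hdX x hx),
    fun y hy => aux hX' hX hcX y (hdY y hy)⟩

end Regularize

section Families
open Finset
open scoped Classical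

/-- Greedy choice of pairwise disjoint dense squares inside finitely many dense rectangles. -/
lemma exists_disjoint_squares {V κ : Type} [Fintype κ] (R : κ → V → V → Prop)
    (hR : ∀ a, ∀ ⦃u v⦄, R a u v → R a v u) (S T : κ → Finset V) {m g : ℕ} {δ : ℝ} (hδ : 0 < δ)
    (hg : (4 * Fintype.card κ * g : ℝ) ≤ δ * m) (hg0 : 0 < g) (hS : ∀ a, m ≤ (S a).card)
    (hT : ∀ a, m ≤ (T a).card) (hd : ∀ a, δ * ((S a).card * (T a).card) ≤ ed (R a) (S a) (T a)) :
    ∃ X Y : κ → Finset V, (∀ a, X a ⊆ S a) ∧ (∀ a, Y a ⊆ T a) ∧ (∀ a, (X a).card = g) ∧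
      (∀ a, (Y a).card = g) ∧ (∀ a, δ / 2 * (g * g) ≤ ed (R a) (X a) (Y a)) ∧
      (∀ a b, a ≠ b → Disjoint (X a) (X b)) ∧ (∀ a b, a ≠ b → Disjoint (Y a) (Y b)) := by
  suffices H : ∀ s : Finset κ, ∃ X Y : κ → Finset V, ∀ a ∈ s, (X a ⊆ S a) ∧ (Y a ⊆ T a) ∧
      ((X a).card = g) ∧ ((Y a).card = g) ∧ (δ / 2 * (g * g) ≤ ed (R a) (X a) (Y a)) ∧
      (∀ b ∈ s, a ≠ b → Disjoint (X a) (X b)) ∧ (∀ b ∈ s, a ≠ b → Disjoint (Y a) (Y b)) by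
    obtain ⟨X, Y, h⟩ := H univ
    simp only [mem_univ, true_implies] at h
    exact ⟨X, Y, fun a => (h a).1, fun a => (h a).2.1, fun a => (h a).2.2.1, fun a => (h a).2.2.2.1,
      fun a => (h a).2.2.2.2.1, fun a => (h a).2.2.2.2.2.1, fun a => (h a).2.2.2.2.2.2⟩
  intro s
  induction s using Finset.induction_on with
  | empty => exact ⟨fun _ => ∅, fun _ => ∅, by simp⟩
  | insert a s ha ih =>
    obtain ⟨X, Y, h⟩ := ih
    have hsc : s.card + 1 ≤ Fintype.card κ := by
      rw [← card_insert_of_notMem ha]; exact card_le_univ _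
    set F := s.biUnion X with hF
    set F' := s.biUnion Y with hF'
    have hFc : F.card ≤ s.card * g := card_biUnion_le_card_mul _ _ _ fun b hb => (h b hb).2.2.1.le
    have hFc' : F'.card ≤ s.card * g :=
      card_biUnion_le_card_mul _ _ _ fun b hb => (h b hb).2.2.2.1.le
    have hg0' : (0 : ℝ) < g := by exact_mod_cast hg0
    have hk1 : ((s.card : ℝ) + 1) ≤ Fintype.card κ := by exact_mod_cast hsc
    have hm0 : (0 : ℝ) < m := by
      by_contra hc
      have : δ * m ≤ 0 := mul_nonpos_of_nonneg_of_nonpos hδ.le (not_lt.1 hc)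
      nlinarith [mul_pos (by positivity : (0 : ℝ) < (s.card : ℝ) + 1) hg0']
    have hδ1 : δ ≤ 1 := by
      have h1 := hd a
      have h2 : (ed (R a) (S a) (T a) : ℝ) ≤ (S a).card * (T a).card := by
        exact_mod_cast ed_le_card_mul _ _
      have h3 : (0 : ℝ) < (S a).card * (T a).card := by
        have e1 : (m : ℝ) ≤ (S a).card := by exact_mod_cast hS a
        have e2 : (m : ℝ) ≤ (T a).card := by exact_mod_cast hT a
        exact mul_pos (by linarith) (by linarith)
      by_contra hc
      nlinarith
    have hsg : ((s.card + 1) * g : ℝ) ≤ δ / 4 * m := by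
      nlinarith [mul_le_mul_of_nonneg_right hk1 hg0'.le]
    have hsgm : (s.card + 1) * g ≤ m := by
      have : ((s.card + 1) * g : ℝ) ≤ m := by nlinarith
      exact_mod_cast this
    have hX1 : g ≤ (S a \ F).card := by
      have := le_card_sdiff F (S a)
      have := hS a
      have e : (s.card + 1) * g = s.card * g + g := by ring
      omega
    have hY1 : g ≤ (T a \ F').card := by
      have := le_card_sdiff F' (T a)
      have := hT a
      have e : (s.card + 1) * g = s.card * g + g := by ring
      omega
    have hdens : δ / 2 * ((S a \ F).card * (T a \ F').card) ≤ ed (R a) (S a \ F) (T a \ F') := by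
      have e1 : ed (R a) (S a) (T a) ≤ ed (R a) (S a \ F) (T a \ F') + (S a).card * F'.card
          + F.card * (T a).card := by
        calc ed (R a) (S a) (T a) ≤ ed (R a) (S a \ F ∪ F) (T a) :=
              ed_mono (fun x hx => by simp only [mem_union, mem_sdiff]; tauto) subset_rfl
          _ = ed (R a) (S a \ F) (T a) + ed (R a) F (T a) := ed_union_left sdiff_disjoint _
          _ ≤ ed (R a) (S a \ F) (T a \ F' ∪ F') + ed (R a) F (T a) := by
              gcongr
              exact ed_mono subset_rfl
                (fun x hx => by simp only [mem_union, mem_sdiff]; tauto)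
          _ = ed (R a) (S a \ F) (T a \ F') + ed (R a) (S a \ F) F' + ed (R a) F (T a) := by
              rw [ed_union_right _ sdiff_disjoint]
          _ ≤ _ := by
              gcongr
              · exact (ed_mono sdiff_subset subset_rfl).trans (ed_le_card_mul _ _)
              · exact ed_le_card_mul _ _
      have e1' : (ed (R a) (S a) (T a) : ℝ) ≤ ed (R a) (S a \ F) (T a \ F') + (S a).card * F'.card
          + F.card * (T a).card := by exact_mod_cast e1
      have hSm : (m : ℝ) ≤ (S a).card := by exact_mod_cast hS a
      have hTm : (m : ℝ) ≤ (T a).card := by exact_mod_cast hT a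
      have hFr : (F.card : ℝ) ≤ δ / 4 * m := by
        have : (F.card : ℝ) ≤ s.card * g := by exact_mod_cast hFc
        nlinarith
      have hFr' : (F'.card : ℝ) ≤ δ / 4 * m := by
        have : (F'.card : ℝ) ≤ s.card * g := by exact_mod_cast hFc'
        nlinarith
      have b1 : ((S a).card * F'.card : ℝ) ≤ δ / 4 * ((S a).card * (T a).card) := by
        have : (F'.card : ℝ) ≤ δ / 4 * (T a).card := hFr'.trans (by gcongr)
        calc ((S a).card * F'.card : ℝ) ≤ (S a).card * (δ / 4 * (T a).card) := by gcongr
          _ = _ := by ring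
      have b2 : (F.card * (T a).card : ℝ) ≤ δ / 4 * ((S a).card * (T a).card) := by
        have : (F.card : ℝ) ≤ δ / 4 * (S a).card := hFr.trans (by gcongr)
        calc (F.card * (T a).card : ℝ) ≤ (δ / 4 * (S a).card) * (T a).card := by gcongr
          _ = _ := by ring
      have b3 : δ / 2 * ((S a \ F).card * (T a \ F').card) ≤ δ / 2 * ((S a).card * (T a).card : ℝ) := by
        have i1 : ((S a \ F).card : ℝ) ≤ (S a).card := by
          exact_mod_cast card_le_card sdiff_subset
        have i2 : ((T a \ F').card : ℝ) ≤ (T a).card := by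
          exact_mod_cast card_le_card sdiff_subset
        gcongr
      linarith [hd a]
    obtain ⟨X0, hX0, Y0, hY0, hcX, hcY, hed⟩ := exists_subrect_ed_ge (hR a) (S a \ F) (T a \ F') g g
      hX1 hY1 hdens (by omega) (by omega)
    have dX : ∀ b ∈ s, Disjoint X0 (X b) := fun b hb => by
      refine disjoint_left.2 fun x hx hx' => ?_
      exact (mem_sdiff.1 (hX0 hx)).2 (mem_biUnion.2 ⟨b, hb, hx'⟩)
    have dY : ∀ b ∈ s, Disjoint Y0 (Y b) := fun b hb => by
      refine disjoint_left.2 fun x hx hx' => ?_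
      exact (mem_sdiff.1 (hY0 hx)).2 (mem_biUnion.2 ⟨b, hb, hx'⟩)
    refine ⟨Function.update X a X0, Function.update Y a Y0, ?_⟩
    intro b hb
    rcases mem_insert.1 hb with rfl | hbs
    · simp only [Function.update_self]
      refine ⟨hX0.trans sdiff_subset, hY0.trans sdiff_subset, hcX, hcY, hed, ?_, ?_⟩ <;>
      · intro b' hb' hne
        rw [Function.update_of_ne hne.symm]
        rcases mem_insert.1 hb' with rfl | hb'
        · exact absurd rfl hne
        · first | exact dX _ hb' | exact dY _ hb'
    · have hba : b ≠ a := fun e => ha (e ▸ hbs)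
      obtain ⟨h1, h2, h3, h4, h5, h6, h7⟩ := h b hbs
      simp only [Function.update_of_ne hba]
      refine ⟨h1, h2, h3, h4, h5, ?_, ?_⟩ <;>
      · intro b' hb' hne
        rcases mem_insert.1 hb' with e | hb'
        · rw [e, Function.update_self]
          first | exact (dX _ hbs).symm | exact (dY _ hbs).symm
        · rw [Function.update_of_ne (fun e : b' = a => ha (e ▸ hb'))]
          first | exact h6 _ hb' hne | exact h7 _ hb' hne

/-- Pairwise disjoint regular squares of a common size inside finitely many dense rectangles. -/
theorem exists_disjoint_regular_family (K : ℕ) {δ ε γ : ℝ} (hδ : 0 < δ) (hε : 0 < ε)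
    (hε2 : ε ≤ 1 / 2) (hγ : 0 < γ) (hγ2 : 4 * K * γ ≤ δ) :
    ∃ c : ℝ, 0 < c ∧ c ≤ 1 ∧ ∀ {V κ : Type} [Fintype κ] [Nonempty κ] (_ : Fintype.card κ ≤ K)
      (R : κ → V → V → Prop) (_ : ∀ a, ∀ ⦃u v⦄, R a u v → R a v u) (S T : κ → Finset V) (m : ℝ),
      1 ≤ c * m → (∀ a, m ≤ (S a).card) → (∀ a, m ≤ (T a).card) →
      (∀ a, δ * ((S a).card * (T a).card) ≤ ed (R a) (S a) (T a)) →
      ∃ (m' q : ℕ) (X Y : κ → Finset V), (∀ a, X a ⊆ S a) ∧ (∀ a, Y a ⊆ T a) ∧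
        (∀ a, (X a).card = m') ∧ (∀ a, (Y a).card = m') ∧ c * m ≤ m' ∧ m' ≤ γ * m ∧ 0 < q ∧
        q ≤ ε * m' ∧ (∀ a, Reg (R a) q (δ / 4) (X a) (Y a)) ∧
        (∀ a b, a ≠ b → Disjoint (X a) (X b)) ∧ (∀ a b, a ≠ b → Disjoint (Y a) (Y b)) := by
  have H : ∀ k : ℕ, ∃ c : ℝ, 0 < c ∧ c ≤ 1 ∧ ∀ {V : Type} (R : Fin k → V → V → Prop)
      (_ : ∀ a, ∀ ⦃u v⦄, R a u v → R a v u) (X Y : Fin k → Finset V) (m : ℕ),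
      1 ≤ c * m → (∀ a, (X a).card = m) → (∀ a, (Y a).card = m) →
      (∀ a, δ / 2 * (m * m) ≤ ed (R a) (X a) (Y a)) →
      ∃ (m' q : ℕ) (X' Y' : Fin k → Finset V), (∀ a, X' a ⊆ X a) ∧ (∀ a, Y' a ⊆ Y a) ∧
        (∀ a, (X' a).card = m') ∧ (∀ a, (Y' a).card = m') ∧ c * m ≤ m' ∧ 0 < q ∧ q ≤ ε * m' ∧
        ∀ a, Reg (R a) q (δ / 2 / 2) (X' a) (Y' a) := fun k =>
    exists_regular_family (Fin k) (by positivity) hε hε2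
  choose c hc hc1 H using H
  obtain ⟨k0, hk0, hmin⟩ := exists_min_image (range (K + 1)) c ⟨0, by simp⟩
  set γ' := min γ 1 with hγ'
  have hγ'0 : 0 < γ' := lt_min hγ one_pos
  have hγ'1 : γ' ≤ 1 := min_le_right _ _
  have hγ'2 : γ' ≤ γ := min_le_left _ _
  refine ⟨c k0 * (γ' / 2), mul_pos (hc _) (by positivity), by nlinarith [hc k0, hc1 k0], ?_⟩
  intro V κ _ _ hκ R hR S T m hm hS hT hd
  have hck : c k0 ≤ c (Fintype.card κ) := hmin _ (mem_range.2 (by omega))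
  have hm0 : 0 < m := by
    by_contra h
    nlinarith [mul_pos (hc k0) (half_pos hγ'0)]
  have h2 : 1 ≤ γ' / 2 * m := by nlinarith [hc k0, hc1 k0, mul_pos (half_pos hγ'0) hm0]
  set g := ⌊γ' * m⌋₊ with hg
  have hgle : (g : ℝ) ≤ γ' * m := Nat.floor_le (by positivity)
  have hgge : γ' / 2 * m ≤ g := by
    have := Nat.lt_floor_add_one (γ' * m)
    rw [← hg] at this
    linarith
  have hg0 : 0 < g := by
    have : (0 : ℝ) < g := by linarith
    exact_mod_cast this
  have hκ' : (Fintype.card κ : ℝ) ≤ K := by exact_mod_cast hκ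
  obtain ⟨X, Y, x1, x2, x3, x4, x5, x6, x7⟩ := exists_disjoint_squares R hR S T (m := ⌈m⌉₊) (g := g) hδ
    (by
      have : m ≤ ⌈m⌉₊ := Nat.le_ceil m
      calc (4 * Fintype.card κ * g : ℝ) ≤ 4 * K * (γ * m) := by
            gcongr
            exact hgle.trans (by gcongr)
        _ = 4 * K * γ * m := by ring
        _ ≤ δ * m := by gcongr
        _ ≤ _ := by gcongr) hg0
    (fun a => Nat.ceil_le.2 (hS a)) (fun a => Nat.ceil_le.2 (hT a)) hd
  let e := Fintype.equivFin κ
  obtain ⟨m', q, X', Y', y1, y2, y3, y4, y5, y6, y7, y8⟩ := H (Fintype.card κ) (fun i => R (e.symm i))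
    (fun i => hR _) (fun i => X (e.symm i)) (fun i => Y (e.symm i)) g
    (by
      have : c k0 * (γ' / 2 * m) ≤ c (Fintype.card κ) * g := by
        apply mul_le_mul hck hgge (by positivity) (hc _).le
      linarith) (fun i => x3 _) (fun i => x4 _) (fun i => x5 _)
  have s1 : ∀ a, X' (e a) ⊆ X a := fun a => by simpa using y1 (e a)
  have s2 : ∀ a, Y' (e a) ⊆ Y a := fun a => by simpa using y2 (e a)
  refine ⟨m', q, fun a => X' (e a), fun a => Y' (e a), fun a => (s1 a).trans (x1 a),
    fun a => (s2 a).trans (x2 a), fun a => y3 _, fun a => y4 _, ?_, ?_, y6, y7, ?_, ?_, ?_⟩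
  · refine le_trans ?_ y5
    have : c k0 * (γ' / 2 * m) ≤ c (Fintype.card κ) * g := by
      apply mul_le_mul hck hgge (by positivity) (hc _).le
    linarith
  · obtain ⟨a⟩ := ‹Nonempty κ›
    have := card_le_card (y1 (e a))
    rw [y3, x3] at this
    have h3 : (m' : ℝ) ≤ g := by exact_mod_cast this
    exact h3.trans (hgle.trans (by gcongr))
  · intro a
    have := y8 (e a)
    simp only [Equiv.symm_apply_apply] at this
    convert this using 1
    ring
  · exact fun a b hab => (x6 a b hab).mono (s1 a) (s1 b)
  · exact fun a b hab => (x7 a b hab).mono (s2 a) (s2 b)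

end Families

section Walks
open Finset
open scoped Classical

/-- A balanced bipartite system of symmetric relations with large total degrees in which
any two large sets span many edges. -/
structure DenseSys {V ι : Type} [Fintype ι] (A B : Finset V) (R : ι → V → V → Prop)
    (θ η δ : ℝ) (N : ℕ) : Prop where
  disj : Disjoint A B
  cardA : A.card = N
  cardB : B.card = N
  symm : ∀ i, ∀ ⦃u v⦄, R i u v → R i v u
  bip : ∀ i, ∀ ⦃u v⦄, R i u v → (u ∈ A ∧ v ∈ B) ∨ (u ∈ B ∧ v ∈ A)
  sum_le : ∀ v T, ∑ i, dg (R i) v T ≤ T.card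
  degA : ∀ v ∈ A, θ * N ≤ ∑ i, (dg (R i) v B : ℝ)
  degB : ∀ v ∈ B, θ * N ≤ ∑ i, (dg (R i) v A : ℝ)
  dense : ∀ S ⊆ A, ∀ T ⊆ B, (θ - η) * N ≤ S.card → (θ - η) * N ≤ T.card →
    δ * (N * N) ≤ ∑ i, (ed (R i) S T : ℝ)

variable {V ι : Type} [Fintype ι] {A B : Finset V} {R : ι → V → V → Prop} {θ η δ : ℝ} {N : ℕ}

lemma DenseSys.swap (h : DenseSys A B R θ η δ N) : DenseSys B A R θ η δ N where
  disj := h.disj.symm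
  cardA := h.cardB
  cardB := h.cardA
  symm := h.symm
  bip := fun i u v huv => (h.bip i huv).symm
  sum_le := h.sum_le
  degA := h.degB
  degB := h.degA
  dense := fun S hS T hT h1 h2 => by
    simp_rw [fun i => ed_comm (h.symm i) S T]
    exact h.dense T hT S hS h2 h1

/-- The classes densely joined to `S0` have total size nearly `θ N`. -/
lemma DenseSys.card_out (h : DenseSys A B R θ η δ N) {κ : Type} (s : Finset κ) (Y : κ → Finset V)
    (hY : ∀ a ∈ s, Y a ⊆ B) (hdY : ∀ a ∈ s, ∀ b ∈ s, a ≠ b → Disjoint (Y a) (Y b))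
    {η' δ' : ℝ} (hδ' : 0 ≤ δ') (hs : (1 - η') * N ≤ ∑ a ∈ s, ((Y a).card : ℝ))
    {S0 : Finset V} (hS0 : S0 ⊆ A) (hne : S0.Nonempty) (hη : η' + Fintype.card ι * δ' ≤ η) :
    (θ - η) * N ≤ ∑ a ∈ s with (∃ i, δ' * (S0.card * (Y a).card) ≤ ed (R i) S0 (Y a)),
      ((Y a).card : ℝ) := by
  set P : κ → Prop := fun a => ∃ i, δ' * (S0.card * (Y a).card) ≤ ed (R i) S0 (Y a) with hP
  have hS0c : (0 : ℝ) < S0.card := by exact_mod_cast card_pos.2 hne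
  set YY := s.biUnion Y with hYY
  have hYYc : (YY.card : ℝ) = ∑ a ∈ s, ((Y a).card : ℝ) := by
    rw [hYY, card_biUnion hdY]; push_cast; rfl
  have hYYB : YY ⊆ B := biUnion_subset.2 hY
  have hYYN : (YY.card : ℝ) ≤ N := by
    rw [← h.cardB]; exact_mod_cast card_le_card hYYB
  have tot : θ * N * S0.card ≤ ∑ i, (ed (R i) S0 B : ℝ) := by
    have : ∑ i, (ed (R i) S0 B : ℝ) = ∑ v ∈ S0, ∑ i, (dg (R i) v B : ℝ) := by
      rw [sum_comm]
      simp [ed]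
    rw [this, mul_comm, ← nsmul_eq_mul]
    exact card_nsmul_le_sum _ _ _ fun v hv => h.degA v (hS0 hv)
  have bnd : ∀ T : Finset V, ∑ i, (ed (R i) S0 T : ℝ) ≤ S0.card * T.card := by
    intro T
    have : ∑ i, (ed (R i) S0 T : ℝ) = ∑ v ∈ S0, ∑ i, (dg (R i) v T : ℝ) := by
      rw [sum_comm]
      simp [ed]
    rw [this, ← nsmul_eq_mul]
    exact sum_le_card_nsmul _ _ _ fun v _ => by exact_mod_cast h.sum_le v T
  have split : ∑ i, (ed (R i) S0 B : ℝ) = ∑ a ∈ s, ∑ i, (ed (R i) S0 (Y a) : ℝ) +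
      ∑ i, (ed (R i) S0 (B \ YY) : ℝ) := by
    rw [sum_comm, ← sum_add_distrib]
    refine sum_congr rfl fun i _ => ?_
    conv_lhs => rw [← union_sdiff_of_subset hYYB]
    rw [ed_union_right _ disjoint_sdiff, hYY, ed_biUnion_right _ _ _ hdY]
    push_cast
    rfl
  have out : ∑ i, (ed (R i) S0 (B \ YY) : ℝ) ≤ S0.card * (η' * N) := by
    refine (bnd _).trans (mul_le_mul_of_nonneg_left ?_ hS0c.le)
    rw [cast_card_sdiff hYYB, h.cardB, hYYc]
    linarith
  have nd : ∑ a ∈ s with ¬ P a, ∑ i, (ed (R i) S0 (Y a) : ℝ) ≤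
      S0.card * (Fintype.card ι * δ' * N) := by
    calc ∑ a ∈ s with ¬ P a, ∑ i, (ed (R i) S0 (Y a) : ℝ)
        ≤ ∑ a ∈ s with ¬ P a, S0.card * (Fintype.card ι * δ') * ((Y a).card : ℝ) := by
          refine sum_le_sum fun a ha => ?_
          have := (mem_filter.1 ha).2
          rw [hP] at this
          push Not at this
          calc ∑ i, (ed (R i) S0 (Y a) : ℝ) ≤ ∑ _i : ι, δ' * (S0.card * (Y a).card) :=
                sum_le_sum fun i _ => (this i).le
            _ = _ := by rw [sum_const, nsmul_eq_mul, card_univ]; ring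
      _ ≤ ∑ a ∈ s, S0.card * (Fintype.card ι * δ') * ((Y a).card : ℝ) :=
          sum_le_sum_of_subset_of_nonneg (filter_subset _ _) fun _ _ _ => by positivity
      _ = S0.card * (Fintype.card ι * δ') * YY.card := by rw [← mul_sum, hYYc]
      _ ≤ S0.card * (Fintype.card ι * δ') * N := by gcongr
      _ = _ := by ring
  have dd : ∑ a ∈ s with P a, ∑ i, (ed (R i) S0 (Y a) : ℝ) ≤
      S0.card * ∑ a ∈ s with P a, ((Y a).card : ℝ) := by
    rw [mul_sum]
    exact sum_le_sum fun a _ => bnd _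
  have fs := sum_filter_add_sum_filter_not s P fun a => ∑ i, (ed (R i) S0 (Y a) : ℝ)
  have fin : S0.card * (θ * N) ≤ S0.card * (∑ a ∈ s with P a, ((Y a).card : ℝ)
      + Fintype.card ι * δ' * N + η' * N) := by
    rw [split, ← fs] at tot
    linarith
  have := le_of_mul_le_mul_left fin hS0c
  have hN : (η' + Fintype.card ι * δ') * N ≤ η * N := by gcongr
  linarith

set_option maxHeartbeats 600000 in
/-- Any set on one side is joined to any set on the other side by a walk through three dense
pairs, passing through two classes. -/
theorem DenseSys.exists_walk (h : DenseSys A B R θ η δ N) {κ : Type} (s : Finset κ)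
    (X Y : κ → Finset V) (hX : ∀ a ∈ s, X a ⊆ A) (hY : ∀ a ∈ s, Y a ⊆ B)
    (hdX : ∀ a ∈ s, ∀ b ∈ s, a ≠ b → Disjoint (X a) (X b))
    (hdY : ∀ a ∈ s, ∀ b ∈ s, a ≠ b → Disjoint (Y a) (Y b))
    (hc : ∀ a ∈ s, (X a).card = (Y a).card) (hN : 0 < N)
    {η' δ' : ℝ} (hδ' : 0 ≤ δ') (hs : (1 - η') * N ≤ ∑ a ∈ s, ((X a).card : ℝ))
    {S0 T0 : Finset V} (hS0 : S0 ⊆ A) (hSne : S0.Nonempty) (hT0 : T0 ⊆ B) (hTne : T0.Nonempty)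
    (hη : η' + Fintype.card ι * δ' ≤ η) (hδ : Fintype.card ι * δ' < δ) :
    ∃ a ∈ s, ∃ b ∈ s, ∃ i j k, δ' * (S0.card * (Y a).card) ≤ ed (R i) S0 (Y a) ∧
      δ' * ((X a).card * (Y b).card) ≤ ed (R j) (X a) (Y b) ∧
      δ' * ((X b).card * T0.card) ≤ ed (R k) (X b) T0 := by
  have hs' : (1 - η') * N ≤ ∑ a ∈ s, ((Y a).card : ℝ) :=
    hs.trans_eq (sum_congr rfl fun a ha => by rw [hc a ha])
  have h1 := h.card_out s Y hY hdY hδ' hs' hS0 hSne hη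
  have h2 := h.swap.card_out s X hX hdX hδ' hs hT0 hTne hη
  set s1 := s.filter fun a => ∃ i, δ' * (S0.card * (Y a).card) ≤ ed (R i) S0 (Y a) with hs1
  set s2 := s.filter fun a => ∃ i, δ' * (T0.card * (X a).card) ≤ ed (R i) T0 (X a) with hs2
  have s1s : s1 ⊆ s := filter_subset _ _
  have s2s : s2 ⊆ s := filter_subset _ _
  have c1 : ((s1.biUnion X).card : ℝ) = ∑ a ∈ s1, ((Y a).card : ℝ) := by
    rw [card_biUnion fun a ha b hb => hdX a (s1s ha) b (s1s hb)]
    push_cast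
    exact sum_congr rfl fun a ha => by rw [hc a (s1s ha)]
  have c2 : ((s2.biUnion Y).card : ℝ) = ∑ a ∈ s2, ((X a).card : ℝ) := by
    rw [card_biUnion fun a ha b hb => hdY a (s2s ha) b (s2s hb)]
    push_cast
    exact sum_congr rfl fun a ha => by rw [hc a (s2s ha)]
  have u1 : s1.biUnion X ⊆ A := biUnion_subset.2 fun a ha => hX a (s1s ha)
  have u2 : s2.biUnion Y ⊆ B := biUnion_subset.2 fun a ha => hY a (s2s ha)
  have h3 := h.dense _ u1 _ u2 (by rw [c1]; exact h1) (by rw [c2]; exact h2)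
  by_contra hcon
  push Not at hcon
  have hnd : ∀ a ∈ s1, ∀ b ∈ s2, ∀ j, (ed (R j) (X a) (Y b) : ℝ) ≤ δ' * ((X a).card * (Y b).card) := by
    intro a ha b hb j
    by_contra hlt
    push Not at hlt
    obtain ⟨ha1, i, hi⟩ := mem_filter.1 ha
    obtain ⟨hb1, k, hk⟩ := mem_filter.1 hb
    have := hcon a ha1 b hb1 i j k hi hlt.le
    rw [ed_comm (h.symm k), mul_comm (T0.card : ℝ)] at hk
    linarith
  have k1 : ∑ a ∈ s1, ((X a).card : ℝ) ≤ N := by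
    have e : ∑ a ∈ s1, ((X a).card : ℝ) = ∑ a ∈ s1, ((Y a).card : ℝ) :=
      sum_congr rfl fun a ha => by rw [hc a (s1s ha)]
    rw [e, ← c1, ← h.cardA]
    exact_mod_cast card_le_card u1
  have k2 : ∑ a ∈ s2, ((Y a).card : ℝ) ≤ N := by
    have e : ∑ a ∈ s2, ((Y a).card : ℝ) = ∑ a ∈ s2, ((X a).card : ℝ) :=
      sum_congr rfl fun a ha => by rw [hc a (s2s ha)]
    rw [e, ← c2, ← h.cardB]
    exact_mod_cast card_le_card u2
  have h4 : ∑ i, (ed (R i) (s1.biUnion X) (s2.biUnion Y) : ℝ) ≤ Fintype.card ι * δ' * (N * N) := by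
    have e : ∀ i, (ed (R i) (s1.biUnion X) (s2.biUnion Y) : ℝ) ≤ δ' * (N * N) := by
      intro i
      rw [ed_biUnion_left _ _ _ fun a ha b hb => hdX a (s1s ha) b (s1s hb)]
      push_cast
      calc ∑ a ∈ s1, (ed (R i) (X a) (s2.biUnion Y) : ℝ)
          ≤ ∑ a ∈ s1, (X a).card * (δ' * ∑ b ∈ s2, ((Y b).card : ℝ)) := by
            refine sum_le_sum fun a ha => ?_
            rw [ed_biUnion_right _ _ _ fun a ha b hb => hdY a (s2s ha) b (s2s hb)]
            push_cast
            rw [mul_sum, mul_sum]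
            refine sum_le_sum fun b hb => (hnd a ha b hb i).trans (le_of_eq (by ring))
        _ = δ' * ((∑ a ∈ s1, ((X a).card : ℝ)) * ∑ b ∈ s2, ((Y b).card : ℝ)) := by
            rw [← sum_mul]; ring
        _ ≤ δ' * (N * N) := by
            exact mul_le_mul_of_nonneg_left (mul_le_mul k1 k2
              (sum_nonneg fun _ _ => Nat.cast_nonneg _) (Nat.cast_nonneg _)) hδ'
    calc _ ≤ ∑ _i : ι, δ' * (N * N : ℝ) := sum_le_sum fun i _ => e i
      _ = _ := by rw [sum_const, nsmul_eq_mul, card_univ]; ring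
  have hNN : (0 : ℝ) < N * N := by positivity
  nlinarith

end Walks

section Packs
open Finset
open scoped Classical

/-- A labelled pair of vertex sets. -/
@[ext] structure Pr (ι V : Type) where
  /-- the label -/
  t : ι
  /-- the first side -/
  X : Finset V
  /-- the second side -/
  Y : Finset V

variable {V ι : Type}

/-- Union of the first sides. -/
noncomputable def SX (P : Finset (Pr ι V)) : Finset V := P.biUnion Pr.X

/-- Union of the second sides. -/
noncomputable def SY (P : Finset (Pr ι V)) : Finset V := P.biUnion Pr.Y

/-- Pairwise disjoint, balanced, regular pairs of size at least `m`. -/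
structure IsPack (A B : Finset V) (R : ι → V → V → Prop) (m ε d : ℝ) (P : Finset (Pr ι V)) :
    Prop where
  subX : ∀ p ∈ P, p.X ⊆ A
  subY : ∀ p ∈ P, p.Y ⊆ B
  card_eq : ∀ p ∈ P, p.X.card = p.Y.card
  le_card : ∀ p ∈ P, m ≤ p.X.card
  disjX : ∀ p ∈ P, ∀ p' ∈ P, p ≠ p' → Disjoint p.X p'.X
  disjY : ∀ p ∈ P, ∀ p' ∈ P, p ≠ p' → Disjoint p.Y p'.Y
  reg : ∀ p ∈ P, ∃ q : ℕ, 0 < q ∧ (q : ℝ) ≤ ε * p.X.card ∧ Reg (R p.t) q d p.X p.Y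

/-- `Q` is obtained from the leftover and small balanced parts of the members of `P`. -/
structure IsAug (P Q : Finset (Pr ι V)) (lam : ℝ) : Prop where
  bal : ∀ p ∈ P, (p.X ∩ SX Q).card = (p.Y ∩ SY Q).card
  trim : ∀ p ∈ P, ((p.X ∩ SX Q).card : ℝ) ≤ lam * p.X.card
  tot : (SX P ∩ SX Q).card ≤ 2 * (SX Q \ SX P).card

variable {A B : Finset V} {R : ι → V → V → Prop} {m ε d : ℝ} {P Q : Finset (Pr ι V)} {lam : ℝ}

lemma SX_subset (h : IsPack A B R m ε d P) : SX P ⊆ A := biUnion_subset.2 h.subX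

lemma SY_subset (h : IsPack A B R m ε d P) : SY P ⊆ B := biUnion_subset.2 h.subY

lemma subset_SX {p : Pr ι V} (hp : p ∈ P) : p.X ⊆ SX P := subset_biUnion_of_mem Pr.X hp

lemma subset_SY {p : Pr ι V} (hp : p ∈ P) : p.Y ⊆ SY P := subset_biUnion_of_mem Pr.Y hp

lemma card_SX (h : IsPack A B R m ε d P) : (SX P).card = ∑ p ∈ P, p.X.card :=
  card_biUnion h.disjX

lemma card_SY (h : IsPack A B R m ε d P) : (SY P).card = ∑ p ∈ P, p.Y.card :=
  card_biUnion h.disjY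

lemma card_SX_inter (h : IsPack A B R m ε d P) (U : Finset V) :
    (SX P ∩ U).card = ∑ p ∈ P, (p.X ∩ U).card := by
  unfold SX
  rw [biUnion_inter]
  exact card_biUnion fun p hp p' hp' hne =>
    (h.disjX p hp p' hp' hne).mono inter_subset_left inter_subset_left

lemma card_SY_inter (h : IsPack A B R m ε d P) (U : Finset V) :
    (SY P ∩ U).card = ∑ p ∈ P, (p.Y ∩ U).card := by
  unfold SY
  rw [biUnion_inter]
  exact card_biUnion fun p hp p' hp' hne =>
    (h.disjY p hp p' hp' hne).mono inter_subset_left inter_subset_left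

lemma IsPack.card_SX_eq (h : IsPack A B R m ε d P) : (SX P).card = (SY P).card := by
  rw [card_SX h, card_SY h]; exact sum_congr rfl h.card_eq

lemma IsAug.card_inter_eq {m' ε' d' : ℝ} (hP : IsPack A B R m ε d P) (_ : IsPack A B R m' ε' d' Q)
    (h : IsAug P Q lam) : (SX P ∩ SX Q).card = (SY P ∩ SY Q).card := by
  rw [card_SX_inter hP, card_SY_inter hP]; exact sum_congr rfl h.bal

lemma IsAug.card_gain_eq {m' ε' d' : ℝ} (hP : IsPack A B R m ε d P) (hQ : IsPack A B R m' ε' d' Q)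
    (h : IsAug P Q lam) : (SX Q \ SX P).card = (SY Q \ SY P).card := by
  have h1 := h.card_inter_eq hP hQ
  have h2 := hQ.card_SX_eq
  have h3 := card_sdiff_add_card_inter (SX Q) (SX P)
  have h4 := card_sdiff_add_card_inter (SY Q) (SY P)
  rw [inter_comm] at h3 h4
  omega

lemma IsAug.card_left_eq {m' ε' d' : ℝ} (hP : IsPack A B R m ε d P) (hQ : IsPack A B R m' ε' d' Q)
    (h : IsAug P Q lam) (hAB : A.card = B.card) :
    (A \ (SX P ∪ SX Q)).card = (B \ (SY P ∪ SY Q)).card := by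
  have h1 := h.card_gain_eq hP hQ
  have h2 := hP.card_SX_eq
  have e1 := card_sdiff_add_card (SX Q) (SX P)
  have e2 := card_sdiff_add_card (SY Q) (SY P)
  rw [card_sdiff_of_subset (union_subset (SX_subset hP) (SX_subset hQ)),
    card_sdiff_of_subset (union_subset (SY_subset hP) (SY_subset hQ)),
    union_comm (SX P), union_comm (SY P)]
  omega

/-- First side of the class of `o`: a trimmed member of `P`, or the leftover. -/
noncomputable def clX (A : Finset V) (P Q : Finset (Pr ι V)) : Option (Pr ι V) → Finset V
  | none => A \ (SX P ∪ SX Q)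
  | some p => p.X \ SX Q

/-- Second side of the class of `o`. -/
noncomputable def clY (B : Finset V) (P Q : Finset (Pr ι V)) : Option (Pr ι V) → Finset V
  | none => B \ (SY P ∪ SY Q)
  | some p => p.Y \ SY Q

lemma card_inter_clX_aux {Z U : Finset V} {P : Finset (Pr ι V)} {p : Pr ι V} {m' : ℕ}
    {o : Option (Pr ι V)} {f : Pr ι V → Finset V} (hZ : Z.card = m') (hp : p ∈ P)
    (ho : ∀ p' ∈ o, p' ∈ P) (hd : ∀ p ∈ P, ∀ p' ∈ P, p ≠ p' → Disjoint (f p) (f p'))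
    (hn : o = none → Disjoint (f p) Z) (hs : ∀ p', o = some p' → Z ⊆ f p' \ U) :
    (f p ∩ Z).card = if o = some p then m' else 0 := by
  split_ifs with h
  · rw [inter_eq_right.2 ((hs p h).trans sdiff_subset), hZ]
  · rw [card_eq_zero, ← disjoint_iff_inter_eq_empty]
    cases o with
    | none => exact hn rfl
    | some p' =>
      have hne : p ≠ p' := fun e => h (by rw [e])
      exact (hd p hp p' (ho p' rfl) hne).mono_right ((hs p' rfl).trans sdiff_subset)

/-- Adding new pairs along balanced locations extends an augmentation. -/
lemma IsAug.extend {m' ε' d' : ℝ} (hP : IsPack A B R m ε d P)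
    (hQ : IsPack A B R m' ε' d' Q) (h : IsAug P Q lam) {κ : Type} [Fintype κ]
    (hκ : Fintype.card κ ≤ 3) (lab : κ → ι) (xl yl : κ → Option (Pr ι V)) (X' Y' : κ → Finset V)
    {g q : ℕ} (hxl : ∀ i, ∀ p ∈ xl i, p ∈ P) (hyl : ∀ i, ∀ p ∈ yl i, p ∈ P)
    (hX' : ∀ i, X' i ⊆ clX A P Q (xl i)) (hY' : ∀ i, Y' i ⊆ clY B P Q (yl i))
    (hcX : ∀ i, (X' i).card = g) (hcY : ∀ i, (Y' i).card = g) (hg : m' ≤ g) (hg0 : 0 < g)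
    (hq : 0 < q) (hqg : (q : ℝ) ≤ ε' * g) (hreg : ∀ i, Reg (R (lab i)) q d' (X' i) (Y' i))
    (hdX : ∀ i j, i ≠ j → Disjoint (X' i) (X' j)) (hdY : ∀ i j, i ≠ j → Disjoint (Y' i) (Y' j))
    (hbal : ∀ p : Pr ι V, (univ.filter fun i => xl i = some p).card =
      (univ.filter fun i => yl i = some p).card)
    (hnone : (univ.filter fun i => xl i = none).card = 1)
    (htrim : ∀ i, ∀ p ∈ xl i, ((p.X ∩ SX Q).card : ℝ) + 2 * g ≤ lam * p.X.card) :
    ∃ Q', IsPack A B R m' ε' d' Q' ∧ IsAug P Q' lam ∧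
      (SX Q \ SX P).card + g ≤ (SX Q' \ SX P).card := by
  have clXA : ∀ i, clX A P Q (xl i) ⊆ A := fun i => by
    rcases hx : xl i with _ | p
    · exact sdiff_subset
    · exact sdiff_subset.trans (hP.subX p (hxl i p hx))
  have clYB : ∀ i, clY B P Q (yl i) ⊆ B := fun i => by
    rcases hx : yl i with _ | p
    · exact sdiff_subset
    · exact sdiff_subset.trans (hP.subY p (hyl i p hx))
  have clXQ : ∀ i, Disjoint (X' i) (SX Q) := fun i => by
    refine disjoint_of_subset_left (hX' i) ?_
    rcases hx : xl i with _ | p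
    · exact sdiff_disjoint.mono_right subset_union_right
    · exact sdiff_disjoint
  have clYQ : ∀ i, Disjoint (Y' i) (SY Q) := fun i => by
    refine disjoint_of_subset_left (hY' i) ?_
    rcases hx : yl i with _ | p
    · exact sdiff_disjoint.mono_right subset_union_right
    · exact sdiff_disjoint
  set N := univ.image fun i => (⟨lab i, X' i, Y' i⟩ : Pr ι V) with hN
  have SXN : SX (Q ∪ N) = SX Q ∪ univ.biUnion X' := by
    unfold SX
    rw [union_biUnion, hN, image_biUnion]
  have SYN : SY (Q ∪ N) = SY Q ∪ univ.biUnion Y' := by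
    unfold SY
    rw [union_biUnion, hN, image_biUnion]
  have mem : ∀ p ∈ Q ∪ N, p ∈ Q ∨ ∃ i, p = ⟨lab i, X' i, Y' i⟩ := fun p hp => by
    rcases mem_union.1 hp with hp | hp
    · exact .inl hp
    · obtain ⟨i, -, rfl⟩ := mem_image.1 hp
      exact .inr ⟨i, rfl⟩
  have hX'c : ∀ p ∈ P, (p.X ∩ SX (Q ∪ N)).card = (p.X ∩ SX Q).card +
      (univ.filter fun i => xl i = some p).card * g := by
    intro p hp
    rw [SXN, inter_union_distrib_left, card_union_of_disjoint, inter_biUnion,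
      card_biUnion, card_filter, sum_mul]
    · congr 1
      refine sum_congr rfl fun i _ => ?_
      rw [card_inter_clX_aux (f := Pr.X) (hcX i) hp (hxl i) hP.disjX (U := SX Q)
        (fun e => ?_) (fun p' e => ?_)]
      · split_ifs <;> simp
      · have := hX' i
        rw [e] at this
        exact ((sdiff_disjoint.mono_right subset_union_left).mono_right
          (subset_SX hp)).symm.mono_right this
      · have := hX' i
        rwa [e] at this
    · exact fun i _ j _ hij => (hdX i j hij).mono inter_subset_right inter_subset_right
    · refine disjoint_of_subset_left inter_subset_right
        (disjoint_of_subset_right inter_subset_right ?_)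
      exact (disjoint_biUnion_right _ _ _).2 fun i _ => (clXQ i).symm
  have hY'c : ∀ p ∈ P, (p.Y ∩ SY (Q ∪ N)).card = (p.Y ∩ SY Q).card +
      (univ.filter fun i => yl i = some p).card * g := by
    intro p hp
    rw [SYN, inter_union_distrib_left, card_union_of_disjoint, inter_biUnion,
      card_biUnion, card_filter, sum_mul]
    · congr 1
      refine sum_congr rfl fun i _ => ?_
      rw [card_inter_clX_aux (f := Pr.Y) (hcY i) hp (hyl i) hP.disjY (U := SY Q)
        (fun e => ?_) (fun p' e => ?_)]
      · split_ifs <;> simp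
      · have := hY' i
        rw [e] at this
        exact ((sdiff_disjoint.mono_right subset_union_left).mono_right
          (subset_SY hp)).symm.mono_right this
      · have := hY' i
        rwa [e] at this
    · exact fun i _ j _ hij => (hdY i j hij).mono inter_subset_right inter_subset_right
    · refine disjoint_of_subset_left inter_subset_right
        (disjoint_of_subset_right inter_subset_right ?_)
      exact (disjoint_biUnion_right _ _ _).2 fun i _ => (clYQ i).symm
  have hcount : (univ.filter fun i => xl i ≠ none).card ≤ 2 := by
    have := card_filter_add_card_filter_not (s := (univ : Finset κ)) fun i => xl i = none
    rw [card_univ] at this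
    simp only [ne_eq]
    omega
  obtain ⟨i0, hi0⟩ := card_pos.1 (by omega : 0 < (univ.filter fun i => xl i = none).card)
  have hi0 := (mem_filter.1 hi0).2
  have hgain : (SX Q \ SX P).card + g ≤ (SX (Q ∪ N) \ SX P).card := by
    rw [← hcX i0, ← card_union_of_disjoint]
    · refine card_le_card (union_subset (sdiff_subset_sdiff ?_ subset_rfl) ?_)
      · rw [SXN]; exact subset_union_left
      · intro v hv
        have h1 := hX' i0 hv
        rw [hi0] at h1
        simp only [clX, mem_sdiff, mem_union, not_or] at h1
        rw [mem_sdiff, SXN]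
        exact ⟨mem_union_right _ (mem_biUnion.2 ⟨i0, mem_univ _, hv⟩), h1.2.1⟩
    · exact (clXQ i0).symm.mono_left sdiff_subset
  refine ⟨Q ∪ N, ⟨?_, ?_, ?_, ?_, ?_, ?_, ?_⟩, ⟨?_, ?_, ?_⟩, hgain⟩
  · intro p hp
    rcases mem p hp with hp | ⟨i, rfl⟩
    exacts [hQ.subX p hp, (hX' i).trans (clXA i)]
  · intro p hp
    rcases mem p hp with hp | ⟨i, rfl⟩
    exacts [hQ.subY p hp, (hY' i).trans (clYB i)]
  · intro p hp
    rcases mem p hp with hp | ⟨i, rfl⟩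
    exacts [hQ.card_eq p hp, (hcX i).trans (hcY i).symm]
  · intro p hp
    rcases mem p hp with hp | ⟨i, rfl⟩
    exacts [hQ.le_card p hp, by simp only; rw [hcX i]; exact hg]
  · intro p hp p' hp' hne
    rcases mem p hp with hp | ⟨i, rfl⟩ <;> rcases mem p' hp' with hp' | ⟨j, rfl⟩
    · exact hQ.disjX p hp p' hp' hne
    · exact (clXQ j).symm.mono_left (subset_SX hp)
    · exact (clXQ i).mono_right (subset_SX hp')
    · exact hdX i j fun e => hne (by rw [e])
  · intro p hp p' hp' hne
    rcases mem p hp with hp | ⟨i, rfl⟩ <;> rcases mem p' hp' with hp' | ⟨j, rfl⟩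
    · exact hQ.disjY p hp p' hp' hne
    · exact (clYQ j).symm.mono_left (subset_SY hp)
    · exact (clYQ i).mono_right (subset_SY hp')
    · exact hdY i j fun e => hne (by rw [e])
  · intro p hp
    rcases mem p hp with hp | ⟨i, rfl⟩
    · exact hQ.reg p hp
    · exact ⟨q, hq, by simp only; rw [hcX i]; exact hqg, hreg i⟩
  · intro p hp
    rw [hX'c p hp, hY'c p hp, h.bal p hp, hbal]
  · intro p hp
    rw [hX'c p hp]
    rcases Nat.eq_zero_or_pos (univ.filter fun i => xl i = some p).card with h0 | h0
    · rw [h0]; simpa using h.trim p hp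
    · obtain ⟨i, hi⟩ := card_pos.1 h0
      have h1 := htrim i p (mem_filter.1 hi).2
      have h2 : (univ.filter fun i => xl i = some p).card ≤ 2 :=
        (card_le_card fun i hi => by
          rw [mem_filter] at hi ⊢
          exact ⟨hi.1, by rw [hi.2]; simp⟩).trans hcount
      have h3 : ((univ.filter fun i => xl i = some p).card : ℝ) ≤ 2 := by exact_mod_cast h2
      push_cast
      have : ((univ.filter fun i => xl i = some p).card : ℝ) * g ≤ 2 * g := by gcongr
      linarith
  · have h1 : (SX P ∩ SX (Q ∪ N)).card ≤ (SX P ∩ SX Q).card + 2 * g := by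
      have : SX P ∩ SX (Q ∪ N) ⊆ (SX P ∩ SX Q) ∪
          (univ.filter fun i => xl i ≠ none).biUnion X' := by
        intro v hv
        rw [mem_inter, SXN, mem_union, mem_biUnion] at hv
        rcases hv with ⟨h1, h2 | ⟨i, -, hi⟩⟩
        · exact mem_union_left _ (mem_inter.2 ⟨h1, h2⟩)
        · refine mem_union_right _ (mem_biUnion.2 ⟨i, ?_, hi⟩)
          refine mem_filter.2 ⟨mem_univ _, fun e => ?_⟩
          have h3 := hX' i hi
          rw [e] at h3
          simp only [clX, mem_sdiff, mem_union, not_or] at h3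
          exact h3.2.1 h1
      refine (card_le_card this).trans ((card_union_le _ _).trans ?_)
      gcongr
      exact (card_biUnion_le_card_mul _ _ _ fun i _ => (hcX i).le).trans (by gcongr)
    have := h.tot
    omega

end Packs

section Rounds
open Finset
open scoped Classical

variable {V ι : Type} {A B : Finset V} {R : ι → V → V → Prop} {m ε d : ℝ} {P Q : Finset (Pr ι V)}
  {lam : ℝ}

lemma clX_subset (hP : IsPack A B R m ε d P) {o : Option (Pr ι V)} (ho : ∀ p ∈ o, p ∈ P) :
    clX A P Q o ⊆ A := by
  rcases o with _ | p
  · exact sdiff_subset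
  · exact sdiff_subset.trans (hP.subX p (ho p rfl))

lemma clY_subset (hP : IsPack A B R m ε d P) {o : Option (Pr ι V)} (ho : ∀ p ∈ o, p ∈ P) :
    clY B P Q o ⊆ B := by
  rcases o with _ | p
  · exact sdiff_subset
  · exact sdiff_subset.trans (hP.subY p (ho p rfl))

lemma clX_disjoint (hP : IsPack A B R m ε d P) {o o' : Option (Pr ι V)} (ho : ∀ p ∈ o, p ∈ P)
    (ho' : ∀ p ∈ o', p ∈ P) (hne : o ≠ o') : Disjoint (clX A P Q o) (clX A P Q o') := by
  rcases o with _ | p <;> rcases o' with _ | p'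
  · exact absurd rfl hne
  · exact sdiff_disjoint.mono_right
      (sdiff_subset.trans ((subset_SX (ho' p' rfl)).trans subset_union_left))
  · exact (sdiff_disjoint.mono_right
      (sdiff_subset.trans ((subset_SX (ho p rfl)).trans subset_union_left))).symm
  · exact (hP.disjX p (ho p rfl) p' (ho' p' rfl) fun e => hne (by rw [e])).mono
      sdiff_subset sdiff_subset

lemma clY_disjoint (hP : IsPack A B R m ε d P) {o o' : Option (Pr ι V)} (ho : ∀ p ∈ o, p ∈ P)
    (ho' : ∀ p ∈ o', p ∈ P) (hne : o ≠ o') : Disjoint (clY B P Q o) (clY B P Q o') := by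
  rcases o with _ | p <;> rcases o' with _ | p'
  · exact absurd rfl hne
  · exact sdiff_disjoint.mono_right
      (sdiff_subset.trans ((subset_SY (ho' p' rfl)).trans subset_union_left))
  · exact (sdiff_disjoint.mono_right
      (sdiff_subset.trans ((subset_SY (ho p rfl)).trans subset_union_left))).symm
  · exact (hP.disjY p (ho p rfl) p' (ho' p' rfl) fun e => hne (by rw [e])).mono
      sdiff_subset sdiff_subset

lemma IsAug.card_cl_eq {m' ε' d' : ℝ} (hP : IsPack A B R m ε d P) (hQ : IsPack A B R m' ε' d' Q)
    (h : IsAug P Q lam) (hAB : A.card = B.card) {o : Option (Pr ι V)} (ho : ∀ p ∈ o, p ∈ P) :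
    (clX A P Q o).card = (clY B P Q o).card := by
  rcases o with _ | p
  · exact h.card_left_eq hP hQ hAB
  · have h1 := h.bal p (ho p rfl)
    have h2 := hP.card_eq p (ho p rfl)
    have h3 := card_sdiff_add_card_inter p.X (SX Q)
    have h4 := card_sdiff_add_card_inter p.Y (SY Q)
    simp only [clX, clY]
    omega

/-- The classes that are not yet substantially used up. -/
noncomputable def avail (P Q : Finset (Pr ι V)) (lam : ℝ) : Finset (Option (Pr ι V)) :=
  insert none ((P.filter fun p => ((p.X ∩ SX Q).card : ℝ) ≤ lam / 2 * p.X.card).image some)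

lemma mem_avail {o : Option (Pr ι V)} (ho : o ∈ avail P Q lam) :
    (∀ p ∈ o, p ∈ P) ∧ ∀ p ∈ o, ((p.X ∩ SX Q).card : ℝ) ≤ lam / 2 * p.X.card := by
  rcases o with _ | p
  · simp
  · simp only [avail, mem_insert, reduceCtorEq, mem_image, mem_filter,
      Option.some.injEq, exists_eq_right, false_or] at ho
    refine ⟨fun p' e => ?_, fun p' e => ?_⟩ <;> cases e
    exacts [ho.1, ho.2]

/-- The available classes have nearly full volume. -/
lemma IsAug.card_avail {m' ε' d' : ℝ} (hP : IsPack A B R m ε d P) (hQ : IsPack A B R m' ε' d' Q)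
    (h : IsAug P Q lam) (hl : 0 < lam) :
    (A.card : ℝ) - (3 + 4 / lam) * (SX Q \ SX P).card ≤
      ∑ o ∈ avail P Q lam, ((clX A P Q o).card : ℝ) := by
  have e1 : ∑ o ∈ avail P Q lam, ((clX A P Q o).card : ℝ) = ((A \ (SX P ∪ SX Q)).card : ℝ) +
      ∑ p ∈ P with ((p.X ∩ SX Q).card : ℝ) ≤ lam / 2 * p.X.card, ((p.X \ SX Q).card : ℝ) := by
    unfold avail
    rw [sum_insert (by simp), sum_image (by simp)]
    rfl
  have e2 : (A.card : ℝ) = (A \ (SX P ∪ SX Q)).card + (SX P).card + (SX Q \ SX P).card := by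
    have := card_sdiff_add_card_eq_card
      (union_subset (SX_subset hP) (SX_subset hQ))
    have := card_sdiff_add_card (SX Q) (SX P)
    rw [union_comm (SX P)] at *
    exact_mod_cast (by omega : A.card = (A \ (SX Q ∪ SX P)).card + (SX P).card +
      (SX Q \ SX P).card)
  have e3 : ((SX P).card : ℝ) = ∑ p ∈ P, (p.X.card : ℝ) := by rw [card_SX hP]; push_cast; rfl
  have e4 : ((SX P ∩ SX Q).card : ℝ) = ∑ p ∈ P, ((p.X ∩ SX Q).card : ℝ) := by
    rw [card_SX_inter hP]; push_cast; rfl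
  have e5 : ((SX P ∩ SX Q).card : ℝ) ≤ 2 * (SX Q \ SX P).card := by exact_mod_cast h.tot
  have key : ∑ p ∈ P, ((p.X.card : ℝ) - (1 + 2 / lam) * (p.X ∩ SX Q).card) ≤
      ∑ p ∈ P with ((p.X ∩ SX Q).card : ℝ) ≤ lam / 2 * p.X.card, ((p.X \ SX Q).card : ℝ) := by
    rw [sum_filter]
    refine sum_le_sum fun p _ => ?_
    have := card_sdiff_add_card_inter p.X (SX Q)
    have c1 : ((p.X \ SX Q).card : ℝ) + (p.X ∩ SX Q).card = p.X.card := by exact_mod_cast this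
    have c2 : (0 : ℝ) ≤ (p.X ∩ SX Q).card := by positivity
    split_ifs with hc
    · have : 0 ≤ 2 / lam * ((p.X ∩ SX Q).card : ℝ) := by positivity
      linarith
    · have : (p.X.card : ℝ) ≤ 2 / lam * ((p.X ∩ SX Q).card : ℝ) := by
        rw [div_mul_eq_mul_div, le_div_iff₀ hl]
        linarith
      linarith
  rw [sum_sub_distrib, ← mul_sum, ← e4, ← e3] at key
  have : (1 + 2 / lam) * ((SX P ∩ SX Q).card : ℝ) ≤ (1 + 2 / lam) * (2 * (SX Q \ SX P).card) :=
    mul_le_mul_of_nonneg_left e5 (by positivity)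
  have : (1 + 2 / lam) * (2 * ((SX Q \ SX P).card : ℝ)) =
      2 * (SX Q \ SX P).card + 4 / lam * (SX Q \ SX P).card := by ring
  rw [e1, e2]
  linarith

/-- One augmentation step along a family of dense classes. -/
lemma IsAug.step {m' ε' d' δ' γ c : ℝ} (hP : IsPack A B R m ε d P)
    (hQ : IsPack A B R m' ε' d' Q) (h : IsAug P Q lam) (hl : 0 < lam) (hl1 : lam ≤ 1)
    (hR : ∀ i, ∀ ⦃u v⦄, R i u v → R i v u)
    (hd' : d' = δ' / 4) (hγ : γ ≤ lam / 2) {M : ℝ}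
    (hM : 2 * M ≤ m) (hM' : M ≤ (clX A P Q none).card) (hAB : A.card = B.card)
    (hcM : m' ≤ c * M) (h1 : 1 ≤ c * M) (hM0 : 0 ≤ M)
    {κ : Type} [Fintype κ]
    (H : ∀ (R : κ → V → V → Prop) (_ : ∀ a, ∀ ⦃u v⦄, R a u v → R a v u) (S T : κ → Finset V)
      (m : ℝ),
      1 ≤ c * m → (∀ a, m ≤ (S a).card) → (∀ a, m ≤ (T a).card) →
      (∀ a, δ' * ((S a).card * (T a).card) ≤ ed (R a) (S a) (T a)) →
      ∃ (m' q : ℕ) (X Y : κ → Finset V), (∀ a, X a ⊆ S a) ∧ (∀ a, Y a ⊆ T a) ∧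
        (∀ a, (X a).card = m') ∧ (∀ a, (Y a).card = m') ∧ c * m ≤ m' ∧ m' ≤ γ * m ∧ 0 < q ∧
        q ≤ ε' * m' ∧ (∀ a, Reg (R a) q (δ' / 4) (X a) (Y a)) ∧
        (∀ a b, a ≠ b → Disjoint (X a) (X b)) ∧ (∀ a b, a ≠ b → Disjoint (Y a) (Y b)))
    (hκ : Fintype.card κ ≤ 3) (lab : κ → ι) (xl yl : κ → Option (Pr ι V))
    (hxl : ∀ i, xl i ∈ avail P Q lam) (hyl : ∀ i, yl i ∈ avail P Q lam)
    (hden : ∀ i, δ' * ((clX A P Q (xl i)).card * (clY B P Q (yl i)).card) ≤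
      ed (R (lab i)) (clX A P Q (xl i)) (clY B P Q (yl i)))
    (hbal : ∀ p : Pr ι V, (univ.filter fun i => xl i = some p).card =
      (univ.filter fun i => yl i = some p).card)
    (hnone : (univ.filter fun i => xl i = none).card = 1) :
    ∃ Q', IsPack A B R m' ε' d' Q' ∧ IsAug P Q' lam ∧
      (SX Q \ SX P).card + 1 ≤ (SX Q' \ SX P).card := by
  have cX : ∀ o ∈ avail P Q lam, M ≤ (clX A P Q o).card := fun o ho => by
    obtain ⟨o1, o2⟩ := mem_avail ho
    rcases o with _ | p
    · exact hM'
    · have := card_sdiff_add_card_inter p.X (SX Q)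
      have c1 : ((p.X \ SX Q).card : ℝ) + (p.X ∩ SX Q).card = p.X.card := by exact_mod_cast this
      have c2 := o2 p rfl
      have c3 := hP.le_card p (o1 p rfl)
      have c4 : (0 : ℝ) ≤ p.X.card := by positivity
      show M ≤ ((p.X \ SX Q).card : ℝ)
      nlinarith
  have cY : ∀ o ∈ avail P Q lam, M ≤ (clY B P Q o).card := fun o ho => by
    rw [← h.card_cl_eq hP hQ hAB (mem_avail ho).1]; exact cX o ho
  obtain ⟨g, q, X, Y, hX, hY, gX, gY, hg1, hg2, hq, hqe, hreg, dX, dY⟩ :=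
    H (fun i => R (lab i)) (fun i => hR _) (fun i => clX A P Q (xl i)) (fun i => clY B P Q (yl i)) M
      h1 (fun i => cX _ (hxl i)) (fun i => cY _ (hyl i)) hden
  have hg0 : 0 < g := by
    have : (0 : ℝ) < g := by linarith
    exact_mod_cast this
  obtain ⟨Q', a1, a2, a3⟩ := h.extend hP hQ hκ lab xl yl X Y (fun i => (mem_avail (hxl i)).1)
    (fun i => (mem_avail (hyl i)).1) hX hY gX gY (hcM.trans hg1) hg0 hq hqe
    (by rw [hd']; exact hreg) dX dY hbal hnone (fun i p hp => by
      have c2 := (mem_avail (hxl i)).2 p hp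
      have c3 := hP.le_card p ((mem_avail (hxl i)).1 p hp)
      have c4 : γ * M ≤ lam / 2 * M := mul_le_mul_of_nonneg_right hγ hM0
      have c5 : lam * (2 * M) ≤ lam * p.X.card := mul_le_mul_of_nonneg_left (by linarith) hl.le
      linarith)
  exact ⟨Q', a1, a2, by omega⟩

/-- A full round of augmentation. -/
theorem exists_round (K : ℕ) {η δ δ' lam σ ε c0 : ℝ} (hδ' : 0 < δ') (hK1 : K * δ' ≤ η / 2)
    (hK2 : K * δ' < δ) (hl : 0 < lam) (hl1 : lam ≤ 1) (hσ : 0 < σ) (hε : 0 < ε) (hε2 : ε ≤ 1 / 2)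
    (hc0 : 0 < c0) :
    ∃ c : ℝ, 0 < c ∧ ∃ N0 : ℕ, ∀ {V ι : Type} [Fintype ι] {A B : Finset V} {R : ι → V → V → Prop}
      {θ : ℝ} {N : ℕ} {P : Finset (Pr ι V)} {ε0 d0 : ℝ}, N0 ≤ N → Fintype.card ι ≤ K →
      DenseSys A B R θ η δ N → IsPack A B R (c0 * N) ε0 d0 P →
      ∃ Q, IsPack A B R (c * N) ε (δ' / 4) Q ∧ IsAug P Q lam ∧
        (((A \ (SX P ∪ SX Q)).card : ℝ) ≤ σ * N ∨
          η * lam / 14 * N ≤ (SX Q \ SX P).card) := by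
  set γ := min (lam / 2) (δ' / 12) with hγ
  have hγ0 : 0 < γ := lt_min (by positivity) (by positivity)
  obtain ⟨c, hc, hc1, H⟩ := exists_disjoint_regular_family 3 hδ' hε hε2 hγ0
    (by push_cast; linarith [min_le_right (lam / 2) (δ' / 12)])
  set μ := min σ (c0 / 2) with hμ
  have hμ0 : 0 < μ := lt_min hσ (by positivity)
  refine ⟨c * μ, by positivity, ⌈1 / (c * μ)⌉₊ + 1, ?_⟩
  intro V ι _ A B R θ N P ε0 d0 hN hι hD hP
  have hN0 : 0 < N := by omega
  have hNr : (0 : ℝ) < N := by exact_mod_cast hN0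
  have hN1 : 1 ≤ c * (μ * N) := by
    have h1 : 1 / (c * μ) ≤ N := (Nat.le_ceil _).trans (by exact_mod_cast (by omega))
    rw [div_le_iff₀ (by positivity)] at h1
    linarith
  have hιr : (Fintype.card ι : ℝ) * δ' ≤ K * δ' :=
    mul_le_mul_of_nonneg_right (by exact_mod_cast hι) hδ'.le
  by_contra hno
  push Not at hno
  have grow : ∀ k : ℕ, ∃ Q, IsPack A B R (c * μ * N) ε (δ' / 4) Q ∧ IsAug P Q lam ∧
      k ≤ (SX Q \ SX P).card := by
    intro k
    induction k with
    | zero =>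
      refine ⟨∅, ⟨by simp, by simp, by simp, by simp, by simp, by simp, by simp⟩,
        ⟨by simp [SX, SY], fun p _ => ?_, by simp [SX]⟩, by simp⟩
      simp only [SX, biUnion_empty, inter_empty, card_empty, Nat.cast_zero]
      positivity
    | succ k ih =>
      obtain ⟨Q, hQ, hA, hk⟩ := ih
      obtain ⟨l1, l2⟩ := hno Q hQ hA
      have hAB : A.card = B.card := hD.cardA.trans hD.cardB.symm
      have vol : (1 - η / 2) * N ≤ ∑ o ∈ avail P Q lam, ((clX A P Q o).card : ℝ) := by
        refine le_trans ?_ (hA.card_avail hP hQ hl)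
        rw [hD.cardA]
        have : (3 + 4 / lam) ≤ 7 / lam := by
          rw [← sub_nonneg]
          have : 7 / lam - (3 + 4 / lam) = 3 * (1 - lam) / lam := by field_simp; ring
          rw [this]
          exact div_nonneg (by linarith) hl.le
        have h2 : (3 + 4 / lam) * ((SX Q \ SX P).card : ℝ) ≤ 7 / lam * (η * lam / 14 * N) := by
          gcongr
        have : 7 / lam * (η * lam / 14 * N) = η / 2 * N := by field_simp; ring
        linarith
      have hM' : μ * N ≤ (clX A P Q none).card :=
        (mul_le_mul_of_nonneg_right (min_le_left _ _) hNr.le).trans l1.le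
      have ne1 : (clX A P Q none).Nonempty := by
        rw [← card_pos]
        have : (0 : ℝ) < (clX A P Q none).card := lt_of_lt_of_le (by positivity) hM'
        exact_mod_cast this
      have ne2 : (clY B P Q none).Nonempty := by
        rw [← card_pos, ← hA.card_cl_eq hP hQ hAB (by simp)]
        exact card_pos.2 ne1
      have nav : none ∈ avail P Q lam := mem_insert_self _ _
      obtain ⟨a, ha, b, hb, i, j, l, w1, w2, w3⟩ := hD.exists_walk (avail P Q lam) (clX A P Q)
        (clY B P Q) (fun o ho => clX_subset hP (mem_avail ho).1)
        (fun o ho => clY_subset hP (mem_avail ho).1)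
        (fun o ho o' ho' => clX_disjoint hP (mem_avail ho).1 (mem_avail ho').1)
        (fun o ho o' ho' => clY_disjoint hP (mem_avail ho).1 (mem_avail ho').1)
        (fun o ho => hA.card_cl_eq hP hQ hAB (mem_avail ho).1) hN0 hδ'.le vol
        (clX_subset hP (by simp) : clX A P Q none ⊆ A) ne1
        (clY_subset hP (by simp) : clY B P Q none ⊆ B) ne2 (by linarith) (by linarith)
      have hM2 : 2 * (μ * N) ≤ c0 * N := by
        have : μ * N ≤ c0 / 2 * N := mul_le_mul_of_nonneg_right (min_le_right _ _) hNr.le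
        linarith
      have direct : ∀ i, δ' * ((clX A P Q none).card * (clY B P Q none).card) ≤
          ed (R i) (clX A P Q none) (clY B P Q none) → ∃ Q',
          IsPack A B R (c * μ * N) ε (δ' / 4) Q' ∧ IsAug P Q' lam ∧
          (SX Q \ SX P).card + 1 ≤ (SX Q' \ SX P).card := fun i hi =>
        hA.step hP hQ hl hl1 hD.symm rfl (min_le_left _ _) hM2 hM' hAB (by rw [mul_assoc]) hN1
          (by positivity) (fun R hR => H (κ := Fin 1) (by simp) R hR) (by simp) (fun _ => i)
          (fun _ => none) (fun _ => none) (fun _ => nav) (fun _ => nav) (fun _ => hi) (fun _ => rfl)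
          (by simp)
      suffices ∃ Q', IsPack A B R (c * μ * N) ε (δ' / 4) Q' ∧ IsAug P Q' lam ∧
          (SX Q \ SX P).card + 1 ≤ (SX Q' \ SX P).card by
        obtain ⟨Q', q1, q2, q3⟩ := this
        exact ⟨Q', q1, q2, by omega⟩
      rcases eq_or_ne a none with rfl | ha0
      · exact direct i w1
      rcases eq_or_ne b none with rfl | hb0
      · exact direct l w3
      refine hA.step hP hQ hl hl1 hD.symm rfl (min_le_left _ _) hM2 hM' hAB (by rw [mul_assoc]) hN1
          (by positivity) (fun R hR => H (κ := Fin 3) (by simp) R hR) (by simp) ![i, j, l]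
          ![none, a, b] ![a, b, none] ?_ ?_ ?_ ?_ ?_
      · intro t; fin_cases t <;> assumption
      · intro t; fin_cases t <;> assumption
      · intro t; fin_cases t <;> assumption
      · intro p
        simp only [card_filter, Fin.sum_univ_three]
        simp
        congr
      · simp only [card_filter, Fin.sum_univ_three]
        simp [ha0, hb0]
  obtain ⟨Q, hQ, -, hk⟩ := grow (N + 1)
  have := card_le_card (sdiff_subset.trans (SX_subset hQ) : SX Q \ SX P ⊆ A)
  rw [hD.cardA] at this
  omega

end Rounds

section Phases
open Finset
open scoped Classical

variable {V ι : Type} {A B : Finset V} {R : ι → V → V → Prop} {m ε d : ℝ} {P Q : Finset (Pr ι V)}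
  {lam : ℝ}

lemma IsPack.mono {m' ε' d' : ℝ} (h : IsPack A B R m ε d P) (hm : m' ≤ m) (hε : ε ≤ ε')
    (hd : d' ≤ d) : IsPack A B R m' ε' d' P where
  subX := h.subX
  subY := h.subY
  card_eq := h.card_eq
  le_card := fun p hp => hm.trans (h.le_card p hp)
  disjX := h.disjX
  disjY := h.disjY
  reg := fun p hp => by
    obtain ⟨q, q0, q1, q2⟩ := h.reg p hp
    refine ⟨q, q0, q1.trans (mul_le_mul_of_nonneg_right hε (by positivity)), ?_⟩
    exact fun X hX Y hY cX cY => (mul_le_mul_of_nonneg_right hd (by positivity)).trans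
      (q2 X hX Y hY cX cY)

/-- Shrinking all pairs of a pack. -/
noncomputable def shrink (P : Finset (Pr ι V)) (f g : Pr ι V → Finset V) : Finset (Pr ι V) :=
  P.image fun p => ⟨p.t, f p, g p⟩

lemma SX_shrink (f g : Pr ι V → Finset V) : SX (shrink P f g) = P.biUnion f := by
  simp [SX, shrink, image_biUnion]

lemma IsPack.shrink (h : IsPack A B R m ε d P) (hε : 0 ≤ ε) {f g : Pr ι V → Finset V}
    (hf : ∀ p ∈ P, f p ⊆ p.X)
    (hg : ∀ p ∈ P, g p ⊆ p.Y) (hc : ∀ p ∈ P, (f p).card = (g p).card)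
    (h2 : ∀ p ∈ P, (p.X.card : ℝ) ≤ 2 * (f p).card) :
    IsPack A B R (m / 2) (2 * ε) d (shrink P f g) := by
  have hm : ∀ {x : Pr ι V}, x ∈ Paper.shrink P f g → ∃ p ∈ P, x = ⟨p.t, f p, g p⟩ := fun hx => by
    obtain ⟨p, hp, rfl⟩ := mem_image.1 hx
    exact ⟨p, hp, rfl⟩
  constructor
  · intro x hx; obtain ⟨p, hp, rfl⟩ := hm hx; exact (hf p hp).trans (h.subX p hp)
  · intro x hx; obtain ⟨p, hp, rfl⟩ := hm hx; exact (hg p hp).trans (h.subY p hp)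
  · intro x hx; obtain ⟨p, hp, rfl⟩ := hm hx; exact hc p hp
  · intro x hx; obtain ⟨p, hp, rfl⟩ := hm hx
    have := h.le_card p hp
    have := h2 p hp
    show m / 2 ≤ ((f p).card : ℝ)
    linarith
  · intro x hx y hy hne; obtain ⟨p, hp, rfl⟩ := hm hx; obtain ⟨p', hp', rfl⟩ := hm hy
    exact (h.disjX p hp p' hp' fun e => hne (by rw [e])).mono (hf p hp) (hf p' hp')
  · intro x hx y hy hne; obtain ⟨p, hp, rfl⟩ := hm hx; obtain ⟨p', hp', rfl⟩ := hm hy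
    exact (h.disjY p hp p' hp' fun e => hne (by rw [e])).mono (hg p hp) (hg p' hp')
  · intro x hx; obtain ⟨p, hp, rfl⟩ := hm hx
    obtain ⟨q, q0, q1, q2⟩ := h.reg p hp
    refine ⟨q, q0, ?_, q2.subset (hf p hp) (hg p hp)⟩
    have := mul_le_mul_of_nonneg_left (h2 p hp) hε
    show (q : ℝ) ≤ 2 * ε * ((f p).card : ℝ)
    linarith

/-- Trimming `P` and adding `Q`. -/
lemma IsAug.merge {m' : ℝ} (hP : IsPack A B R m ε d P) (hQ : IsPack A B R m' (2 * ε) d Q)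
    (h : IsAug P Q lam) (hl : lam ≤ 1 / 2) (hε : 0 ≤ ε) :
    ∃ P', IsPack A B R (min (m / 2) m') (2 * ε) d P' ∧ SX P' = SX P ∪ SX Q := by
  have c1 : ∀ p ∈ P, (p.X \ SX Q).card = (p.Y \ SY Q).card := fun p hp => by
    have h1 := h.bal p hp
    have h2 := hP.card_eq p hp
    have h3 := card_sdiff_add_card_inter p.X (SX Q)
    have h4 := card_sdiff_add_card_inter p.Y (SY Q)
    omega
  have c2 : ∀ p ∈ P, (p.X.card : ℝ) ≤ 2 * (p.X \ SX Q).card := fun p hp => by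
    have h1 := h.trim p hp
    have h3 : ((p.X \ SX Q).card : ℝ) + (p.X ∩ SX Q).card = p.X.card := by
      exact_mod_cast card_sdiff_add_card_inter p.X (SX Q)
    have h4 : (0 : ℝ) ≤ p.X.card := by positivity
    nlinarith
  have hS := (hP.shrink hε (f := fun p => p.X \ SX Q) (g := fun p => p.Y \ SY Q)
    (fun _ _ => sdiff_subset) (fun _ _ => sdiff_subset) c1 c2).mono
    (min_le_left (m / 2) m') le_rfl le_rfl
  have hQ' := hQ.mono (min_le_right (m / 2) m') le_rfl le_rfl
  set S := Paper.shrink P (fun p => p.X \ SX Q) (fun p => p.Y \ SY Q)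
  have dX : ∀ p ∈ S, ∀ p' ∈ Q, Disjoint p.X p'.X := fun p hp p' hp' => by
    obtain ⟨p, -, rfl⟩ := mem_image.1 hp
    exact sdiff_disjoint.mono_right (subset_SX hp')
  have dY : ∀ p ∈ S, ∀ p' ∈ Q, Disjoint p.Y p'.Y := fun p hp p' hp' => by
    obtain ⟨p, -, rfl⟩ := mem_image.1 hp
    exact sdiff_disjoint.mono_right (subset_SY hp')
  refine ⟨S ∪ Q, ⟨?_, ?_, ?_, ?_, ?_, ?_, ?_⟩, ?_⟩
  · exact fun p hp => (mem_union.1 hp).elim (hS.subX p) (hQ'.subX p)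
  · exact fun p hp => (mem_union.1 hp).elim (hS.subY p) (hQ'.subY p)
  · exact fun p hp => (mem_union.1 hp).elim (hS.card_eq p) (hQ'.card_eq p)
  · exact fun p hp => (mem_union.1 hp).elim (hS.le_card p) (hQ'.le_card p)
  · intro p hp p' hp' hne
    rcases mem_union.1 hp with hp | hp <;> rcases mem_union.1 hp' with hp' | hp'
    exacts [hS.disjX p hp p' hp' hne, dX p hp p' hp', (dX p' hp' p hp).symm,
      hQ.disjX p hp p' hp' hne]
  · intro p hp p' hp' hne
    rcases mem_union.1 hp with hp | hp <;> rcases mem_union.1 hp' with hp' | hp'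
    exacts [hS.disjY p hp p' hp' hne, dY p hp p' hp', (dY p' hp' p hp).symm,
      hQ.disjY p hp p' hp' hne]
  · exact fun p hp => (mem_union.1 hp).elim (hS.reg p) (hQ'.reg p)
  · have : SX (S ∪ Q) = SX S ∪ SX Q := by unfold SX; rw [union_biUnion]
    rw [this, SX_shrink]
    ext v
    simp only [SX, mem_union, mem_biUnion, mem_sdiff]
    by_cases hv : ∃ a ∈ Q, v ∈ a.X <;> simp [hv]

/-- Nearly all vertices can be packed into boundedly many regular pairs of linear size. -/
theorem exists_pack (K : ℕ) {η δ δ' σ ε : ℝ} (hη : 0 < η) (hδ' : 0 < δ') (hK1 : K * δ' ≤ η / 2)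
    (hK2 : K * δ' < δ) (hσ : 0 < σ) (hε : 0 < ε) (hε2 : ε ≤ 1 / 2) :
    ∃ c : ℝ, 0 < c ∧ ∃ N0 : ℕ, ∀ {V ι : Type} [Fintype ι] {A B : Finset V} {R : ι → V → V → Prop}
      {θ : ℝ} {N : ℕ}, N0 ≤ N → Fintype.card ι ≤ K → DenseSys A B R θ η δ N →
      ∃ P, IsPack A B R (c * N) ε (δ' / 4) P ∧ ((A \ SX P).card : ℝ) ≤ σ * N := by
  have H : ∀ k : ℕ, ∀ ε : ℝ, 0 < ε → ε ≤ 1 / 2 → ∃ c : ℝ, 0 < c ∧ ∃ N0 : ℕ, ∀ {V ι : Type}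
      [Fintype ι] {A B : Finset V} {R : ι → V → V → Prop}
      {θ : ℝ} {N : ℕ}, N0 ≤ N → Fintype.card ι ≤ K → DenseSys A B R θ η δ N →
      ∃ P, IsPack A B R (c * N) ε (δ' / 4) P ∧ (((A \ SX P).card : ℝ) ≤ σ * N ∨
        k * (η / 28) * N ≤ (SX P).card) := by
    intro k
    induction k with
    | zero =>
      refine fun ε _ _ => ⟨1, one_pos, 0, ?_⟩
      intro V ι _ A B R θ N _ _ _
      exact ⟨∅, ⟨by simp, by simp, by simp, by simp, by simp, by simp, by simp⟩, .inr (by simp)⟩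
    | succ k ih =>
      intro ε hε hε2
      obtain ⟨c0, hc0, N0, h0⟩ := ih (ε / 2) (by positivity) (by linarith)
      obtain ⟨c, hc, N1, h1⟩ := exists_round K hδ' hK1 hK2 (one_half_pos (α := ℝ)) (by norm_num) hσ hε hε2 hc0
      refine ⟨min (c0 / 2) c, lt_min (by positivity) hc, max N0 N1, ?_⟩
      intro V ι _ A B R θ N hN hι hD
      obtain ⟨P, hP, hP'⟩ := h0 ((le_max_left _ _).trans hN) hι hD
      have hN' : (0 : ℝ) ≤ N := by positivity
      rcases hP' with hP' | hP'
      · exact ⟨P, hP.mono (mul_le_mul_of_nonneg_right ((min_le_left _ _).trans (by linarith)) hN')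
          (by linarith) le_rfl, .inl hP'⟩
      obtain ⟨Q, hQ, hA, hor⟩ := h1 ((le_max_right _ _).trans hN) hι hD hP
      obtain ⟨P', hP'1, hP'2⟩ := hA.merge hP (by rwa [mul_div_cancel₀ _ two_ne_zero]) le_rfl (by positivity)
      refine ⟨P', hP'1.mono ?_ (by linarith) le_rfl, ?_⟩
      · refine le_min ?_ (mul_le_mul_of_nonneg_right (min_le_right _ _) hN')
        exact (mul_le_mul_of_nonneg_right (min_le_left _ _) hN').trans (by linarith)
      · rw [hP'2]
        refine hor.imp id fun hg => ?_
        have := card_sdiff_add_card (SX Q) (SX P)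
        rw [union_comm] at this
        rw [← this]
        push_cast
        linarith
  set k := ⌈28 / η⌉₊ + 1 with hk
  obtain ⟨c, hc, N0, h⟩ := H k ε hε hε2
  refine ⟨c, hc, N0 + 1, ?_⟩
  intro V ι _ A B R θ N hN hι hD
  obtain ⟨P, hP, hor⟩ := h (by omega) hι hD
  refine ⟨P, hP, hor.resolve_right fun hlt => ?_⟩
  have h1 : ((SX P).card : ℝ) ≤ N := by
    rw [← hD.cardA]; exact_mod_cast card_le_card (SX_subset hP)
  have h2 : 28 / η < k := by rw [hk]; push_cast; linarith [Nat.le_ceil (28 / η)]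
  rw [div_lt_iff₀ hη] at h2
  have h3 : (0 : ℝ) < N := by exact_mod_cast (by omega : 0 < N)
  nlinarith

/-- Base pairs with minimum degree conditions, together with extra pairs exhausting almost
everything. -/
theorem exists_base_extra (K : ℕ) {η δ δ' lam τ ε : ℝ} (hη : 0 < η) (hδ' : 0 < δ')
    (hK1 : K * δ' ≤ η / 2) (hK2 : K * δ' < δ) (hl : 0 < lam) (hl1 : lam ≤ 1) (hτ : 0 < τ)
    (hτ2 : τ < η * lam / 14) (hε : 0 < ε) (hε2 : ε ≤ 1 / 4) (hεd : ε ≤ δ' / 8) :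
    ∃ c : ℝ, 0 < c ∧ ∀ σ ε' : ℝ, 0 < σ → 0 < ε' → ε' ≤ 1 / 2 → ∃ c' : ℝ, 0 < c' ∧ ∃ N0 : ℕ,
      ∀ {V ι : Type} [Fintype ι] {A B : Finset V} {R : ι → V → V → Prop}
      {θ : ℝ} {N : ℕ}, N0 ≤ N → Fintype.card ι ≤ K → DenseSys A B R θ η δ N →
      ∃ P Q, IsPack A B R (c * N) ε (δ' / 4) P ∧ IsPack A B R (c' * N) ε' (δ' / 4) Q ∧
        IsAug P Q lam ∧ ((A \ SX P).card : ℝ) ≤ τ * N ∧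
        ((A \ (SX P ∪ SX Q)).card : ℝ) ≤ σ * N ∧
        (∀ p ∈ P, (∀ x ∈ p.X, δ' / 8 * p.X.card ≤ dg (R p.t) x p.Y) ∧
          ∀ y ∈ p.Y, δ' / 8 * p.X.card ≤ dg (R p.t) y p.X) := by
  set ε1 := min (ε / 2) (τ / 2) with hε1
  have hε10 : 0 < ε1 := lt_min (by positivity) (by positivity)
  have hε1e : ε1 ≤ ε / 2 := min_le_left _ _
  have hε1t : ε1 ≤ τ / 2 := min_le_right _ _
  obtain ⟨c, hc, N0, h0⟩ := exists_pack K hη hδ' hK1 hK2 (half_pos hτ) hε10 (by linarith)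
  refine ⟨c / 2, by positivity, fun σ ε' hσ hε' hε'2 => ?_⟩
  obtain ⟨c', hc', N1, h1⟩ := exists_round K hδ' hK1 hK2 hl hl1 hσ hε' hε'2 (half_pos hc)
  refine ⟨c', hc', max N0 N1 + 1, ?_⟩
  intro V ι _ A B R θ N hN hι hD
  have hN0 : N0 ≤ N := (le_max_left N0 N1).trans (by omega)
  have hN1 : N1 ≤ N := (le_max_right N0 N1).trans (by omega)
  have hNr : (0 : ℝ) < N := by exact_mod_cast (by omega : 0 < N)
  obtain ⟨P0, hP0, hL0⟩ := h0 hN0 hι hD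
  have hcl : ∀ p : Pr ι V, ∃ X' Y' : Finset V, p ∈ P0 → X' ⊆ p.X ∧ Y' ⊆ p.Y ∧
      X'.card = Y'.card ∧ (p.X.card : ℝ) ≤ 2 * X'.card ∧ (p.X.card : ℝ) ≤ X'.card + ε1 * p.X.card ∧
      (∀ x ∈ X', δ' / 8 * X'.card ≤ dg (R p.t) x Y') ∧
      ∀ y ∈ Y', δ' / 8 * X'.card ≤ dg (R p.t) y X' := by
    intro p
    by_cases hp : p ∈ P0
    swap
    · exact ⟨∅, ∅, fun h => absurd h hp⟩
    obtain ⟨q, q0, q1, q2⟩ := hP0.reg p hp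
    have hpc : (0 : ℝ) ≤ p.X.card := by positivity
    have hq1 : (q : ℝ) ≤ p.X.card := by nlinarith
    obtain ⟨X', hX', Y', hY', cX, cY, dX, dY⟩ := q2.clean (hD.symm _) rfl (hP0.card_eq p hp).symm q0
      (by exact_mod_cast hq1)
    have hcX : (X'.card : ℝ) = p.X.card - q := by
      rw [cX, Nat.cast_sub (by exact_mod_cast hq1)]
    have hcd : δ' / 8 * X'.card ≤ δ' / 4 * p.X.card - q := by
      have : (X'.card : ℝ) ≤ p.X.card := by rw [hcX]; linarith [(Nat.cast_nonneg q : (0 : ℝ) ≤ q)]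
      nlinarith
    refine ⟨X', Y', fun _ => ⟨hX', hY', cX.trans cY.symm, ?_, ?_, fun x hx => ?_, fun y hy => ?_⟩⟩
    · rw [hcX]; nlinarith
    · rw [hcX]; nlinarith
    · exact hcd.trans (dX x hx)
    · exact hcd.trans (dY y hy)
  choose f g hfg using hcl
  have hP := (hP0.shrink hε10.le (fun p hp => (hfg p hp).1) (fun p hp => (hfg p hp).2.1)
    (fun p hp => (hfg p hp).2.2.1) (fun p hp => (hfg p hp).2.2.2.1)).mono (m' := c / 2 * N)
    (by linarith) (by linarith : 2 * ε1 ≤ ε) le_rfl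
  have hdeg : ∀ p ∈ shrink P0 f g, (∀ x ∈ p.X, δ' / 8 * p.X.card ≤ dg (R p.t) x p.Y) ∧
          ∀ y ∈ p.Y, δ' / 8 * p.X.card ≤ dg (R p.t) y p.X := fun p hp => by
    obtain ⟨p, hp0, rfl⟩ := mem_image.1 hp
    exact (hfg p hp0).2.2.2.2.2
  have hL : ((A \ SX (shrink P0 f g)).card : ℝ) ≤ τ * N := by
    have e1 : ((SX P0).card : ℝ) = ∑ p ∈ P0, (p.X.card : ℝ) := by
      rw [card_SX hP0]; push_cast; rfl
    have e2 : ((SX (shrink P0 f g)).card : ℝ) = ∑ p ∈ P0, ((f p).card : ℝ) := by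
      rw [SX_shrink, card_biUnion]
      · push_cast; rfl
      · exact fun p hp p' hp' hne => (hP0.disjX p hp p' hp' hne).mono (hfg p hp).1 (hfg p' hp').1
    have e3 : ∑ p ∈ P0, (p.X.card : ℝ) ≤ ∑ p ∈ P0, ((f p).card + ε1 * (p.X.card : ℝ)) :=
      sum_le_sum fun p hp => (hfg p hp).2.2.2.2.1
    rw [sum_add_distrib, ← mul_sum, ← e1, ← e2] at e3
    have e4 : ((A \ SX P0).card : ℝ) + (SX P0).card = N := by
      rw [← hD.cardA]; exact_mod_cast card_sdiff_add_card_eq_card (SX_subset hP0)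
    have e5 : ((A \ SX (shrink P0 f g)).card : ℝ) + (SX (shrink P0 f g)).card = N := by
      rw [← hD.cardA]; exact_mod_cast card_sdiff_add_card_eq_card (SX_subset hP)
    have e6 : (0 : ℝ) ≤ (A \ SX P0).card := by positivity
    have e7 : ε1 * ((SX P0).card : ℝ) ≤ τ / 2 * N := by
      have : ((SX P0).card : ℝ) ≤ N := by linarith
      have : (0 : ℝ) ≤ (SX P0).card := by positivity
      nlinarith
    linarith
  obtain ⟨Q, hQ, hA, hor⟩ := h1 hN1 hι hD hP
  refine ⟨_, Q, hP, hQ, hA, hL, hor.resolve_right fun hlt => ?_, hdeg⟩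
  have : ((SX Q \ SX (shrink P0 f g)).card : ℝ) ≤ (A \ SX (shrink P0 f g)).card := by
    exact_mod_cast card_le_card (sdiff_subset_sdiff (SX_subset hQ) le_rfl)
  have : τ * N < η * lam / 14 * N := mul_lt_mul_of_pos_right hτ2 hNr
  linarith

end Phases

section Soft
open Finset
open scoped Classical

variable {V : Type*} {R : V → V → Prop}

lemma exists_nbrs_of_le_dg {v : V} {T U : Finset V} {k : ℕ} (h : k + U.card ≤ dg R v T) :
    ∃ S ⊆ T \ U, S.card = k ∧ ∀ y ∈ S, R v y := by
  have := dg_le_sdiff_add (R := R) v T U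
  obtain ⟨S, hS, hc⟩ := exists_subset_card_eq (s := (T \ U).filter (R v)) (n := k)
    (by unfold dg at *; omega)
  exact ⟨S, hS.trans (filter_subset _ _), hc, fun y hy => (mem_filter.1 (hS hy)).2⟩

lemma card_le_dg {v : V} {S T : Finset V} (hS : S ⊆ T) (h : ∀ y ∈ S, R v y) :
    S.card ≤ dg R v T :=
  card_le_card fun y hy => mem_filter.2 ⟨hS hy, h y hy⟩

/-- A regular pair contains spanning paths of balanced subsets of any prescribed size between
given vertices of large degree, avoiding a small set. -/
theorem Reg.exists_path (hR : ∀ ⦃u v⦄, R u v → R v u) {q g : ℕ} {d : ℝ} {X Y U : Finset V}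
    (h : Reg R q d X Y) (hq : 0 < q) (hd : 0 < d) (hd1 : d ≤ 1) (hXY : Disjoint X Y) {x0 y0 : V}
    (hx0 : x0 ∈ X \ U) (hy0 : y0 ∈ Y \ U) (hxd : U.card + 4 * q + 4 ≤ dg R x0 Y)
    (hyd : U.card + 4 * q + 4 ≤ dg R y0 X) (hg : (3 * q + 4 : ℝ) ≤ d * g)
    (hgX : g + U.card + q ≤ X.card) (hgY : g + U.card + q ≤ Y.card) :
    ∃ X1 ⊆ X \ U, ∃ Y1 ⊆ Y \ U, X1.card = g ∧ Y1.card = g ∧ ∃ l : List V, l.Nodup ∧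
      Pth R x0 y0 l ∧ ∀ v, v ∈ l ↔ v ∈ X1 ∪ Y1 := by
  have hgq : 3 * q + 4 ≤ g := by
    have : (3 * q + 4 : ℝ) ≤ g := hg.trans (by nlinarith [(Nat.cast_nonneg g : (0 : ℝ) ≤ g)])
    exact_mod_cast this
  have cXU := le_card_sdiff U X
  have cYU := le_card_sdiff U Y
  obtain ⟨T, hT, cT, rT⟩ := exists_nbrs_of_le_dg (k := 3 * q + 3) (U := U) (by omega) (T := Y)
    (v := x0) (R := R)
  obtain ⟨Y0, hY0, hY0', cY0⟩ := exists_subsuperset_card_eq (s := insert y0 T) (t := Y \ U)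
    (n := g) (insert_subset hy0 hT) (by have := card_insert_le y0 T; omega) (by omega)
  set lowX := X.filter fun x => (dg R x Y0 : ℝ) < d * Y0.card with hlowX
  have clX : lowX.card < q := h.card_low_lt hR hq (hY0'.trans sdiff_subset) (by omega)
  obtain ⟨S, hS, cS, rS⟩ := exists_nbrs_of_le_dg (k := 3 * q + 3) (U := U ∪ lowX)
    (by have := card_union_le U lowX; omega) (T := X) (v := y0) (R := R)
  obtain ⟨X1, hX1, hX1', cX1⟩ := exists_subsuperset_card_eq (s := insert x0 S)
    (t := insert x0 (X \ (U ∪ lowX))) (n := g) (insert_subset_insert _ hS)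
    (by have := card_insert_le x0 S; omega)
    (by
      have h1 := card_le_card (subset_insert x0 (X \ (U ∪ lowX)))
      have h2 := le_card_sdiff (U ∪ lowX) X
      have h3 := card_union_le U lowX
      omega)
  have hX1X : X1 ⊆ X \ U := fun x hx => by
    rcases mem_insert.1 (hX1' hx) with rfl | h'
    · exact hx0
    · exact sdiff_subset_sdiff le_rfl subset_union_left h'
  set lowY := (Y.filter fun y => (dg R y X1 : ℝ) < d * X1.card).erase y0 with hlowY
  have clY : lowY.card < q := lt_of_le_of_lt (card_le_card (erase_subset _ _))
    (h.symm hR |>.card_low_lt hR hq (hX1X.trans sdiff_subset) (by omega))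
  obtain ⟨Y1, hY1, hY1', cY1⟩ := exists_subsuperset_card_eq (s := Y0 \ lowY)
    (t := (Y \ U) \ lowY) (n := g) (sdiff_subset_sdiff hY0' le_rfl)
    (by have := card_le_card (sdiff_subset (s := Y0) (t := lowY)); omega)
    (by have := le_card_sdiff lowY (Y \ U); omega)
  have hY1Y : Y1 ⊆ Y \ U := hY1'.trans sdiff_subset
  have deg1 : ∀ x ∈ X1, 3 * q + 3 ≤ dg R x Y0 := fun x hx => by
    rcases mem_insert.1 (hX1' hx) with rfl | h'
    · rw [← cT]
      exact card_le_dg ((subset_insert _ _).trans hY0) rT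
    · have hx' := mem_sdiff.1 h'
      have : ¬ (dg R x Y0 : ℝ) < d * Y0.card := fun hlt =>
        hx'.2 (mem_union_right _ (mem_filter.2 ⟨hx'.1, hlt⟩))
      rw [cY0] at this
      have : (3 * q + 4 : ℝ) ≤ dg R x Y0 := hg.trans (not_lt.1 this)
      have : 3 * q + 4 ≤ dg R x Y0 := by exact_mod_cast this
      omega
  have deg2 : ∀ x ∈ X1, 2 * q + 2 ≤ dg R x Y1 := fun x hx => by
    have h1 := deg1 x hx
    have h2 := dg_le_sdiff_add (R := R) x Y0 lowY
    have h3 := dg_mono (R := R) (v := x) hY1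
    omega
  have deg3 : ∀ y ∈ Y1, 2 * q + 2 ≤ dg R y X1 := fun y hy => by
    by_cases hyy : y = y0
    · subst hyy
      have : S.card ≤ dg R y X1 := card_le_dg ((subset_insert _ _).trans hX1) rS
      omega
    · have hy' := mem_sdiff.1 (hY1' hy)
      have : ¬ (dg R y X1 : ℝ) < d * X1.card := fun hlt =>
        hy'.2 (mem_erase.2 ⟨hyy, mem_filter.2 ⟨(mem_sdiff.1 hy'.1).1, hlt⟩⟩)
      rw [cX1] at this
      have : (3 * q + 4 : ℝ) ≤ dg R y X1 := hg.trans (not_lt.1 this)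
      have : 3 * q + 4 ≤ dg R y X1 := by exact_mod_cast this
      omega
  have hx1 : x0 ∈ X1 := hX1 (mem_insert_self _ _)
  have hy1 : y0 ∈ Y1 := hY1 (mem_sdiff.2 ⟨hY0 (mem_insert_self _ _),
    notMem_erase _ _⟩)
  have hX1s := hX1X.trans sdiff_subset
  have hY1s := hY1Y.trans sdiff_subset
  exact ⟨X1, hX1X, Y1, hY1Y, cX1, cY1, exists_hamPath hR (hXY.mono hX1s hY1s) (cX1.trans cY1.symm)
    hx1 hy1 ((h.subset hX1s hY1s).holeFree hq hd) le_rfl deg2 deg3⟩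

end Soft

section Cover
open Finset
open scoped Classical

lemma exists_last_split {α : Type*} (p : α → Prop) (l : List α) (h : ∃ x ∈ l, p x) :
    ∃ (l₁ : List α) (x : α) (l₂ : List α), l = l₁ ++ x :: l₂ ∧ p x ∧ ∀ u ∈ l₂, ¬ p u := by
  induction l with
  | nil => simp at h
  | cons a l ih =>
    by_cases hl : ∃ x ∈ l, p x
    · obtain ⟨l₁, x, l₂, rfl, h2, h3⟩ := ih hl
      exact ⟨a :: l₁, x, l₂, rfl, h2, h3⟩
    · push Not at hl
      obtain ⟨x, hx, hpx⟩ := h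
      rcases List.mem_cons.1 hx with rfl | hx
      · exact ⟨[], x, l, rfl, hpx, hl⟩
      · exact absurd hpx (hl x hx)

variable {V : Type*} {S : V → V → Prop}

/-- A cyclic list containing the whole neighbourhood of one of its members. -/
lemma exists_cyclic_list (hS : ∀ ⦃u v⦄, S u v → S v u) {L : Finset V} (hrefl : ∀ v ∈ L, S v v)
    (hL : L.Nonempty) : ∃ (v : V) (l : List V), (v :: l).Nodup ∧ (∀ x ∈ v :: l, x ∈ L) ∧
      (v :: l).IsChain S ∧ S ((v :: l).getLast (by simp)) v ∧ ∀ u ∈ L, S v u → u ∈ v :: l := by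
  set p : ℕ → Prop := fun k => ∃ l : List V, l.length = k ∧ l.Nodup ∧ (∀ x ∈ l, x ∈ L) ∧
    l.IsChain S with hp
  obtain ⟨v0, hv0⟩ := hL
  have p1 : p 1 := ⟨[v0], by simp [hv0]⟩
  have hbd : ∀ k, p k → k ≤ L.card := by
    rintro k ⟨l, rfl, nd, hl, -⟩
    rw [← List.toFinset_card_of_nodup nd]
    exact card_le_card fun x hx => hl x (by simpa using hx)
  have hspec := Nat.findGreatest_spec (P := p) (hbd 1 p1) p1
  set k := Nat.findGreatest p L.card with hk
  have hmax : ∀ j, p j → j ≤ k := fun j hj => Nat.le_findGreatest (hbd j hj) hj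
  obtain ⟨l, hlk, nd, hl, hch⟩ := hspec
  cases l with
  | nil => have := hmax 1 p1; simp at hlk; omega
  | cons v t =>
    have hv : v ∈ L := hl v (by simp)
    have hnb : ∀ u ∈ L, S v u → u ∈ v :: t := by
      intro u hu hvu
      by_contra hnot
      have := hmax (k + 1) ⟨u :: v :: t, by simp [← hlk], List.nodup_cons.2 ⟨hnot, nd⟩,
        fun x hx => by
          rcases List.mem_cons.1 hx with rfl | hx
          · exact hu
          · exact hl x hx, List.IsChain.cons_cons (hS hvu) hch⟩
      omega
    obtain ⟨l₁, x, l₂, he, hx, hl₂⟩ := exists_last_split (S v) (v :: t) ⟨v, by simp, hrefl v hv⟩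
    have he' : v :: t = (l₁ ++ [x]) ++ l₂ := by simp [he]
    obtain ⟨s, hs⟩ : ∃ s, l₁ ++ [x] = v :: s := by
      cases l₁ with
      | nil => simp at he; exact ⟨[], by simp [he.1]⟩
      | cons a l₁ => simp at he; exact ⟨l₁ ++ [x], by simp [he.1]⟩
    rw [hs] at he'
    refine ⟨v, s, ?_, ?_, ?_, ?_, ?_⟩
    · exact (List.nodup_append.1 (he' ▸ nd)).1
    · exact fun y hy => hl y (he' ▸ List.mem_append_left _ hy)
    · exact (List.isChain_append.1 (he' ▸ hch)).1
    · have : (v :: s).getLast (by simp) = x := by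
        simp [← hs]
      rw [this]; exact hS hx
    · intro u hu hvu
      have := hnb u hu hvu
      rw [he'] at this
      exact (List.mem_append.1 this).resolve_right fun h => hl₂ u h hvu

/-- Interleaving a chain with common neighbours. -/
lemma exists_interleave {R : V → V → Prop} (hR : ∀ ⦃u v⦄, R u v → R v u) {B : Finset V} {M : ℕ}
    (l : List V) : ∀ (v w : V) (F : Finset V),
    (v :: l).Nodup → (∀ x ∈ v :: l, x ∉ B) → F.card + (v :: l).length ≤ M →
    (v :: l).IsChain (fun u v => M ≤ (B.filter fun b => R u b ∧ R v b).card) →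
    M ≤ (B.filter fun b => R ((v :: l).getLast (by simp)) b ∧ R w b).card →
    ∃ (b : V) (l' : List V) (Z : Finset V), Z ⊆ B \ F ∧ Z.card = (v :: l).length ∧
      (v :: l').Nodup ∧ Pth R v b (v :: l') ∧ R b w ∧ ∀ x, x ∈ v :: l' ↔ x ∈ v :: l ∨ x ∈ Z := by
  induction l with
  | nil =>
    intro v w F _ hB hF _ hM
    have hM : M ≤ (B.filter fun b => R v b ∧ R w b).card := hM
    simp only [List.length_cons, List.length_nil] at hF
    obtain ⟨b, hb⟩ : ((B.filter fun b => R v b ∧ R w b) \ F).Nonempty := by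
      rw [← card_pos]
      have := le_card_sdiff F (B.filter fun b => R v b ∧ R w b)
      omega
    obtain ⟨hb1, hbF⟩ := mem_sdiff.1 hb
    obtain ⟨hbB, hvb, hwb⟩ := mem_filter.1 hb1
    have hvB := hB v (by simp)
    refine ⟨b, [b], {b}, by simp [hbB, hbF], by simp, ?_, ⟨by simp [hvb], by simp, by simp⟩,
      hR hwb, by simp⟩
    simp only [List.nodup_cons, List.mem_singleton, List.not_mem_nil, not_false_eq_true,
      List.nodup_nil, and_true]
    rintro rfl; exact hvB hbB
  | cons a l ih =>
    intro v w F nd hB hF hch hM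
    obtain ⟨hva, hch'⟩ := List.isChain_cons_cons.1 hch
    simp only [List.length_cons] at hF
    obtain ⟨b, hb⟩ : ((B.filter fun b => R v b ∧ R a b) \ F).Nonempty := by
      rw [← card_pos]
      have := le_card_sdiff F (B.filter fun b => R v b ∧ R a b)
      omega
    obtain ⟨hb1, hbF⟩ := mem_sdiff.1 hb
    obtain ⟨hbB, hvb, hab⟩ := mem_filter.1 hb1
    obtain ⟨e, l', Z, hZ, cZ, nd', hp, hew, hmem⟩ := ih a w (insert b F) (List.nodup_cons.1 nd).2
      (fun x hx => hB x (List.mem_cons_of_mem _ hx))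
      (by have := card_insert_le b F; simp only [List.length_cons]; omega) hch'
      (by simpa using hM)
    have hbZ : b ∉ Z := fun h => (mem_sdiff.1 (hZ h)).2 (mem_insert_self _ _)
    have hZB : ∀ x ∈ Z, x ∈ B := fun x hx => (mem_sdiff.1 (hZ hx)).1
    refine ⟨e, b :: a :: l', insert b Z, ?_, ?_, ?_, ⟨?_, by simp, ?_⟩, hew, ?_⟩
    · intro x hx
      rcases mem_insert.1 hx with rfl | hx
      · exact mem_sdiff.2 ⟨hbB, hbF⟩
      · have := mem_sdiff.1 (hZ hx)
        exact mem_sdiff.2 ⟨this.1, fun h => this.2 (mem_insert_of_mem h)⟩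
    · rw [card_insert_of_notMem hbZ, cZ]; simp
    · have h1 : b ∉ a :: l' := fun h => ((hmem b).1 h).elim
        (fun h => hB b (List.mem_cons_of_mem _ h) hbB) hbZ
      have h2 : v ∉ a :: l' := fun h => ((hmem v).1 h).elim (List.nodup_cons.1 nd).1
        (fun h => hB v (by simp) (hZB v h))
      refine List.nodup_cons.2 ⟨fun h => ?_, List.nodup_cons.2 ⟨h1, nd'⟩⟩
      rcases List.mem_cons.1 h with rfl | h
      · exact hB v (by simp) hbB
      · exact h2 h
    · exact List.IsChain.cons_cons hvb (List.IsChain.cons_cons (hR hab) hp.1)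
    · simpa using hp.2.2
    · intro x
      rw [List.mem_cons, List.mem_cons, hmem x, List.mem_cons (a := x) (b := v), mem_insert]
      clear * -
      tauto

variable {r : ℕ} {G : SimpleGraph V} {c : Sym2 V → Fin r}

lemma exists_cover_of_indep {i : Fin r} {B : Finset V} {M : ℕ} (s : ℕ) :
    ∀ (L F : Finset V), Disjoint L B → F.card + L.card ≤ M → (∀ v ∈ L, M ≤ dg (Rc G c i) v B) →
      (∀ I ⊆ L, (∀ u ∈ I, ∀ v ∈ I, u ≠ v →
        (B.filter fun b => Rc G c i u b ∧ Rc G c i v b).card < M) → I.card ≤ s) →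
      ∃ Z ⊆ B \ F, Z.card = L.card ∧ CP G c ↑(L ∪ Z) s := by
  set S : V → V → Prop := fun u v => M ≤ (B.filter fun b => Rc G c i u b ∧ Rc G c i v b).card
    with hSdef
  have hS : ∀ ⦃u v⦄, S u v → S v u := fun u v h => by
    rw [hSdef] at *; simpa only [and_comm] using h
  induction s with
  | zero =>
    intro L F _ _ _ hI
    rcases L.eq_empty_or_nonempty with rfl | ⟨v, hv⟩
    · exact ⟨∅, by simp, by simp, by simpa using CP.empty⟩
    · have := hI {v} (by simpa using hv) (by simp)
      simp at this
  | succ s ih =>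
    intro L F hLB hF hdeg hI
    rcases L.eq_empty_or_nonempty with rfl | hLne
    · exact ⟨∅, by simp, by simp, by simpa using CP.empty.mono (Nat.zero_le _)⟩
    obtain ⟨v, l, nd, hlL, hch, hcl, hnb⟩ := exists_cyclic_list hS (L := L)
      (fun v hv => by rw [hSdef]; simpa [dg] using hdeg v hv) hLne
    have hlen : (v :: l).toFinset.card = (v :: l).length := List.toFinset_card_of_nodup nd
    have hsub : (v :: l).toFinset ⊆ L := fun x hx => hlL x (by simpa using hx)
    have hcard := card_sdiff_add_card_eq_card hsub
    obtain ⟨b, l', Z, hZ, cZ, nd', hp, hbv, hmem⟩ := exists_interleave (R := Rc G c i) Rc.symm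
      (B := B) (M := M) l v v F nd (fun x hx => disjoint_left.1 hLB (hlL x hx))
      (by omega) hch hcl
    have hcyc : IsCyc (Rc G c i) (v :: l') := hp.isCyc nd' hbv
    obtain ⟨Z', hZ', cZ', hCP⟩ := ih (L \ (v :: l).toFinset) (F ∪ Z)
      (hLB.mono_left sdiff_subset)
      (by have := card_union_le F Z; omega)
      (fun u hu => hdeg u (mem_sdiff.1 hu).1)
      (fun I hIL hIp => by
        have hvI : v ∉ I := fun h => (mem_sdiff.1 (hIL h)).2 (by simp)
        have hnS : ∀ u ∈ I, ¬ S v u := fun u hu h => by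
          have := mem_sdiff.1 (hIL hu)
          exact this.2 (by simpa using hnb u this.1 h)
        have := hI (insert v I) (insert_subset (hlL v (by simp))
          (hIL.trans sdiff_subset)) (fun x hx y hy hne => by
            rcases mem_insert.1 hx with rfl | hx1 <;>
            rcases mem_insert.1 hy with rfl | hy1
            · exact absurd rfl hne
            · exact not_le.1 (hnS y hy1)
            · exact not_le.1 fun h => hnS x hx1 (hS h)
            · exact hIp x hx1 y hy1 hne)
        rw [card_insert_of_notMem hvI] at this
        omega)
    have hZ'd : Disjoint Z Z' := disjoint_left.2 fun x hx hx' =>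
      (mem_sdiff.1 (hZ' hx')).2 (mem_union_right _ hx)
    refine ⟨Z ∪ Z', union_subset hZ (hZ'.trans (sdiff_subset_sdiff le_rfl
      subset_union_left)), ?_, ?_⟩
    · rw [card_union_of_disjoint hZ'd]; omega
    · have hu := hcyc.cp.union hCP (Set.disjoint_left.2 fun x hx hx' => by
        have h1 := (hmem x).1 hx
        rcases mem_union.1 (mem_coe.1 hx') with h2 | h2
        · have h3 := mem_sdiff.1 h2
          rcases h1 with h1 | h1
          · exact h3.2 (by simpa using h1)
          · exact disjoint_left.1 hLB h3.1 (mem_sdiff.1 (hZ h1)).1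
        · rcases h1 with h1 | h1
          · exact disjoint_left.1 hLB (hlL x h1) (mem_sdiff.1 (hZ' h2)).1
          · exact disjoint_left.1 hZ'd h1 h2)
      rw [add_comm]
      convert hu using 1
      ext x
      have hm := hmem x
      have hx := hlL x
      simp only [coe_union, Set.mem_union, mem_coe, mem_sdiff,
        List.mem_toFinset, Set.mem_ofPred_eq] at *
      tauto

/-- A small set of vertices of large degree into `B` is covered by few cycles using equally many
vertices of `B`. -/
theorem exists_cover (hr : 0 < r) {L B : Finset V} {κ : ℝ} {N : ℕ} (hκ : 0 < κ)
    (hLB : Disjoint L B) (hdeg : ∀ v ∈ L, κ * N ≤ dg G.Adj v B) (hB : B.card ≤ N) {s : ℕ}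
    (hs : 2 * r ≤ κ * (s + 1)) (hLs : (s + 1) * (s + 1) * L.card < N) :
    ∃ Z ⊆ B, Z.card = L.card ∧ CP G c ↑(L ∪ Z) (r * s) := by
  have hNr : (0 : ℝ) < N := by exact_mod_cast (by omega : 0 < N)
  have hrr : (0 : ℝ) < r := by exact_mod_cast hr
  have hmaj : ∀ v, ∃ i : Fin r, v ∈ L → κ * N / r ≤ dg (Rc G c i) v B := by
    intro v
    have : Nonempty (Fin r) := ⟨⟨0, hr⟩⟩
    by_cases hv : v ∈ L
    swap
    · exact ⟨Classical.arbitrary _, fun h => absurd h hv⟩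
    by_contra hno
    push Not at hno
    have h1 : (dg G.Adj v B : ℝ) = ∑ i : Fin r, (dg (Rc G c i) v B : ℝ) := by
      have : dg G.Adj v B = ∑ i : Fin r, dg (Rc G c i) v B := by
        unfold dg
        rw [card_eq_sum_card_fiberwise (f := fun b => c s(v, b)) (t := univ)
          (by simp)]
        refine sum_congr rfl fun i _ => ?_
        rw [filter_filter]
        congr
      rw [this]; push_cast; rfl
    have h2 : ∑ i : Fin r, (dg (Rc G c i) v B : ℝ) < ∑ _i : Fin r, κ * N / r :=
      sum_lt_sum_of_nonempty univ_nonempty fun i _ => (hno i).2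
    rw [sum_const, card_univ, Fintype.card_fin, nsmul_eq_mul,
      mul_div_cancel₀ _ hrr.ne'] at h2
    linarith [hdeg v hv]
  choose f hf using hmaj
  have hL1 : (L.card : ℝ) ≤ κ * N / r := by
    rw [le_div_iff₀ hrr]
    have h1 : ((s : ℝ) + 1) * (s + 1) * L.card < N := by exact_mod_cast hLs
    have h2 : 2 * r * (L.card : ℝ) ≤ κ * (s + 1) * L.card :=
      mul_le_mul_of_nonneg_right hs (by positivity)
    have h3 : ((s : ℝ) + 1) * L.card ≤ (s + 1) * (s + 1) * L.card := by
      have : (0 : ℝ) ≤ s := by positivity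
      gcongr
      nlinarith
    have h4 : κ * (((s : ℝ) + 1) * L.card) ≤ κ * N := mul_le_mul_of_nonneg_left (by linarith) hκ.le
    have : (0 : ℝ) ≤ L.card := by positivity
    nlinarith
  have key : ∀ C : Finset (Fin r), ∃ Z ⊆ B, Z.card = (L.filter fun v => f v ∈ C).card ∧
      CP G c ↑(L.filter (fun v => f v ∈ C) ∪ Z) (C.card * s) := by
    intro C
    induction C using Finset.induction_on with
    | empty => exact ⟨∅, by simp, by simp, by simpa using CP.empty⟩
    | insert i C hi ih =>
      obtain ⟨Z, hZ, cZ, hCP⟩ := ih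
      have hsplit : L.filter (fun v => f v ∈ insert i C) =
          L.filter (fun v => f v = i) ∪ L.filter fun v => f v ∈ C := by
        ext v; simp only [mem_insert, mem_filter, mem_union]; tauto
      have hdis : Disjoint (L.filter (fun v => f v = i)) (L.filter fun v => f v ∈ C) :=
        disjoint_left.2 fun v h1 h2 => hi
          ((mem_filter.1 h1).2 ▸ (mem_filter.1 h2).2)
      have hcs := card_union_of_disjoint hdis
      rw [← hsplit] at hcs
      have hcs2 := card_le_card (filter_subset (fun v => f v ∈ insert i C) L)
      obtain ⟨Z', hZ', cZ', hCP'⟩ := exists_cover_of_indep (G := G) (c := c) (i := i) (B := B)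
        (M := L.card) s (L.filter fun v => f v = i) Z (hLB.mono_left (filter_subset _ _))
        (by omega)
        (fun v hv => by
          obtain ⟨hv1, hv2⟩ := mem_filter.1 hv
          have := hL1.trans (hf v hv1)
          rw [hv2] at this
          exact_mod_cast this)
        (fun I hI hIp => by
          by_contra hcon
          push Not at hcon
          obtain ⟨J, hJI, cJ⟩ := exists_subset_card_eq (n := s + 1) hcon
          set Nb : V → Finset V := fun v => B.filter (Rc G c i v) with hNb
          have h1 : ∀ v ∈ J, (dg (Rc G c i) v B : ℝ) ≤ (Nb v \ (J.erase v).biUnion Nb).card +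
              s * L.card := by
            intro v hv
            have e1 : Nb v ⊆ (Nb v \ (J.erase v).biUnion Nb) ∪
                (J.erase v).biUnion fun u => Nb u ∩ Nb v := by
              intro x hx
              simp only [mem_union, mem_sdiff, mem_biUnion, mem_inter]
              by_cases h : ∃ a ∈ J.erase v, x ∈ Nb a
              · obtain ⟨a, ha, hxa⟩ := h
                exact .inr ⟨a, ha, hxa, hx⟩
              · exact .inl ⟨hx, h⟩
            have e2 : ((J.erase v).biUnion fun u => Nb u ∩ Nb v).card ≤ s * L.card := by
              refine (card_biUnion_le_card_mul _ _ L.card fun u hu => ?_).trans_eq ?_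
              · obtain ⟨hu1, hu2⟩ := mem_erase.1 hu
                have := hIp u (hJI hu2) v (hJI hv) hu1
                refine le_trans (card_le_card fun x hx => ?_) this.le
                simp only [hNb, mem_inter, mem_filter] at *
                tauto
              · rw [card_erase_of_mem hv, cJ]; rfl
            have e3 := (card_le_card e1).trans (card_union_le _ _)
            exact_mod_cast e3.trans (by omega)
          have h2 : ∑ v ∈ J, ((Nb v \ (J.erase v).biUnion Nb).card : ℝ) ≤ N := by
            have : ∑ v ∈ J, (Nb v \ (J.erase v).biUnion Nb).card ≤ N := by
              rw [← card_biUnion]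
              · refine (card_le_card (biUnion_subset.2 fun v _ => ?_)).trans hB
                exact sdiff_subset.trans (filter_subset _ _)
              · intro u hu v hv huv
                refine disjoint_left.2 fun x hx hx' => (mem_sdiff.1 hx').2 ?_
                exact mem_biUnion.2 ⟨u, mem_erase.2 ⟨huv, hu⟩,
                  (mem_sdiff.1 hx).1⟩
            exact_mod_cast this
          have h3 : ∑ v ∈ J, κ * N / r ≤ ∑ v ∈ J, (((Nb v \ (J.erase v).biUnion Nb).card : ℝ) +
              s * L.card) := sum_le_sum fun v hv => by
            obtain ⟨hv1, hv2⟩ := mem_filter.1 (hI (hJI hv))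
            refine le_trans ?_ (h1 v hv)
            have := hf v hv1
            rwa [hv2] at this
          rw [sum_add_distrib, sum_const, sum_const, cJ, nsmul_eq_mul,
            nsmul_eq_mul] at h3
          push_cast at h3
          have h4 : ((s : ℝ) + 1) * (s * L.card) ≤ N := by
            have : (s + 1) * (s * L.card) ≤ (s + 1) * (s + 1) * L.card := by
              rw [mul_assoc]; gcongr; omega
            exact_mod_cast this.trans hLs.le
          have h5 : 2 * (N : ℝ) ≤ (s + 1) * (κ * N / r) := by
            rw [← mul_div_assoc, le_div_iff₀ hrr]
            nlinarith
          have h6 : ((s : ℝ) + 1) * (s * L.card) < N := by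
            have : (s + 1) * (s * L.card) < N := by
              refine lt_of_le_of_lt ?_ hLs
              rw [mul_assoc]; gcongr; omega
            exact_mod_cast this
          linarith)
      have hZd : Disjoint Z' Z := disjoint_left.2 fun x hx hx' =>
        (mem_sdiff.1 (hZ' hx)).2 hx'
      have hZ'B : Z' ⊆ B := hZ'.trans sdiff_subset
      refine ⟨Z' ∪ Z, union_subset hZ'B hZ, ?_, ?_⟩
      · rw [card_union_of_disjoint hZd]; omega
      · have hu := hCP'.union hCP (by
          rw [disjoint_coe, disjoint_union_left, disjoint_union_right,
            disjoint_union_right]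
          exact ⟨⟨hdis, hLB.mono (filter_subset _ _) hZ⟩,
            (hLB.mono (filter_subset _ _) hZ'B).symm, hZd⟩)
        refine (cast ?_ hu : CP G c _ (s + C.card * s)).mono ?_
        · congr 1
          rw [hsplit]
          push_cast
          ext x
          simp only [Set.mem_union]
          tauto
        · rw [card_insert_of_notMem hi]; linarith
  obtain ⟨Z, hZ, cZ, hCP⟩ := key univ
  refine ⟨Z, hZ, ?_, ?_⟩
  · simpa using cZ
  · simpa using hCP

end Cover

section Segments
open Finset
open scoped Classical

/-- A label-preserving successor map, cyclic on every label class. -/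
lemma exists_cyclic_next {J ι : Type*} [Fintype J] (lab : J → ι) :
    ∃ nx : J → J, (∀ a, lab (nx a) = lab a) ∧ ∀ t, ∃ l : List J, l.Nodup ∧
      (∀ a, a ∈ l ↔ lab a = t) ∧ l.IsChain (fun a b => nx a = b) ∧
      ∀ h : l ≠ [], nx (l.getLast h) = l.head h := by
  set L : ι → List J := fun t => (univ.filter fun a => lab a = t).toList with hL
  have hm : ∀ t a, a ∈ L t ↔ lab a = t := fun t a => by simp [hL]
  have nd : ∀ t, (L t).Nodup := fun t => nodup_toList _
  have hnx : ∀ a t (h : lab a = t), (L (lab a)).next a ((hm _ _).2 rfl) =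
      (L t).next a ((hm _ _).2 h) := by rintro a t rfl; rfl
  refine ⟨fun a => (L (lab a)).next a ((hm _ _).2 rfl), fun a => ?_, fun t => ⟨L t, nd t, hm t, ?_,
    fun h => ?_⟩⟩
  · exact (hm _ _).1 (List.next_mem _ _ _)
  · rw [List.isChain_iff_getElem]
    intro i hi
    have h1 : lab (L t)[i] = t := (hm _ _).1 (List.getElem_mem _)
    beta_reduce
    rw [hnx _ t h1, List.next_getElem _ (nd t)]
    congr 1
    exact Nat.mod_eq_of_lt hi
  · have h1 : lab ((L t).getLast h) = t := (hm _ _).1 (List.getLast_mem _)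
    beta_reduce
    rw [hnx _ t h1]
    have := List.next_getElem _ (nd t) ((L t).length - 1)
      (by have := List.length_pos_iff.2 h; omega)
    rw [List.head_eq_getElem]
    convert this using 1
    · congr 1
      rw [List.getLast_eq_getElem]
    · congr 1
      rw [Nat.sub_add_cancel (List.length_pos_iff.2 h), Nat.mod_self]

variable {V : Type*}

/-- Concatenating segments along a cyclic list gives a cyclic list. -/
lemma isCyc_flatMap {J : Type*} {R : V → V → Prop} {nx : J → J} {l : List J} (hl : l.Nodup)
    (hch : l.IsChain (fun a b => nx a = b)) (hcl : ∀ h : l ≠ [], nx (l.getLast h) = l.head h)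
    {S : J → List V} {x z : J → V} (hS : ∀ a ∈ l, Pth R (x a) (z a) (S a))
    (hnd : ∀ a ∈ l, (S a).Nodup) (hd : ∀ a ∈ l, ∀ b ∈ l, a ≠ b → List.Disjoint (S a) (S b))
    (hR : ∀ a ∈ l, R (z a) (x (nx a))) : IsCyc R (l.flatMap S) := by
  rcases eq_or_ne l [] with rfl | hne
  · exact ⟨by simp, by simp, by simp⟩
  have key : ∀ l : List J, ∀ h : l ≠ [], l.IsChain (fun a b => nx a = b) →
      (∀ a ∈ l, Pth R (x a) (z a) (S a)) → (∀ a ∈ l, R (z a) (x (nx a))) →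
      Pth R (x (l.head h)) (z (l.getLast h)) (l.flatMap S) := by
    intro l
    induction l with
    | nil => simp
    | cons a l ih =>
      intro _ hch hS hR
      cases l with
      | nil => simpa using hS a (by simp)
      | cons b l =>
        rw [List.isChain_cons_cons] at hch
        have h1 := ih (by simp) hch.2 (fun c hc => hS c (List.mem_cons_of_mem _ hc))
          (fun c hc => hR c (List.mem_cons_of_mem _ hc))
        have h2 := hR a (by simp)
        rw [hch.1] at h2
        have := (hS a (by simp)).append h1 (by simpa using h2)
        simpa using this
  refine (key l hne hch hS hR).isCyc ?_ ?_
  · rw [List.nodup_flatMap]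
    refine ⟨hnd, ?_⟩
    exact hl.imp_of_mem fun ha hb hab => hd _ ha _ hb hab
  · rw [← hcl hne]
    exact hR _ (List.getLast_mem hne)

/-- Greedy choice of pairwise disjoint short lists. -/
lemma exists_disjoint_lists {J : Type*} [Fintype J] (Q : J → List V → Prop) (ℓ M : ℕ)
    (F0 : Finset V) (h : ∀ a, ∀ F : Finset V, F.card ≤ M → ∃ l, Q a l ∧ l.length ≤ ℓ ∧ ∀ x ∈ l, x ∉ F)
    (hM : F0.card + Fintype.card J * ℓ ≤ M) :
    ∃ f : J → List V, (∀ a, Q a (f a) ∧ (f a).length ≤ ℓ ∧ ∀ x ∈ f a, x ∉ F0) ∧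
      ∀ a b, a ≠ b → List.Disjoint (f a) (f b) := by
  have key : ∀ s : Finset J, ∃ f : J → List V,
      (∀ a ∈ s, Q a (f a) ∧ (f a).length ≤ ℓ ∧ ∀ x ∈ f a, x ∉ F0) ∧
      ∀ a ∈ s, ∀ b ∈ s, a ≠ b → List.Disjoint (f a) (f b) := by
    intro s
    induction s using Finset.induction_on with
    | empty => exact ⟨fun _ => [], by simp, by simp⟩
    | insert j s hj ih =>
      obtain ⟨f, h1, h2⟩ := ih
      have hcs : s.card ≤ Fintype.card J := card_le_univ s
      obtain ⟨l, l1, l2, l3⟩ := h j (F0 ∪ s.biUnion fun a => (f a).toFinset) (by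
        refine (card_union_le _ _).trans (le_trans ?_ hM)
        refine Nat.add_le_add_left ((card_biUnion_le_card_mul _ _ ℓ fun a ha => ?_).trans
          (Nat.mul_le_mul_right _ hcs)) _
        exact (List.toFinset_card_le _).trans (h1 a ha).2.1)
      simp only [mem_union, mem_biUnion, List.mem_toFinset, not_or, not_exists,
        not_and] at l3
      have hne : ∀ a ∈ s, a ≠ j := fun a ha e => hj (e ▸ ha)
      refine ⟨Function.update f j l, fun a ha => ?_, fun a ha b hb hab => ?_⟩
      · rcases mem_insert.1 ha with e | ha1
        · subst e
          rw [Function.update_self]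
          exact ⟨l1, l2, fun x hx => (l3 x hx).1⟩
        · rw [Function.update_of_ne (hne a ha1)]
          exact h1 a ha1
      · rcases mem_insert.1 ha with e | ha1
        · rcases mem_insert.1 hb with e' | hb1
          · exact absurd (e.trans e'.symm) hab
          · rw [e, Function.update_self, Function.update_of_ne (hne b hb1)]
            exact fun x hx hx' => (l3 x hx).2 b hb1 hx'
        · rcases mem_insert.1 hb with e' | hb1
          · rw [e', Function.update_self, Function.update_of_ne (hne a ha1)]
            exact fun x hx' hx => (l3 x hx).2 a ha1 hx'
          · rw [Function.update_of_ne (hne a ha1), Function.update_of_ne (hne b hb1)]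
            exact h2 a ha1 b hb1 hab
  obtain ⟨f, h1, h2⟩ := key univ
  exact ⟨f, fun a => h1 a (mem_univ _), fun a b => h2 a (mem_univ _) b
    (mem_univ _)⟩

/-- A bipartite path between different sides is balanced. -/
lemma Pth.card_filter_eq {R : V → V → Prop} {A B : Finset V} (hAB : Disjoint A B)
    (hR : ∀ ⦃u v⦄, R u v → (u ∈ A ∧ v ∈ B) ∨ (u ∈ B ∧ v ∈ A)) {a b : V} {l : List V}
    (h : Pth R a b l) (ha : a ∈ A) (hb : b ∈ B) (nd : l.Nodup) :
    (l.toFinset ∩ A).card = (l.toFinset ∩ B).card := by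
  have key : ∀ l : List V, ∀ a, (a :: l).Nodup → (a :: l).IsChain R →
      (a :: l).getLast (by simp) ∈ B →
      (a ∈ A → ((a :: l).toFinset ∩ A).card = ((a :: l).toFinset ∩ B).card) ∧
      (a ∈ B → ((a :: l).toFinset ∩ A).card + 1 = ((a :: l).toFinset ∩ B).card) := by
    intro l
    induction l with
    | nil =>
      intro a _ _ h
      have h' : a ∈ B := by simpa using h
      have h'' : a ∉ A := fun h => disjoint_left.1 hAB h h'
      refine ⟨fun h => absurd h h'', fun _ => ?_⟩
      simp [h', h'']
    | cons c l ih =>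
      intro a nd hch hl
      rw [List.isChain_cons_cons] at hch
      have nd' := List.nodup_cons.1 nd
      have hac : a ∉ (c :: l).toFinset := by simpa using nd'.1
      obtain ⟨i1, i2⟩ := ih c nd'.2 hch.2 (by simpa using hl)
      have hcase := hR hch.1
      rw [List.toFinset_cons]
      refine ⟨fun haA => ?_, fun haB => ?_⟩
      · have haB : a ∉ B := disjoint_left.1 hAB haA
        have hcB : c ∈ B := by tauto
        rw [insert_inter_of_mem haA, insert_inter_of_notMem haB,
          card_insert_of_notMem (fun h => hac (mem_inter.1 h).1)]
        exact i2 hcB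
      · have haA : a ∉ A := disjoint_right.1 hAB haB
        have hcA : c ∈ A := by tauto
        rw [insert_inter_of_mem haB, insert_inter_of_notMem haA,
          card_insert_of_notMem (fun h => hac (mem_inter.1 h).1)]
        rw [i1 hcA]
  obtain ⟨h1, h2, h3⟩ := h
  cases l with
  | nil => simp at h2
  | cons c l =>
    simp only [List.head?_cons, Option.some.injEq] at h2
    subst h2
    refine (key l c nd h1 ?_).1 ha
    rw [List.getLast?_eq_some_getLast (by simp)] at h3
    simp only [Option.some.injEq] at h3
    rwa [h3]

variable {r : ℕ} {G : SimpleGraph V} {c : Sym2 V → Fin r}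

/-- Disjoint labelled paths joined up by disjoint links form one cycle for every label. -/
lemma cp_of_segments {J ι : Type*} [Fintype J] [Fintype ι] {R : ι → V → V → Prop} {col : ι → Fin r}
    (hcol : ∀ t u v, R t u v → Rc G c (col t) u v) {lab : J → ι} {nx : J → J}
    (hnx : ∀ t, ∃ l : List J, l.Nodup ∧ (∀ a, a ∈ l ↔ lab a = t) ∧
      l.IsChain (fun a b => nx a = b) ∧ ∀ h : l ≠ [], nx (l.getLast h) = l.head h)
    {S : J → List V} {x z : J → V} (hS : ∀ a, Pth (R (lab a)) (x a) (z a) (S a))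
    (hnd : ∀ a, (S a).Nodup) (hd : ∀ a b, a ≠ b → List.Disjoint (S a) (S b))
    (hR : ∀ a, R (lab a) (z a) (x (nx a))) :
    CP G c {v | ∃ a, v ∈ S a} (Fintype.card ι) := by
  choose l h1 h2 h3 h4 using hnx
  have := CP.biUnion (G := G) (c := c) (univ : Finset ι) (fun t => {v | v ∈ (l t).flatMap S})
    (fun _ => 1) (fun t _ => by
      refine IsCyc.cp (i := col t) (isCyc_flatMap (h1 t) (h3 t) (h4 t) (x := x) (z := z)
        (fun a ha => ?_) (fun a _ => hnd a) (fun a _ b _ => hd a b) fun a ha => ?_)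
      · have e := (h2 t a).1 ha
        exact ⟨(hS a).1.imp fun u v huv => hcol _ _ _ (e ▸ huv), (hS a).2⟩
      · have e := (h2 t a).1 ha
        exact hcol _ _ _ (e ▸ hR a))
    (fun t _ t' _ hne => Set.disjoint_left.2 fun v hv hv' => by
      obtain ⟨a, ha, hva⟩ := List.mem_flatMap.1 hv
      obtain ⟨b, hb, hvb⟩ := List.mem_flatMap.1 hv'
      have e1 := (h2 t a).1 ha
      have e2 := (h2 t' b).1 hb
      refine hd a b (fun e => hne ?_) hva hvb
      rw [← e1, ← e2, e])
  simp only [sum_const, card_univ, smul_eq_mul, mul_one] at this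
  convert this using 1
  ext v
  simp only [Set.mem_ofPred_eq, Set.mem_iUnion, mem_univ, List.mem_flatMap, exists_prop,
    true_and, h2]
  exact ⟨fun ⟨a, ha⟩ => ⟨_, a, rfl, ha⟩, fun ⟨_, a, _, ha⟩ => ⟨a, ha⟩⟩

end Segments

section Links
open Finset
open scoped Classical
variable {V : Type*} {r : ℕ} {G : SimpleGraph V} {c : Sym2 V → Fin r}

/-- A set `W` of link vertices such that any disjoint system of paths `x a → y a` off `W` can be
closed up, using exactly `W`, to one cycle for every label. -/
theorem exists_links {J ι : Type*} [Fintype J] [Fintype ι] {R : ι → V → V → Prop} {col : ι → Fin r}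
    (hcol : ∀ t u v, R t u v → Rc G c (col t) u v) (hR : ∀ t, ∀ ⦃u v⦄, R t u v → R t v u)
    {A B : Finset V} (hAB : Disjoint A B)
    (hbip : ∀ t, ∀ ⦃u v⦄, R t u v → (u ∈ A ∧ v ∈ B) ∨ (u ∈ B ∧ v ∈ A))
    (lab : J → ι) {x y : J → V} (hx : ∀ a, x a ∈ A) (hy : ∀ a, y a ∈ B) {ℓ M : ℕ}
    (hlink : ∀ a b, lab a = lab b → ∀ F : Finset V, F.card ≤ M → ∃ s z l, R (lab a) (y a) s ∧
      R (lab a) (x b) z ∧ Pth (R (lab a)) s z l ∧ l.Nodup ∧ l.length ≤ ℓ ∧ ∀ v ∈ l, v ∉ F)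
    (hM : Fintype.card J * (ℓ + 2) ≤ M) :
    ∃ W : Finset V, W ⊆ A ∪ B ∧ W.card ≤ Fintype.card J * ℓ ∧ (W ∩ A).card = (W ∩ B).card ∧
      (∀ a, x a ∉ W ∧ y a ∉ W) ∧
      ∀ H : J → List V, (∀ a, (H a).Nodup) → (∀ a, Pth (R (lab a)) (x a) (y a) (H a)) →
        (∀ a b, a ≠ b → List.Disjoint (H a) (H b)) → (∀ a, ∀ v ∈ H a, v ∉ W) →
        CP G c ({v | ∃ a, v ∈ H a} ∪ ↑W) (Fintype.card ι) := by
  obtain ⟨nx, hnl, hnx⟩ := exists_cyclic_next lab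
  set F0 : Finset V := univ.image x ∪ univ.image y with hF0
  have hF0c : F0.card ≤ 2 * Fintype.card J := by
    refine (card_union_le _ _).trans ?_
    have h1 := card_image_le (s := (univ : Finset J)) (f := x)
    have h2 := card_image_le (s := (univ : Finset J)) (f := y)
    rw [card_univ] at h1 h2
    omega
  obtain ⟨lk, h1, h2⟩ := exists_disjoint_lists (V := V) (J := J)
    (fun a l => ∃ s z, R (lab a) (y a) s ∧ R (lab a) (x (nx a)) z ∧ Pth (R (lab a)) s z l ∧ l.Nodup)
    ℓ M F0 (fun a F hF => by
      obtain ⟨s, z, l, e1, e2, e3, e4, e5, e6⟩ := hlink a (nx a) (hnl a).symm F hF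
      exact ⟨l, ⟨s, z, e1, e2, e3, e4⟩, e5, e6⟩) (by nlinarith)
  choose hq hlen hav using h1
  choose s z hs hz hp hnd using hq
  have hsA : ∀ a, s a ∈ A := fun a => by
    rcases hbip _ (hs a) with h | h
    · exact absurd (hy a) (disjoint_left.1 hAB h.1)
    · exact h.2
  have hzB : ∀ a, z a ∈ B := fun a => by
    rcases hbip _ (hz a) with h | h
    · exact h.2
    · exact absurd h.1 (disjoint_left.1 hAB (hx _))
  have hmem : ∀ a, ∀ v ∈ lk a, v ∈ A ∪ B := by
    intro a v hv
    have hch := (hp a).1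
    rw [List.isChain_iff_getElem] at hch
    obtain ⟨i, hi, rfl⟩ := List.getElem_of_mem hv
    by_cases h0 : i + 1 < (lk a).length
    · rcases hbip _ (hch i h0) with h | h <;> simp [h.1]
    · have := (hp a).getElem_last
      have hi' : i = (lk a).length - 1 := by omega
      subst hi'
      rw [this]
      exact mem_union_right _ (hzB a)
  set W : Finset V := univ.biUnion fun a => (lk a).toFinset with hW
  have hmW : ∀ v, v ∈ W ↔ ∃ a, v ∈ lk a := fun v => by simp [hW]
  have hdj : ∀ a b, a ≠ b → Disjoint (lk a).toFinset (lk b).toFinset := fun a b hab =>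
    disjoint_left.2 fun v hv hv' => h2 a b hab (List.mem_toFinset.1 hv) (List.mem_toFinset.1 hv')
  have hcW : ∀ S : Finset V, (W ∩ S).card = ∑ a, ((lk a).toFinset ∩ S).card := fun S => by
    rw [hW, biUnion_inter]
    exact card_biUnion fun a _ b _ hab =>
      (hdj a b hab).mono inter_subset_left inter_subset_left
  refine ⟨W, fun v hv => ?_, ?_, ?_, fun a => ⟨fun h => ?_, fun h => ?_⟩, fun H k1 k2 k3 k4 => ?_⟩
  · obtain ⟨a, ha⟩ := (hmW v).1 hv
    exact hmem a v ha
  · refine (card_biUnion_le_card_mul _ _ ℓ fun a _ => ?_).trans_eq (by simp)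
    exact (List.toFinset_card_le _).trans (hlen a)
  · rw [hcW, hcW]
    exact sum_congr rfl fun a _ =>
      (hp a).card_filter_eq hAB (hbip (lab a)) (hsA a) (hzB a) (hnd a)
  · obtain ⟨b, hb⟩ := (hmW _).1 h
    exact hav b _ hb (by simp [hF0])
  · obtain ⟨b, hb⟩ := (hmW _).1 h
    exact hav b _ hb (by simp [hF0])
  · have := cp_of_segments (G := G) (c := c) hcol hnx (S := fun a => H a ++ lk a) (x := x) (z := z)
      (fun a => (k2 a).append (hp a) (hs a))
      (fun a => List.nodup_append'.2 ⟨k1 a, hnd a, fun v hv hv' => k4 a v hv ((hmW v).2 ⟨a, hv'⟩)⟩)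
      (fun a b hab v hv hv' => by
        rcases List.mem_append.1 hv with h | h <;> rcases List.mem_append.1 hv' with h' | h'
        · exact k3 a b hab h h'
        · exact k4 a v h ((hmW v).2 ⟨b, h'⟩)
        · exact k4 b v h' ((hmW v).2 ⟨a, h⟩)
        · exact h2 a b hab h h')
      (fun a => hR _ (hz a))
    convert this using 1
    ext v
    simp only [Set.mem_union, Set.mem_ofPred_eq, mem_coe, hmW, List.mem_append]
    exact ⟨fun h => h.elim (fun ⟨a, h⟩ => ⟨a, Or.inl h⟩) fun ⟨a, h⟩ => ⟨a, Or.inr h⟩,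
      fun ⟨a, h⟩ => h.elim (fun h => Or.inl ⟨a, h⟩) fun h => Or.inr ⟨a, h⟩⟩

end Links

section AssembleAux
open Finset
open scoped Classical

lemma flex_balance {J : Type*} [Fintype J] {xl yl : J × Bool × Fin 3 → J} {p0 : J}
    (hdiv : ∀ t p b, (∑ k, ((if xl (p, b, k) = t then 1 else 0) -
      (if yl (p, b, k) = t then 1 else 0)) : ℤ) =
      (if b then 1 else -1) * ((if p = t then 1 else 0) - if p0 = t then 1 else 0))
    {u : J → ℤ} (hu : ∑ p, u p = 0) {g : J × Bool × Fin 3 → ℕ} {h : ℕ}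
    (hg : ∀ p b k, g (p, b, k) = h + (if b then (u p).toNat else (-u p).toNat)) (t : J) :
    ((∑ f, if xl f = t then g f else 0 : ℕ) : ℤ) = (∑ f, if yl f = t then g f else 0 : ℕ) + u t := by
  have e : ((∑ f, if xl f = t then g f else 0 : ℕ) : ℤ) - (∑ f, if yl f = t then g f else 0 : ℕ) =
      ∑ p, u p * ((if p = t then 1 else 0) - if p0 = t then 1 else 0) := by
    push_cast
    rw [← sum_sub_distrib, Fintype.sum_prod_type]
    refine sum_congr rfl fun p _ => ?_
    rw [Fintype.sum_prod_type, Fintype.sum_bool]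
    have h1 : ∀ b, (∑ k, ((if xl (p, b, k) = t then (g (p, b, k) : ℤ) else 0) -
        if yl (p, b, k) = t then (g (p, b, k) : ℤ) else 0)) =
        (h + (if b then ((u p).toNat : ℤ) else ((-u p).toNat : ℤ))) *
        ((if b then 1 else -1) * ((if p = t then 1 else 0) - if p0 = t then 1 else 0)) := by
      intro b
      rw [← hdiv t p b, mul_sum]
      refine sum_congr rfl fun k _ => ?_
      rw [hg, mul_sub]
      push_cast
      congr 1 <;> split_ifs <;> simp
    rw [h1, h1]
    have h2 := Int.toNat_sub_toNat_neg (u p)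
    simp only [if_true, Bool.false_eq_true, if_false]
    linear_combination ((if p = t then 1 else 0) - if p0 = t then 1 else 0) * h2
  have e2 : ∑ p, u p * ((if p = t then 1 else 0) - if p0 = t then 1 else 0) = u t := by
    rw [sum_congr rfl fun p _ => mul_sub _ _ _, sum_sub_distrib, ← sum_mul, hu]
    simp
  linarith

variable {V : Type*}

lemma card_inter_biUnion_loc {J F : Type*} [Fintype F] {X : J → Finset V}
    (hX : ∀ p p', p ≠ p' → Disjoint (X p) (X p')) {Y : F → Finset V} {xl : F → J}
    (hY : ∀ f, Y f ⊆ X (xl f)) (hd : ∀ f f', f ≠ f' → Disjoint (Y f) (Y f')) (t : J) :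
    (X t ∩ univ.biUnion Y).card = ∑ f, if xl f = t then (Y f).card else 0 := by
  rw [inter_biUnion, card_biUnion fun f _ f' _ h =>
    (hd f f' h).mono inter_subset_right inter_subset_right]
  refine sum_congr rfl fun f _ => ?_
  split_ifs with h
  · rw [inter_eq_right.2 (h ▸ hY f)]
  · rw [card_eq_zero, ← disjoint_iff_inter_eq_empty]
    exact (hX t (xl f) fun e => h e.symm).mono_right (hY f)

lemma card_leftover {J1 J2 : Type*} [Fintype J1] [Fintype J2] {A W : Finset V} {X : J1 → Finset V}
    {E E' : J2 → Finset V} (hXA : ∀ p, X p ⊆ A) (hEA : ∀ e, E e ⊆ A)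
    (hEE : ∀ e e', e ≠ e' → Disjoint (E e) (E e')) (hEX : ∀ e p, Disjoint (E e) (X p))
    (hE' : ∀ e, E' e ⊆ E e \ W) {L : Finset V}
    (hL : L = A \ (univ.biUnion X ∪ univ.biUnion E' ∪ W)) :
    L.card + (univ.biUnion X).card + ∑ e, (E' e).card + (W ∩ A).card =
      A.card + (W ∩ univ.biUnion X).card ∧
    L.card + ∑ e, (E' e).card ≤
      (A \ (univ.biUnion X ∪ univ.biUnion E)).card + ∑ e, (E e).card := by
  set U := univ.biUnion X with hU
  set D := univ.biUnion E' with hD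
  have hDc : D.card = ∑ e, (E' e).card := card_biUnion fun e _ e' _ h =>
    (hEE e e' h).mono ((hE' e).trans sdiff_subset) ((hE' e').trans sdiff_subset)
  have hEc : (univ.biUnion E).card = ∑ e, (E e).card :=
    card_biUnion fun e _ e' _ h => hEE e e' h
  have hUA : U ⊆ A := biUnion_subset.2 fun p _ => hXA p
  have hDE : D ⊆ univ.biUnion E := biUnion_subset.2 fun e _ =>
    ((hE' e).trans sdiff_subset).trans (subset_biUnion_of_mem E (mem_univ e))
  have hEA' : univ.biUnion E ⊆ A := biUnion_subset.2 fun e _ => hEA e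
  have hDA : D ⊆ A := hDE.trans hEA'
  have hDU : Disjoint D U := by
    rw [hD, hU, disjoint_biUnion_left]
    intro e _
    rw [disjoint_biUnion_right]
    exact fun p _ => (hEX e p).mono_left ((hE' e).trans sdiff_subset)
  have hDW : Disjoint D W := by
    rw [hD, disjoint_biUnion_left]
    exact fun e _ => disjoint_of_subset_left (hE' e) sdiff_disjoint
  rw [← hDc, ← hEc]
  constructor
  · have e1 : A = (L ∪ U ∪ D) ∪ (W ∩ A) := by
      ext v
      have := @hUA v
      have := @hDA v
      simp only [hL, mem_union, mem_sdiff, mem_inter]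
      tauto
    have c1 := card_union_add_card_inter (L ∪ U ∪ D) (W ∩ A)
    rw [← e1] at c1
    have e2 : (L ∪ U ∪ D) ∩ (W ∩ A) = W ∩ U := by
      ext v
      have := @hUA v
      have : v ∈ D → v ∉ W := fun h => disjoint_left.1 hDW h
      simp only [hL, mem_union, mem_sdiff, mem_inter]
      tauto
    rw [e2] at c1
    have c2 : (L ∪ U ∪ D).card = L.card + U.card + D.card := by
      rw [card_union_of_disjoint, card_union_of_disjoint]
      · rw [hL, disjoint_left]
        intro v hv hv'
        simp only [mem_union, mem_sdiff] at hv
        tauto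
      · rw [hL, disjoint_left]
        intro v hv hv'
        have := disjoint_left.1 hDU hv'
        simp only [mem_union, mem_sdiff] at hv
        tauto
    omega
  · have h1 : L ⊆ A \ (U ∪ univ.biUnion E) ∪ (univ.biUnion E \ D) := by
      intro v hv
      simp only [hL, mem_union, mem_sdiff] at hv ⊢
      tauto
    have h2 := (card_le_card h1).trans (card_union_le _ _)
    have h3 := card_sdiff_add_card_eq_card hDE
    omega

end AssembleAux

section AssembleSide
open Finset
open scoped Classical
variable {V : Type*}

/-- One side of the final decomposition: what is left of the base pairs, the extra pairs and the
flexible pairs, together with links, leftover and cover vertices. -/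
lemma side_cover {J1 J2 J3 : Type*} [Fintype J1] [Fintype J2] [Fintype J3] {A W Z L : Finset V}
    {XB XR : J1 → Finset V} {XE X2 : J2 → Finset V} {XF X3 : J3 → Finset V} {xl : J3 → J1}
    (hXBA : ∀ p, XB p ⊆ A) (hXEA : ∀ e, XE e ⊆ A)
    (dXB : ∀ p p', p ≠ p' → Disjoint (XB p) (XB p'))
    (dXE : ∀ e e', e ≠ e' → Disjoint (XE e) (XE e')) (dXEB : ∀ e p, Disjoint (XE e) (XB p))
    (XFB : ∀ f, XF f ⊆ XB (xl f)) (dXF : ∀ f f', f ≠ f' → Disjoint (XF f) (XF f'))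
    (h2 : ∀ e, X2 e ⊆ XE e \ W) (h3 : ∀ f, X3 f ⊆ XF f \ W)
    (hZ : Z ⊆ (univ.biUnion fun p => XB p \ univ.biUnion XF) \ W)
    (hXR : ∀ p, XR p = XB p \ (univ.biUnion X3 ∪ (W ∪ Z)))
    (hL : L = A \ (univ.biUnion XB ∪ univ.biUnion X2 ∪ W))
    {XS : J1 ⊕ J2 ⊕ J3 → Finset V} (hXS : XS = Sum.elim XR (Sum.elim X2 X3)) :
    (∀ a b, a ≠ b → Disjoint (XS a) (XS b)) ∧ (∀ a, ∀ v ∈ XS a, v ∈ A ∧ v ∉ W) ∧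
    (∀ v ∈ A, (∃ a, v ∈ XS a) ∨ v ∈ W ∨ v ∈ L ∨ v ∈ Z) ∧
    (∀ v ∈ L, v ∈ A ∧ v ∉ W ∧ v ∉ Z ∧ ∀ a, v ∉ XS a) ∧
    (∀ v ∈ Z, v ∈ A ∧ v ∉ W ∧ ∀ a, v ∉ XS a) := by
  subst hXS
  have m2 : ∀ e v, v ∈ X2 e → v ∈ XE e ∧ v ∉ W := fun e v h => mem_sdiff.1 (h2 e h)
  have m3 : ∀ f v, v ∈ X3 f → v ∈ XF f ∧ v ∉ W ∧ v ∈ XB (xl f) := fun f v h =>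
    ⟨(mem_sdiff.1 (h3 f h)).1, (mem_sdiff.1 (h3 f h)).2,
      XFB f (mem_sdiff.1 (h3 f h)).1⟩
  have mR : ∀ p v, v ∈ XR p ↔ v ∈ XB p ∧ (∀ f, v ∉ X3 f) ∧ v ∉ W ∧ v ∉ Z := fun p v => by
    rw [hXR]; simp
  have mZ : ∀ v ∈ Z, v ∉ W ∧ (∀ f, v ∉ XF f) ∧ ∃ p, v ∈ XB p := fun v h => by
    have := hZ h
    simp only [mem_sdiff, mem_biUnion, mem_univ, true_and, not_exists] at this
    obtain ⟨⟨p, hp, hf⟩, hw⟩ := this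
    exact ⟨hw, hf, p, hp⟩
  have mL : ∀ v, v ∈ L ↔ v ∈ A ∧ (∀ p, v ∉ XB p) ∧ (∀ e, v ∉ X2 e) ∧ v ∉ W := fun v => by
    rw [hL]; simp
  have dEB : ∀ e p v, v ∈ XE e → v ∉ XB p := fun e p v h => disjoint_left.1 (dXEB e p) h
  refine ⟨?_, ?_, ?_, ?_, ?_⟩
  · rintro (p | e | f) (p' | e' | f') hne <;> rw [disjoint_left] <;> intro v hv hv' <;>
      simp only [Sum.elim_inl, Sum.elim_inr] at hv hv'
    · exact disjoint_left.1 (dXB p p' fun h => hne (by rw [h])) ((mR _ _).1 hv).1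
        ((mR _ _).1 hv').1
    · exact dEB _ _ _ (m2 _ _ hv').1 ((mR _ _).1 hv).1
    · exact ((mR _ _).1 hv).2.1 _ hv'
    · exact dEB _ _ _ (m2 _ _ hv).1 ((mR _ _).1 hv').1
    · exact disjoint_left.1 (dXE e e' fun h => hne (by rw [h])) (m2 _ _ hv).1 (m2 _ _ hv').1
    · exact dEB _ _ _ (m2 _ _ hv).1 (m3 _ _ hv').2.2
    · exact ((mR _ _).1 hv').2.1 _ hv
    · exact dEB _ _ _ (m2 _ _ hv').1 (m3 _ _ hv).2.2
    · exact disjoint_left.1 (dXF f f' fun h => hne (by rw [h])) (m3 _ _ hv).1 (m3 _ _ hv').1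
  · rintro (p | e | f) v hv <;> simp only [Sum.elim_inl, Sum.elim_inr] at hv
    · exact ⟨hXBA p ((mR _ _).1 hv).1, ((mR _ _).1 hv).2.2.1⟩
    · exact ⟨hXEA e (m2 _ _ hv).1, (m2 _ _ hv).2⟩
    · exact ⟨hXBA _ (m3 _ _ hv).2.2, (m3 _ _ hv).2.1⟩
  · intro v hv
    by_contra hcon
    push Not at hcon
    obtain ⟨k1, k2, k3, k4⟩ := hcon
    refine k3 ((mL v).2 ⟨hv, fun p hp => ?_, fun e => k1 (Sum.inr (Sum.inl e)), k2⟩)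
    exact k1 (Sum.inl p) ((mR _ _).2 ⟨hp, fun f => k1 (Sum.inr (Sum.inr f)), k2, k4⟩)
  · intro v hv
    obtain ⟨k1, k2, k3, k4⟩ := (mL v).1 hv
    refine ⟨k1, k4, fun h => ?_, ?_⟩
    · obtain ⟨_, _, p, hp⟩ := mZ v h
      exact k2 p hp
    · rintro (p | e | f) h <;> simp only [Sum.elim_inl, Sum.elim_inr] at h
      · exact k2 _ ((mR _ _).1 h).1
      · exact k3 _ h
      · exact k2 _ (m3 _ _ h).2.2
  · intro v hv
    obtain ⟨k1, k2, p, hp⟩ := mZ v hv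
    refine ⟨hXBA p hp, k1, ?_⟩
    rintro (p' | e | f) h <;> simp only [Sum.elim_inl, Sum.elim_inr] at h
    · exact ((mR _ _).1 h).2.2.2 hv
    · exact dEB _ _ _ (m2 _ _ h).1 hp
    · exact k2 _ (m3 _ _ h).1

lemma card_base_rest {J1 J3 : Type*} [Fintype J1] [Fintype J3] {W Z : Finset V}
    {XB : J1 → Finset V} {XF X3 : J3 → Finset V} {xl : J3 → J1}
    (dXB : ∀ p p', p ≠ p' → Disjoint (XB p) (XB p'))
    (XFB : ∀ f, XF f ⊆ XB (xl f)) (dXF : ∀ f f', f ≠ f' → Disjoint (XF f) (XF f'))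
    (h3 : ∀ f, X3 f ⊆ XF f \ W)
    (hZ : Z ⊆ (univ.biUnion fun p => XB p \ univ.biUnion XF) \ W) (p : J1) :
    (XB p \ (univ.biUnion X3 ∪ (W ∪ Z))).card + (XB p ∩ (W ∪ Z)).card +
      ∑ f, (if xl f = p then (X3 f).card else 0) = (XB p).card := by
  have h3' : ∀ f, X3 f ⊆ XF f := fun f => (h3 f).trans sdiff_subset
  rw [← card_inter_biUnion_loc dXB (fun f => (h3' f).trans (XFB f))
    (fun f f' h => (dXF f f' h).mono (h3' f) (h3' f')) p]
  have e1 := card_sdiff_add_card_inter (XB p) (univ.biUnion X3 ∪ (W ∪ Z))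
  rw [inter_union_distrib_left, card_union_of_disjoint] at e1
  · omega
  · refine disjoint_left.2 fun v hv hv' => ?_
    obtain ⟨f, _, hf⟩ := mem_biUnion.1 (mem_inter.1 hv).2
    rcases mem_union.1 (mem_inter.1 hv').2 with h | h
    · exact (mem_sdiff.1 (h3 f hf)).2 h
    · have := hZ h
      simp only [mem_sdiff, mem_biUnion, mem_univ, true_and,
        not_exists] at this
      obtain ⟨⟨p, hp, hff⟩, hw⟩ := this
      exact hff f (h3' f hf)

lemma sum_card_base_inter {J1 J3 : Type*} [Fintype J1] [Fintype J3] {W Z : Finset V}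
    {XB : J1 → Finset V} {XF : J3 → Finset V}
    (dXB : ∀ p p', p ≠ p' → Disjoint (XB p) (XB p'))
    (hZ : Z ⊆ (univ.biUnion fun p => XB p \ univ.biUnion XF) \ W) :
    ∑ p, (XB p ∩ (W ∪ Z)).card = (W ∩ univ.biUnion XB).card + Z.card := by
  rw [← card_biUnion fun p _ p' _ h => (dXB p p' h).mono inter_subset_left
    inter_subset_left, ← biUnion_inter, ← card_union_of_disjoint]
  · congr 1
    ext v
    have : v ∈ Z → ∃ p, v ∈ XB p := fun h => by
      have := hZ h
      simp only [mem_sdiff, mem_biUnion, mem_univ, true_and] at this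
      obtain ⟨⟨p, hp, -⟩, -⟩ := this
      exact ⟨p, hp⟩
    simp only [mem_inter, mem_union, mem_biUnion, mem_univ, true_and]
    tauto
  · refine disjoint_left.2 fun v hv hv' => ?_
    exact (mem_sdiff.1 (hZ hv')).2 (mem_inter.1 hv).1

end AssembleSide

section Assemble
open Finset
open scoped Classical

/-- Base pairs `XB, YB`, extra pairs `XE, YE` and flexible pairs `XF, YF` inside the base pairs;
the flexible pairs shift vertices between any base pair and the base pair `p0`. -/
structure Layout {V J1 J2 : Type*} [Fintype J1] [Fintype J2] (A B : Finset V) (XB YB : J1 → Finset V)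
    (XE YE : J2 → Finset V) (XF YF : J1 × Bool × Fin 3 → Finset V)
    (xl yl : J1 × Bool × Fin 3 → J1) (p0 : J1) : Prop where
  disj : Disjoint A B
  card : A.card = B.card
  XBA : ∀ p, XB p ⊆ A
  YBB : ∀ p, YB p ⊆ B
  XEA : ∀ e, XE e ⊆ A
  YEB : ∀ e, YE e ⊆ B
  dXB : ∀ p p', p ≠ p' → Disjoint (XB p) (XB p')
  dYB : ∀ p p', p ≠ p' → Disjoint (YB p) (YB p')
  dXE : ∀ e e', e ≠ e' → Disjoint (XE e) (XE e')
  dYE : ∀ e e', e ≠ e' → Disjoint (YE e) (YE e')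
  dXEB : ∀ e p, Disjoint (XE e) (XB p)
  dYEB : ∀ e p, Disjoint (YE e) (YB p)
  cB : ∀ p, (XB p).card = (YB p).card
  cE : ∀ e, (XE e).card = (YE e).card
  XFB : ∀ f, XF f ⊆ XB (xl f)
  YFB : ∀ f, YF f ⊆ YB (yl f)
  dXF : ∀ f f', f ≠ f' → Disjoint (XF f) (XF f')
  dYF : ∀ f f', f ≠ f' → Disjoint (YF f) (YF f')
  div : ∀ t p b, (∑ k, ((if xl (p, b, k) = t then 1 else 0) -
      (if yl (p, b, k) = t then 1 else 0)) : ℤ) =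
      (if b then 1 else -1) * ((if p = t then 1 else 0) - if p0 = t then 1 else 0)

variable {V J1 J2 ι : Type*} [Fintype J1] [Fintype J2] [Fintype ι] {A B : Finset V}
  {XB YB : J1 → Finset V} {XE YE : J2 → Finset V} {XF YF : J1 × Bool × Fin 3 → Finset V}
  {xl yl : J1 × Bool × Fin 3 → J1} {p0 : J1} {r : ℕ} {G : SimpleGraph V} {c : Sym2 V → Fin r}

theorem Layout.cp (h : Layout A B XB YB XE YE XF YF xl yl p0) {R : ι → V → V → Prop}
    (hR : ∀ t, ∀ ⦃u v⦄, R t u v → R t v u) {lab : J1 ⊕ J2 ⊕ J1 × Bool × Fin 3 → ι}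
    {x y : J1 ⊕ J2 ⊕ J1 × Bool × Fin 3 → V} {W : Finset V} {w z N s mf qf : ℕ} {q1 : J1 → ℕ}
    {q2 : J2 → ℕ} {d κ : ℝ} (hr : 0 < r) (hκ : 0 < κ) (hd : 0 < d) (hd1 : d ≤ 1) (hAN : A.card ≤ N)
    (hWAB : W ⊆ A ∪ B) (hWc : W.card ≤ w) (hWb : (W ∩ A).card = (W ∩ B).card)
    (hxW : ∀ a, x a ∉ W) (hyW : ∀ a, y a ∉ W)
    (hclose : ∀ H : J1 ⊕ J2 ⊕ J1 × Bool × Fin 3 → List V, (∀ a, (H a).Nodup) →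
        (∀ a, Pth (R (lab a)) (x a) (y a) (H a)) →
        (∀ a b, a ≠ b → List.Disjoint (H a) (H b)) → (∀ a, ∀ v ∈ H a, v ∉ W) →
        CP G c ({v | ∃ a, v ∈ H a} ∪ ↑W) (Fintype.card ι))
    -- base pairs
    (hx1 : ∀ p, x (Sum.inl p) ∈ XB p \ univ.biUnion XF)
    (hy1 : ∀ p, y (Sum.inl p) ∈ YB p \ univ.biUnion YF) (hq1 : ∀ p, 0 < q1 p)
    (reg1 : ∀ p, Reg (R (lab (Sum.inl p))) (q1 p) d (XB p) (YB p))
    (hX1 : ∀ p, ∀ v ∈ XB p, 2 * q1 p + 2 + (w + z) ≤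
      dg (R (lab (Sum.inl p))) v (YB p \ univ.biUnion YF))
    (hY1 : ∀ p, ∀ v ∈ YB p, 2 * q1 p + 2 + (w + z) ≤
      dg (R (lab (Sum.inl p))) v (XB p \ univ.biUnion XF))
    -- extra pairs
    (hx2 : ∀ e, x (Sum.inr (Sum.inl e)) ∈ XE e) (hy2 : ∀ e, y (Sum.inr (Sum.inl e)) ∈ YE e)
    (hq2 : ∀ e, 0 < q2 e) (reg2 : ∀ e, Reg (R (lab (Sum.inr (Sum.inl e)))) (q2 e) d (XE e) (YE e))
    (hX2 : ∀ e, w + 4 * q2 e + 4 ≤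
      dg (R (lab (Sum.inr (Sum.inl e)))) (x (Sum.inr (Sum.inl e))) (YE e))
    (hY2 : ∀ e, w + 4 * q2 e + 4 ≤
      dg (R (lab (Sum.inr (Sum.inl e)))) (y (Sum.inr (Sum.inl e))) (XE e))
    (hE : ∀ e, w + q2 e ≤ (XE e).card)
    (hg2 : ∀ e, (3 * q2 e + 4 : ℝ) ≤ d * ((XE e).card - (w + q2 e) : ℕ))
    -- flexible pairs
    (hx3 : ∀ f, x (Sum.inr (Sum.inr f)) ∈ XF f) (hy3 : ∀ f, y (Sum.inr (Sum.inr f)) ∈ YF f)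
    (hqf : 0 < qf) (reg3 : ∀ f, Reg (R (lab (Sum.inr (Sum.inr f)))) qf d (XF f) (YF f))
    (hcXF : ∀ f, (XF f).card = mf) (hcYF : ∀ f, (YF f).card = mf)
    (hX3 : ∀ f, w + 4 * qf + 4 ≤
      dg (R (lab (Sum.inr (Sum.inr f)))) (x (Sum.inr (Sum.inr f))) (YF f))
    (hY3 : ∀ f, w + 4 * qf + 4 ≤
      dg (R (lab (Sum.inr (Sum.inr f)))) (y (Sum.inr (Sum.inr f))) (XF f))
    (hg3 : (3 * qf + 4 : ℝ) ≤ d * (mf / 2 : ℕ)) (hmf : mf / 2 + (w + z) + w + qf ≤ mf)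
    -- leftover
    (hzA : (A \ (univ.biUnion XB ∪ univ.biUnion XE)).card + ∑ e, (w + q2 e) ≤ z)
    (hzB : (B \ (univ.biUnion YB ∪ univ.biUnion YE)).card + ∑ e, (w + q2 e) ≤ z)
    (hcovA : ∀ v ∈ A, κ * N + (w + Fintype.card J1 : ℕ) ≤
      dg G.Adj v (univ.biUnion fun p => YB p \ univ.biUnion YF))
    (hcovB : ∀ v ∈ B, κ * N + (w + Fintype.card J1 : ℕ) ≤
      dg G.Adj v (univ.biUnion fun p => XB p \ univ.biUnion XF))
    (hs : 2 * r ≤ κ * (s + 1)) (hzs : (s + 1) * (s + 1) * z < N) :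
    CP G c ↑(A ∪ B) (Fintype.card ι + (r * s + r * s)) := by
  have hAB := disjoint_left.1 h.disj
  have hBE : ∀ e, Disjoint (XE e) (YE e) := fun e => h.disj.mono (h.XEA e) (h.YEB e)
  have hBB : ∀ p, Disjoint (XB p) (YB p) := fun e => h.disj.mono (h.XBA e) (h.YBB e)
  have hBF : ∀ f, Disjoint (XF f) (YF f) := fun f =>
    h.disj.mono ((h.XFB f).trans (h.XBA _)) ((h.YFB f).trans (h.YBB _))
  -- paths through the extra pairs
  have ex2 := fun e => Reg.exists_path (hR _) (U := W) (g := (XE e).card - (w + q2 e)) (reg2 e)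
    (hq2 e) hd hd1 (hBE e) (mem_sdiff.2 ⟨hx2 e, hxW _⟩) (mem_sdiff.2 ⟨hy2 e, hyW _⟩)
    (by have := hX2 e; omega) (by have := hY2 e; omega) (hg2 e) (by have := hE e; omega)
    (by have := hE e; have := h.cE e; omega)
  choose X2 hX2s Y2 hY2s cX2 cY2 H2 nd2 pt2 mem2 using ex2
  set LA := A \ (univ.biUnion XB ∪ univ.biUnion X2 ∪ W) with hLA
  set LB := B \ (univ.biUnion YB ∪ univ.biUnion Y2 ∪ W) with hLB
  obtain ⟨cLA, bLA⟩ := card_leftover h.XBA h.XEA h.dXE h.dXEB hX2s hLA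
  obtain ⟨cLB, bLB⟩ := card_leftover h.YBB h.YEB h.dYE h.dYEB hY2s hLB
  have hsum : ∀ E E' : J2 → Finset V, (∀ e, (E e).card = (XE e).card) →
      (∀ e, (E' e).card = (XE e).card - (w + q2 e)) →
      ∑ e, (E e).card = ∑ e, (E' e).card + ∑ e, (w + q2 e) := by
    intro E E' h1 h2
    rw [← sum_add_distrib]
    exact sum_congr rfl fun e _ => by have := hE e; have := h1 e; have := h2 e; omega
  have s2A := hsum XE X2 (fun _ => rfl) cX2
  have s2B := hsum YE Y2 (fun e => (h.cE e).symm) cY2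
  have zA : LA.card ≤ z := by omega
  have zB : LB.card ≤ z := by omega
  -- covering the leftover
  have hIm : ∀ f : J1 ⊕ J2 ⊕ J1 × Bool × Fin 3 → V,
      (W ∪ univ.image fun p => f (Sum.inl p)).card ≤ w + Fintype.card J1 := fun f => by
    refine (card_union_le _ _).trans (Nat.add_le_add hWc ?_)
    exact card_image_le
  have hcov : ∀ (v : V) (T I : Finset V), κ * N + (w + Fintype.card J1 : ℕ) ≤ dg G.Adj v T →
      I.card ≤ w + Fintype.card J1 → κ * N ≤ dg G.Adj v (T \ I) := by
    intro v T I h1 h2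
    have h3 : (dg G.Adj v T : ℝ) ≤ dg G.Adj v (T \ I) + I.card := by
      exact_mod_cast dg_le_sdiff_add v T I
    have h4 : (I.card : ℝ) ≤ (w + Fintype.card J1 : ℕ) := by exact_mod_cast h2
    linarith
  have hYNB : (univ.biUnion fun p => YB p \ univ.biUnion YF) ⊆ B :=
    biUnion_subset.2 fun p _ => sdiff_subset.trans (h.YBB p)
  have hXNA : (univ.biUnion fun p => XB p \ univ.biUnion XF) ⊆ A :=
    biUnion_subset.2 fun p _ => sdiff_subset.trans (h.XBA p)
  have hLAA : LA ⊆ A := sdiff_subset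
  have hLBB : LB ⊆ B := sdiff_subset
  obtain ⟨ZB, hZB, cZB, cpA⟩ := exists_cover (G := G) (c := c) hr (L := LA)
    (B := (univ.biUnion fun p => YB p \ univ.biUnion YF) \
      (W ∪ univ.image fun p => y (Sum.inl p))) hκ
    (h.disj.mono hLAA (sdiff_subset.trans hYNB))
    (fun v hv => hcov v _ _ (hcovA v (hLAA hv)) (hIm y))
    ((card_le_card (sdiff_subset.trans hYNB)).trans (h.card.symm.trans_le hAN)) hs
    ((Nat.mul_le_mul_left _ zA).trans_lt hzs)
  obtain ⟨ZA, hZA, cZA, cpB⟩ := exists_cover (G := G) (c := c) hr (L := LB)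
    (B := (univ.biUnion fun p => XB p \ univ.biUnion XF) \
      (W ∪ univ.image fun p => x (Sum.inl p))) hκ
    (h.disj.symm.mono hLBB (sdiff_subset.trans hXNA))
    (fun v hv => hcov v _ _ (hcovB v (hLBB hv)) (hIm x))
    ((card_le_card (sdiff_subset.trans hXNA)).trans hAN) hs
    ((Nat.mul_le_mul_left _ zB).trans_lt hzs)
  have hZBW : ZB ⊆ (univ.biUnion fun p => YB p \ univ.biUnion YF) \ W :=
    hZB.trans (sdiff_subset_sdiff subset_rfl subset_union_left)
  have hZAW : ZA ⊆ (univ.biUnion fun p => XB p \ univ.biUnion XF) \ W :=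
    hZA.trans (sdiff_subset_sdiff subset_rfl subset_union_left)
  have hyZ : ∀ p, y (Sum.inl p) ∉ ZB := fun p hp => (mem_sdiff.1 (hZB hp)).2
    (mem_union_right _ (mem_image_of_mem _ (mem_univ p)))
  have hxZ : ∀ p, x (Sum.inl p) ∉ ZA := fun p hp => (mem_sdiff.1 (hZA hp)).2
    (mem_union_right _ (mem_image_of_mem _ (mem_univ p)))
  -- the imbalance of the base pairs
  set u : J1 → ℤ := fun p => ((YB p ∩ (W ∪ ZB)).card : ℤ) - (XB p ∩ (W ∪ ZA)).card with hu
  have hu0 : ∑ p, u p = 0 := by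
    have e1 := sum_card_base_inter h.dYB hZBW
    have e2 := sum_card_base_inter h.dXB hZAW
    have e3 : ∑ e, (X2 e).card = ∑ e, (Y2 e).card :=
      sum_congr rfl fun e _ => by rw [cX2, cY2]
    have e4 : (univ.biUnion XB).card = (univ.biUnion YB).card := by
      rw [card_biUnion fun p _ p' _ => h.dXB p p', card_biUnion fun p _ p' _ => h.dYB p p']
      exact sum_congr rfl fun p _ => h.cB p
    have e5 := h.card
    rw [hu, sum_sub_distrib, ← Nat.cast_sum, ← Nat.cast_sum, e1, e2]
    omega
  have hWZ : ∀ (T Z : Finset V), Z.card ≤ z → (T ∩ (W ∪ Z)).card ≤ w + z := fun T Z hZ =>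
    (card_le_card inter_subset_right).trans ((card_union_le _ _).trans
      (Nat.add_le_add hWc hZ))
  have hub : ∀ p, (u p).toNat ≤ w + z ∧ (-u p).toNat ≤ w + z := fun p => by
    have e1 := hWZ (YB p) ZB (by omega)
    have e2 := hWZ (XB p) ZA (by omega)
    constructor <;> simp only [hu] <;> omega
  -- paths through the flexible pairs
  set g : J1 × Bool × Fin 3 → ℕ := fun f =>
    mf / 2 + (if f.2.1 then (u f.1).toNat else (-u f.1).toNat) with hg
  have hgb : ∀ f, mf / 2 ≤ g f ∧ g f ≤ mf / 2 + (w + z) := fun f => by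
    have := hub f.1
    simp only [hg]
    split_ifs <;> omega
  have ex3 := fun f => Reg.exists_path (hR _) (U := W) (g := g f) (reg3 f)
    hqf hd hd1 (hBF f) (mem_sdiff.2 ⟨hx3 f, hxW _⟩) (mem_sdiff.2 ⟨hy3 f, hyW _⟩)
    (by have := hX3 f; omega) (by have := hY3 f; omega) (hg3.trans (by
      have : ((mf / 2 : ℕ) : ℝ) ≤ g f := by exact_mod_cast (hgb f).1
      exact mul_le_mul_of_nonneg_left this hd.le))
    (by have := hgb f; have := hcXF f; omega) (by have := hgb f; have := hcYF f; omega)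
  choose X3 hX3s Y3 hY3s cX3 cY3 H3 nd3 pt3 mem3 using ex3
  -- Hamilton paths in what remains of the base pairs
  set XR : J1 → Finset V := fun p => XB p \ (univ.biUnion X3 ∪ (W ∪ ZA)) with hXR
  set YR : J1 → Finset V := fun p => YB p \ (univ.biUnion Y3 ∪ (W ∪ ZB)) with hYR
  have hcR : ∀ p, (XR p).card = (YR p).card := by
    intro p
    have e1 := card_base_rest h.dXB h.XFB h.dXF hX3s hZAW p
    have e2 := card_base_rest h.dYB h.YFB h.dYF hY3s hZBW p
    have e3 := flex_balance h.div hu0 (g := g) (h := mf / 2) (fun _ _ _ => rfl) p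
    simp only [cX3] at e1
    simp only [cY3] at e2
    have e4 := h.cB p
    have e5 : u p = ((YB p ∩ (W ∪ ZB)).card : ℤ) - (XB p ∩ (W ∪ ZA)).card := rfl
    simp only [hXR, hYR]
    omega
  have hnot : ∀ (F F3 : J1 × Bool × Fin 3 → Finset V), (∀ f, F3 f ⊆ F f \ W) → ∀ T Z : Finset V,
      (T \ univ.biUnion F) \ (W ∪ Z) ⊆ T \ (univ.biUnion F3 ∪ (W ∪ Z)) := by
    intro F F3 hF T Z v hv
    simp only [mem_sdiff, mem_union, mem_biUnion, mem_univ, true_and,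
      not_or, not_exists] at hv ⊢
    exact ⟨hv.1.1, fun f hf => hv.1.2 f (mem_sdiff.1 (hF f hf)).1, hv.2⟩
  have hdeg : ∀ (t : ι) (v : V) (T T' Z : Finset V) (k : ℕ), k + (w + z) ≤ dg (R t) v T →
      Z.card ≤ z → T \ (W ∪ Z) ⊆ T' → k ≤ dg (R t) v T' := by
    intro t v T T' Z k h1 h2 h3
    have h4 := dg_le_sdiff_add (R := R t) v T (W ∪ Z)
    have h5 := card_union_le W Z
    have h6 := dg_mono (R := R t) (v := v) h3
    omega
  have ex1 := fun p => exists_hamPath (hR (lab (Sum.inl p))) (X := XR p) (Y := YR p)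
    (q := q1 p) (D := 2 * q1 p + 2)
    ((hBB p).mono sdiff_subset sdiff_subset) (hcR p)
    (hnot XF X3 hX3s (XB p) ZA (mem_sdiff.2 ⟨hx1 p, by
      simp only [mem_union, not_or]; exact ⟨hxW _, hxZ p⟩⟩))
    (hnot YF Y3 hY3s (YB p) ZB (mem_sdiff.2 ⟨hy1 p, by
      simp only [mem_union, not_or]; exact ⟨hyW _, hyZ p⟩⟩))
    (((reg1 p).subset sdiff_subset sdiff_subset).holeFree (hq1 p) hd) le_rfl
    (fun v hv => hdeg _ v _ _ ZB _ (hX1 p v (mem_sdiff.1 hv).1) (by omega)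
      (hnot YF Y3 hY3s (YB p) ZB))
    (fun v hv => hdeg _ v _ _ ZA _ (hY1 p v (mem_sdiff.1 hv).1) (by omega)
      (hnot XF X3 hX3s (XB p) ZA))
  choose H1 nd1 pt1 mem1 using ex1
  set XS : J1 ⊕ J2 ⊕ J1 × Bool × Fin 3 → Finset V := Sum.elim XR (Sum.elim X2 X3) with hXS
  set YS : J1 ⊕ J2 ⊕ J1 × Bool × Fin 3 → Finset V := Sum.elim YR (Sum.elim Y2 Y3) with hYS
  set H : J1 ⊕ J2 ⊕ J1 × Bool × Fin 3 → List V := Sum.elim H1 (Sum.elim H2 H3) with hH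
  obtain ⟨a1, a2, a3, a4, a5⟩ := side_cover h.XBA h.XEA h.dXB h.dXE h.dXEB h.XFB h.dXF hX2s hX3s
    hZAW (fun _ => rfl) hLA hXS
  obtain ⟨b1, b2, b3, b4, b5⟩ := side_cover h.YBB h.YEB h.dYB h.dYE h.dYEB h.YFB h.dYF hY2s hY3s
    hZBW (fun _ => rfl) hLB hYS
  have hmem : ∀ a v, v ∈ H a ↔ v ∈ XS a ∨ v ∈ YS a := by
    rintro (p | e | f) v
    · exact (mem1 p v).trans mem_union
    · exact (mem2 e v).trans mem_union
    · exact (mem3 f v).trans mem_union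
  clear_value XS YS LA LB
  have cp0 := hclose H (by rintro (p | e | f); exacts [nd1 p, nd2 e, nd3 f])
    (by rintro (p | e | f); exacts [pt1 p, pt2 e, pt3 f])
    (fun a b hab v hv hv' => by
      rcases (hmem _ _).1 hv with k | k <;> rcases (hmem _ _).1 hv' with k' | k'
      · exact disjoint_left.1 (a1 a b hab) k k'
      · exact hAB (a2 a v k).1 (b2 b v k').1
      · exact hAB (a2 b v k').1 (b2 a v k).1
      · exact disjoint_left.1 (b1 a b hab) k k')
    (fun a v hv => by
      rcases (hmem _ _).1 hv with k | k
      · exact (a2 a v k).2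
      · exact (b2 a v k).2)
  have hfin := cp0.union (cpA.union cpB (Set.disjoint_left.2 fun v hv hv' => by
    simp only [coe_union, Set.mem_union, mem_coe] at hv hv'
    rcases hv with k | k <;> rcases hv' with k' | k'
    · exact hAB (a4 v k).1 (b4 v k').1
    · exact (a4 v k).2.2.1 k'
    · exact (b4 v k').2.2.1 k
    · exact hAB (a5 v k').1 (b5 v k).1)) (Set.disjoint_left.2 fun v hv hv' => by
    simp only [coe_union, Set.mem_union, mem_coe, Set.mem_ofPred_eq, hmem] at hv hv'
    rcases hv with ⟨a, k⟩ | k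
    · rcases hv' with (k' | k') | (k' | k')
      · exact k.elim ((a4 v k').2.2.2 a) fun k => hAB (a4 v k').1 (b2 a v k).1
      · exact k.elim (fun k => hAB (a2 a v k).1 (b5 v k').1) ((b5 v k').2.2 a)
      · exact k.elim (fun k => hAB (a2 a v k).1 (b4 v k').1) ((b4 v k').2.2.2 a)
      · exact k.elim ((a5 v k').2.2 a) fun k => hAB (a5 v k').1 (b2 a v k).1
    · rcases hv' with (k' | k') | (k' | k')
      · exact (a4 v k').2.1 k
      · exact (b5 v k').2.1 k
      · exact (b4 v k').2.1 k
      · exact (a5 v k').2.1 k)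
  convert hfin using 1
  ext v
  simp only [coe_union, Set.mem_union, mem_coe, Set.mem_ofPred_eq, hmem]
  constructor
  · rintro (hv | hv)
    · rcases a3 v hv with ⟨a, k⟩ | k | k | k
      · exact Or.inl (Or.inl ⟨a, Or.inl k⟩)
      · exact Or.inl (Or.inr k)
      · exact Or.inr (Or.inl (Or.inl k))
      · exact Or.inr (Or.inr (Or.inr k))
    · rcases b3 v hv with ⟨a, k⟩ | k | k | k
      · exact Or.inl (Or.inl ⟨a, Or.inr k⟩)
      · exact Or.inl (Or.inr k)
      · exact Or.inr (Or.inr (Or.inl k))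
      · exact Or.inr (Or.inl (Or.inr k))
  · rintro ((⟨a, k | k⟩ | k) | ((k | k) | (k | k)))
    · exact Or.inl (a2 a v k).1
    · exact Or.inr (b2 a v k).1
    · exact mem_union.1 (hWAB k)
    · exact Or.inl (a4 v k).1
    · exact Or.inr (b5 v k).1
    · exact Or.inr (b4 v k).1
    · exact Or.inl (a5 v k).1

end Assemble

section LayoutExists
open Finset
open scoped Classical

variable {V ι : Type} {A B : Finset V} {R : ι → V → V → Prop} {P Q : Finset (Pr ι V)}

lemma IsAug.card_rest {m ε d lam : ℝ} (hP : IsPack A B R m ε d P)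
    (h : IsAug P Q lam) (hlam : lam ≤ 1 / 2) {p : Pr ι V}
    (hp : p ∈ P) : (p.X \ SX Q).card = (p.Y \ SY Q).card ∧ m / 2 ≤ ((p.X \ SX Q).card : ℝ) := by
  have h1 := card_sdiff_add_card_inter p.X (SX Q)
  have h2 := card_sdiff_add_card_inter p.Y (SY Q)
  have h3 := h.bal p hp
  have h4 := hP.card_eq p hp
  refine ⟨by omega, ?_⟩
  have h5 := h.trim p hp
  have h6 := hP.le_card p hp
  have h7 : ((p.X \ SX Q).card : ℝ) + (p.X ∩ SX Q).card = p.X.card := by exact_mod_cast h1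
  have h8 : (0 : ℝ) ≤ p.X.card := Nat.cast_nonneg _
  nlinarith

lemma IsAug.sum_rest_ge {m m' ε ε' d d' lam τ : ℝ} {N : ℕ} (hP : IsPack A B R m ε d P)
    (hQ : IsPack A B R m' ε' d' Q) (h : IsAug P Q lam) (hA : A.card = N)
    (hτ : ((A \ SX P).card : ℝ) ≤ τ * N) :
    (1 - 3 * τ) * N ≤ ∑ p ∈ P, ((p.X \ SX Q).card : ℝ) := by
  have h1 : ∑ p ∈ P, (p.X \ SX Q).card + (SX P ∩ SX Q).card = (SX P).card := by
    rw [card_SX_inter hP, card_SX hP, ← sum_add_distrib]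
    exact sum_congr rfl fun p _ => card_sdiff_add_card_inter _ _
  have h2 := h.tot
  have h3 : (SX Q \ SX P).card ≤ (A \ SX P).card :=
    card_le_card (sdiff_subset_sdiff (SX_subset hQ) subset_rfl)
  have h4 := card_sdiff_add_card_eq_card (SX_subset hP)
  have h5 : N ≤ ∑ p ∈ P, (p.X \ SX Q).card + 3 * (A \ SX P).card := by omega
  have h6 : (N : ℝ) ≤ ∑ p ∈ P, ((p.X \ SX Q).card : ℝ) + 3 * (A \ SX P).card := by exact_mod_cast h5
  linarith

lemma IsPack.card_le {m ε d : ℝ} {N : ℕ} (hP : IsPack A B R (m * N) ε d P) (hA : A.card = N)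
    (hN : 0 < N) : m * P.card ≤ 1 := by
  have h1 : (SX P).card ≤ N := hA ▸ card_le_card (SX_subset hP)
  rw [card_SX hP] at h1
  have h2 : ∑ p ∈ P, (p.X.card : ℝ) ≤ N := by exact_mod_cast h1
  have h3 : (P.card : ℝ) * (m * N) ≤ ∑ p ∈ P, (p.X.card : ℝ) := by
    rw [← nsmul_eq_mul]
    exact card_nsmul_le_sum _ _ _ fun p hp => hP.le_card p hp
  have hN' : (0 : ℝ) < N := by exact_mod_cast hN
  by_contra hcon
  push Not at hcon
  nlinarith

theorem exists_layout (K K3 : ℕ) {η δ δ' c1 ε3 γ : ℝ} (hδ' : 0 < δ') (hη1 : η ≤ 1)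
    (hK1 : K * δ' ≤ η / 2) (hK2 : K * δ' < δ) (hc1 : 0 < c1) (hε3 : 0 < ε3)
    (hε3' : ε3 ≤ 1 / 2) (hγ : 0 < γ) (hγ2 : 4 * K3 * γ ≤ δ') (hK3 : 6 / c1 ≤ K3) :
    ∃ c3 : ℝ, 0 < c3 ∧ ∃ N0 : ℕ, ∀ {V ι : Type} [Fintype ι] {A B : Finset V}
      {R : ι → V → V → Prop} {P Q : Finset (Pr ι V)} {θ m' ε ε' d d' lam τ : ℝ} {N : ℕ},
      N0 ≤ N → Fintype.card ι ≤ K → DenseSys A B R θ η δ N → IsPack A B R (c1 * N) ε d P →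
      IsPack A B R m' ε' d' Q → IsAug P Q lam → lam ≤ 1 / 2 → ((A \ SX P).card : ℝ) ≤ τ * N →
      3 * τ ≤ η / 2 →
      ∃ (p0 : P) (XF YF : P × Bool × Fin 3 → Finset V) (xl yl : P × Bool × Fin 3 → P)
        (lab : P × Bool × Fin 3 → ι) (mf qf : ℕ),
        Layout A B (fun p : P => p.1.X \ SX Q) (fun p : P => p.1.Y \ SY Q) (fun e : Q => e.1.X)
          (fun e : Q => e.1.Y) XF YF xl yl p0 ∧ (∀ f, (XF f).card = mf) ∧ (∀ f, (YF f).card = mf) ∧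
        c3 * N ≤ mf ∧ mf ≤ γ * c1 * N ∧ 0 < qf ∧ (qf : ℝ) ≤ ε3 * mf ∧
        ∀ f, Reg (R (lab f)) qf (δ' / 4) (XF f) (YF f) := by
  obtain ⟨c, hc, hc1', hfam⟩ := exists_disjoint_regular_family K3 hδ' hε3 hε3' hγ hγ2
  obtain ⟨N0, hN0⟩ := exists_nat_gt (2 / (c * c1))
  refine ⟨c * c1 / 2, by positivity, N0 + 1, ?_⟩
  intro V ι _ A B R P Q θ m' ε ε' d d' lam τ N hN hι hD hP hQ hAug hlam hτ hτ2
  have hN1 : 0 < N := by omega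
  have hNr : (0 : ℝ) < N := by exact_mod_cast hN1
  have hcN : 1 ≤ c * (c1 * N / 2) := by
    have h1 : (N0 : ℝ) ≤ N := by exact_mod_cast (by omega : N0 ≤ N)
    have h2 := hN0.trans_le h1
    rw [div_lt_iff₀ (by positivity)] at h2
    linarith
  have hrest := fun p : P => hAug.card_rest hP hlam p.2
  have hsum : (1 - η / 2) * N ≤ ∑ p : P, ((p.1.X \ SX Q).card : ℝ) := by
    have h1 := hAug.sum_rest_ge hP hQ hD.cardA hτ
    rw [sum_coe_sort P fun p => ((p.X \ SX Q).card : ℝ)]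
    refine le_trans ?_ h1
    exact mul_le_mul_of_nonneg_right (by linarith) hNr.le
  have hne : Nonempty P := by
    by_contra hcon
    rw [not_nonempty_iff] at hcon
    rw [univ_eq_empty, sum_empty] at hsum
    nlinarith
  obtain ⟨p0⟩ := hne
  have hpos : ∀ p : P, 0 < (p.1.X \ SX Q).card := fun p => by
    have h1 : (0 : ℝ) < c1 * N / 2 := by positivity
    exact_mod_cast h1.trans_le (hrest p).2
  have hKι : (Fintype.card ι : ℝ) ≤ K := by exact_mod_cast hι
  have hKd : (Fintype.card ι : ℝ) * δ' ≤ K * δ' := mul_le_mul_of_nonneg_right hKι hδ'.le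
  have dX : ∀ p p' : P, p ≠ p' → Disjoint (p.1.X \ SX Q) (p'.1.X \ SX Q) := fun p p' h =>
    (hP.disjX p.1 p.2 p'.1 p'.2 fun e => h (Subtype.ext e)).mono sdiff_subset
      sdiff_subset
  have dY : ∀ p p' : P, p ≠ p' → Disjoint (p.1.Y \ SY Q) (p'.1.Y \ SY Q) := fun p p' h =>
    (hP.disjY p.1 p.2 p'.1 p'.2 fun e => h (Subtype.ext e)).mono sdiff_subset
      sdiff_subset
  have hwalk := fun st en : P => hD.exists_walk (κ := P) univ (fun p => p.1.X \ SX Q)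
    (fun p => p.1.Y \ SY Q) (fun p _ => sdiff_subset.trans (hP.subX p.1 p.2))
    (fun p _ => sdiff_subset.trans (hP.subY p.1 p.2)) (fun p _ p' _ => dX p p')
    (fun p _ p' _ => dY p p') (fun p _ => (hrest p).1) hN1 hδ'.le hsum
    (S0 := st.1.X \ SX Q) (T0 := en.1.Y \ SY Q) (sdiff_subset.trans (hP.subX st.1 st.2))
    (card_pos.1 (hpos st)) (sdiff_subset.trans (hP.subY en.1 en.2))
    (card_pos.1 ((hrest en).1 ▸ hpos en)) (by linarith) (by linarith)
  choose wa _ wb _ wi wj wk e1 e2 e3 using hwalk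
  set st : P × Bool × Fin 3 → P := fun f => if f.2.1 then f.1 else p0 with hst
  set en : P × Bool × Fin 3 → P := fun f => if f.2.1 then p0 else f.1 with hen
  set xl : P × Bool × Fin 3 → P := fun f => ![st f, wa (st f) (en f), wb (st f) (en f)] f.2.2 with hxl
  set yl : P × Bool × Fin 3 → P := fun f => ![wa (st f) (en f), wb (st f) (en f), en f] f.2.2 with hyl
  set lab : P × Bool × Fin 3 → ι := fun f =>
    ![wi (st f) (en f), wj (st f) (en f), wk (st f) (en f)] f.2.2 with hlab
  have hdense : ∀ f, δ' * (((xl f).1.X \ SX Q).card * ((yl f).1.Y \ SY Q).card) ≤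
      ed (R (lab f)) ((xl f).1.X \ SX Q) ((yl f).1.Y \ SY Q) := by
    rintro ⟨p, b, k⟩
    fin_cases k
    · exact e1 _ _
    · exact e2 _ _
    · exact e3 _ _
  have : Nonempty (P × Bool × Fin 3) := ⟨(p0, true, 0)⟩
  have hcardJ : Fintype.card (P × Bool × Fin 3) ≤ K3 := by
    have h1 := hP.card_le hD.cardA hN1
    simp only [Fintype.card_prod, Fintype.card_coe, Fintype.card_bool, Fintype.card_fin]
    have h2 : (P.card : ℝ) * 6 ≤ K3 := by
      refine le_trans ?_ hK3
      rw [le_div_iff₀ hc1]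
      linarith
    have h3 : P.card * 6 ≤ K3 := by exact_mod_cast h2
    omega
  obtain ⟨mf, qf, XF, YF, f1, f2, f3, f4, f5, f6, f7, f8, f9, f10, f11⟩ := hfam hcardJ
    (fun f => R (lab f)) (fun f => hD.symm _) (fun f => (xl f).1.X \ SX Q)
    (fun f => (yl f).1.Y \ SY Q) (c1 * N / 2) hcN (fun f => (hrest _).2)
    (fun f => (hrest (yl f)).1 ▸ (hrest (yl f)).2) hdense
  refine ⟨p0, XF, YF, xl, yl, lab, mf, qf, ?_, f3, f4, by linarith, ?_, f7, f8, f9⟩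
  swap
  · refine f6.trans ?_
    have : 0 < γ * c1 * N := by positivity
    linarith
  exact {
    disj := hD.disj
    card := hD.cardA.trans hD.cardB.symm
    XBA := fun p => sdiff_subset.trans (hP.subX p.1 p.2)
    YBB := fun p => sdiff_subset.trans (hP.subY p.1 p.2)
    XEA := fun e => hQ.subX e.1 e.2
    YEB := fun e => hQ.subY e.1 e.2
    dXB := dX
    dYB := dY
    dXE := fun e e' h => hQ.disjX _ e.2 _ e'.2 fun k => h (Subtype.ext k)
    dYE := fun e e' h => hQ.disjY _ e.2 _ e'.2 fun k => h (Subtype.ext k)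
    dXEB := fun e p => (sdiff_disjoint.mono_right (subset_SX e.2)).symm
    dYEB := fun e p => (sdiff_disjoint.mono_right (subset_SY e.2)).symm
    cB := fun p => (hrest p).1
    cE := fun e => hQ.card_eq e.1 e.2
    XFB := f1
    YFB := f2
    dXF := f10
    dYF := f11
    div := by
      intro t p b
      rw [Fin.sum_univ_three]
      cases b <;> simp [hxl, hyl, hst, hen] <;> ring_nf }

end LayoutExists

section CoreTwo
open Finset
open scoped Classical

lemma Reg.exists_typical {V : Type*} {R : V → V → Prop} (hR : ∀ ⦃u v⦄, R u v → R v u) {q : ℕ} {d : ℝ}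
    {X Y : Finset V} (h : Reg R q d X Y) (hq : 0 < q) (hqX : q ≤ X.card) (hc : X.card = Y.card) :
    ∃ x ∈ X, ∃ y ∈ Y, d * X.card ≤ dg R x Y ∧ d * X.card ≤ dg R y X := by
  have key : ∀ X Y : Finset V, Reg R q d X Y → q ≤ X.card → X.card = Y.card →
      ∃ x ∈ X, d * X.card ≤ dg R x Y := by
    intro X Y h hqX hc
    by_contra hcon
    push Not at hcon
    have := h.card_low_lt hR hq subset_rfl (hc ▸ hqX)
    rw [filter_true_of_mem fun x hx => hc ▸ hcon x hx] at this
    omega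
  obtain ⟨x, hx, h1⟩ := key X Y h hqX hc
  obtain ⟨y, hy, h2⟩ := key Y X (h.symm hR) (hc ▸ hqX) hc.symm
  exact ⟨x, hx, y, hy, h1, by rwa [hc]⟩

lemma Reg.rel_mono {V : Type*} {R R' : V → V → Prop} {q : ℕ} {d : ℝ} {X Y : Finset V}
    (h : Reg R q d X Y) (hRR : ∀ u v, R u v → R' u v) : Reg R' q d X Y := fun X' hX Y' hY h1 h2 =>
  (h X' hX Y' hY h1 h2).trans (by
    exact_mod_cast sum_le_sum fun v _ => dg_rel_le hRR v _)

lemma Layout.mono {V J1 J2 : Type*} [Fintype J1] [Fintype J2] {A B A₁ B₁ : Finset V}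
    {XB YB : J1 → Finset V} {XE YE : J2 → Finset V} {XF YF : J1 × Bool × Fin 3 → Finset V}
    {xl yl : J1 × Bool × Fin 3 → J1} {p0 : J1} (h : Layout A B XB YB XE YE XF YF xl yl p0)
    (hA : A ⊆ A₁) (hB : B ⊆ B₁) (hd : Disjoint A₁ B₁) (hc : A₁.card = B₁.card) :
    Layout A₁ B₁ XB YB XE YE XF YF xl yl p0 :=
  { h with
    disj := hd
    card := hc
    XBA := fun p => (h.XBA p).trans hA
    YBB := fun p => (h.YBB p).trans hB
    XEA := fun p => (h.XEA p).trans hA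
    YEB := fun p => (h.YEB p).trans hB }

lemma exists_nat_le_mul (k : ℝ) {e : ℝ} (he : 0 < e) : ∃ N0 : ℕ, ∀ N : ℕ, N0 ≤ N → k ≤ e * N := by
  obtain ⟨N0, h⟩ := exists_nat_ge (k / e)
  refine ⟨N0, fun N hN => ?_⟩
  have : (N0 : ℝ) ≤ N := by exact_mod_cast hN
  rw [div_le_iff₀ he] at h
  nlinarith

/-- Any two large sets of non-isolated vertices are joined by many short disjoint paths. -/
def Linked {V ι : Type*} (R : ι → V → V → Prop) (Φ : ℝ → ℝ) (ℓ : ℝ → ℕ) (N : ℕ) : Prop :=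
  ∀ c : ℝ, 0 < c → ∀ (t : ι) (X Y F : Finset V), c * N ≤ X.card → c * N ≤ Y.card →
    (∀ x ∈ X, ∃ v, R t x v) → (∀ y ∈ Y, ∃ v, R t y v) → (F.card : ℝ) ≤ Φ c * N →
    ∃ s ∈ X, ∃ z ∈ Y, ∃ l, Pth (R t) s z l ∧ l.Nodup ∧ l.length ≤ ℓ c ∧ ∀ v ∈ l, v ∉ F

set_option maxHeartbeats 1600000 in
theorem DenseSys.exists_cp (K r s : ℕ) (hr : 0 < r) {η δ θ : ℝ} (hη : 0 < η) (hη1 : η ≤ 1)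
    (hδ : 0 < δ) (hθ : 0 < θ) (hs : 2 * r ≤ θ / 2 * (s + 1)) :
    ∃ σ0 : ℝ, 0 < σ0 ∧ ∀ Φ : ℝ → ℝ, (∀ c, 0 < c → 0 < Φ c) → ∀ Λ : ℝ → ℕ,
    ∃ N0 : ℕ, ∀ {V ι : Type} [Fintype ι] {A B A₁ B₁ : Finset V} {R R₁ : ι → V → V → Prop} {N : ℕ}
      {G : SimpleGraph V} {c : Sym2 V → Fin r} {col : ι → Fin r}, N0 ≤ N → Fintype.card ι ≤ K →
      DenseSys A B R θ η δ N → A ⊆ A₁ → B ⊆ B₁ → Disjoint A₁ B₁ → A₁.card = B₁.card →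
      (A₁.card : ℝ) ≤ N + σ0 * N → (∀ t u v, R t u v → R₁ t u v) →
      (∀ t, ∀ ⦃u v⦄, R₁ t u v → R₁ t v u) →
      (∀ t, ∀ ⦃u v⦄, R₁ t u v → (u ∈ A₁ ∧ v ∈ B₁) ∨ (u ∈ B₁ ∧ v ∈ A₁)) →
      Linked R₁ Φ Λ N → (∀ t u v, R₁ t u v → Rc G c (col t) u v) →
      (∀ v ∈ A₁, θ * N ≤ dg G.Adj v B) → (∀ v ∈ B₁, θ * N ≤ dg G.Adj v A) →
      CP G c ↑(A₁ ∪ B₁) (K + (r * s + r * s)) := by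
  obtain ⟨δ', hδ'0, hδ'1, hK1, hK2⟩ : ∃ δ' : ℝ, 0 < δ' ∧ δ' ≤ 1 ∧ K * δ' ≤ η / 2 ∧ K * δ' < δ := by
    have hK : (0 : ℝ) < K + 1 := by positivity
    have hm : 0 < min η δ := lt_min hη hδ
    refine ⟨min η δ / (2 * (K + 1)), by positivity, ?_, ?_, ?_⟩
    · rw [div_le_one (by positivity)]
      have := min_le_left η δ
      have : (0 : ℝ) ≤ K := by positivity
      linarith
    · have := min_le_left η δ
      rw [← mul_div_assoc, div_le_iff₀ (by positivity)]
      have : (0 : ℝ) ≤ K := by positivity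
      nlinarith
    · have := min_le_right η δ
      rw [← mul_div_assoc, div_lt_iff₀ (by positivity)]
      have : (0 : ℝ) ≤ K := by positivity
      nlinarith
  obtain ⟨τ, hτ0, hτ1, hτ2, hτ3⟩ : ∃ τ : ℝ, 0 < τ ∧ τ < η * (δ' / 64) / 14 ∧ 3 * τ ≤ η / 2 ∧
      τ ≤ θ / 24 := by
    have h1 : 0 < η * (δ' / 64) / 15 := by positivity
    refine ⟨min (η * (δ' / 64) / 15) (min (η / 6) (θ / 24)), by positivity, ?_, ?_, ?_⟩
    · refine (min_le_left _ _).trans_lt ?_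
      linarith
    · linarith [(min_le_right (η * (δ' / 64) / 15) (min (η / 6) (θ / 24))).trans (min_le_left _ _)]
    · exact (min_le_right _ _).trans (min_le_right _ _)
  obtain ⟨c1, hc1, hbase⟩ := exists_base_extra K hη hδ'0 hK1 hK2 (lam := δ' / 64) (τ := τ)
    (ε := δ' / 64) (by positivity) (by linarith) hτ0 hτ1 (by positivity) (by linarith) (by linarith)
  obtain ⟨K3, hK3⟩ := exists_nat_ge (6 / c1)
  obtain ⟨γ, hγ0, hγ1, hγ2, hγ3⟩ : ∃ γ : ℝ, 0 < γ ∧ 4 * K3 * γ ≤ δ' ∧ 6 * γ ≤ δ' / 64 * c1 ∧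
      6 * γ ≤ θ / 8 := by
    have h1 : 0 < δ' / (4 * (K3 + 1)) := by positivity
    have h2 : 0 < δ' * c1 / 384 := by positivity
    refine ⟨min (δ' / (4 * (K3 + 1))) (min (δ' * c1 / 384) (θ / 48)), by positivity, ?_, ?_, ?_⟩
    · have h3 := min_le_left (δ' / (4 * (K3 + 1))) (min (δ' * c1 / 384) (θ / 48))
      have h4 : (4 * K3 : ℝ) * (δ' / (4 * (K3 + 1))) ≤ δ' := by
        rw [← mul_div_assoc, div_le_iff₀ (by positivity)]
        nlinarith
      exact (mul_le_mul_of_nonneg_left h3 (by positivity)).trans h4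
    · linarith [(min_le_right (δ' / (4 * (K3 + 1))) (min (δ' * c1 / 384) (θ / 48))).trans
        (min_le_left _ _)]
    · linarith [(min_le_right (δ' / (4 * (K3 + 1))) (min (δ' * c1 / 384) (θ / 48))).trans
        (min_le_right _ _)]
  obtain ⟨c3, hc3, M1, hlay⟩ := exists_layout K K3 hδ'0 hη1 hK1 hK2 hc1 (ε3 := δ' / 64)
    (by positivity) (by linarith) hγ0 hγ1 hK3
  obtain ⟨σ, hσ0, hσ1, hσ2, hσ3⟩ : ∃ σ : ℝ, 0 < σ ∧ σ ≤ c3 / 64 ∧ σ ≤ δ' * c1 / 512 ∧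
      (s + 1) * (s + 1) * (4 * σ) < 1 := by
    have h1 : (0 : ℝ) < 1 / (8 * ((s + 1) * (s + 1))) := by positivity
    refine ⟨min (1 / (8 * ((s + 1) * (s + 1)))) (min (c3 / 64) (δ' * c1 / 512)), by positivity,
      (min_le_right _ _).trans (min_le_left _ _), (min_le_right _ _).trans (min_le_right _ _), ?_⟩
    have h3 := min_le_left (1 / (8 * ((s + 1 : ℝ) * (s + 1)))) (min (c3 / 64) (δ' * c1 / 512))
    rw [le_div_iff₀ (by positivity)] at h3
    linarith
  obtain ⟨c2, hc2, M2, hext⟩ := hbase σ (min σ (δ' / 64)) hσ0 (by positivity)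
    ((min_le_right _ _).trans (by linarith))
  set cJ := min (δ' / 16 * c1) (min (δ' / 4 * c2) (δ' / 4 * c3)) with hcJ
  have hcJ0 : 0 < cJ := by positivity
  have hcJ1 : cJ ≤ δ' / 16 * c1 := min_le_left _ _
  have hcJ2 : cJ ≤ δ' / 4 * c2 := (min_le_right _ _).trans (min_le_left _ _)
  have hcJ3 : cJ ≤ δ' / 4 * c3 := (min_le_right _ _).trans (min_le_right _ _)
  obtain ⟨NJ, hNJ⟩ := exists_nat_ge (7 / c1 + 1 / c2)
  refine ⟨min σ (1 / 8), by positivity, fun Φ hΦ Λ => ?_⟩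
  set w := NJ * Λ cJ with hw
  obtain ⟨T1, hT1⟩ := exists_nat_le_mul (NJ * (Λ cJ + 2) : ℕ) (hΦ cJ hcJ0)
  obtain ⟨T2, hT2⟩ := exists_nat_le_mul (w + NJ : ℕ) (e := θ / 8) (by positivity)
  obtain ⟨T3, hT3⟩ := exists_nat_le_mul (w + 2) (e := δ' * c1 / 128) (by positivity)
  obtain ⟨T4, hT4⟩ := exists_nat_le_mul (w + 4) (e := δ' * c2 / 32) (by positivity)
  obtain ⟨T5, hT5⟩ := exists_nat_le_mul (w + 4) (e := δ' * c3 / 64) (by positivity)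
  obtain ⟨T6, hT6⟩ := exists_nat_le_mul (NJ * w + 1) (e := σ) (by positivity)
  refine ⟨M1 + M2 + T1 + T2 + T3 + T4 + T5 + T6 + 1, ?_⟩
  intro V ι _ A B A₁ B₁ R R₁ N G c col hN hι hD hAA hBB hAB₁ hc₁ hN₁ hRR hR₁ hbip₁ hL hcol hGA hGB
  obtain ⟨P, Q, hP, hQ, hAug, hτP, hσQ, hdegP⟩ := hext (by omega) hι hD
  obtain ⟨p0, XF, YF, xl, yl, lab3, mf, qf, hlo, hcXF, hcYF, hmf1, hmf2, hqf0, hqf, hreg3⟩ :=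
    hlay (by omega) hι hD hP hQ hAug (by linarith) hτP hτ2
  specialize hT1 N (by omega)
  specialize hT2 N (by omega)
  specialize hT3 N (by omega)
  specialize hT4 N (by omega)
  specialize hT5 N (by omega)
  specialize hT6 N (by omega)
  clear hext hlay hbase
  have hN1 : 0 < N := by omega
  have hNr : (0 : ℝ) < N := by exact_mod_cast hN1
  have hPc := hP.card_le hD.cardA hN1
  have hQc := hQ.card_le hD.cardA hN1
  have hPX : ∀ p : P, c1 * N ≤ (p.1.X.card : ℝ) := fun p => hP.le_card _ p.2
  have hQX : ∀ e : Q, c2 * N ≤ (e.1.X.card : ℝ) := fun e => hQ.le_card _ e.2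
  have hJ : Fintype.card (P ⊕ Q ⊕ P × Bool × Fin 3) ≤ NJ := by
    simp only [Fintype.card_sum, Fintype.card_prod, Fintype.card_coe, Fintype.card_bool,
      Fintype.card_fin]
    have h1 : (P.card : ℝ) ≤ 1 / c1 := by rw [le_div_iff₀ hc1]; linarith
    have h2 : (Q.card : ℝ) ≤ 1 / c2 := by rw [le_div_iff₀ hc2]; linarith
    have h3 : (P.card + (Q.card + P.card * (2 * 3)) : ℝ) ≤ NJ := by
      have h4 : 7 / c1 = 7 * (1 / c1) := by ring
      linarith
    exact_mod_cast h3
  have hflex : ∀ F : P × Bool × Fin 3 → Finset V, (∀ f, (F f).card = mf) →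
      ((univ.biUnion F).card : ℝ) ≤ 6 * γ * N := by
    intro F hF
    have h1 : (univ.biUnion F).card ≤ Fintype.card (P × Bool × Fin 3) * mf := by
      refine card_biUnion_le.trans_eq ?_
      rw [sum_congr rfl fun f _ => hF f, sum_const, smul_eq_mul, card_univ]
    simp only [Fintype.card_prod, Fintype.card_coe, Fintype.card_bool, Fintype.card_fin] at h1
    have h2 : ((univ.biUnion F).card : ℝ) ≤ P.card * (2 * 3) * mf := by exact_mod_cast h1
    have h3 : (P.card : ℝ) * (2 * 3) * mf ≤ P.card * (2 * 3) * (γ * c1 * N) :=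
      mul_le_mul_of_nonneg_left hmf2 (by positivity)
    have h4 : c1 * P.card * (6 * γ * N) ≤ 1 * (6 * γ * N) :=
      mul_le_mul_of_nonneg_right hPc (by positivity)
    linarith
  have hFX := hflex XF hcXF
  have hFY := hflex YF hcYF
  have hdg : ∀ (t : ι) (v : V) (T S F : Finset V) (x : ℝ), δ' / 8 * x ≤ dg (R t) v T →
      ((T ∩ S).card : ℝ) ≤ δ' / 64 * x → (F.card : ℝ) ≤ 6 * γ * N → c1 * N ≤ x →
      3 * δ' / 32 * x ≤ dg (R t) v ((T \ S) \ F) := by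
    intro t v T S F x h1 h2 h3 h4
    have h5 := dg_le_sdiff_add (R := R t) v T (T ∩ S)
    rw [sdiff_inter_self_left] at h5
    have h6 := dg_le_sdiff_add (R := R t) v (T \ S) F
    have h7 : (dg (R t) v T : ℝ) ≤ dg (R t) v ((T \ S) \ F) + F.card + (T ∩ S).card := by
      exact_mod_cast (by omega)
    have h8 : 6 * γ * N ≤ δ' / 64 * c1 * N := mul_le_mul_of_nonneg_right hγ2 hNr.le
    have h9 : δ' / 64 * (c1 * N) ≤ δ' / 64 * x := mul_le_mul_of_nonneg_left h4 (by positivity)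
    linarith
  have hdX : ∀ p : P, ∀ v ∈ p.1.X, 3 * δ' / 32 * p.1.X.card ≤
      dg (R p.1.t) v ((p.1.Y \ SY Q) \ univ.biUnion YF) := fun p v hv =>
    hdg _ _ _ _ _ _ ((hdegP p.1 p.2).1 v hv) (hAug.bal p.1 p.2 ▸ hAug.trim p.1 p.2) hFY (hPX p)
  have hdY : ∀ p : P, ∀ v ∈ p.1.Y, 3 * δ' / 32 * p.1.X.card ≤
      dg (R p.1.t) v ((p.1.X \ SX Q) \ univ.biUnion XF) := fun p v hv =>
    hdg _ _ _ _ _ _ ((hdegP p.1 p.2).2 v hv) (hAug.trim p.1 p.2) hFX (hPX p)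
  have hpos : ∀ p : P, 0 < (p.1.X.card : ℝ) := fun p => lt_of_lt_of_le (by positivity) (hPX p)
  have hne : ∀ (t : ι) (v : V) (T : Finset V) (p : P), 3 * δ' / 32 * p.1.X.card ≤ dg (R t) v T →
      ∃ x, x ∈ T := by
    intro t v T p h
    have h1 : (0 : ℝ) < dg (R t) v T := lt_of_lt_of_le (by have := hpos p; positivity) h
    have h2 : 0 < dg (R t) v T := by exact_mod_cast h1
    exact card_pos.1 (h2.trans_le (dg_le_card v T))
  have exB : ∀ p : P, ∃ x y, x ∈ (p.1.X \ SX Q) \ univ.biUnion XF ∧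
      y ∈ (p.1.Y \ SY Q) \ univ.biUnion YF := by
    intro p
    have h1 : 0 < p.1.X.card := by exact_mod_cast hpos p
    obtain ⟨v, hv⟩ := card_pos.1 h1
    obtain ⟨u, hu⟩ := card_pos.1 (hP.card_eq p.1 p.2 ▸ h1)
    obtain ⟨x, hx⟩ := hne _ _ _ p (hdY p u hu)
    obtain ⟨y, hy⟩ := hne _ _ _ p (hdX p v hv)
    exact ⟨x, y, hx, hy⟩
  choose xb yb hxb hyb using exB
  have q1ex := fun p : P => hP.reg p.1 p.2
  choose q1 hq10 hq1 hreg1 using q1ex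
  have q2ex := fun e : Q => hQ.reg e.1 e.2
  choose q2 hq20 hq2 hreg2 using q2ex
  have hq2' : ∀ e, (q2 e : ℝ) ≤ δ' / 64 * e.1.X.card := fun e => (hq2 e).trans
    (mul_le_mul_of_nonneg_right (min_le_right _ _) (Nat.cast_nonneg _))
  have exE := fun e : Q => Reg.exists_typical (hD.symm _) (hreg2 e) (hq20 e)
    (by
      have h1 := hq2' e
      have h2 : δ' / 64 * (e.1.X.card : ℝ) ≤ 1 * e.1.X.card :=
        mul_le_mul_of_nonneg_right (by linarith) (Nat.cast_nonneg _)
      exact_mod_cast (by linarith : (q2 e : ℝ) ≤ e.1.X.card)) (hQ.card_eq e.1 e.2)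
  choose xe hxe ye hye dxe dye using exE
  have exF := fun f => Reg.exists_typical (hD.symm _) (hreg3 f) hqf0
    (by
      rw [hcXF]
      have h2 : δ' / 64 * (mf : ℝ) ≤ 1 * mf :=
        mul_le_mul_of_nonneg_right (by linarith) (Nat.cast_nonneg _)
      exact_mod_cast (by linarith : (qf : ℝ) ≤ mf)) ((hcXF f).trans (hcYF f).symm)
  choose xf hxf yf hyf dxf dyf using exF
  simp only [hcXF] at dxf dyf
  set lab : P ⊕ Q ⊕ P × Bool × Fin 3 → ι :=
    Sum.elim (fun p => p.1.t) (Sum.elim (fun e => e.1.t) lab3) with hlab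
  set x : P ⊕ Q ⊕ P × Bool × Fin 3 → V := Sum.elim xb (Sum.elim xe xf) with hx
  set y : P ⊕ Q ⊕ P × Bool × Fin 3 → V := Sum.elim yb (Sum.elim ye yf) with hy
  have hbX : ∀ p : P, xb p ∈ p.1.X := fun p => (mem_sdiff.1 (mem_sdiff.1 (hxb p)).1).1
  have hbY : ∀ p : P, yb p ∈ p.1.Y := fun p => (mem_sdiff.1 (mem_sdiff.1 (hyb p)).1).1
  have hxA : ∀ a, x a ∈ A := by
    rintro (p | e | f)
    · exact hP.subX p.1 p.2 (hbX p)
    · exact hQ.subX e.1 e.2 (hxe e)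
    · exact (hlo.XFB f).trans (hlo.XBA _) (hxf f)
  have hyB : ∀ a, y a ∈ B := by
    rintro (p | e | f)
    · exact hP.subY p.1 p.2 (hbY p)
    · exact hQ.subY e.1 e.2 (hye e)
    · exact (hlo.YFB f).trans (hlo.YBB _) (hyf f)
  have hbase : ∀ p : P, cJ * N ≤ 3 * δ' / 32 * (p.1.X.card : ℝ) := fun p => by
    have h1 := mul_le_mul_of_nonneg_right hcJ1 hNr.le
    have h2 := mul_le_mul_of_nonneg_left (hPX p) (by positivity : 0 ≤ 3 * δ' / 32)
    have h3 : 0 ≤ δ' * (c1 * N) := by positivity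
    linarith
  have hextr : ∀ e : Q, cJ * N ≤ δ' / 4 * (e.1.X.card : ℝ) := fun e => by
    have h1 := mul_le_mul_of_nonneg_right hcJ2 hNr.le
    have h2 := mul_le_mul_of_nonneg_left (hQX e) (by positivity : 0 ≤ δ' / 4)
    linarith
  have hfl : cJ * N ≤ δ' / 4 * (mf : ℝ) := by
    have h1 := mul_le_mul_of_nonneg_right hcJ3 hNr.le
    have h2 := mul_le_mul_of_nonneg_left hmf1 (by positivity : 0 ≤ δ' / 4)
    linarith
  have hdgm : ∀ {t : ι} {v : V} {S T : Finset V} {k l : ℝ}, S ⊆ T → k ≤ l → l ≤ dg (R t) v S →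
      k ≤ dg (R t) v T := fun h1 h2 h3 => h2.trans (h3.trans (by exact_mod_cast dg_mono h1))
  have hyd : ∀ a, cJ * N ≤ dg (R (lab a)) (y a) A := by
    rintro (p | e | f)
    · exact hdgm (sdiff_subset.trans (sdiff_subset.trans (hP.subX p.1 p.2)))
        (hbase p) (hdY p _ (hbY p))
    · exact hdgm (hQ.subX e.1 e.2) (hextr e) (dye e)
    · exact hdgm ((hlo.XFB f).trans (hlo.XBA _)) hfl (dyf f)
  have hxd : ∀ a, cJ * N ≤ dg (R (lab a)) (x a) B := by
    rintro (p | e | f)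
    · exact hdgm (sdiff_subset.trans (sdiff_subset.trans (hP.subY p.1 p.2)))
        (hbase p) (hdX p _ (hbX p))
    · exact hdgm (hQ.subY e.1 e.2) (hextr e) (dxe e)
    · exact hdgm ((hlo.YFB f).trans (hlo.YBB _)) hfl (dxf f)
  obtain ⟨W, hWAB, hWc, hWb, hxyW, hclose⟩ := exists_links (ℓ := Λ cJ) (M := NJ * (Λ cJ + 2)) hcol
    hR₁ hAB₁ hbip₁ lab (fun a => hAA (hxA a)) (fun a => hBB (hyB a)) (by
      intro a b hab F hF
      have hF' : (F.card : ℝ) ≤ Φ cJ * N := le_trans (by exact_mod_cast hF) hT1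
      obtain ⟨s', h1, z', h2, l, h3⟩ := hL cJ hcJ0 (lab a) (A.filter (R (lab a) (y a)))
        (B.filter (R (lab a) (x b))) F (hyd a) (by rw [hab]; exact hxd b)
        (fun v hv => ⟨_, hRR _ _ _ (hD.symm _ (mem_filter.1 hv).2)⟩)
        (fun v hv => ⟨_, hRR _ _ _ (hD.symm _ (mem_filter.1 hv).2)⟩) hF'
      exact ⟨s', z', l, hRR _ _ _ (mem_filter.1 h1).2, hRR _ _ _ (mem_filter.1 h2).2,
        h3⟩)
    (Nat.mul_le_mul_right _ hJ)
  replace hWc : W.card ≤ w := hWc.trans (Nat.mul_le_mul_right _ hJ)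
  set z := ⌊4 * σ * N⌋₊ with hz
  have hz1 : (z : ℝ) ≤ 4 * σ * N := Nat.floor_le (by positivity)
  have hσ1N := mul_le_mul_of_nonneg_right hσ1 hNr.le
  have hσ2N := mul_le_mul_of_nonneg_right hσ2 hNr.le
  have hT5' : (w + 4 : ℝ) ≤ δ' / 64 * mf := hT5.trans (by
    have := mul_le_mul_of_nonneg_left hmf1 (by positivity : 0 ≤ δ' / 64)
    linarith)
  have hT4' : ∀ e : Q, (w + 4 : ℝ) ≤ δ' / 32 * e.1.X.card := fun e => hT4.trans (by
    have := mul_le_mul_of_nonneg_left (hQX e) (by positivity : 0 ≤ δ' / 32)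
    linarith)
  have hmfδ : δ' / 64 * (mf : ℝ) ≤ 1 / 64 * mf :=
    mul_le_mul_of_nonneg_right (by linarith) (Nat.cast_nonneg _)
  have hQδ : ∀ e : Q, δ' / 64 * (e.1.X.card : ℝ) ≤ 1 / 64 * e.1.X.card := fun e =>
    mul_le_mul_of_nonneg_right (by linarith) (Nat.cast_nonneg _)
  have hb1 : ∀ (p : P) (v : V) (T : Finset V), 3 * δ' / 32 * (p.1.X.card : ℝ) ≤ dg (R p.1.t) v T →
      2 * q1 p + 2 + (w + z) ≤ dg (R p.1.t) v T := by
    intro p v T h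
    have h1 := hq1 p
    have h2 := mul_le_mul_of_nonneg_left (hPX p) hδ'0.le
    have h3 : (2 * q1 p + 2 + (w + z) : ℝ) ≤ dg (R p.1.t) v T := by linarith
    exact_mod_cast h3
  have hb2 : ∀ (e : Q) (k : ℕ), δ' / 4 * (e.1.X.card : ℝ) ≤ k → w + 4 * q2 e + 4 ≤ k := by
    intro e k h
    have h1 := hq2' e
    have h2 := hT4' e
    have h3 : (w + 4 * q2 e + 4 : ℝ) ≤ k := by linarith
    exact_mod_cast h3
  have hb3 : ∀ k : ℕ, δ' / 4 * (mf : ℝ) ≤ k → w + 4 * qf + 4 ≤ k := by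
    intro k h
    have h3 : (w + 4 * qf + 4 : ℝ) ≤ k := by linarith
    exact_mod_cast h3
  have hE : ∀ e : Q, w + q2 e ≤ e.1.X.card := by
    intro e
    have h1 := hq2' e
    have h2 := hT4' e
    have h4 := hQδ e
    have h3 : (w + q2 e : ℝ) ≤ e.1.X.card := by linarith
    exact_mod_cast h3
  have hsumE : ((∑ e : Q, (w + q2 e) : ℕ) : ℝ) ≤ NJ * w + σ * N := by
    push_cast
    rw [sum_add_distrib, sum_const, card_univ, nsmul_eq_mul]
    refine add_le_add (mul_le_mul_of_nonneg_right ?_ (Nat.cast_nonneg _)) ?_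
    · have h1 : Fintype.card Q ≤ NJ := by
        simp only [Fintype.card_sum] at hJ
        omega
      exact_mod_cast h1
    · have h1 : ∑ e : Q, (q2 e : ℝ) ≤ ∑ e : Q, σ * (e.1.X.card : ℝ) :=
        sum_le_sum fun e _ => (hq2 e).trans
          (mul_le_mul_of_nonneg_right (min_le_left _ _) (Nat.cast_nonneg _))
      rw [← mul_sum, sum_coe_sort Q fun e => (e.X.card : ℝ)] at h1
      have h2 : (SX Q).card ≤ N := hD.cardA ▸ card_le_card (SX_subset hQ)
      rw [card_SX hQ] at h2
      have h3 : ∑ e ∈ Q, (e.X.card : ℝ) ≤ N := by exact_mod_cast h2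
      exact h1.trans (mul_le_mul_of_nonneg_left h3 hσ0.le)
  have hσ0N : min σ (1 / 8) * N ≤ σ * N := mul_le_mul_of_nonneg_right (min_le_left _ _) hNr.le
  have hσ8N : min σ (1 / 8) * N ≤ 1 / 8 * N := mul_le_mul_of_nonneg_right (min_le_right _ _) hNr.le
  have hzk : ∀ k : ℕ, (k : ℝ) ≤ 2 * (σ * N) → k + ∑ e : Q, (w + q2 e) ≤ z := by
    intro k hk
    refine Nat.le_floor ?_
    push_cast at hsumE ⊢
    linarith
  have hSX : univ.biUnion (fun p : P => p.1.X \ SX Q) ∪ univ.biUnion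
      (fun e : Q => e.1.X) = SX P ∪ SX Q := by
    ext v
    simp only [SX, mem_union, mem_biUnion, mem_univ, true_and,
      Subtype.exists, mem_sdiff, exists_prop]
    constructor
    · rintro (⟨p, hp, h1, -⟩ | h)
      · exact Or.inl ⟨p, hp, h1⟩
      · exact Or.inr h
    · intro h
      by_cases h' : ∃ a ∈ Q, v ∈ a.X
      · exact Or.inr h'
      · obtain ⟨p, hp, h1⟩ := h.resolve_right h'
        exact Or.inl ⟨p, hp, h1, h'⟩
  have hSY : univ.biUnion (fun p : P => p.1.Y \ SY Q) ∪ univ.biUnion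
      (fun e : Q => e.1.Y) = SY P ∪ SY Q := by
    ext v
    simp only [SY, mem_union, mem_biUnion, mem_univ, true_and,
      Subtype.exists, mem_sdiff, exists_prop]
    constructor
    · rintro (⟨p, hp, h1, -⟩ | h)
      · exact Or.inl ⟨p, hp, h1⟩
      · exact Or.inr h
    · intro h
      by_cases h' : ∃ a ∈ Q, v ∈ a.Y
      · exact Or.inr h'
      · obtain ⟨p, hp, h1⟩ := h.resolve_right h'
        exact Or.inl ⟨p, hp, h1, h'⟩
  have hrest : (1 - 3 * τ) * N ≤ ∑ p : P, ((p.1.X \ SX Q).card : ℝ) := by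
    rw [sum_coe_sort P fun p => ((p.X \ SX Q).card : ℝ)]
    exact hAug.sum_rest_ge hP hQ hD.cardA hτP
  have hcov : ∀ (v : V) (T F : Finset V) (Z : P → Finset V), T.card = N → (∀ p, Z p ⊆ T) →
      (∀ p p', p ≠ p' → Disjoint (Z p) (Z p')) → (∀ p, (Z p).card = (p.1.X \ SX Q).card) →
      (F.card : ℝ) ≤ 6 * γ * N → θ * N ≤ dg G.Adj v T →
      θ / 2 * A₁.card + (w + Fintype.card P : ℕ) ≤ dg G.Adj v (univ.biUnion fun p => Z p \ F) := by
    intro v T F Z hT hZ hZd hZc hF hv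
    have e1 : (univ.biUnion fun p => Z p \ F) = univ.biUnion Z \ F := by
      ext u; simp
    have h1 := dg_le_sdiff_add (R := G.Adj) v T (T \ univ.biUnion Z)
    have hsub : univ.biUnion Z ⊆ T := biUnion_subset.2 fun p _ => hZ p
    rw [Finset.sdiff_sdiff_eq_self hsub] at h1
    have h2 := dg_le_sdiff_add (R := G.Adj) v (univ.biUnion Z) F
    have h3 := card_sdiff_add_card_eq_card hsub
    rw [card_biUnion fun p _ p' _ => hZd p p', sum_congr rfl fun p _ => hZc p, hT] at h3
    have h4 : ((T \ univ.biUnion Z).card : ℝ) + ∑ p : P, ((p.1.X \ SX Q).card : ℝ) = N := by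
      exact_mod_cast h3
    have h5 : (dg G.Adj v T : ℝ) ≤ dg G.Adj v (univ.biUnion Z \ F) + F.card +
        (T \ univ.biUnion Z).card := by exact_mod_cast (by omega)
    have h6 : Fintype.card P ≤ NJ := by
      simp only [Fintype.card_sum] at hJ
      omega
    have h7 : ((w + Fintype.card P : ℕ) : ℝ) ≤ (w + NJ : ℕ) := by exact_mod_cast (by omega)
    have h8 := mul_le_mul_of_nonneg_right hτ3 hNr.le
    have h9 := mul_le_mul_of_nonneg_right hγ3 hNr.le
    have h10 := mul_le_mul_of_nonneg_left hN₁ (by positivity : 0 ≤ θ / 2)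
    have h11 := mul_le_mul_of_nonneg_left hσ8N (by positivity : 0 ≤ θ / 2)
    have h12 : 0 ≤ θ * N := by positivity
    rw [e1]
    linarith
  have hout : ∀ S S₁ Z : Finset V, S.card = N → S ⊆ S₁ → S₁.card = A₁.card →
      ((S \ Z).card : ℝ) ≤ σ * N → ((S₁ \ Z).card : ℝ) ≤ 2 * (σ * N) := by
    intro S S₁ Z hS hSS hS₁ h
    have h1 : (S₁ \ Z).card ≤ (S \ Z).card + (S₁ \ S).card := by
      refine (card_le_card fun v hv => ?_).trans (card_union_le _ _)
      rw [mem_sdiff] at hv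
      rw [mem_union, mem_sdiff, mem_sdiff]
      by_cases h : v ∈ S
      · exact Or.inl ⟨h, hv.2⟩
      · exact Or.inr ⟨hv.1, h⟩
    have h2 := card_sdiff_add_card_eq_card hSS
    have h3 : ((S₁ \ Z).card : ℝ) + N ≤ (S \ Z).card + A₁.card := by exact_mod_cast (by omega)
    linarith
  have hdR : ∀ {t : ι} {v : V} {T : Finset V} {k : ℕ}, k ≤ dg (R t) v T → k ≤ dg (R₁ t) v T :=
    fun h => h.trans (dg_rel_le (hRR _) _ _)
  refine CP.mono ((hlo.mono hAA hBB hAB₁ hc₁).cp hR₁ (lab := lab) (x := x) (y := y) (W := W) (w := w) (z := z) (N := A₁.card)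
    (s := s) (q1 := q1) (q2 := q2) (d := δ' / 4) (κ := θ / 2) hr (by positivity) (by positivity)
    (by linarith) le_rfl hWAB hWc hWb (fun a => (hxyW a).1) (fun a => (hxyW a).2) hclose
    hxb hyb hq10 (fun p => ((hreg1 p).subset sdiff_subset sdiff_subset).rel_mono (hRR _))
    (fun p v hv => hdR (hb1 p v _ (hdX p v (mem_sdiff.1 hv).1)))
    (fun p v hv => hdR (hb1 p v _ (hdY p v (mem_sdiff.1 hv).1)))
    hxe hye hq20 (fun e => (hreg2 e).rel_mono (hRR _)) (fun e => hdR (hb2 e _ (dxe e)))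
    (fun e => hdR (hb2 e _ (dye e))) hE ?_ hxf hyf hqf0 (fun f => (hreg3 f).rel_mono (hRR _))
    hcXF hcYF (fun f => hdR (hb3 _ (dxf f))) (fun f => hdR (hb3 _ (dyf f))) ?_ ?_ ?_ ?_ ?_ ?_ hs ?_)
    (by omega)
  · intro e
    have h1 := hq2' e
    have h2 := hT4' e
    rw [Nat.cast_sub (hE e)]
    push_cast
    have h3 : δ' / 4 * (w + q2 e : ℝ) ≤ 1 * (w + q2 e) :=
      mul_le_mul_of_nonneg_right (by linarith) (by positivity)
    linarith
  · have h1 : (mf : ℝ) - 1 ≤ 2 * (mf / 2 : ℕ) := by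
      have : mf ≤ 2 * (mf / 2) + 1 := by omega
      have : (mf : ℝ) ≤ 2 * (mf / 2 : ℕ) + 1 := by exact_mod_cast this
      linarith
    have h2 := mul_le_mul_of_nonneg_left h1 (by positivity : 0 ≤ δ' / 8)
    have h3 : (0 : ℝ) ≤ w := Nat.cast_nonneg _
    linarith
  · have h1 : (2 * (w + z + w + qf) : ℝ) ≤ mf := by linarith
    have h2 : 2 * (w + z + w + qf) ≤ mf := by exact_mod_cast h1
    omega
  · rw [hSX]
    exact hzk _ (hout A A₁ _ hD.cardA hAA rfl hσQ)
  · rw [hSY]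
    refine hzk _ (hout B B₁ _ hD.cardB hBB hc₁.symm ?_)
    rw [← hAug.card_left_eq hP hQ (hD.cardA.trans hD.cardB.symm)]
    exact hσQ
  · intro v hv
    exact hcov v B _ _ hD.cardB hlo.YBB hlo.dYB (fun p => (hlo.cB p).symm) hFY (hGA v hv)
  · intro v hv
    exact hcov v A _ _ hD.cardA hlo.XBA hlo.dXB (fun p => rfl) hFX (hGB v hv)
  · have hNA : (N : ℝ) ≤ A₁.card := by exact_mod_cast hD.cardA ▸ card_le_card hAA
    have h1 : ((s + 1) * (s + 1) * z : ℝ) < A₁.card := by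
      have h2 := mul_lt_mul_of_pos_right hσ3 hNr
      have h3 := mul_le_mul_of_nonneg_left hz1 (by positivity : (0 : ℝ) ≤ (s + 1) * (s + 1))
      linarith
    exact_mod_cast h1

end CoreTwo

section Components
open Finset
open scoped Classical

variable {V : Type*} {R : V → V → Prop}

/-- `u` and `v` are joined by an `R`-walk inside `S`. -/
def Cn (R : V → V → Prop) (S : Finset V) : V → V → Prop :=
  Relation.ReflTransGen fun a b => R a b ∧ a ∈ S ∧ b ∈ S

lemma Cn.mono {S T : Finset V} (h : S ⊆ T) {u v : V} (huv : Cn R S u v) : Cn R T u v := by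
  induction huv with
  | refl => exact .refl
  | tail _ h' ih => exact ih.tail ⟨h'.1, h h'.2.1, h h'.2.2⟩

lemma Cn.symm (hR : ∀ ⦃u v⦄, R u v → R v u) {S : Finset V} {u v : V} (huv : Cn R S u v) :
    Cn R S v u := by
  induction huv with
  | refl => exact .refl
  | tail _ h ih => exact Relation.ReflTransGen.head ⟨hR h.1, h.2.2, h.2.1⟩ ih

/-- Every subset of `C` has a large neighbourhood in `C` unless it fills almost all of `C`. -/
def Robust (R : V → V → Prop) (k : ℕ) (C : Finset V) : Prop :=
  ∀ T ⊆ C, 2 * T.card * ((C \ T) \ (C \ T).filter fun v => ∃ t ∈ T, R t v).card ≤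
    k * ((C \ T).filter fun v => ∃ t ∈ T, R t v).card

/-- After deleting few vertices every connected component becomes robust. -/
theorem exists_robust (hR : ∀ ⦃u v⦄, R u v → R v u) (U : Finset V) (L : ℕ) :
    ∃ S ⊆ U, L * (U \ S).card ≤ U.card ∧
      ∀ u ∈ S, Robust R (L * U.card) (S.filter (Cn R S u)) := by
  set pairs : Finset V → Finset (V × V) := fun S => (S ×ˢ S).filter fun p => Cn R S p.1 p.2
    with hpairs
  obtain ⟨S, hS, hmin⟩ := U.powerset.exists_min_image
    (fun S => L * U.card * (U \ S).card + (pairs S).card) ⟨∅, by simp⟩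
  rw [mem_powerset] at hS
  refine ⟨S, hS, ?_, ?_⟩
  · rcases Nat.eq_zero_or_pos U.card with h0 | h0
    · have := card_le_card (sdiff_subset (s := U) (t := S))
      have : (U \ S).card = 0 := by omega
      simp [this]
    have h1 := hmin U (by simp)
    have h2 : (pairs U).card ≤ U.card * U.card :=
      (card_filter_le _ _).trans_eq (card_product _ _)
    simp only [Finset.sdiff_self, card_empty] at h1
    refine Nat.le_of_mul_le_mul_left (?_ : U.card * _ ≤ U.card * _) h0
    nlinarith
  · intro u hu T hT
    set C := S.filter (Cn R S u) with hC
    set W := (C \ T).filter fun v => ∃ t ∈ T, R t v with hW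
    have hCS : C ⊆ S := filter_subset _ _
    have hWS : W ⊆ S := (filter_subset _ _).trans (sdiff_subset.trans hCS)
    have h1 := hmin (S \ W) (mem_powerset.2 (sdiff_subset.trans hS))
    have hE : (U \ (S \ W)).card = (U \ S).card + W.card := by
      have e1 := card_sdiff_add_card_eq_card (sdiff_subset.trans hS : S \ W ⊆ U)
      have e2 := card_sdiff_add_card_eq_card hS
      have e3 := card_sdiff_add_card_eq_card hWS
      omega
    have hstay : ∀ a ∈ T, ∀ b, Cn R (S \ W) a b → b ∈ T := by
      intro a ha b hab
      induction hab with
      | refl => exact ha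
      | @tail b' c' _ hbc ih =>
        by_contra hcT
        have hcS := mem_sdiff.1 hbc.2.2
        have hb := mem_filter.1 (hT ih)
        refine hcS.2 (mem_filter.2 ⟨mem_sdiff.2 ⟨mem_filter.2 ⟨hcS.1, ?_⟩, hcT⟩,
          b', ih, hbc.1⟩)
        exact hb.2.tail ⟨hbc.1, hb.1, hcS.1⟩
    set Z := (C \ T) \ W with hZ
    have hZC : Z ⊆ C := sdiff_subset.trans sdiff_subset
    have hZT : Disjoint T Z := disjoint_left.2 fun v h2 h3 =>
      (mem_sdiff.1 (mem_sdiff.1 h3).1).2 h2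
    have hcon : ∀ a ∈ C, ∀ b ∈ C, (a, b) ∈ pairs S := by
      intro a ha b hb
      rw [hC, mem_filter] at ha hb
      exact mem_filter.2 ⟨mk_mem_product ha.1 hb.1, (Cn.symm hR ha.2).trans hb.2⟩
    have hsub : pairs (S \ W) ∪ (T ×ˢ Z ∪ Z ×ˢ T) ⊆ pairs S := by
      intro p hp
      rcases mem_union.1 hp with h | h
      · have h' := mem_filter.1 h
        have h'' := mem_product.1 h'.1
        exact mem_filter.2 ⟨mem_product.2 ⟨(mem_sdiff.1 h''.1).1,
          (mem_sdiff.1 h''.2).1⟩, Cn.mono sdiff_subset h'.2⟩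
      · rcases mem_union.1 h with h' | h' <;> have h'' := mem_product.1 h'
        · exact hcon _ (hT h''.1) _ (hZC h''.2)
        · exact hcon _ (hZC h''.1) _ (hT h''.2)
    have hdis : Disjoint (pairs (S \ W)) (T ×ˢ Z ∪ Z ×ˢ T) := by
      refine disjoint_left.2 fun p hp h => ?_
      have h' := (mem_filter.1 hp).2
      rcases mem_union.1 h with h2 | h2 <;> have h3 := mem_product.1 h2
      · exact disjoint_left.1 hZT (hstay _ h3.1 _ h') h3.2
      · exact disjoint_left.1 hZT (hstay _ h3.2 _ (Cn.symm hR h')) h3.1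
    have hdis2 : Disjoint (T ×ˢ Z) (Z ×ˢ T) := disjoint_left.2 fun p h2 h3 =>
      disjoint_left.1 hZT (mem_product.1 h2).1 (mem_product.1 h3).1
    have h2 := card_le_card hsub
    rw [card_union_of_disjoint hdis, card_union_of_disjoint hdis2,
      card_product, card_product] at h2
    rw [hE] at h1
    nlinarith

/-- In a robust set any two large subsets are joined by a short path avoiding a small set. -/
theorem Robust.exists_path {C : Finset V} {L M : ℕ} (h : Robust R (L * M) C) (hL : 0 < L) {N : ℕ}
    (hN : 0 < N) (hM : M ≤ 2 * N) (hCM : C.card ≤ M) {c : ℝ} (hc : 0 < c) {X Y F : Finset V}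
    (hX : X ⊆ C) (hY : Y ⊆ C) (hXc : c * N ≤ X.card) (hYc : c * N ≤ Y.card)
    (hF : (F.card : ℝ) ≤ c ^ 2 / (16 * L) * N) :
    ∃ s ∈ X, ∃ z ∈ Y, ∃ l, Pth (fun u v => R u v ∧ u ∈ C ∧ v ∈ C) s z l ∧ l.Nodup ∧
      l.length ≤ ⌈2 / (c ^ 2 / (16 * L))⌉₊ + 1 ∧ ∀ v ∈ l, v ∉ F := by
  set g := c ^ 2 / (16 * L) with hg
  have hNr : (0 : ℝ) < N := by exact_mod_cast hN
  have hLr : (1 : ℝ) ≤ L := by exact_mod_cast hL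
  have hg0 : 0 < g := by positivity
  have hgL : g * (16 * L) = c ^ 2 := by rw [hg]; field_simp
  have hMr : (M : ℝ) ≤ 2 * N := by exact_mod_cast hM
  have hCr : (C.card : ℝ) ≤ 2 * N := le_trans (by exact_mod_cast hCM) hMr
  have hc2 : c ≤ 2 := by
    have h1 : (X.card : ℝ) ≤ C.card := by exact_mod_cast card_le_card hX
    have h2 : c * N ≤ 2 * N := by linarith
    exact le_of_mul_le_mul_right h2 hNr
  have hgc : 8 * g ≤ c := by
    have : g * 16 ≤ g * (16 * L) := mul_le_mul_of_nonneg_left (by linarith) hg0.le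
    nlinarith
  have hgcN : 8 * g * N ≤ c * N := mul_le_mul_of_nonneg_right hgc hNr.le
  have hgN : 0 < g * N := by positivity
  set k := ⌈2 / g⌉₊ with hk
  have hkg : 2 ≤ k * g := by
    have := Nat.le_ceil (2 / g)
    rwa [div_le_iff₀ hg0] at this
  by_contra hcon
  have hstep : ∀ j ≤ k, ∃ T ⊆ C \ F, c / 2 * N + j * (g * N) ≤ T.card ∧ ∀ v ∈ T, ∃ s ∈ X, ∃ l,
      Pth (fun u v => R u v ∧ u ∈ C ∧ v ∈ C) s v l ∧ l.Nodup ∧ l.length ≤ j + 1 ∧ ∀ u ∈ l, u ∈ T := by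
    intro j
    induction j with
    | zero =>
      intro _
      refine ⟨X \ F, sdiff_subset_sdiff hX subset_rfl, ?_, fun v hv =>
        ⟨v, (mem_sdiff.1 hv).1, [v], Pth.single v, by simp, by simp, by simpa using hv⟩⟩
      have h1 := le_card_sdiff F X
      have h2 : (X.card : ℝ) ≤ (X \ F).card + F.card := by exact_mod_cast (by omega)
      push_cast
      linarith
    | succ j ih =>
      intro hj
      obtain ⟨T, hT, hTc, hTl⟩ := ih (by omega)
      have hTC : T ⊆ C := hT.trans sdiff_subset
      have hjg : 0 ≤ j * (g * N) := by positivity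
      have hYT : Disjoint Y T := disjoint_left.2 fun z hz hzT => by
        obtain ⟨s, hs, l, h1, h2, h3, h4⟩ := hTl z hzT
        exact hcon ⟨s, hs, z, hz, l, h1, h2, by omega, fun v hv =>
          (mem_sdiff.1 (hT (h4 v hv))).2⟩
      set W := (C \ T).filter fun v => ∃ t ∈ T, R t v with hW
      have hWC : W ⊆ C \ T := filter_subset _ _
      have hrob := h T hTC
      rw [← hW] at hrob
      have hCT : (Y.card : ℝ) ≤ (C \ T).card := by
        exact_mod_cast card_le_card fun v hv => mem_sdiff.2 ⟨hY hv,
          disjoint_left.1 hYT hv⟩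
      have hsd : (((C \ T) \ W).card : ℝ) + W.card = (C \ T).card := by
        exact_mod_cast card_sdiff_add_card_eq_card hWC
      have hWbig : 2 * (g * N) ≤ W.card := by
        by_contra hlt
        push Not at hlt
        have h1 : c / 4 * N ≤ ((C \ T) \ W).card := by linarith
        have h2 : c / 2 * N ≤ T.card := by linarith
        have h3 : (2 * T.card * ((C \ T) \ W).card : ℝ) ≤ L * M * W.card := by exact_mod_cast hrob
        have h4 : c / 2 * N * (c / 4 * N) ≤ T.card * ((C \ T) \ W).card :=
          mul_le_mul h2 h1 (by positivity) (by positivity)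
        have h5 : (L * M * W.card : ℝ) ≤ L * (2 * N) * W.card :=
          mul_le_mul_of_nonneg_right (mul_le_mul_of_nonneg_left hMr (by positivity)) (by positivity)
        have h6 : (L * (2 * N) * W.card : ℝ) < L * (2 * N) * (2 * (g * N)) :=
          mul_lt_mul_of_pos_left hlt (by positivity)
        have h7 : L * (2 * N) * (2 * (g * N)) = c ^ 2 / 4 * N * N := by
          rw [← hgL]; ring
        nlinarith
      refine ⟨T ∪ (W \ F), ?_, ?_, ?_⟩
      · exact union_subset hT (sdiff_subset_sdiff (hWC.trans sdiff_subset)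
          subset_rfl)
      · rw [card_union_of_disjoint (disjoint_left.2 fun v h1 h2 =>
          (mem_sdiff.1 (hWC (mem_sdiff.1 h2).1)).2 h1)]
        have h1 := le_card_sdiff F W
        have h2 : (W.card : ℝ) ≤ (W \ F).card + F.card := by exact_mod_cast (by omega)
        push_cast
        linarith
      · intro v hv
        rcases mem_union.1 hv with h1 | h1
        · obtain ⟨s, hs, l, h2, h3, h4, h5⟩ := hTl v h1
          exact ⟨s, hs, l, h2, h3, by omega, fun u hu => mem_union_left _ (h5 u hu)⟩
        · have hvW := (mem_sdiff.1 h1).1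
          have hvC := mem_sdiff.1 (hWC hvW)
          obtain ⟨t, ht, htv⟩ := (mem_filter.1 hvW).2
          obtain ⟨s, hs, l, h2, h3, h4, h5⟩ := hTl t ht
          refine ⟨s, hs, l ++ [v], h2.append (Pth.single v) ⟨htv, hTC ht, hvC.1⟩, ?_, ?_, ?_⟩
          · rw [List.nodup_append']
            refine ⟨h3, by simp, ?_⟩
            simp only [List.disjoint_singleton]
            exact fun hvl => hvC.2 (h5 v hvl)
          · simp only [List.length_append, List.length_singleton]
            omega
          · intro u hu
            rcases List.mem_append.1 hu with h6 | h6
            · exact mem_union_left _ (h5 u h6)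
            · rw [List.mem_singleton.1 h6]
              exact hv
  obtain ⟨T, hT, hTc, -⟩ := hstep k le_rfl
  have h1 : (T.card : ℝ) ≤ C.card := by
    exact_mod_cast card_le_card (hT.trans sdiff_subset)
  have h2 : 2 * N ≤ k * g * N := mul_le_mul_of_nonneg_right hkg hNr.le
  have h3 : 0 < c / 2 * N := by positivity
  linarith

end Components

section CoreThm
open Finset
open scoped Classical

variable {V : Type} {R : V → V → Prop}

/-- The components of `R` inside `S` with at least `b` vertices. -/
noncomputable def comps (R : V → V → Prop) (S : Finset V) (b : ℝ) : Finset (Finset V) :=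
  (S.image fun u => S.filter (Cn R S u)).filter fun C => b ≤ C.card

lemma comps.eq (hR : ∀ ⦃u v⦄, R u v → R v u) {S C : Finset V} {b : ℝ} (hC : C ∈ comps R S b) {v : V}
    (hv : v ∈ C) : C = S.filter (Cn R S v) := by
  obtain ⟨u, -, rfl⟩ := mem_image.1 (mem_filter.1 hC).1
  have huv := (mem_filter.1 hv).2
  ext w
  simp only [mem_filter, and_congr_right_iff]
  exact fun _ => ⟨fun h => (Cn.symm hR huv).trans h, fun h => Relation.ReflTransGen.trans huv h⟩

lemma comps.subset {S C : Finset V} {b : ℝ} (hC : C ∈ comps R S b) : C ⊆ S := by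
  obtain ⟨u, -, rfl⟩ := mem_image.1 (mem_filter.1 hC).1
  exact filter_subset _ _

lemma comps.card_mul_le (hR : ∀ ⦃u v⦄, R u v → R v u) (S : Finset V) (b : ℝ) :
    (comps R S b).card * b ≤ S.card := by
  have h1 : ((comps R S b).biUnion id).card = ∑ C ∈ comps R S b, C.card :=
    card_biUnion fun C hC D hD hne => disjoint_left.2 fun v h1 h2 =>
      hne ((comps.eq hR hC h1).trans (comps.eq hR hD h2).symm)
  have h2 : ((comps R S b).biUnion id).card ≤ S.card :=
    card_le_card (biUnion_subset.2 fun C hC => comps.subset hC)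
  have h3 : ((comps R S b).card : ℝ) * b ≤ ∑ C ∈ comps R S b, (C.card : ℝ) := by
    rw [← nsmul_eq_mul]
    exact card_nsmul_le_sum _ _ _ fun C hC => (mem_filter.1 hC).2
  refine h3.trans ?_
  rw [h1] at h2
  exact_mod_cast h2

/-- The relation that an `R`-edge lies within one of the large components. -/
def CRel {r : ℕ} (R : Fin r → V → V → Prop) (S : Fin r → Finset V) (b : ℝ)
    (t : (i : Fin r) × {C // C ∈ comps (R i) (S i) b}) (u v : V) : Prop :=
  R t.1 u v ∧ u ∈ t.2.1 ∧ v ∈ t.2.1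

lemma card_comps_le {r : ℕ} {R : Fin r → V → V → Prop} (hR : ∀ i, ∀ ⦃u v⦄, R i u v → R i v u)
    {S : Fin r → Finset V} {U : Finset V} (hS : ∀ i, S i ⊆ U) (b : ℝ) :
    Fintype.card ((i : Fin r) × {C // C ∈ comps (R i) (S i) b}) * b ≤ r * U.card := by
  rw [Fintype.card_sigma]
  push_cast
  rw [sum_mul]
  have h : ∀ i ∈ (univ : Finset (Fin r)),
      (Fintype.card {C // C ∈ comps (R i) (S i) b} : ℝ) * b ≤ U.card := by
    intro i _
    rw [Fintype.card_coe]
    exact (comps.card_mul_le (hR i) _ _).trans (by exact_mod_cast card_le_card (hS i))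
  refine (sum_le_card_nsmul _ _ _ h).trans_eq ?_
  simp

lemma CRel.sum_le {r : ℕ} {R : Fin r → V → V → Prop} (hR : ∀ i, ∀ ⦃u v⦄, R i u v → R i v u)
    (hdis : ∀ i j u v, R i u v → R j u v → i = j) {S : Fin r → Finset V} {b : ℝ} (v : V)
    (T : Finset V) : ∑ t, dg (CRel R S b t) v T ≤ T.card := by
  unfold dg
  rw [← card_biUnion]
  · exact card_le_card (biUnion_subset.2 fun t _ => filter_subset _ _)
  · rintro ⟨i, C, hC⟩ - ⟨j, D, hD⟩ - hne
    refine disjoint_left.2 fun w h1 h2 => hne ?_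
    have h1' := (mem_filter.1 h1).2
    have h2' := (mem_filter.1 h2).2
    obtain rfl : i = j := hdis _ _ _ _ h1'.1 h2'.1
    obtain rfl : C = D := (comps.eq (hR i) hC h1'.2.1).trans (comps.eq (hR i) hD h2'.2.1).symm
    rfl

/-- A vertex that survives in all colours loses few edges when passing to large components. -/
lemma CRel.dg_le {r : ℕ} {R : Fin r → V → V → Prop} {S : Fin r → Finset V} {b : ℝ} (hb : 0 ≤ b)
    {v : V} {T : Finset V} (hv : ∀ i, v ∈ S i) (hT : ∀ i, T ⊆ S i) (Q : V → V → Prop)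
    (hQ : ∀ w ∈ T, Q v w → ∃ i, R i v w) :
    (dg Q v T : ℝ) ≤ ∑ t, (dg (CRel R S b t) v T : ℝ) + r * b := by
  set bad : Fin r → Finset V := fun i =>
    if ((S i).filter (Cn (R i) (S i) v)).card < b then (S i).filter (Cn (R i) (S i) v) else ∅
    with hbad
  have hsub : T.filter (Q v) ⊆ (univ.biUnion fun t => T.filter (CRel R S b t v)) ∪
      univ.biUnion bad := by
    intro w hw
    obtain ⟨hwT, hQw⟩ := mem_filter.1 hw
    obtain ⟨i, hi⟩ := hQ w hwT hQw
    have hmem : w ∈ (S i).filter (Cn (R i) (S i) v) := mem_filter.2 ⟨hT i hwT,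
      Relation.ReflTransGen.single ⟨hi, hv i, hT i hwT⟩⟩
    by_cases hlt : ((S i).filter (Cn (R i) (S i) v)).card < b
    · refine mem_union_right _ (mem_biUnion.2 ⟨i, mem_univ _, ?_⟩)
      rw [hbad]
      dsimp only
      rwa [if_pos hlt]
    · push Not at hlt
      refine mem_union_left _ (mem_biUnion.2 ⟨⟨i, (S i).filter (Cn (R i) (S i) v),
        mem_filter.2 ⟨mem_image.2 ⟨v, hv i, rfl⟩, hlt⟩⟩, mem_univ _,
        mem_filter.2 ⟨hwT, hi, mem_filter.2 ⟨hv i, .refl⟩, hmem⟩⟩)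
  have h1 : dg Q v T ≤ ∑ t, dg (CRel R S b t) v T + ∑ i, (bad i).card :=
    (card_le_card hsub).trans ((card_union_le _ _).trans
      (Nat.add_le_add card_biUnion_le card_biUnion_le))
  have h2 : ∑ i, ((bad i).card : ℝ) ≤ r * b := by
    refine (sum_le_card_nsmul _ _ b fun i _ => ?_).trans_eq (by simp)
    rw [hbad]
    dsimp only
    split_ifs with h
    · exact h.le
    · simpa using hb
  have h3 : (dg Q v T : ℝ) ≤ ∑ t, (dg (CRel R S b t) v T : ℝ) + ∑ i, ((bad i).card : ℝ) := by
    exact_mod_cast h1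
  linarith

end CoreThm

section CoreThmTwo
open Finset
open scoped Classical

/-- `A` and `B` have large cross degrees and no large sparse rectangle. -/
structure Core {V : Type} (G : SimpleGraph V) (A B : Finset V) (θ η : ℝ) (N : ℕ) : Prop where
  disj : Disjoint A B
  cardA : A.card = N
  cardB : B.card = N
  degA : ∀ v ∈ A, θ * N ≤ dg G.Adj v B
  degB : ∀ v ∈ B, θ * N ≤ dg G.Adj v A
  dense : ∀ S ⊆ A, ∀ T ⊆ B, (θ - η) * N ≤ S.card → (θ - η) * N ≤ T.card →
    (∀ u ∈ S, (dg G.Adj u T : ℝ) ≤ η * N) → (∀ v ∈ T, (dg G.Adj v S : ℝ) ≤ η * N) → False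

lemma dg_congr {V : Type*} {R R' : V → V → Prop} {v : V} {T : Finset V}
    (h : ∀ w ∈ T, R v w ↔ R' v w) : dg R v T = dg R' v T :=
  congrArg card (filter_congr h)

lemma card_filter_mul_le {V : Type*} (S : Finset V) (f : V → ℝ) (hf : ∀ v ∈ S, 0 ≤ f v) (x : ℝ) :
    (S.filter fun v => x < f v).card * x ≤ ∑ v ∈ S, f v := by
  refine le_trans ?_ (sum_le_sum_of_subset_of_nonneg (filter_subset (fun v => x < f v) S)
    fun v hv _ => hf v hv)
  rw [← nsmul_eq_mul]
  exact card_nsmul_le_sum _ _ _ fun v hv => (mem_filter.1 hv).2.le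

set_option maxHeartbeats 1600000 in
theorem Core.exists_cp (r K s : ℕ) (hr : 0 < r) {θ η : ℝ} (hη : 0 < η) (hηθ : η ≤ θ) (hθ : θ ≤ 1)
    (hK : 16 * r ^ 2 / η ≤ K) (hs : 6 * r ≤ θ * (s + 1)) :
    ∃ N0 : ℕ, ∀ {V : Type} {G : SimpleGraph V} {c : Sym2 V → Fin r} {A B : Finset V} {N : ℕ},
      N0 ≤ N → Core G A B θ η N → CP G c ↑(A ∪ B) (K + (r * s + r * s)) := by
  have hθ0 : 0 < θ := by linarith
  have hrr : (0 : ℝ) < r := by exact_mod_cast hr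
  obtain ⟨σ0, hσ0, hcp⟩ := DenseSys.exists_cp K r s hr (η := η / 4) (δ := η ^ 2 / 8)
    (θ := θ - η / 4) (by positivity) (by linarith) (by positivity) (by linarith)
    (hs := by
      have : (0 : ℝ) ≤ s + 1 := by positivity
      nlinarith)
  set ε := min (η / 8) (σ0 / 2) with hε
  have hε0 : 0 < ε := by positivity
  have hε1 : ε ≤ η / 8 := min_le_left _ _
  have hε2 : ε ≤ σ0 / 2 := min_le_right _ _
  obtain ⟨L, hL⟩ := exists_nat_ge (2 * r / ε)
  have hL0 : 0 < L := by
    have : (0 : ℝ) < L := lt_of_lt_of_le (by positivity) hL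
    exact_mod_cast this
  have hLr : (0 : ℝ) < L := by exact_mod_cast hL0
  obtain ⟨N0, hN0⟩ := hcp (fun c => (c / 2) ^ 2 / (16 * L)) (fun c hc => by positivity)
    (fun c => ⌈2 / ((c / 2) ^ 2 / (16 * L))⌉₊ + 1)
  refine ⟨2 * N0 + 1, ?_⟩
  intro V G c A B N hN hC
  have hNr : (0 : ℝ) < N := by exact_mod_cast (by omega : 0 < N)
  set U := A ∪ B with hU
  have hUc : U.card = 2 * N := by
    rw [hU, card_union_of_disjoint hC.disj, hC.cardA, hC.cardB]; ring
  set Q : Fin r → V → V → Prop := fun i u v =>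
    Rc G c i u v ∧ ((u ∈ A ∧ v ∈ B) ∨ (u ∈ B ∧ v ∈ A)) with hQ
  have hQs : ∀ i, ∀ ⦃u v⦄, Q i u v → Q i v u := fun i u v h =>
    ⟨Rc.symm h.1, h.2.symm.imp And.symm And.symm⟩
  have hQd : ∀ i j u v, Q i u v → Q j u v → i = j := fun i j u v h1 h2 =>
    h1.1.2.symm.trans h2.1.2
  have hrob := fun i => exists_robust (hQs i) U L
  choose S hSU hSc hSr using hrob
  set E := univ.biUnion fun i => U \ S i with hE
  have hEc : (E.card : ℝ) ≤ ε * N := by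
    have h1 : (E.card : ℝ) * L ≤ r * (2 * N) := by
      have h2 : E.card * L ≤ r * (2 * N) := by
        calc E.card * L ≤ (∑ i, (U \ S i).card) * L := Nat.mul_le_mul_right _ card_biUnion_le
          _ = ∑ i, L * (U \ S i).card := by rw [sum_mul]; simp only [mul_comm]
          _ ≤ ∑ _i : Fin r, 2 * N := sum_le_sum fun i _ => (hSc i).trans_eq hUc
          _ = r * (2 * N) := by simp
      exact_mod_cast h2
    rw [div_le_iff₀ hε0] at hL
    have h3 : (E.card : ℝ) * L ≤ (ε * N) * L := by nlinarith
    exact le_of_mul_le_mul_right h3 hLr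
  have hES : ∀ v ∈ U, v ∉ E → ∀ i, v ∈ S i := by
    intro v hv hvE i
    by_contra hcon
    exact hvE (mem_biUnion.2 ⟨i, mem_univ _, mem_sdiff.2 ⟨hv, hcon⟩⟩)
  have hEN : (E.card : ℝ) ≤ 1 / 8 * N := hEc.trans (mul_le_mul_of_nonneg_right (by linarith) hNr.le)
  have hEN' : 2 * E.card ≤ N := by
    have : (2 * E.card : ℝ) ≤ N := by linarith
    exact_mod_cast this
  obtain ⟨n, hn⟩ : ∃ n, n + E.card = N := ⟨N - E.card, by omega⟩
  have hnr : (n : ℝ) + E.card = N := by exact_mod_cast hn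
  have hn0 : (0 : ℝ) < n := by linarith
  have hsubs : ∀ X : Finset V, X.card = N → ∃ Y ⊆ X \ E, Y.card = n := fun X hX =>
    exists_subset_card_eq (by have := le_card_sdiff E X; omega)
  obtain ⟨A', hA', hA'c⟩ := hsubs A hC.cardA
  obtain ⟨B', hB', hB'c⟩ := hsubs B hC.cardB
  have hA'A : A' ⊆ A := hA'.trans sdiff_subset
  have hB'B : B' ⊆ B := hB'.trans sdiff_subset
  have hA'S : ∀ i, A' ⊆ S i := fun i v hv => hES v (mem_union_left _ (hA'A hv))
    (mem_sdiff.1 (hA' hv)).2 i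
  have hB'S : ∀ i, B' ⊆ S i := fun i v hv => hES v (mem_union_right _ (hB'B hv))
    (mem_sdiff.1 (hB' hv)).2 i
  set b := η / (8 * r) * N with hb
  have hb0 : 0 < b := by positivity
  have hrb : r * b = η / 8 * N := by rw [hb]; field_simp
  have hEη : (E.card : ℝ) ≤ η / 8 * N := hEc.trans (mul_le_mul_of_nonneg_right hε1 hNr.le)
  have hdrop : ∀ (v : V) (X Y : Finset V), Y ⊆ X → X.card = N → Y.card = n →
      (dg G.Adj v X : ℝ) ≤ dg G.Adj v Y + E.card := by
    intro v X Y hYX hX hY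
    have h1 := dg_le_sdiff_add (R := G.Adj) v X (X \ Y)
    rw [Finset.sdiff_sdiff_eq_self hYX] at h1
    have h2 := card_sdiff_add_card_eq_card hYX
    exact_mod_cast (by omega)
  have hgA : ∀ v ∈ A', ∀ T ⊆ B', (dg G.Adj v T : ℝ) ≤ ∑ t, (dg (CRel Q S b t) v T : ℝ) + η / 8 * N :=
    fun v hv T hT => hrb ▸ CRel.dg_le hb0.le (fun i => hA'S i hv) (fun i => hT.trans (hB'S i)) _
      fun w hw hvw => ⟨c s(v, w), ⟨hvw, rfl⟩, Or.inl ⟨hA'A hv, hB'B (hT hw)⟩⟩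
  have hgB : ∀ v ∈ B', ∀ T ⊆ A', (dg G.Adj v T : ℝ) ≤ ∑ t, (dg (CRel Q S b t) v T : ℝ) + η / 8 * N :=
    fun v hv T hT => hrb ▸ CRel.dg_le hb0.le (fun i => hB'S i hv) (fun i => hT.trans (hA'S i)) _
      fun w hw hvw => ⟨c s(v, w), ⟨hvw, rfl⟩, Or.inr ⟨hB'B hv, hA'A (hT hw)⟩⟩
  set R : ((i : Fin r) × {C // C ∈ comps (Q i) (S i) b}) → V → V → Prop := fun t u v =>
    CRel Q S b t u v ∧ ((u ∈ A' ∧ v ∈ B') ∨ (u ∈ B' ∧ v ∈ A')) with hR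
  have hRA : ∀ t, ∀ v ∈ A', ∀ T ⊆ B', dg (R t) v T = dg (CRel Q S b t) v T := by
    intro t v hv T hT
    exact dg_congr fun w hw => ⟨fun h => h.1, fun h => ⟨h, Or.inl ⟨hv, hT hw⟩⟩⟩
  have hRB : ∀ t, ∀ v ∈ B', ∀ T ⊆ A', dg (R t) v T = dg (CRel Q S b t) v T := by
    intro t v hv T hT
    exact dg_congr fun w hw => ⟨fun h => h.1, fun h => ⟨h, Or.inr ⟨hv, hT hw⟩⟩⟩
  have hCs : ∀ t, ∀ ⦃u v⦄, CRel Q S b t u v → CRel Q S b t v u := fun t u v h =>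
    ⟨hQs _ h.1, h.2.2, h.2.1⟩
  have hRs : ∀ t, ∀ ⦃u v⦄, R t u v → R t v u := fun t u v h =>
    ⟨hCs t h.1, h.2.symm.imp And.symm And.symm⟩
  have hnN : (n : ℝ) ≤ N := by linarith [(Nat.cast_nonneg E.card : (0 : ℝ) ≤ E.card)]
  have hθn : (θ - η / 4) * n ≤ (θ - η / 4) * N := mul_le_mul_of_nonneg_left hnN (by linarith)
  have hD : DenseSys A' B' R (θ - η / 4) (η / 4) (η ^ 2 / 8) n := by
    refine ⟨hC.disj.mono hA'A hB'B, hA'c, hB'c, hRs, fun t u v h => h.2, ?_, ?_, ?_, ?_⟩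
    · intro v T
      exact (sum_le_sum fun t _ => dg_rel_le (fun _ _ h => h.1) v T).trans
        (CRel.sum_le hQs hQd v T)
    · intro v hv
      rw [sum_congr rfl fun t _ => congrArg Nat.cast (hRA t v hv B' subset_rfl)]
      have h1 := hgA v hv B' subset_rfl
      have h2 := hdrop v B B' hB'B hC.cardB hB'c
      have h3 := hC.degA v (hA'A hv)
      linarith
    · intro v hv
      rw [sum_congr rfl fun t _ => congrArg Nat.cast (hRB t v hv A' subset_rfl)]
      have h1 := hgB v hv A' subset_rfl
      have h2 := hdrop v A A' hA'A hC.cardA hA'c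
      have h3 := hC.degB v (hB'B hv)
      linarith
    · intro X hX Y hY hXc hYc
      by_contra hlt
      push Not at hlt
      have hsX : ∑ v ∈ X, ∑ t, (dg (R t) v Y : ℝ) < η ^ 2 / 8 * (n * n) := by
        rw [sum_comm]
        refine lt_of_eq_of_lt (sum_congr rfl fun t _ => ?_) hlt
        unfold ed
        push_cast
        rfl
      have hsY : ∑ v ∈ Y, ∑ t, (dg (R t) v X : ℝ) < η ^ 2 / 8 * (n * n) := by
        rw [sum_comm]
        refine lt_of_eq_of_lt (sum_congr rfl fun t _ => ?_) hlt
        rw [ed_comm (hRs t)]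
        unfold ed
        push_cast
        rfl
      have hnn : (n : ℝ) * n ≤ N * N := mul_le_mul hnN hnN hn0.le hNr.le
      have hcut : ∀ Z Z' : Finset V, ∑ v ∈ Z, ∑ t, (dg (R t) v Z' : ℝ) < η ^ 2 / 8 * (n * n) →
          (θ - η / 4 - η / 4) * n ≤ Z.card →
          (θ - η) * N ≤ (Z \ Z.filter fun v => η / 2 * N < ∑ t, (dg (R t) v Z' : ℝ)).card := by
        intro Z Z' h1 h2
        have h3 := card_filter_mul_le Z (fun v => ∑ t, (dg (R t) v Z' : ℝ))
          (fun v _ => sum_nonneg fun t _ => Nat.cast_nonneg _) (η / 2 * N)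
        have h4 : ((Z.filter fun v => η / 2 * N < ∑ t, (dg (R t) v Z' : ℝ)).card : ℝ) ≤
            η / 4 * N := by
          have h5 : ((Z.filter fun v => η / 2 * N < ∑ t, (dg (R t) v Z' : ℝ)).card : ℝ) *
              (η / 2 * N) ≤ η / 4 * N * (η / 2 * N) := by
            have := mul_le_mul_of_nonneg_left hnn (by positivity : 0 ≤ η ^ 2 / 8)
            nlinarith
          exact le_of_mul_le_mul_right h5 (by positivity)
        have h6 : ((Z \ Z.filter fun v => η / 2 * N < ∑ t, (dg (R t) v Z' : ℝ)).card : ℝ) +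
            (Z.filter fun v => η / 2 * N < ∑ t, (dg (R t) v Z' : ℝ)).card = Z.card := by
          exact_mod_cast card_sdiff_add_card_eq_card (filter_subset _ _)
        have h7 : (θ - η / 2) * (N - n) ≤ 1 * (N - n) :=
          mul_le_mul_of_nonneg_right (by linarith) (by linarith)
        have h8 : 0 < η * N := by positivity
        linarith
      refine hC.dense _ (sdiff_subset.trans (hX.trans hA'A)) _
        (sdiff_subset.trans (hY.trans hB'B)) (hcut X Y hsX hXc) (hcut Y X hsY hYc) ?_ ?_
      · intro u hu
        obtain ⟨huX, hu⟩ := mem_sdiff.1 hu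
        have h1 : ∑ t, (dg (R t) u Y : ℝ) ≤ η / 2 * N := by
          by_contra hcon
          exact hu (mem_filter.2 ⟨huX, not_le.1 hcon⟩)
        rw [sum_congr rfl fun t _ => congrArg Nat.cast (hRA t u (hX huX) Y hY)] at h1
        have h2 := hgA u (hX huX) Y hY
        have h3 : (dg G.Adj u (Y \ Y.filter fun v => η / 2 * N < ∑ t, (dg (R t) v X : ℝ)) : ℝ) ≤
          dg G.Adj u Y := by exact_mod_cast dg_mono sdiff_subset
        have h8 : 0 < η * N := by positivity
        linarith
      · intro u hu
        obtain ⟨huX, hu⟩ := mem_sdiff.1 hu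
        have h1 : ∑ t, (dg (R t) u X : ℝ) ≤ η / 2 * N := by
          by_contra hcon
          exact hu (mem_filter.2 ⟨huX, not_le.1 hcon⟩)
        rw [sum_congr rfl fun t _ => congrArg Nat.cast (hRB t u (hY huX) X hX)] at h1
        have h2 := hgB u (hY huX) X hX
        have h3 : (dg G.Adj u (X \ X.filter fun v => η / 2 * N < ∑ t, (dg (R t) v Y : ℝ)) : ℝ) ≤
          dg G.Adj u X := by exact_mod_cast dg_mono sdiff_subset
        have h8 : 0 < η * N := by positivity
        linarith
  refine hN0 (R₁ := CRel Q S b) (col := fun t => t.1) (by omega) ?_ hD hA'A hB'B hC.disj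
    (hC.cardA.trans hC.cardB.symm) ?_ (fun t u v h => h.1) hCs (fun t u v h => h.1.2) ?_
    (fun t u v h => h.1.1) ?_ ?_
  · have h1 := card_comps_le hQs hSU b
    rw [hUc] at h1
    have h2 : (Fintype.card ((i : Fin r) × {C // C ∈ comps (Q i) (S i) b}) : ℝ) ≤ 16 * r ^ 2 / η := by
      rw [le_div_iff₀ hη]
      have h3 : Fintype.card ((i : Fin r) × {C // C ∈ comps (Q i) (S i) b}) * η * b ≤
          16 * r ^ 2 * b := by
        have h4 : 16 * r ^ 2 * b = η * (r * (2 * N)) := by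
          calc (16 : ℝ) * r ^ 2 * b = 16 * r * (r * b) := by ring
            _ = _ := by rw [hrb]; ring
        rw [h4]
        push_cast at h1
        nlinarith
      exact le_of_mul_le_mul_right h3 hb0
    exact_mod_cast h2.trans hK
  · rw [hC.cardA]
    have h1 : ε * N ≤ σ0 / 2 * N := mul_le_mul_of_nonneg_right hε2 hNr.le
    have h2 : σ0 / 2 * N ≤ σ0 / 2 * (2 * n) := mul_le_mul_of_nonneg_left (by linarith) (by positivity)
    linarith
  · rintro x hx ⟨i, D, hDc⟩ X Y F hX hY hXn hYn hF
    have hsub : ∀ Z : Finset V, (∀ x ∈ Z, ∃ v, CRel Q S b ⟨i, D, hDc⟩ x v) → Z ⊆ D :=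
      fun Z hZ v hv => by
        obtain ⟨w, hw⟩ := hZ v hv
        exact hw.2.1
    obtain ⟨u, hu, rfl⟩ := mem_image.1 (mem_filter.1 hDc).1
    have hxn : x / 2 * N ≤ x * n := by
      have := mul_le_mul_of_nonneg_left (by linarith : (N : ℝ) / 2 ≤ n) hx.le
      linarith
    have hFn : (x / 2) ^ 2 / (16 * L) * (n : ℝ) ≤ (x / 2) ^ 2 / (16 * L) * N :=
      mul_le_mul_of_nonneg_left hnN (by positivity)
    exact (hSr i u hu).exists_path hL0 (by omega) hUc.le
      (card_le_card ((filter_subset _ _).trans (hSU i))) (half_pos hx) (hsub X hXn)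
      (hsub Y hYn) (hxn.trans hX) (hxn.trans hY) (hF.trans hFn)
  · intro v hv
    have h2 := hdrop v B B' hB'B hC.cardB hB'c
    have h3 := hC.degA v hv
    have h8 : 0 < η * N := by positivity
    linarith
  · intro v hv
    have h2 := hdrop v A A' hA'A hC.cardA hA'c
    have h3 := hC.degB v hv
    have h8 : 0 < η * N := by positivity
    linarith

end CoreThmTwo

section EvenCycleTree
open Finset
open scoped Classical
variable {V : Type*} {R : V → V → Prop}

lemma exists_nbr_notMem {v : V} {T Z : Finset V} (h : Z.card < dg R v T) :
    ∃ w ∈ T, R v w ∧ w ∉ Z := by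
  by_contra hcon
  push Not at hcon
  refine absurd (card_le_card fun w hw => ?_) (not_le.2 h)
  obtain ⟨h1, h2⟩ := mem_filter.1 hw
  exact hcon w h1 h2

lemma exists_even_path {X Y F : Finset V} {D : ℕ} (hXY : Disjoint X Y)
    (hX : ∀ x ∈ X, D < dg R x Y) (hY : ∀ y ∈ Y, D < dg R y X) {a : V} (ha : a ∈ X) (haF : a ∉ F)
    (j : ℕ) (hj : 2 * j + 1 + F.card ≤ D) :
    ∃ l a', Pth R a a' l ∧ l.Nodup ∧ l.length = 2 * j + 1 ∧ a' ∈ X ∧ (∀ x ∈ l, x ∈ X ∪ Y) ∧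
      ∀ x ∈ l, x ∉ F := by
  induction j with
  | zero => exact ⟨[a], a, Pth.single a, by simp, by simp, ha, by simp [ha], by simpa using haF⟩
  | succ j ih =>
    obtain ⟨l, a', hp, hn, hlen, ha', hl, hlF⟩ := ih (by omega)
    have hc : (l.toFinset ∪ F).card ≤ D := by
      have h1 := card_union_le l.toFinset F
      have h2 := List.toFinset_card_le l
      omega
    obtain ⟨y, hyY, hay, hy⟩ := exists_nbr_notMem (hc.trans_lt (hX a' ha'))
    obtain ⟨x, hxX, hyx, hx⟩ := exists_nbr_notMem (hc.trans_lt (hY y hyY))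
    simp only [mem_union, List.mem_toFinset, not_or] at hx hy
    have hxy : x ≠ y := fun h => disjoint_left.1 hXY hxX (h ▸ hyY)
    refine ⟨l ++ ([y] ++ [x]), x, hp.append ((Pth.single y).append (Pth.single x) hyx) hay, ?_, ?_,
      hxX, ?_, ?_⟩
    · refine List.nodup_append.2 ⟨hn, by simpa using hxy.symm, ?_⟩
      rintro u hu v hv rfl
      simp only [List.cons_append, List.nil_append, List.mem_cons, List.not_mem_nil, or_false] at hv
      rcases hv with rfl | rfl
      · exact hy.1 hu
      · exact hx.1 hu
    · simp [hlen]; ring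
    · intro u hu
      simp only [List.cons_append, List.nil_append, List.mem_append, List.mem_cons,
        List.not_mem_nil, or_false] at hu
      rcases hu with hu | rfl | rfl
      · exact hl u hu
      · exact mem_union_right _ hyY
      · exact mem_union_left _ hxX
    · intro u hu
      simp only [List.cons_append, List.nil_append, List.mem_append, List.mem_cons,
        List.not_mem_nil, or_false] at hu
      rcases hu with hu | rfl | rfl
      · exact hlF u hu
      · exact hy.2
      · exact hx.2

/-- Vertices of different colours at every small even distance. -/
lemma exists_bicoloured_path (hR : ∀ ⦃u v⦄, R u v → R v u) {X Y : Finset V} {D : ℕ}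
    (hXY : Disjoint X Y) (hX : ∀ x ∈ X, D < dg R x Y) (hY : ∀ y ∈ Y, D < dg R y X) (P : V → Prop)
    {a b w : V} (ha : a ∈ X) (hb : b ∈ X) (hw : w ∈ Y) (haw : R a w) (hbw : R b w) (hPa : P a)
    (hPb : ¬ P b) (j : ℕ) (hj0 : 0 < j) (hj : 4 * j ≤ D) :
    ∃ l, ∃ a' ∈ X, ∃ b' ∈ X, P a' ∧ ¬ P b' ∧ Pth R a' b' l ∧ l.Nodup ∧ l.length = 2 * j + 1 ∧
      ∀ x ∈ l, x ∈ X ∪ Y := by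
  obtain ⟨i, rfl⟩ := Nat.exists_eq_succ_of_ne_zero hj0.ne'
  have hne : ∀ x ∈ X, x ≠ w := fun x hx h => disjoint_left.1 hXY hx (h ▸ hw)
  have hab : a ≠ b := fun h => hPb (h ▸ hPa)
  obtain ⟨l, a', hp, hn, hlen, ha', hl, hlF⟩ := exists_even_path (F := {w, b}) hXY hX hY ha
    (by simp [hne a ha, hab]) i (by have := card_le_two (a := w) (b := b); omega)
  obtain ⟨l', b', hp', hn', hlen', hb', hl', hlF'⟩ := exists_even_path (F := {w, a}) hXY hX hY hb
    (by simp [hne b hb, hab.symm]) i (by have := card_le_two (a := w) (b := a); omega)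
  have hext : ∀ (l : List V) (s e d : V), Pth R s e l → l.Nodup → l.length = 2 * i + 1 →
      (∀ x ∈ l, x ∈ X ∪ Y) → w ∉ l → d ∉ l → R s w → R w d → d ∈ X →
      Pth R e d (l.reverse ++ ([w] ++ [d])) ∧ (l.reverse ++ ([w] ++ [d])).Nodup ∧
        (l.reverse ++ ([w] ++ [d])).length = 2 * (i + 1) + 1 ∧
        ∀ x ∈ l.reverse ++ ([w] ++ [d]), x ∈ X ∪ Y := by
    intro l s e d hp hn hlen hl hwl hdl hsw hwd hd
    refine ⟨(hp.reverse hR).append ((Pth.single w).append (Pth.single d) hwd) hsw, ?_, ?_, ?_⟩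
    · refine List.nodup_append.2 ⟨List.nodup_reverse.2 hn, by simpa using (hne d hd).symm, ?_⟩
      rintro u hu v hv rfl
      simp only [List.cons_append, List.nil_append, List.mem_cons, List.not_mem_nil, or_false] at hv
      rw [List.mem_reverse] at hu
      rcases hv with rfl | rfl
      · exact hwl hu
      · exact hdl hu
    · simp [hlen]; ring
    · intro u hu
      simp only [List.cons_append, List.nil_append, List.mem_append, List.mem_cons,
        List.not_mem_nil, or_false, List.mem_reverse] at hu
      rcases hu with hu | rfl | rfl
      · exact hl u hu
      · exact mem_union_right _ hw
      · exact mem_union_left _ hd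
  have hwl : w ∉ l := fun h => hlF w h (by simp)
  have hwl' : w ∉ l' := fun h => hlF' w h (by simp)
  have hbl : b ∉ l := fun h => hlF b h (by simp)
  have hal' : a ∉ l' := fun h => hlF' a h (by simp)
  obtain ⟨d, hdX, hwd, hd⟩ := exists_nbr_notMem (v := w) (T := X) (R := R)
    (Z := l.toFinset ∪ l'.toFinset) (lt_of_le_of_lt (by
      have h1 := card_union_le l.toFinset l'.toFinset
      have h2 := List.toFinset_card_le l
      have h3 := List.toFinset_card_le l'
      omega) (hY w hw))
  simp only [mem_union, List.mem_toFinset, not_or] at hd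
  have hfin : ∀ (l : List V) (s e d : V), Pth R s e l → l.Nodup → l.length = 2 * i + 1 →
      (∀ x ∈ l, x ∈ X ∪ Y) → w ∉ l → d ∉ l → R s w → R w d → d ∈ X → e ∈ X → ¬ (P e ↔ P d) →
      ∃ l, ∃ a' ∈ X, ∃ b' ∈ X, P a' ∧ ¬ P b' ∧ Pth R a' b' l ∧ l.Nodup ∧
        l.length = 2 * (i + 1) + 1 ∧ ∀ x ∈ l, x ∈ X ∪ Y := by
    intro l s e d hp hn hlen hl hwl hdl hsw hwd hd he hed
    obtain ⟨h1, h2, h3, h4⟩ := hext l s e d hp hn hlen hl hwl hdl hsw hwd hd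
    by_cases hPe : P e
    · exact ⟨_, e, he, d, hd, hPe, fun h => hed ⟨fun _ => h, fun _ => hPe⟩, h1, h2, h3, h4⟩
    · refine ⟨_, d, hd, e, he, ?_, hPe, h1.reverse hR, List.nodup_reverse.2 h2,
        by rw [List.length_reverse, h3], fun x hx => h4 x (List.mem_reverse.1 hx)⟩
      by_contra hPd
      exact hed ⟨fun h => absurd h hPe, fun h => absurd h hPd⟩
  by_cases hPa' : P a'
  · exact hfin l a a' b hp hn hlen hl hwl hbl haw (hR hbw) hb ha' fun h => hPb (h.1 hPa')
  by_cases hPb' : P b'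
  · by_cases hPd : P d
    · exact hfin l a a' d hp hn hlen hl hwl hd.1 haw hwd hdX ha' fun h => hPa' (h.2 hPd)
    · exact hfin l' b b' d hp' hn' hlen' hl' hwl' hd.2 hbw hwd hdX hb' fun h => hPd (h.1 hPb')
  · exact hfin l' b b' a hp' hn' hlen' hl' hwl' hal' hbw (hR haw) ha hb' fun h => hPb' (h.2 hPa)

lemma exists_connected_subpair (hR : ∀ ⦃u v⦄, R u v → R v u) {X Y : Finset V} {D : ℕ}
    (hne : X.Nonempty) (hX : ∀ x ∈ X, D < dg R x Y) (hY : ∀ y ∈ Y, D < dg R y X) :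
    ∃ X' ⊆ X, ∃ Y' ⊆ Y, X'.Nonempty ∧ (∀ x ∈ X', D < dg R x Y') ∧ (∀ y ∈ Y', D < dg R y X') ∧
      ∀ P : V → Prop, (∃ a ∈ X', P a) → (∃ b ∈ X', ¬ P b) →
        ∃ w ∈ Y', ∃ a ∈ X', ∃ b ∈ X', R a w ∧ R b w ∧ P a ∧ ¬ P b := by
  set 𝒞 := X.powerset.filter fun X' => X'.Nonempty ∧
    ∀ x ∈ X', ∀ y ∈ Y, ∀ x' ∈ X, R x y → R y x' → x' ∈ X' with h𝒞
  obtain ⟨X', hX', hmin⟩ := exists_min_image 𝒞 card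
    ⟨X, by simp only [h𝒞, mem_filter, mem_powerset]; exact ⟨subset_rfl, hne,
      fun _ _ _ _ x' hx' _ _ => hx'⟩⟩
  simp only [h𝒞, mem_filter, mem_powerset, and_imp] at hX' hmin
  obtain ⟨hsub, hne', hcl⟩ := hX'
  refine ⟨X', hsub, Y.filter fun y => ∃ x ∈ X', R x y, filter_subset _ _, hne', ?_, ?_, ?_⟩
  · intro x hx
    refine (hX x (hsub hx)).trans_le (card_le_card fun y hy => ?_)
    obtain ⟨h1, h2⟩ := mem_filter.1 hy
    exact mem_filter.2 ⟨mem_filter.2 ⟨h1, x, hx, h2⟩, h2⟩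
  · intro y hy
    obtain ⟨hyY, x, hx, hxy⟩ := mem_filter.1 hy
    refine (hY y hyY).trans_le (card_le_card fun x' hx' => ?_)
    obtain ⟨h1, h2⟩ := mem_filter.1 hx'
    exact mem_filter.2 ⟨hcl x hx y hyY x' h1 hxy h2, h2⟩
  · rintro P ⟨a, ha, hPa⟩ ⟨b, hb, hPb⟩
    by_contra hcon
    have := hmin (X'.filter P) ((filter_subset _ _).trans hsub)
      ⟨a, mem_filter.2 ⟨ha, hPa⟩⟩ (by
        intro x hx y hy x' hx' h1 h2
        obtain ⟨hx, hPx⟩ := mem_filter.1 hx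
        refine mem_filter.2 ⟨hcl x hx y hy x' hx' h1 h2, ?_⟩
        by_contra hPx'
        exact hcon ⟨y, mem_filter.2 ⟨hy, x, hx, h1⟩, x, hx, x',
          hcl x hx y hy x' hx' h1 h2, h1, hR h2, hPx, hPx'⟩)
    refine absurd this (not_le.2 (card_lt_card (filter_ssubset.2 ⟨b, hb, hPb⟩)))

lemma Pth.iterate (p : V → V) (v : V) (k : ℕ) (h : ∀ i < k, R (p^[i] v) (p^[i + 1] v)) :
    Pth R v (p^[k] v) ((List.range (k + 1)).map fun i => p^[i] v) := by
  induction k with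
  | zero => simpa using Pth.single v
  | succ k ih =>
    rw [List.range_succ, List.map_append]
    exact (ih fun i hi => h i (by omega)).append (Pth.single _) (h k (by omega))

lemma nodup_iterate {p : V → V} {v : V} {lev : V → ℕ} {g k : ℕ} (hk : k ≤ g + 1)
    (h : ∀ i ≤ g, lev (p^[i] v) + i = g) : ((List.range k).map fun i => p^[i] v).Nodup := by
  refine List.Nodup.map_on (fun i hi j hj hij => ?_) List.nodup_range
  rw [List.mem_range] at hi hj
  have h1 := h i (by omega)
  have h2 := h j (by omega)
  rw [hij] at h1
  omega

/-- A connected bipartite graph of large minimum degree hanging from the leaves of a tree yields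
cycles of all even lengths in an interval. -/
lemma exists_even_cycle_of_tree (hR : ∀ ⦃u v⦄, R u v → R v u) {X Y U : Finset V} {D g : ℕ}
    {p : V → V} {lev : V → ℕ} (hD : 0 < D) (hne : X.Nonempty) (hXU : X ⊆ U) (hYU : Y ⊆ U)
    (hX : ∀ x ∈ X, D < dg R x Y) (hY : ∀ y ∈ Y, D < dg R y X)
    (hlev : ∀ x ∈ X, ∀ i ≤ g, lev (p^[i] x) + i = g) (hpU : ∀ x ∈ X, ∀ i ≤ g, p^[i] x ∈ U)
    (hpR : ∀ x ∈ X, ∀ i < g, R (p^[i] x) (p^[i + 1] x))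
    (hroot : ∀ x ∈ X, ∀ x' ∈ X, p^[g] x = p^[g] x') (hYlev : ∀ y ∈ Y, g < lev y) :
    ∃ h ≤ g, ∀ j, 0 < j → 4 * j ≤ D →
      ∃ l, IsCyc R l ∧ l.length = 2 * (h + j) ∧ ∀ x ∈ l, x ∈ U := by
  obtain ⟨X', hX'X, Y', hY'Y, hne', hX', hY', hconn⟩ := exists_connected_subpair hR hne hX hY
  have hex : ∃ k, ∀ x ∈ X', ∀ x' ∈ X', p^[k] x = p^[k] x' :=
    ⟨g, fun x hx x' hx' => hroot x (hX'X hx) x' (hX'X hx')⟩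
  have hlevX : ∀ x ∈ X', lev x = g := fun x hx => by simpa using hlev x (hX'X hx) 0 (by omega)
  have hdis : Disjoint X' Y' := disjoint_left.2 fun x hx hy => by
    have := hlevX x hx
    have := hYlev x (hY'Y hy)
    omega
  set h := Nat.find hex with hh
  have hspec := Nat.find_spec hex
  rw [← hh] at hspec
  have hhg : h ≤ g := Nat.find_le fun x hx x' hx' => hroot x (hX'X hx) x' (hX'X hx')
  have hh0 : h ≠ 0 := by
    intro h0
    obtain ⟨x, hx⟩ := hne'
    obtain ⟨y, hy, -, -⟩ := exists_nbr_notMem (Z := ∅) ((by simp : (∅ : Finset V).card ≤ 0).trans_lt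
      (hD.trans (hX' x hx)))
    obtain ⟨x', hx', -, hxx'⟩ := exists_nbr_notMem (Z := {x}) (lt_of_le_of_lt (by simp; omega)
      (hY' y hy))
    rw [h0] at hspec
    exact hxx' (by simpa using hspec x' hx' x hx)
  obtain ⟨k, hk⟩ := Nat.exists_eq_succ_of_ne_zero hh0
  have hnot := Nat.find_min hex (m := k) (by omega)
  push Not at hnot
  obtain ⟨a₀, ha₀, b₀, hb₀, hab⟩ := hnot
  obtain ⟨w, hw, a, ha, b, hb, haw, hbw, hPa, hPb⟩ := hconn (fun x => p^[k] x = p^[k] a₀)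
    ⟨a₀, ha₀, rfl⟩ ⟨b₀, hb₀, fun h => hab h.symm⟩
  refine ⟨h, hhg, fun j hj0 hj => ?_⟩
  obtain ⟨l, a', ha', b', hb', hPa', hPb', hp, hn, hlen, hl⟩ := exists_bicoloured_path hR hdis hX'
    hY' (fun x => p^[k] x = p^[k] a₀) ha hb hw haw hbw hPa hPb j hj0 hj
  have hkab : p^[k] a' ≠ p^[k] b' := fun h => hPb' (h ▸ hPa')
  have hz : p^[k + 1] a' = p^[k + 1] b' := by
    have := hspec a' ha' b' hb'
    rwa [hk] at this
  have hlow : ∀ x ∈ l, g ≤ lev x ∧ x ∈ U := by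
    intro x hx
    rcases mem_union.1 (hl x hx) with h | h
    · exact ⟨(hlevX x h).ge, hXU (hX'X h)⟩
    · exact ⟨(hYlev x (hY'Y h)).le, hYU (hY'Y h)⟩
  have hit : ∀ x i, p^[i] (p x) = p^[i + 1] x := fun x i => (Function.iterate_succ_apply p i x).symm
  have hpb : Pth R (p b') (p^[k + 1] b') ((List.range (k + 1)).map fun i => p^[i] (p b')) := by
    rw [← hit]
    refine Pth.iterate p (p b') k fun i hi => ?_
    rw [hit, hit]
    exact hpR b' (hX'X hb') (i + 1) (by omega)
  have hfull : Pth R a' (p^[k + 1] b') (l ++ (List.range (k + 1)).map fun i => p^[i] (p b')) :=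
    hp.append hpb (by simpa using hpR b' (hX'X hb') 0 (by omega))
  obtain ⟨g', rfl⟩ : ∃ g', g = g' + 1 := ⟨g - 1, by omega⟩
  have hlev' : ∀ x ∈ X', ∀ i ≤ g', lev (p^[i] (p x)) + i = g' := by
    intro x hx i hi
    rw [hit]
    have := hlev x (hX'X hx) (i + 1) (by omega)
    omega
  have hnfull : (l ++ (List.range (k + 1)).map fun i => p^[i] (p b')).Nodup := by
    refine List.nodup_append.2 ⟨hn, nodup_iterate (by omega) (hlev' b' hb'), ?_⟩
    rintro u hu v hv rfl
    obtain ⟨i, hi, rfl⟩ := List.mem_map.1 hv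
    have h1 := hlev' b' hb' i (by have := List.mem_range.1 hi; omega)
    have h2 := (hlow _ hu).1
    omega
  have hUm : ∀ x ∈ X', ∀ i < k + 1, p^[i] (p x) ∈ U := fun x hx i hi => by
    rw [hit]; exact hpU x (hX'X hx) (i + 1) (by omega)
  rcases k with _ | k
  · refine ⟨_, hfull.isCyc hnfull ?_, ?_, ?_⟩
    · rw [← hz]
      exact hR (by simpa using hpR a' (hX'X ha') 0 (by omega))
    · simp [hlen]; omega
    · intro x hx
      rcases List.mem_append.1 hx with hx | hx
      · exact (hlow x hx).2
      · obtain ⟨i, hi, rfl⟩ := List.mem_map.1 hx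
        exact hUm b' hb' i (List.mem_range.1 hi)
  · have hpa : Pth R (p a') (p^[k + 1] a') ((List.range (k + 1)).map fun i => p^[i] (p a')) := by
      rw [← hit]
      refine Pth.iterate p (p a') k fun i hi => ?_
      rw [hit, hit]
      exact hpR a' (hX'X ha') (i + 1) (by omega)
    refine ⟨_, (hfull.append (hpa.reverse hR) ?_).isCyc ?_ ?_, ?_, ?_⟩
    · rw [← hz]
      exact hR (hpR a' (hX'X ha') (k + 1) (by omega))
    · refine List.nodup_append.2 ⟨hnfull, List.nodup_reverse.2
        (nodup_iterate (by omega) (hlev' a' ha')), ?_⟩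
      rintro u hu v hv rfl
      obtain ⟨i, hi, rfl⟩ := List.mem_map.1 (List.mem_reverse.1 hv)
      have hi' := List.mem_range.1 hi
      have h1 := hlev' a' ha' i (by omega)
      rcases List.mem_append.1 hu with hu | hu
      · have h2 := (hlow _ hu).1
        omega
      · obtain ⟨i', hi2, he⟩ := List.mem_map.1 hu
        have hi3 := List.mem_range.1 hi2
        have h2 := hlev' b' hb' i' (by omega)
        rw [he] at h2
        obtain rfl : i = i' := by omega
        rw [hit, hit] at he
        apply hkab
        have := congrArg (p^[k - i]) he
        rw [← Function.iterate_add_apply, ← Function.iterate_add_apply,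
          show k - i + (i + 1) = k + 1 by omega] at this
        exact this.symm
    · exact hR (by simpa using hpR a' (hX'X ha') 0 (by omega))
    · simp [hlen]; omega
    · intro x hx
      rcases List.mem_append.1 hx with hx | hx
      · rcases List.mem_append.1 hx with hx | hx
        · exact (hlow x hx).2
        · obtain ⟨i, hi, rfl⟩ := List.mem_map.1 hx
          exact hUm b' hb' i (List.mem_range.1 hi)
      · obtain ⟨i, hi, rfl⟩ := List.mem_map.1 (List.mem_reverse.1 hx)
        exact hUm a' ha' i (by have := List.mem_range.1 hi; omega)

end EvenCycleTree

section EvenCycles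
open Finset
open scoped Classical
variable {V : Type*} {R : V → V → Prop}

lemma dg_le_of_forall {v : V} {T T' : Finset V} (h : ∀ w ∈ T, R v w → w ∈ T') :
    dg R v T ≤ dg R v T' := card_le_card fun w hw => by
  obtain ⟨h1, h2⟩ := mem_filter.1 hw
  exact mem_filter.2 ⟨h w h1 h2, h2⟩

lemma ed_singleton_left (v : V) (T : Finset V) : ed R {v} T = dg R v T := sum_singleton _ _

lemma ed_singleton_right (hR : ∀ ⦃u v⦄, R u v → R v u) (v : V) (T : Finset V) :
    ed R T {v} = dg R v T := by rw [ed_comm hR, ed_singleton_left]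

/-- Every graph has a cut containing half of its edges. -/
lemma exists_cut (hR : ∀ ⦃u v⦄, R u v → R v u) (hirr : ∀ v, ¬ R v v) (U : Finset V) :
    ∃ X Y : Finset V, Disjoint X Y ∧ X ∪ Y = U ∧ ed R U U ≤ 4 * ed R X Y := by
  induction U using Finset.induction_on with
  | empty => exact ⟨∅, ∅, by simp, by simp, by simp [ed]⟩
  | insert v U hv ih =>
    obtain ⟨X, Y, hXY, rfl, he⟩ := ih
    have hvX : v ∉ X := fun h => hv (mem_union_left _ h)
    have hvY : v ∉ Y := fun h => hv (mem_union_right _ h)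
    have hd : Disjoint {v} (X ∪ Y) := disjoint_singleton_left.2 hv
    have h0 : dg R v {v} = 0 := by simp [dg, filter_singleton, hirr v]
    have h1 : ed R (insert v (X ∪ Y)) (insert v (X ∪ Y)) = ed R (X ∪ Y) (X ∪ Y) +
        2 * (dg R v X + dg R v Y) := by
      rw [insert_eq, ed_union_left hd, ed_union_right _ hd, ed_union_right _ hd,
        ed_singleton_left, ed_singleton_left, ed_singleton_right hR, h0, dg_union v hXY]
      ring
    rcases le_total (dg R v X) (dg R v Y) with h | h
    · refine ⟨{v} ∪ X, Y, ?_, by rw [union_assoc, insert_eq], ?_⟩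
      · rw [disjoint_union_left]; exact ⟨disjoint_singleton_left.2 hvY, hXY⟩
      · rw [h1, ed_union_left (disjoint_singleton_left.2 hvX), ed_singleton_left]
        omega
    · refine ⟨X, {v} ∪ Y, ?_, by
        rw [insert_eq, union_left_comm], ?_⟩
      · rw [disjoint_union_right]; exact ⟨disjoint_singleton_right.2 hvX, hXY⟩
      · rw [h1, ed_union_right _ (disjoint_singleton_left.2 hvY), ed_singleton_right hR]
        omega

lemma exists_min_degree_subpair (hR : ∀ ⦃u v⦄, R u v → R v u) (X Y : Finset V) (ρ : ℕ)
    (h : ρ * (X.card + Y.card) < ed R X Y) :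
    ∃ X' ⊆ X, ∃ Y' ⊆ Y, X'.Nonempty ∧ (∀ x ∈ X', ρ < dg R x Y') ∧ ∀ y ∈ Y', ρ < dg R y X' := by
  induction hn : X.card + Y.card generalizing X Y with
  | zero =>
    have := ed_le_card_mul (R := R) X Y
    have : X.card = 0 := by omega
    simp_all
  | succ n ih =>
    by_cases hx : ∃ x ∈ X, dg R x Y ≤ ρ
    · obtain ⟨x, hx, hd⟩ := hx
      have h1 : ed R X Y = dg R x Y + ed R (X.erase x) Y := by
        conv_lhs => rw [← insert_erase hx, insert_eq]
        rw [ed_union_left (by simp), ed_singleton_left]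
      have h2 := card_erase_add_one hx
      obtain ⟨X', hX', Y', hY', h3⟩ := ih (X.erase x) Y (by
        rw [hn, mul_add] at h
        rw [show (X.erase x).card + Y.card = n by omega]
        omega) (by omega)
      exact ⟨X', hX'.trans (erase_subset _ _), Y', hY', h3⟩
    by_cases hy : ∃ y ∈ Y, dg R y X ≤ ρ
    · obtain ⟨y, hy, hd⟩ := hy
      have h1 : ed R X Y = dg R y X + ed R X (Y.erase y) := by
        conv_lhs => rw [← insert_erase hy, insert_eq]
        rw [ed_union_right _ (by simp), ed_singleton_right hR]
      have h2 := card_erase_add_one hy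
      obtain ⟨X', hX', Y', hY', h3⟩ := ih X (Y.erase y) (by
        rw [hn, mul_add] at h
        rw [show X.card + (Y.erase y).card = n by omega]
        omega) (by omega)
      exact ⟨X', hX', Y', hY'.trans (erase_subset _ _), h3⟩
    push Not at hx hy
    refine ⟨X, subset_rfl, Y, subset_rfl, ?_, hx, hy⟩
    rw [nonempty_iff_ne_empty]
    rintro rfl
    simp [ed] at h

/-- Breadth-first search levels. -/
lemma exists_levels (R : V → V → Prop) (U : Finset V) {x : V} (hx : x ∈ U) :
    ∃ (W : Finset V) (lev : V → ℕ), W ⊆ U ∧ x ∈ W ∧ lev x = 0 ∧ (∀ v ∈ W, lev v = 0 → v = x) ∧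
      (∀ v ∈ W, ∀ w ∈ U, R v w → w ∈ W ∧ lev w ≤ lev v + 1) ∧
      ∀ w ∈ W, lev w ≠ 0 → ∃ u ∈ W, R u w ∧ lev u + 1 = lev w := by
  set B : ℕ → Finset V := fun i => Nat.rec {x} (fun _ S => S ∪ U.filter fun v => ∃ u ∈ S, R u v) i
    with hB
  have hBs : ∀ i, B (i + 1) = B i ∪ U.filter fun v => ∃ u ∈ B i, R u v := fun i => rfl
  have hB0 : B 0 = {x} := rfl
  have hBU : ∀ i, B i ⊆ U := by
    intro i
    induction i with
    | zero => simpa [hB0] using hx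
    | succ i ih => rw [hBs]; exact union_subset ih (filter_subset _ _)
  set lev : V → ℕ := fun v => sInf {i | v ∈ B i} with hlev
  have hmem : ∀ v i, v ∈ B i → v ∈ B (lev v) := fun v i h => Nat.sInf_mem (s := {i | v ∈ B i}) ⟨i, h⟩
  have hle : ∀ v i, v ∈ B i → lev v ≤ i := fun v i h => Nat.sInf_le h
  have hW : ∀ v, v ∈ U.filter (fun v => ∃ i, v ∈ B i) ↔ ∃ i, v ∈ B i := fun v => by
    rw [mem_filter]
    exact ⟨fun h => h.2, fun ⟨i, h⟩ => ⟨hBU i h, i, h⟩⟩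
  refine ⟨U.filter fun v => ∃ i, v ∈ B i, lev, filter_subset _ _, ?_, ?_, ?_, ?_, ?_⟩
  · exact (hW x).2 ⟨0, by simp [hB0]⟩
  · exact Nat.le_zero.1 (hle x 0 (by simp [hB0]))
  · intro v hv h0
    obtain ⟨i, hi⟩ := (hW v).1 hv
    have := hmem v i hi
    rw [h0, hB0] at this
    simpa using this
  · intro v hv w hw hvw
    obtain ⟨i, hi⟩ := (hW v).1 hv
    have : w ∈ B (lev v + 1) := by
      rw [hBs]
      exact mem_union_right _ (mem_filter.2 ⟨hw, v, hmem v i hi, hvw⟩)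
    exact ⟨(hW w).2 ⟨lev v + 1, this⟩, hle w (lev v + 1) this⟩
  · intro w hw h0
    obtain ⟨i, hi⟩ := (hW w).1 hw
    obtain ⟨k, hk⟩ := Nat.exists_eq_succ_of_ne_zero h0
    have h1 := hmem w i hi
    rw [hk, Nat.succ_eq_add_one, hBs] at h1
    rcases mem_union.1 h1 with h | h
    · have := hle w k h
      omega
    · obtain ⟨hwU, u, hu, huw⟩ := mem_filter.1 h
      refine ⟨u, (hW u).2 ⟨k, hu⟩, huw, ?_⟩
      have h2 := hle u k hu
      have h3 : w ∈ B (lev u + 1) := by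
        rw [hBs]
        exact mem_union_right _ (mem_filter.2 ⟨hwU, u, hmem u k hu, huw⟩)
      have h4 := hle w (lev u + 1) h3
      omega

lemma IsCyc.rel_mono {R' : V → V → Prop} (h : ∀ u v, R u v → R' u v) {l : List V}
    (hl : IsCyc R l) : IsCyc R' l :=
  ⟨hl.1, hl.2.1.imp h, fun h1 h2 => h _ _ (hl.2.2 h1 h2)⟩

theorem exists_even_cycle (hR : ∀ ⦃u v⦄, R u v → R v u) (hirr : ∀ v, ¬ R v v) {U : Finset V}
    {k H m : ℕ} (hH : U.card < 2 ^ (H + 1)) (hk : 72 * k * U.card < ed R U U) (hm : H < m)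
    (hmk : m ≤ k) : ∃ l, IsCyc R l ∧ l.length = 2 * m ∧ ∀ x ∈ l, x ∈ U := by
  obtain ⟨X₀, Y₀, hd₀, hU, he₀⟩ := exists_cut hR hirr U
  have hc₀ : U.card = X₀.card + Y₀.card := by rw [← hU, card_union_of_disjoint hd₀]
  obtain ⟨X, hX, Y, hY, ⟨x, hx⟩, hdX, hdY⟩ := exists_min_degree_subpair hR X₀ Y₀ (18 * k) (by
    rw [← hc₀]; nlinarith)
  have hd : Disjoint X Y := hd₀.mono hX hY
  set Q : V → V → Prop := fun u v => R u v ∧ ((u ∈ X ∧ v ∈ Y) ∨ (u ∈ Y ∧ v ∈ X)) with hQ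
  have hQs : ∀ ⦃u v⦄, Q u v → Q v u := fun u v h => ⟨hR h.1, h.2.symm.imp And.symm And.symm⟩
  have hQd : ∀ v ∈ X ∪ Y, 18 * k < dg Q v (X ∪ Y) := by
    intro v hv
    rcases mem_union.1 hv with hv | hv
    · refine (hdX v hv).trans_le (le_trans ?_ (dg_mono subset_union_right))
      exact (dg_congr fun w hw => ⟨fun h => ⟨h, Or.inl ⟨hv, hw⟩⟩, fun h => h.1⟩).le
    · refine (hdY v hv).trans_le (le_trans ?_ (dg_mono subset_union_left))
      exact (dg_congr fun w hw => ⟨fun h => ⟨h, Or.inr ⟨hv, hw⟩⟩, fun h => h.1⟩).le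
  obtain ⟨W, lev, hWU, hxW, hx0, hroot, hnb, hpar⟩ := exists_levels Q (X ∪ Y)
    (mem_union_left _ hx)
  have hparity : ∀ n, ∀ v ∈ W, lev v = n → (v ∈ X ↔ Even n) := by
    intro n
    induction n with
    | zero => intro v hv h0; rw [hroot v hv h0]; simp [hx]
    | succ n ih =>
      intro v hv hn
      obtain ⟨u, hu, huv, hl⟩ := hpar v hv (by omega)
      have h1 := ih u hu (by omega)
      rw [Nat.even_add_one, ← h1]
      rcases huv.2 with ⟨h2, h3⟩ | ⟨h2, h3⟩
      · exact ⟨fun h => absurd h3 (disjoint_left.1 hd h), fun h => absurd h2 h⟩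
      · exact ⟨fun _ h => absurd h2 (disjoint_left.1 hd h), fun _ => h3⟩
  have hpar' : ∀ w, ∃ u, w ∈ W → lev w ≠ 0 → u ∈ W ∧ Q u w ∧ lev u + 1 = lev w := by
    intro w
    by_cases h : w ∈ W ∧ lev w ≠ 0
    · obtain ⟨u, hu⟩ := hpar w h.1 h.2
      exact ⟨u, fun _ _ => hu⟩
    · exact ⟨w, fun h1 h2 => absurd ⟨h1, h2⟩ h⟩
  choose p hp using hpar'
  set L : ℕ → Finset V := fun i => W.filter fun v => lev v = i with hL
  have hmemL : ∀ i v, v ∈ L i ↔ v ∈ W ∧ lev v = i := fun i v => by simp [hL]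
  have hLU : ∀ i, L i ⊆ U := fun i => (filter_subset _ _).trans (hWU.trans
    (hU ▸ union_subset_union hX hY))
  have hL0 : L 0 = {x} := by
    ext v
    rw [hmemL, mem_singleton]
    exact ⟨fun h => hroot v h.1 h.2, fun h => h ▸ ⟨hxW, hx0⟩⟩
  have hnbL : ∀ i, ∀ v ∈ L i, ∀ w ∈ X ∪ Y, Q v w → w ∈ L (i + 1) ∨ (w ∈ W ∧ lev w + 1 = i) := by
    intro i v hv w hw hvw
    obtain ⟨hvW, hvi⟩ := (hmemL i v).1 hv
    obtain ⟨hwW, h1⟩ := hnb v hvW w hw hvw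
    obtain ⟨-, h2⟩ := hnb w hwW v (hWU hvW) (hQs hvw)
    rw [hmemL]
    by_cases h3 : lev w = i
    · have h4 := hparity i v hvW hvi
      rw [← hparity i w hwW h3] at h4
      rcases hvw.2 with ⟨h5, h6⟩ | ⟨h5, h6⟩
      · exact absurd h6 (disjoint_left.1 hd (h4.1 h5))
      · exact absurd h5 (disjoint_left.1 hd (h4.2 h6))
    · by_cases h4 : lev w = i + 1
      · exact Or.inl ⟨hwW, h4⟩
      · exact Or.inr ⟨hwW, by omega⟩
  have hdL : ∀ i, ∀ v ∈ L i, 18 * k < dg Q v (L (i + 1)) +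
      dg Q v (W.filter fun w => lev w + 1 = i) := by
    intro i v hv
    refine (hQd v (hWU ((hmemL i v).1 hv).1)).trans_le (le_trans (dg_le_of_forall fun w hw hvw => ?_)
      (dg_union_le (R := Q) v (L (i + 1)) _))
    rcases hnbL i v hv w hw hvw with h | h
    · exact mem_union_left _ h
    · exact mem_union_right _ (mem_filter.2 h)
  have hgrow : ∃ i, (L (i + 1)).card < 2 * (L i).card := by
    by_contra hcon
    push Not at hcon
    have hpow : ∀ i, 2 ^ i ≤ (L i).card := by
      intro i
      induction i with
      | zero => simp [hL0]
      | succ i ih => have := hcon i; rw [pow_succ]; omega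
    have h1 := hpow (H + 1)
    have h2 := card_le_card (hLU (H + 1))
    omega
  set i := Nat.find hgrow with hi
  have hspec : (L (i + 1)).card < 2 * (L i).card := Nat.find_spec hgrow
  have hmin : ∀ j < i, 2 * (L j).card ≤ (L (j + 1)).card := fun j hj =>
    not_lt.1 (Nat.find_min hgrow hj)
  have hpow : ∀ j ≤ i, 2 ^ j ≤ (L j).card := by
    intro j
    induction j with
    | zero => simp [hL0]
    | succ j ih => intro hj; have := hmin j (by omega); have := ih (by omega); rw [pow_succ]; omega
  have hgH : ∀ g ≤ i, g ≤ H := by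
    intro g hg
    by_contra hcon
    have h1 := (hpow g hg).trans (card_le_card (hLU g))
    have h2 : 2 ^ (H + 1) ≤ 2 ^ g := Nat.pow_le_pow_right (by norm_num) (by omega)
    omega
  have hsum : 18 * k * (L i).card < ed Q (L i) (L (i + 1)) +
      ed Q (L i) (W.filter fun w => lev w + 1 = i) := by
    unfold ed
    rw [← sum_add_distrib, mul_comm, ← smul_eq_mul, ← sum_const]
    refine sum_lt_sum_of_nonempty ?_ fun v hv => hdL i v hv
    rw [← card_pos]
    exact lt_of_lt_of_le (by positivity) (hpow i le_rfl)
  obtain ⟨g, hg, hge⟩ : ∃ g ≤ H, 4 * k * ((L g).card + (L (g + 1)).card) <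
      ed Q (L g) (L (g + 1)) := by
    by_cases h1 : 12 * k * (L i).card < ed Q (L i) (L (i + 1))
    · refine ⟨i, hgH i le_rfl, lt_of_le_of_lt ?_ h1⟩
      nlinarith
    · have h2 : 6 * k * (L i).card < ed Q (L i) (W.filter fun w => lev w + 1 = i) := by
        nlinarith
      rcases Nat.eq_zero_or_eq_succ_pred i with h0 | h0
      · rw [h0] at h2
        simp [ed, dg] at h2
      · set j := i.pred
        refine ⟨j, hgH j (by omega), ?_⟩
        have h3 : (W.filter fun w => lev w + 1 = i) = L j := by
          ext w
          rw [hmemL, mem_filter]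
          exact and_congr_right fun _ => by omega
        rw [h3, ed_comm hQs] at h2
        have h4 := hmin j (by omega)
        rw [← Nat.succ_eq_add_one, ← h0] at *
        refine lt_of_le_of_lt ?_ h2
        nlinarith
  obtain ⟨X', hX', Y', hY', hne, h1, h2⟩ := exists_min_degree_subpair hQs _ _ _ hge
  have hup : ∀ j ≤ g, ∀ v ∈ X', p^[j] v ∈ W ∧ lev (p^[j] v) + j = g := by
    intro j
    induction j with
    | zero => intro _ v hv; exact (hmemL g v).1 (hX' hv)
    | succ j ih =>
      intro hj v hv
      obtain ⟨h3, h4⟩ := ih (by omega) v hv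
      rw [Function.iterate_succ_apply']
      obtain ⟨h5, -, h6⟩ := hp _ h3 (by omega)
      exact ⟨h5, by omega⟩
  obtain ⟨h, hhg, hcyc⟩ := exists_even_cycle_of_tree hQs (D := 4 * k) (g := g) (p := p) (lev := lev)
    (U := U) (by omega) hne (hX'.trans (hLU g)) (hY'.trans (hLU _)) h1 h2
    (fun v hv j hj => (hup j hj v hv).2)
    (fun v hv j hj => hLU _ ((hmemL _ _).2 ⟨(hup j hj v hv).1, rfl⟩))
    (fun v hv j hj => by
      rw [Function.iterate_succ_apply']
      obtain ⟨h3, h4⟩ := hup j hj.le v hv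
      exact hQs (hp _ h3 (by omega)).2.1)
    (fun v hv v' hv' => by
      obtain ⟨h3, h4⟩ := hup g le_rfl v hv
      obtain ⟨h5, h6⟩ := hup g le_rfl v' hv'
      rw [hroot _ h3 (by omega), hroot _ h5 (by omega)])
    (fun y hy => by have := ((hmemL _ _).1 (hY' hy)).2; omega)
  obtain ⟨l, hl, hlen, hlU⟩ := hcyc (m - h) (by omega) (by omega)
  exact ⟨l, hl.rel_mono fun _ _ h => h.1, by rw [hlen]; omega, hlU⟩

end EvenCycles

section BalancedSplit
open Finset
open scoped Classical
variable {V : Type*}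

lemma exists_split_cosh_sum_le {ι : Type*} (I : Finset ι) (f : ι → V → ℝ) (hf0 : ∀ i v, 0 ≤ f i v)
    (hf1 : ∀ i v, f i v ≤ 1) (s : ℝ) (N : ℕ) (U : Finset V) (hU : U.card = 2 * N) :
    ∃ A B : Finset V, Disjoint A B ∧ A ∪ B = U ∧ A.card = N ∧ B.card = N ∧
      ∑ i ∈ I, Real.cosh (s * (∑ v ∈ A, f i v - ∑ v ∈ B, f i v)) ≤ I.card * Real.cosh s ^ N := by
  induction N generalizing U with
  | zero =>
    have : U = ∅ := card_eq_zero.1 (by omega)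
    exact ⟨∅, ∅, by simp, by simp [this], by simp, by simp, by simp⟩
  | succ N ih =>
    obtain ⟨u, hu⟩ : U.Nonempty := card_pos.1 (by omega)
    have h1 := card_erase_add_one hu
    obtain ⟨v, hv⟩ : (U.erase u).Nonempty := card_pos.1 (by omega)
    have h2 := card_erase_add_one hv
    obtain ⟨A, B, hd, hAB, hA, hB, hsum⟩ := ih ((U.erase u).erase v) (by omega)
    have hvu : v ≠ u := ne_of_mem_erase hv
    have hnot : ∀ x, x ∈ A ∨ x ∈ B → x ≠ u ∧ x ≠ v ∧ x ∈ U := by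
      intro x hx
      have : x ∈ (U.erase u).erase v := by rw [← hAB]; exact mem_union.2 hx
      simp only [mem_erase] at this
      exact ⟨this.2.1, this.1, this.2.2⟩
    have huA : u ∉ A := fun h => (hnot u (Or.inl h)).1 rfl
    have huB : u ∉ B := fun h => (hnot u (Or.inr h)).1 rfl
    have hvA : v ∉ A := fun h => (hnot v (Or.inl h)).2.1 rfl
    have hvB : v ∉ B := fun h => (hnot v (Or.inr h)).2.1 rfl
    have hUeq : insert u (insert v (A ∪ B)) = U := by
      rw [hAB, insert_erase hv, insert_erase hu]
    set d : ι → ℝ := fun i => ∑ v ∈ A, f i v - ∑ v ∈ B, f i v with hdd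
    set a : ι → ℝ := fun i => f i u - f i v with ha
    have hcosh : ∀ p q : ℝ, Real.cosh (s * (p + q)) + Real.cosh (s * (p - q)) =
        2 * (Real.cosh (s * p) * Real.cosh (s * q)) := fun p q => by
      rw [mul_add, mul_sub, Real.cosh_add, Real.cosh_sub]
      ring
    have hkey : ∑ i ∈ I, Real.cosh (s * (d i + a i)) + ∑ i ∈ I, Real.cosh (s * (d i - a i)) ≤
        2 * (I.card * Real.cosh s ^ (N + 1)) := by
      calc _ = ∑ i ∈ I, 2 * (Real.cosh (s * d i) * Real.cosh (s * a i)) := by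
            rw [← sum_add_distrib]
            refine sum_congr rfl fun i _ => ?_
            exact hcosh _ _
        _ ≤ ∑ i ∈ I, 2 * (Real.cosh (s * d i) * Real.cosh s) := by
            refine sum_le_sum fun i _ => ?_
            have h3 : Real.cosh (s * a i) ≤ Real.cosh s := by
              rw [Real.cosh_le_cosh, abs_mul]
              refine mul_le_of_le_one_right (abs_nonneg s) (abs_le.2 ⟨?_, ?_⟩)
              · have := hf0 i u; have := hf1 i v; simp only [ha]; linarith
              · have := hf0 i v; have := hf1 i u; simp only [ha]; linarith
            have h4 := mul_le_mul_of_nonneg_left h3 (Real.cosh_pos (s * d i)).le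
            linarith
        _ = 2 * Real.cosh s * ∑ i ∈ I, Real.cosh (s * d i) := by
            rw [mul_sum]
            exact sum_congr rfl fun i _ => by ring
        _ ≤ 2 * Real.cosh s * (I.card * Real.cosh s ^ N) :=
            mul_le_mul_of_nonneg_left hsum (by have := Real.cosh_pos s; positivity)
        _ = _ := by ring
    have hor : ∑ i ∈ I, Real.cosh (s * (d i + a i)) ≤ I.card * Real.cosh s ^ (N + 1) ∨
        ∑ i ∈ I, Real.cosh (s * (d i - a i)) ≤ I.card * Real.cosh s ^ (N + 1) := by
      by_contra hcon
      push Not at hcon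
      linarith [hcon.1, hcon.2]
    rcases hor with h | h
    · refine ⟨insert u A, insert v B, ?_, ?_, ?_, ?_, ?_⟩
      · rw [disjoint_insert_left, disjoint_insert_right]
        simp [hvu.symm, huB, hvA, hd]
      · rw [← hUeq]; ext x; simp only [mem_union, mem_insert]; tauto
      · rw [card_insert_of_notMem huA, hA]
      · rw [card_insert_of_notMem hvB, hB]
      · refine le_of_eq_of_le (sum_congr rfl fun i _ => ?_) h
        rw [sum_insert huA, sum_insert hvB]
        simp only [hdd, ha]
        congr 2; ring
    · refine ⟨insert v A, insert u B, ?_, ?_, ?_, ?_, ?_⟩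
      · rw [disjoint_insert_left, disjoint_insert_right]
        simp [hvu, hvB, huA, hd]
      · rw [← hUeq]; ext x; simp only [mem_union, mem_insert]; tauto
      · rw [card_insert_of_notMem hvA, hA]
      · rw [card_insert_of_notMem huB, hB]
      · refine le_of_eq_of_le (sum_congr rfl fun i _ => ?_) h
        rw [sum_insert hvA, sum_insert huB]
        simp only [hdd, ha]
        congr 2; ring

/-- A balanced split that almost halves polynomially many sets. -/
theorem exists_balanced_split (C : ℕ) {ξ : ℝ} (hξ : 0 < ξ) :
    ∃ N0 : ℕ, ∀ {V : Type} (U : Finset V) (𝓕 : Finset (Finset V)) (N : ℕ), N0 ≤ N →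
      U.card = 2 * N → 𝓕.card ≤ C * N ^ 2 →
      ∃ A B : Finset V, Disjoint A B ∧ A ∪ B = U ∧ A.card = N ∧ B.card = N ∧
        ∀ F ∈ 𝓕, |((F ∩ A).card : ℝ) - (F ∩ B).card| ≤ ξ * N := by
  obtain ⟨N0, hN0⟩ := exists_nat_gt (96 * C / ξ ^ 6)
  refine ⟨N0, ?_⟩
  intro V U 𝓕 N hN hU h𝓕
  obtain ⟨A, B, hd, hAB, hA, hB, hsum⟩ := exists_split_cosh_sum_le 𝓕
    (fun F v => if v ∈ F then (1 : ℝ) else 0) (fun F v => by positivity)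
    (fun F v => by split_ifs <;> norm_num) ξ N U hU
  refine ⟨A, B, hd, hAB, hA, hB, fun F hF => ?_⟩
  by_contra hcon
  push Not at hcon
  simp only [sum_boole, filter_mem_eq_inter, inter_comm _ A,
    inter_comm _ B] at hsum hcon
  set d : ℝ := ((A ∩ F).card : ℝ) - (B ∩ F).card with hdd
  have h1 : Real.cosh (ξ * d) ≤ 𝓕.card * Real.cosh ξ ^ N := by
    refine le_trans ?_ hsum
    exact single_le_sum (f := fun F : Finset V =>
      Real.cosh (ξ * (((A ∩ F).card : ℝ) - (B ∩ F).card))) (fun i _ => (Real.cosh_pos _).le) hF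
  have h2 : Real.cosh ξ ^ N ≤ Real.exp (ξ ^ 2 * N / 2) := by
    calc _ ≤ Real.exp (ξ ^ 2 / 2) ^ N :=
          pow_le_pow_left₀ (Real.cosh_pos _).le (Real.cosh_le_exp_half_sq ξ) N
      _ = _ := by rw [← Real.exp_nat_mul]; congr 1; ring
  have h3 : Real.exp (ξ ^ 2 * N) ≤ 2 * Real.cosh (ξ * d) := by
    rw [← Real.cosh_abs, Real.cosh_eq, abs_mul, abs_of_pos hξ]
    have h4 : Real.exp (ξ ^ 2 * N) ≤ Real.exp (ξ * |d|) := by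
      rw [Real.exp_le_exp]
      nlinarith
    have := Real.exp_pos (-(ξ * |d|))
    linarith
  have hNr : (0 : ℝ) ≤ N := Nat.cast_nonneg N
  have hd0 : N ≠ 0 := by
    rintro rfl
    have hA0 : A = ∅ := card_eq_zero.1 hA
    have hB0 : B = ∅ := card_eq_zero.1 hB
    simp [hdd, hA0, hB0] at hcon
  have hN' : (0 : ℝ) < N := by exact_mod_cast Nat.pos_of_ne_zero hd0
  set x := ξ ^ 2 * N / 2 with hx
  have hx0 : 0 < x := by positivity
  have h5 : x ^ 3 / 6 ≤ Real.exp x := by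
    have := Real.pow_div_factorial_le_exp x hx0.le 3
    simpa [Nat.factorial] using this
  have h6 : Real.exp (ξ ^ 2 * N) = Real.exp x * Real.exp x := by
    rw [← Real.exp_add]; congr 1; rw [hx]; ring
  have h7 : Real.exp x ≤ 2 * 𝓕.card := by
    have : Real.exp x * Real.exp x ≤ 2 * 𝓕.card * Real.exp x := by
      rw [← h6]
      have := mul_le_mul_of_nonneg_left h2 (Nat.cast_nonneg (α := ℝ) 𝓕.card)
      linarith
    exact le_of_mul_le_mul_right this (Real.exp_pos x)
  have h8 : (𝓕.card : ℝ) ≤ C * N ^ 2 := by exact_mod_cast h𝓕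
  have h9 : 96 * C < ξ ^ 6 * N := by
    have : (N0 : ℝ) ≤ N := by exact_mod_cast hN
    have := hN0.trans_le this
    rw [div_lt_iff₀ (by positivity)] at this
    linarith
  have h10 : 96 * C * (N : ℝ) ^ 2 < ξ ^ 6 * N * N ^ 2 := mul_lt_mul_of_pos_right h9 (by positivity)
  have h11 : x ^ 3 / 6 = ξ ^ 6 * N * N ^ 2 / 48 := by rw [hx]; ring
  linarith

end BalancedSplit

section Rebalance
open Finset
open scoped Classical

lemma exists_log_le {ε : ℝ} (hε : 0 < ε) :
    ∃ N0 : ℕ, ∀ N : ℕ, N0 ≤ N → Real.log N ≤ ε * N ∧ 10 ≤ Real.log N := by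
  have h1 := (Real.isLittleO_log_id_atTop.def hε).and (Real.tendsto_log_atTop.eventually_ge_atTop 10)
  obtain ⟨N0, hN0⟩ := Filter.eventually_atTop.1 (tendsto_natCast_atTop_atTop.eventually h1)
  refine ⟨N0, fun N hN => ?_⟩
  obtain ⟨h2, h3⟩ := hN0 N hN
  refine ⟨?_, h3⟩
  rw [Real.norm_of_nonneg (by linarith), id, Real.norm_of_nonneg (Nat.cast_nonneg N)] at h2
  exact h2

lemma natLog_two_mul_le {N : ℕ} (h : 10 ≤ Real.log N) :
    (Nat.log 2 (2 * N) : ℝ) ≤ 1.6 * Real.log N := by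
  have hN : N ≠ 0 := by rintro rfl; norm_num at h
  have h1 : (2 : ℝ) ^ Nat.log 2 (2 * N) ≤ 2 * N := by
    exact_mod_cast Nat.pow_log_le_self 2 (by omega)
  have h2 := Real.log_le_log (by positivity) h1
  have hN' : (N : ℝ) ≠ 0 := by exact_mod_cast hN
  rw [Real.log_pow, Real.log_mul (by norm_num) hN'] at h2
  have h3 := Real.log_two_gt_d9
  have h4 := Real.log_two_lt_d9
  have h5 : (0 : ℝ) ≤ (Nat.log 2 (2 * N) : ℝ) := Nat.cast_nonneg _
  nlinarith

variable {V : Type*} {r : ℕ} {G : SimpleGraph V} {c : Sym2 V → Fin r}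

lemma dg_le_sum_Rc (v : V) (T : Finset V) : dg G.Adj v T ≤ ∑ i, dg (Rc G c i) v T := by
  refine le_trans (card_le_card fun w hw => ?_) card_biUnion_le
  obtain ⟨h1, h2⟩ := mem_filter.1 hw
  exact mem_biUnion.2 ⟨c s(v, w), mem_univ _, mem_filter.2 ⟨h1, h2, rfl⟩⟩

/-- A monochromatic cycle of prescribed even length in a graph with many edges. -/
lemma exists_mono_even_cycle {S : Finset V} {k H m : ℕ} (hH : S.card < 2 ^ (H + 1))
    (hk : r * (72 * k * S.card) < ed G.Adj S S) (hm : H < m) (hmk : m ≤ k) :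
    ∃ X ⊆ S, X.card = 2 * m ∧ CP G c ↑X 1 := by
  obtain ⟨i, hi⟩ : ∃ i, 72 * k * S.card < ed (Rc G c i) S S := by
    by_contra hcon
    push Not at hcon
    have h1 : ed G.Adj S S ≤ ∑ i, ed (Rc G c i) S S := by
      unfold ed
      rw [sum_comm]
      exact sum_le_sum fun v _ => dg_le_sum_Rc v S
    have h2 := sum_le_sum fun i (_ : i ∈ (univ : Finset (Fin r))) => hcon i
    simp only [sum_const, card_univ, Fintype.card_fin, smul_eq_mul] at h2
    omega
  obtain ⟨l, hl, hlen, hlS⟩ := exists_even_cycle (fun _ _ h => Rc.symm h)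
    (fun v h => G.irrefl h.1) hH hi hm hmk
  refine ⟨l.toFinset, fun x hx => hlS x (List.mem_toFinset.1 hx), ?_, ?_⟩
  · rw [List.toFinset_card_of_nodup hl.1, hlen]
  · rw [List.coe_toFinset]
    exact hl.cp

/-- Removing an exact even number of vertices by few monochromatic cycles. -/
lemma exists_cp_card_eq {L : Finset V} {k H q : ℕ} (hH : L.card < 2 ^ (H + 1))
    (hkH : 2 * H + 2 ≤ k)
    (hL : ∀ Y ⊆ L, Y.card ≤ 2 * q → r * (72 * k * L.card) < ed G.Adj (L \ Y) (L \ Y)) (q' : ℕ)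
    (hq' : H < q') (Y : Finset V) (hY : Y ⊆ L) (hYq : Y.card + 2 * q' ≤ 2 * q) :
    ∃ X ⊆ L \ Y, X.card = 2 * q' ∧ CP G c ↑X (q' / (k - H - 1) + 1) := by
  induction q' using Nat.strong_induction_on generalizing Y with
  | _ q' ih =>
    have hcard : (L \ Y).card ≤ L.card := card_le_card sdiff_subset
    have hed : r * (72 * k * (L \ Y).card) < ed G.Adj (L \ Y) (L \ Y) :=
      lt_of_le_of_lt (Nat.mul_le_mul_left _ (Nat.mul_le_mul_left _ hcard)) (hL Y hY (by omega))
    by_cases hqk : q' ≤ k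
    · obtain ⟨X, h1, h2, h3⟩ := exists_mono_even_cycle (c := c) (hcard.trans_lt hH) hed hq' hqk
      exact ⟨X, h1, h2, h3.mono (Nat.le_add_left 1 _)⟩
    · obtain ⟨X, h1, h2, h3⟩ := exists_mono_even_cycle (c := c) (m := k - H - 1)
        (hcard.trans_lt hH) hed (by omega) (by omega)
      have hXY : Disjoint Y X := disjoint_left.2 fun x hx hx' =>
        (mem_sdiff.1 (h1 hx')).2 hx
      obtain ⟨X', h1', h2', h3'⟩ := ih (q' - (k - H - 1)) (by omega) (by omega) (Y ∪ X)
        (union_subset hY (h1.trans sdiff_subset)) (by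
          rw [card_union_of_disjoint hXY]; omega)
      have hXX' : Disjoint X X' := disjoint_left.2 fun x hx hx' =>
        (mem_sdiff.1 (h1' hx')).2 (mem_union_right _ hx)
      refine ⟨X ∪ X', union_subset h1 (h1'.trans
        (sdiff_subset_sdiff subset_rfl subset_union_left)), ?_, ?_⟩
      · rw [card_union_of_disjoint hXX']; omega
      · rw [coe_union]
        refine (h3.union h3' (by exact_mod_cast hXX')).mono ?_
        have := Nat.add_div_right (q' - (k - H - 1)) (show 0 < k - H - 1 by omega)
        rw [Nat.sub_add_cancel (by omega)] at this
        omega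

lemma ed_le_ed_sdiff_add {R : V → V → Prop} (hR : ∀ ⦃u v⦄, R u v → R v u) (L Y : Finset V)
    (hY : Y ⊆ L) : ed R L L ≤ ed R (L \ Y) (L \ Y) + 2 * ed R Y L := by
  have hd : Disjoint Y (L \ Y) := disjoint_sdiff
  have h1 : ed R L L = ed R Y L + (ed R Y (L \ Y) + ed R (L \ Y) (L \ Y)) := by
    rw [ed_comm hR Y (L \ Y), ← ed_union_right _ hd, union_sdiff_of_subset hY,
      ← ed_union_left hd, union_sdiff_of_subset hY]
  have h2 : ed R Y (L \ Y) ≤ ed R Y L := ed_mono subset_rfl sdiff_subset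
  omega

end Rebalance

section NearBipartite
open Finset
open scoped Classical
variable {V : Type} {G : SimpleGraph V} {A B M X Y : Finset V} {N N' : ℕ}

/-- A vertex split with large crossing degrees and no large sparse crossing pair. -/
structure NearBip (G : SimpleGraph V) (A B : Finset V) (N : ℕ) : Prop where
  disj : Disjoint A B
  degA : ∀ v ∈ A, (N : ℝ) / 6 ≤ dg G.Adj v B
  degB : ∀ v ∈ B, (N : ℝ) / 6 ≤ dg G.Adj v A
  dense : ∀ S ⊆ A, ∀ T ⊆ B, (6 / 100 : ℝ) * N ≤ S.card → (6 / 100 : ℝ) * N ≤ T.card →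
    (∀ u ∈ S, (dg G.Adj u T : ℝ) ≤ 3 / 100 * N) → (∀ v ∈ T, (dg G.Adj v S : ℝ) ≤ 3 / 100 * N) →
    False

lemma NearBip.symm (h : NearBip G A B N) : NearBip G B A N :=
  ⟨h.disj.symm, h.degB, h.degA, fun S hS T hT h1 h2 h3 h4 => h.dense T hT S hS h2 h1 h4 h3⟩

lemma NearBip.core (h : NearBip G A B N) (hN : 0 < N) (hM : M ⊆ A)
    (hMd : ∀ v ∈ M, (N : ℝ) / 8 ≤ dg G.Adj v A) (hMc : (M.card : ℝ) ≤ N / 200) (hX : X ⊆ A \ M)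
    (hXc : (X.card : ℝ) ≤ N / 90) (hYc : (Y.card : ℝ) ≤ N / 1000)
    (hA : N ≤ A.card) (hA' : (A.card : ℝ) ≤ N + N / 200) (e1 : ((A \ M) \ X).card = N')
    (e2 : ((B ∪ M) \ Y).card = N') :
    Core G ((A \ M) \ X) ((B ∪ M) \ Y) (1 / 10) (1 / 50) N' := by
  have hN0 : (0 : ℝ) < N := by exact_mod_cast hN
  have hc1 : ((A \ M).card : ℝ) + M.card = A.card := by
    exact_mod_cast card_sdiff_add_card_eq_card hM
  have hc2 : (N' : ℝ) + X.card = (A \ M).card := by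
    rw [← e1]; exact_mod_cast card_sdiff_add_card_eq_card hX
  have hAr : (N : ℝ) ≤ A.card := by exact_mod_cast hA
  have hMc0 : (0 : ℝ) ≤ M.card := by positivity
  have hXc0 : (0 : ℝ) ≤ X.card := by positivity
  have hdegA : ∀ v, (dg G.Adj v A : ℝ) ≤ dg G.Adj v ((A \ M) \ X) + M.card + X.card := fun v => by
    have h1 := dg_le_sdiff_add (R := G.Adj) v A M
    have h2 := dg_le_sdiff_add (R := G.Adj) v (A \ M) X
    exact_mod_cast (by omega :
      dg G.Adj v A ≤ dg G.Adj v ((A \ M) \ X) + M.card + X.card)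
  refine ⟨?_, e1, e2, fun v hv => ?_, fun v hv => ?_, fun S hS T hT hSc hTc hSd hTd => ?_⟩
  · rw [disjoint_left]
    intro x hx hx'
    simp only [mem_sdiff, mem_union] at hx hx'
    rcases hx'.1 with h' | h'
    exacts [disjoint_left.1 h.disj hx.1.1 h', hx.1.2 h']
  · have h1 := h.degA v (sdiff_subset (sdiff_subset hv))
    have h2 := dg_mono (R := G.Adj) (v := v) (subset_union_left : B ⊆ B ∪ M)
    have h3 : (dg G.Adj v (B ∪ M) : ℝ) ≤ dg G.Adj v ((B ∪ M) \ Y) + Y.card := by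
      exact_mod_cast dg_le_sdiff_add (R := G.Adj) v (B ∪ M) Y
    have h2' : (dg G.Adj v B : ℝ) ≤ dg G.Adj v (B ∪ M) := by exact_mod_cast h2
    linarith
  · have h3 := hdegA v
    rcases mem_union.1 (mem_sdiff.1 hv).1 with h' | h'
    · linarith [h.degB v h']
    · linarith [hMd v h']
  · have hTM : (T.card : ℝ) ≤ (T \ M).card + M.card := by
      exact_mod_cast (card_le_card_sdiff_add_card : T.card ≤ (T \ M).card + M.card)
    refine h.dense S (hS.trans (sdiff_subset.trans sdiff_subset)) (T \ M)
      (fun x hx => ?_) (by linarith) (by linarith) (fun u hu => ?_) (fun v hv => ?_)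
    · rw [mem_sdiff] at hx
      exact (mem_union.1 (mem_sdiff.1 (hT hx.1)).1).resolve_right hx.2
    · have h1 : (dg G.Adj u (T \ M) : ℝ) ≤ dg G.Adj u T := by
        exact_mod_cast dg_mono (R := G.Adj) sdiff_subset
      linarith [hSd u hu]
    · linarith [hTd v (sdiff_subset hv)]

end NearBipartite

section Balancing
open Finset
open scoped Classical
variable {V : Type} {r : ℕ} {G : SimpleGraph V} {c : Sym2 V → Fin r} {A B : Finset V} {N t : ℕ}

set_option maxHeartbeats 1600000 in
/-- Two sides of different sizes can be balanced by removing few monochromatic cycles. -/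
lemma exists_balancing (hr : 0 < r) (hd : Disjoint A B) (hA : A.card = N + t)
    (hB : B.card + t = N) (hAd : ∀ v ∈ A, (dg G.Adj v A : ℝ) ≤ N / 8)
    (hlog : 10 ≤ Real.log N) (hBN : N ≤ 2 * B.card)
    (hdeg : ∀ v ∈ A ∪ B, (N : ℝ) + 1000 * r * Real.log N ≤ dg G.Adj v (A ∪ B)) :
    ∃ X ⊆ A, ∃ Y ⊆ B, X.card = Y.card + 2 * t ∧ (Y.card : ℝ) ≤ 4 * Real.log N ∧
      CP G c ↑X (144 * r + 2) ∧ CP G c ↑Y 1 := by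
  set H := Nat.log 2 (2 * N) with hHdef
  set L := Real.log N with hL
  have hHL : (H : ℝ) ≤ 1.6 * L := natLog_two_mul_le hlog
  have hN : 0 < N := by
    rcases Nat.eq_zero_or_pos N with h | h
    · rw [hL, h] at hlog; norm_num at hlog
    · exact h
  have hNr : (0 : ℝ) < N := by exact_mod_cast hN
  have hr1 : (1 : ℝ) ≤ r := by exact_mod_cast hr
  have h2N : 2 * N < 2 ^ (H + 1) := Nat.lt_pow_succ_log_self (by norm_num) _
  have hrL : L ≤ r * L := by nlinarith
  have hrL' : 10 * (r : ℝ) ≤ r * L := by nlinarith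
  have hAB : ∀ v, (dg G.Adj v (A ∪ B) : ℝ) = dg G.Adj v A + dg G.Adj v B := fun v => by
    exact_mod_cast dg_union v hd
  have hAcr : (A.card : ℝ) = N + t := by exact_mod_cast hA
  have hBcr : (B.card : ℝ) + t = N := by exact_mod_cast hB
  have hBpos : (0 : ℝ) < B.card := by exact_mod_cast (by omega : 0 < B.card)
  -- a short cycle in `B` when the excess is small
  have hY : ∃ p, ∃ Y ⊆ B, Y.card = 2 * p ∧ CP G c ↑Y 1 ∧ H < t + p ∧ p ≤ H + 1 := by
    by_cases htH : H < t
    · exact ⟨0, ∅, by simp, by simp, by simpa using CP.empty.mono (by omega), by omega, by omega⟩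
    · push Not at htH
      have htL : (t : ℝ) ≤ H := by exact_mod_cast htH
      obtain ⟨Y, h1, h2, h3⟩ := exists_mono_even_cycle (G := G) (c := c) (S := B) (k := H + 1)
        (H := H) (m := H + 1) (by omega) (by
          have : ((r * (72 * (H + 1) * B.card) : ℕ) : ℝ) < ed G.Adj B B := by
            calc ((r * (72 * (H + 1) * B.card) : ℕ) : ℝ)
                = B.card * (72 * (r * H) + 72 * r) := by push_cast; ring
              _ < B.card * (1000 * r * L - t) := by
                  apply mul_lt_mul_of_pos_left _ hBpos
                  nlinarith
              _ = ∑ _v ∈ B, (1000 * r * L - t) := by rw [sum_const, nsmul_eq_mul]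
              _ ≤ ∑ v ∈ B, (dg G.Adj v B : ℝ) := by
                  refine sum_le_sum fun v hv => ?_
                  have h1 := hdeg v (mem_union_right _ hv)
                  have h2 : (dg G.Adj v A : ℝ) ≤ A.card := by exact_mod_cast dg_le_card v A
                  linarith [hAB v]
              _ = _ := by simp [ed]
          exact_mod_cast this) (by omega) le_rfl
      exact ⟨H + 1, Y, h1, h2, h3, by omega, le_rfl⟩
  obtain ⟨p, Y, hYB, hYc, hYcp, hp, hpH⟩ := hY
  have hpr : (p : ℝ) ≤ H + 1 := by exact_mod_cast hpH
  have hp0 : (0 : ℝ) ≤ p := by positivity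
  have hkt' : 144 * r * (t / (144 * r)) ≤ t := Nat.mul_div_le t (144 * r)
  have htz : t < 144 * r * (t / (144 * r) + 1) := Nat.lt_mul_div_succ t (by omega)
  generalize t / (144 * r) = z at hkt' htz
  obtain ⟨k, hk⟩ : ∃ k, k = z + (2 * H + 2) := ⟨_, rfl⟩
  have hkt : (144 : ℝ) * r * z ≤ t := by
    exact_mod_cast hkt'
  have hkr : (k : ℝ) = z + (2 * H + 2) := by rw [hk]; push_cast; ring
  obtain ⟨X, hX, hXc, hXcp⟩ := exists_cp_card_eq (G := G) (c := c) (L := A) (k := k) (H := H)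
    (q := t + p) (by omega) (by omega) (fun Z hZ hZc => by
      have h1 : (ed G.Adj A A : ℝ) ≤ ed G.Adj (A \ Z) (A \ Z) + 2 * ed G.Adj Z A := by
        exact_mod_cast ed_le_ed_sdiff_add (R := G.Adj) (fun _ _ h => h.symm) A Z hZ
      have h2 : (ed G.Adj Z A : ℝ) ≤ 2 * (t + p) * (N / 8) := by
        calc (ed G.Adj Z A : ℝ) = ∑ v ∈ Z, (dg G.Adj v A : ℝ) := by simp [ed]
          _ ≤ ∑ _v ∈ Z, (N / 8 : ℝ) := sum_le_sum fun v hv => hAd v (hZ hv)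
          _ = Z.card * (N / 8) := by simp
          _ ≤ _ := mul_le_mul_of_nonneg_right (by exact_mod_cast hZc) (by positivity)
      have h3 : (A.card : ℝ) * (t + 1000 * r * L) ≤ ed G.Adj A A := by
        calc (A.card : ℝ) * (t + 1000 * r * L) = ∑ _v ∈ A, (t + 1000 * r * L) := by
              rw [sum_const, nsmul_eq_mul]
          _ ≤ ∑ v ∈ A, (dg G.Adj v A : ℝ) := by
              refine sum_le_sum fun v hv => ?_
              have h1 := hdeg v (mem_union_left _ hv)
              have h2 : (dg G.Adj v B : ℝ) ≤ B.card := by exact_mod_cast dg_le_card v B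
              linarith [hAB v]
          _ = _ := by simp [ed]
      have h4 : (t + p : ℝ) * (N / 8) * 4 ≤ A.card * ((t + p) / 2) := by
        have ht0 : (0 : ℝ) ≤ t := by positivity
        rw [hAcr]; nlinarith [mul_nonneg ht0 (add_nonneg ht0 hp0)]
      have hApos : (0 : ℝ) < A.card := by rw [hAcr]; positivity
      have h5 : (72 : ℝ) * r * k < t / 2 + 1000 * r * L - p / 2 := by
        rw [hkr]; nlinarith
      have h6 := mul_lt_mul_of_pos_left h5 hApos
      have : ((r * (72 * k * A.card) : ℕ) : ℝ) < ed G.Adj (A \ Z) (A \ Z) := by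
        push_cast; nlinarith
      exact_mod_cast this) (t + p) hp ∅ (by simp) (by simp)
  refine ⟨X, hX.trans sdiff_subset, Y, hYB, by omega, ?_, hXcp.mono ?_, hYcp⟩
  · rw [hYc]; push_cast; linarith
  · have : (t + p) / (k - H - 1) ≤ 144 * r + 1 := by
      refine Nat.div_le_of_le_mul ?_
      have h2 : k - H - 1 = z + (H + 1) := by omega
      rw [h2]
      have h3 : 144 * r * (z + 1) ≤ 144 * r * (z + (H + 1)) :=
        Nat.mul_le_mul_left _ (by omega)
      have h4 : (z + (H + 1)) * (144 * r + 1) =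
        144 * r * (z + (H + 1)) + (z + (H + 1)) := by ring
      omega
    omega

set_option maxHeartbeats 1600000 in
/-- A nearly balanced and nearly bipartite split admits a partition into few cycles. -/
theorem NearBip.exists_cp (r : ℕ) (hr : 0 < r) : ∃ N0 : ℕ, ∀ {V : Type} {G : SimpleGraph V}
    {c : Sym2 V → Fin r} {A B : Finset V} {N : ℕ}, N0 ≤ N → NearBip G A B N →
    A.card + B.card = 2 * N → N ≤ A.card → (A.card : ℝ) ≤ N + N / 200 →
    (∀ v ∈ A ∪ B, (N : ℝ) + 1000 * r * Real.log N ≤ dg G.Adj v (A ∪ B)) →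
    CP G c ↑(A ∪ B) (1300 * r ^ 2) := by
  obtain ⟨N1, hcore⟩ := Core.exists_cp (θ := 1 / 10) (η := 1 / 50) r (800 * r ^ 2) (60 * r) hr
    (by norm_num) (by norm_num) (by norm_num) (by push_cast; linarith) (by push_cast; linarith)
  obtain ⟨N2, hlog⟩ := exists_log_le (ε := 1 / 4000) (by norm_num)
  refine ⟨2 * N1 + N2, fun {V G c A B N} hN h hcard hA hA' hdeg => ?_⟩
  obtain ⟨hl1, hl2⟩ := hlog N (by omega)
  have hN0 : 0 < N := by
    rcases Nat.eq_zero_or_pos N with h | h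
    · rw [h] at hl2; norm_num at hl2
    · exact h
  have hN0r : (0 : ℝ) < N := by exact_mod_cast hN0
  obtain ⟨M, X, Y, hM, hMd, hMc, hX, hXc, hY, hYc, he, hXcp, hYcp⟩ : ∃ M X Y : Finset V, M ⊆ A ∧
      (∀ v ∈ M, (N : ℝ) / 8 ≤ dg G.Adj v A) ∧ (M.card : ℝ) ≤ N / 200 ∧ X ⊆ A \ M ∧
      (X.card : ℝ) ≤ N / 90 ∧ Y ⊆ B ∪ M ∧ (Y.card : ℝ) ≤ N / 1000 ∧
      ((A \ M) \ X).card = ((B ∪ M) \ Y).card ∧ CP G c ↑X (144 * r + 2) ∧ CP G c ↑Y 1 := by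
    set M0 := A.filter fun v => (N : ℝ) / 8 ≤ dg G.Adj v A with hM0
    have hM0A : M0 ⊆ A := filter_subset _ _
    have hdBM : ∀ M ⊆ A, Disjoint B M := fun M hM => h.disj.symm.mono_right hM
    by_cases hMt : A.card - N ≤ M0.card
    · obtain ⟨M, hM, hMc⟩ := exists_subset_card_eq hMt
      have h1 := card_sdiff_add_card_eq_card (hM.trans hM0A)
      refine ⟨M, ∅, ∅, hM.trans hM0A, fun v hv => (mem_filter.1 (hM hv)).2, ?_, by simp,
        by simp; positivity, by simp, by simp; positivity, ?_, by simpa using CP.empty.mono (by omega),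
        by simpa using CP.empty.mono (by omega)⟩
      · have : (M.card : ℝ) + N = A.card := by exact_mod_cast (by omega : M.card + N = A.card)
        linarith
      · rw [sdiff_empty, sdiff_empty,
          card_union_of_disjoint (hdBM _ (hM.trans hM0A))]
        omega
    · push Not at hMt
      have h1 := card_sdiff_add_card_eq_card hM0A
      have h2 := card_union_of_disjoint (hdBM _ hM0A)
      have h3 : (A \ M0) ∪ (B ∪ M0) = A ∪ B := by
        ext x
        simp only [mem_union, mem_sdiff]
        have := @hM0A x
        tauto
      obtain ⟨t, ht⟩ : ∃ t, A.card = N + M0.card + t := ⟨_, (Nat.add_sub_cancel' (by omega)).symm⟩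
      have hr1 : (A.card : ℝ) = N + M0.card + t := by exact_mod_cast ht
      have ht0 : (0 : ℝ) ≤ t := by positivity
      have hm0 : (0 : ℝ) ≤ M0.card := by positivity
      obtain ⟨X, hX, Y, hY, hXY, hYc, hXcp, hYcp⟩ := exists_balancing (c := c) (A := A \ M0)
        (B := B ∪ M0) (N := N) (t := t) hr (by
          rw [disjoint_union_right]
          exact ⟨h.disj.mono_left sdiff_subset, sdiff_disjoint⟩) (by omega) (by omega)
        (fun v hv => by
          have h4 : (dg G.Adj v (A \ M0) : ℝ) ≤ dg G.Adj v A := by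
            exact_mod_cast dg_mono (R := G.Adj) sdiff_subset
          rw [mem_sdiff, hM0, mem_filter, not_and, not_le] at hv
          exact h4.trans (hv.2 hv.1).le) hl2 (by
          have : (2 * t : ℝ) ≤ N := by linarith
          have : 2 * t ≤ N := by exact_mod_cast this
          omega) (by rw [h3]; exact hdeg)
      have hXr : (X.card : ℝ) = Y.card + 2 * t := by exact_mod_cast hXY
      refine ⟨M0, X, Y, hM0A, fun v hv => (mem_filter.1 hv).2, by linarith, hX,
        by linarith, hY, by linarith, ?_, hXcp, hYcp⟩
      have h4 := card_sdiff_add_card_eq_card hX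
      have h5 := card_sdiff_add_card_eq_card hY
      omega
  have hc := h.core hN0 hM hMd hMc hX hXc hYc hA hA' rfl he.symm
  have hc1 := card_sdiff_add_card_eq_card hM
  have hc2 := card_sdiff_add_card_eq_card hX
  have hcp := hcore (c := c) (by
    have : (N : ℝ) ≤ 2 * ((A \ M) \ X).card := by
      have h1 : (N : ℝ) ≤ (((A \ M) \ X).card + X.card + M.card : ℕ) := by
        exact_mod_cast (by omega)
      push_cast at h1
      linarith
    have : N ≤ 2 * ((A \ M) \ X).card := by exact_mod_cast this
    omega) hc
  have hdXY : Disjoint X Y := by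
    refine disjoint_left.2 fun x hx hy => ?_
    rcases mem_union.1 (hY hy) with h' | h'
    exacts [disjoint_left.1 h.disj (mem_sdiff.1 (hX hx)).1 h',
      (mem_sdiff.1 (hX hx)).2 h']
  have hXY := hXcp.union hYcp (by exact_mod_cast hdXY)
  have hall := hcp.union hXY (by
    rw [← coe_union, disjoint_coe, disjoint_left]
    intro x hx hx'
    simp only [mem_union, mem_sdiff] at hx hx'
    have hX' := @hX x
    have hY' := @hY x
    have hd : x ∈ A → x ∉ B := fun h1 => disjoint_left.1 h.disj h1
    simp only [mem_union, mem_sdiff] at hX' hY'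
    tauto)
  have he : ((A \ M) \ X ∪ (B ∪ M) \ Y) ∪ (X ∪ Y) = A ∪ B := by
    ext x
    have hX' := @hX x
    have hY' := @hY x
    have hM' := @hM x
    simp only [mem_union, mem_sdiff] at hX' hY' ⊢
    tauto
  rw [← he]
  push_cast at hall ⊢
  exact hall.mono (by nlinarith)

end Balancing

section NearClique
open Finset
open scoped Classical

lemma filter_inter_of_subset {V : Type} {U A : Finset V} (p : V → Prop) (h : A ⊆ U) :
    U.filter p ∩ A = A.filter p := by
  ext x
  simp only [mem_inter, mem_filter]
  have := @h x
  tauto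

lemma exists_even_subset {V : Type} {r : ℕ} {G : SimpleGraph V} {c : Sym2 V → Fin r}
    (D : Finset V) : ∃ D' ⊆ D, D'.card = 2 * (D.card / 2) ∧ CP G c ↑(D \ D') 1 := by
  obtain ⟨D', hD', hc⟩ := exists_subset_card_eq (s := D) (n := 2 * (D.card / 2)) (by omega)
  refine ⟨D', hD', hc, ?_⟩
  have hsd := card_sdiff_add_card_eq_card hD'
  rcases Nat.lt_or_ge (D \ D').card 1 with h | h
  · rw [card_eq_zero.1 (by omega : (D \ D').card = 0), coe_empty]
    exact CP.empty.mono (by omega)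
  · obtain ⟨v, hv⟩ := card_eq_one.1 (by omega : (D \ D').card = 1)
    rw [hv, coe_singleton]
    exact CP.singleton v

set_option maxHeartbeats 1600000 in
/-- A nearly complete graph admits a partition into few monochromatic cycles. -/
theorem exists_cp_of_nearClique (r : ℕ) (hr : 0 < r) : ∃ N0 : ℕ, ∀ {V : Type} {G : SimpleGraph V}
    {c : Sym2 V → Fin r} {D E : Finset V} {N : ℕ}, N0 ≤ N → (99 / 100 : ℝ) * N ≤ D.card →
    (D.card : ℝ) ≤ 101 / 100 * N → (∀ v ∈ D, (N : ℝ) / 4 ≤ dg G.Adj v D) →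
    (E.card : ℝ) ≤ 3 / 100 * N → (∀ v ∈ D \ E, (D.card : ℝ) - 3 / 100 * N ≤ dg G.Adj v D) →
    CP G c ↑D (900 * r ^ 2) := by
  obtain ⟨N1, hcore⟩ := Core.exists_cp (θ := 1 / 5) (η := 1 / 50) r (800 * r ^ 2) (30 * r) hr
    (by norm_num) (by norm_num) (by norm_num) (by push_cast; linarith) (by push_cast; linarith)
  obtain ⟨N2, hsplit⟩ := exists_balanced_split (ξ := 1 / 1000) 3 (by norm_num)
  refine ⟨3 * N1 + 3 * N2 + 1000, fun {V G c D E N} hN hD1 hD2 hdeg hE hDE => ?_⟩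
  have hNr : (1000 : ℝ) ≤ N := by exact_mod_cast (by omega : 1000 ≤ N)
  obtain ⟨D', hD', hD'c, hrest⟩ := exists_even_subset (G := G) (c := c) D
  set m := D.card / 2 with hm
  have hsd := card_sdiff_add_card_eq_card hD'
  have hmD : D.card ≤ 2 * m + 1 := by omega
  have hmD' : 2 * m ≤ D.card := by omega
  have hmr : (D.card : ℝ) ≤ 2 * m + 1 := by exact_mod_cast hmD
  have hmr' : (2 * m : ℝ) ≤ D.card := by exact_mod_cast hmD'
  have hNm : N ≤ 3 * m := by
    have : (N : ℝ) ≤ 3 * m := by linarith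
    exact_mod_cast this
  obtain ⟨A, B, hAB, hU, hA, hB, hbal⟩ := hsplit D' (D.image fun v => D'.filter (G.Adj v)) m
    (by omega) hD'c (card_image_le.trans (by nlinarith))
  have hAU : A ⊆ D' := hU ▸ subset_union_left
  have hBU : B ⊆ D' := hU ▸ subset_union_right
  have key : ∀ v ∈ D, |(dg G.Adj v A : ℝ) - dg G.Adj v B| ≤ 1 / 1000 * m ∧
      (dg G.Adj v D : ℝ) ≤ dg G.Adj v A + dg G.Adj v B + 1 := fun v hv => by
    constructor
    · have := hbal _ (mem_image_of_mem _ hv)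
      rwa [filter_inter_of_subset _ hAU, filter_inter_of_subset _ hBU] at this
    · have h1 := dg_union (R := G.Adj) v hAB
      have h2 := dg_le_sdiff_add (R := G.Adj) v D (D \ D')
      rw [Finset.sdiff_sdiff_eq_self hD', ← hU, h1, hU] at h2
      exact_mod_cast h2.trans (by omega)
  have hc : Core G A B (1 / 5) (1 / 50) m := by
    refine ⟨hAB, hA, hB, fun v hv => ?_, fun v hv => ?_, fun S hS T hT hSc hTc hSd _ => ?_⟩
    · obtain ⟨h1, h2⟩ := key v (hD' (hAU hv))
      rw [abs_le] at h1
      linarith [hdeg v (hD' (hAU hv))]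
    · obtain ⟨h1, h2⟩ := key v (hD' (hBU hv))
      rw [abs_le] at h1
      linarith [hdeg v (hD' (hBU hv))]
    · obtain ⟨u, hu, huE⟩ : ∃ u ∈ S, u ∉ E := by
        by_contra hcon
        push Not at hcon
        have : (S.card : ℝ) ≤ E.card := by exact_mod_cast card_le_card hcon
        linarith
      have h1 := hDE u (mem_sdiff.2 ⟨hD' (hAU (hS hu)), huE⟩)
      have hTD : T ⊆ D := hT.trans (hBU.trans hD')
      have h2 : (dg G.Adj u D : ℝ) ≤ dg G.Adj u T + (D \ T).card := by
        have h3 := dg_le_sdiff_add (R := G.Adj) u D (D \ T)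
        rw [Finset.sdiff_sdiff_eq_self hTD] at h3
        exact_mod_cast h3
      have h3 : ((D \ T).card : ℝ) + T.card = D.card := by
        exact_mod_cast card_sdiff_add_card_eq_card hTD
      linarith [hSd u hu]
  have hcp := hcore (c := c) (by omega) hc
  rw [hU] at hcp
  have hall := hcp.union hrest (by exact_mod_cast disjoint_sdiff)
  rw [← coe_union, union_sdiff_of_subset hD'] at hall
  exact hall.mono (by nlinarith)

end NearClique

section Extremal
open Finset
open scoped Classical

set_option maxHeartbeats 1600000 in
/-- The case of a sparse set on almost half of the vertices. -/
theorem exists_cp_of_sparse_half (r : ℕ) (hr : 0 < r) : ∃ N0 : ℕ, ∀ {V : Type} {G : SimpleGraph V}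
    {c : Sym2 V → Fin r} {U S : Finset V} {N : ℕ}, N0 ≤ N → S ⊆ U → U.card = 2 * N →
    (1 - 1 / 5000 : ℝ) * N ≤ S.card → S.card ≤ N → (∀ v ∈ S, (dg G.Adj v S : ℝ) ≤ N / 5000) →
    (∀ v ∈ U, (N : ℝ) + 1000 * r * Real.log N ≤ dg G.Adj v U) → CP G c ↑U (1300 * r ^ 2) := by
  obtain ⟨N1, hmain⟩ := NearBip.exists_cp r hr
  refine ⟨N1 + 1, fun {V G c U S N} hN hSU hU hS1 hS2 hSd hdeg => ?_⟩
  have hNr : (0 : ℝ) < N := by exact_mod_cast (by omega : 0 < N)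
  have hdegN : ∀ v ∈ U, (N : ℝ) ≤ dg G.Adj v U := fun v hv => by
    have h1 := hdeg v hv
    have h2 : (0 : ℝ) ≤ 1000 * r * Real.log N := by positivity
    linarith
  have hS2r : (S.card : ℝ) ≤ N := by exact_mod_cast hS2
  set W := (U \ S).filter fun v => (dg G.Adj v S : ℝ) < N / 5 with hW
  have hWU : W ⊆ U \ S := filter_subset _ _
  have hUS : ((U \ S).card : ℝ) + S.card = 2 * N := by
    exact_mod_cast hU ▸ card_sdiff_add_card_eq_card hSU
  have hSout : ∀ v ∈ S, (1 - 1 / 5000 : ℝ) * N ≤ dg G.Adj v (U \ S) := fun v hv => by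
    have h1 := dg_union (R := G.Adj) v (disjoint_sdiff (s := S) (t := U))
    rw [union_sdiff_of_subset hSU] at h1
    have h2 : (dg G.Adj v U : ℝ) = dg G.Adj v S + dg G.Adj v (U \ S) := by exact_mod_cast h1
    linarith [hSd v hv, hdegN v (hSU hv)]
  have hWc : (W.card : ℝ) ≤ 3 / 5000 * N := by
    have h1 : (S.card : ℝ) * ((1 - 1 / 5000) * N) ≤ ed G.Adj S (U \ S) := by
      rw [← nsmul_eq_mul]
      unfold ed
      push_cast
      exact card_nsmul_le_sum _ _ _ hSout
    have h2 : (ed G.Adj S (U \ S) : ℝ) ≤ W.card * (N / 5) + ((U \ S) \ W).card * S.card := by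
      rw [ed_comm (fun _ _ h => h.symm)]
      unfold ed
      push_cast
      rw [← sum_sdiff hWU, add_comm]
      refine add_le_add ?_ ?_
      · rw [← nsmul_eq_mul]
        exact sum_le_card_nsmul _ _ _ fun v hv => (mem_filter.1 hv).2.le
      · rw [← nsmul_eq_mul]
        exact sum_le_card_nsmul _ _ _ fun v _ => by exact_mod_cast dg_le_card v S
    have h3 : (((U \ S) \ W).card : ℝ) + W.card = (U \ S).card := by
      exact_mod_cast card_sdiff_add_card_eq_card hWU
    have h4 : (((U \ S) \ W).card : ℝ) = 2 * N - S.card - W.card := by linarith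
    rw [h4] at h2
    by_contra hcon
    push Not at hcon
    have h5 : 0 < (W.card - 3 / 5000 * N : ℝ) * (S.card - N / 5) :=
      mul_pos (by linarith) (by linarith)
    nlinarith
  set B := (U \ S) \ W with hB
  have hSW : Disjoint S W := disjoint_sdiff.mono_right hWU
  have hAB : Disjoint (S ∪ W) B := by
    rw [disjoint_union_left]
    exact ⟨disjoint_sdiff.mono_right sdiff_subset, disjoint_sdiff⟩
  have hun : (S ∪ W) ∪ B = U := by
    rw [union_assoc, hB, union_sdiff_of_subset hWU, union_sdiff_of_subset hSU]
  have hcardA := card_union_of_disjoint hSW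
  have hcard : (S ∪ W).card + B.card = 2 * N := by
    rw [← card_union_of_disjoint hAB, hun, hU]
  have hcardAr : ((S ∪ W).card : ℝ) = S.card + W.card := by exact_mod_cast hcardA
  have hcardr : ((S ∪ W).card : ℝ) + B.card = 2 * N := by exact_mod_cast hcard
  have hW0 : (0 : ℝ) ≤ W.card := by positivity
  have hdB : ∀ v, (dg G.Adj v (U \ S) : ℝ) ≤ dg G.Adj v B + W.card := fun v => by
    exact_mod_cast dg_le_sdiff_add (R := G.Adj) v (U \ S) W
  have hnb : NearBip G (S ∪ W) B N := by
    refine ⟨hAB, fun v hv => ?_, fun v hv => ?_, fun S' hS' T hT hSc hTc hSd' _ => ?_⟩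
    · rcases mem_union.1 hv with h | h
      · linarith [hSout v h, hdB v]
      · obtain ⟨h1, h2⟩ := mem_filter.1 h
        have h3 := hdegN v (sdiff_subset h1)
        have h4 := dg_union (R := G.Adj) v (disjoint_sdiff (s := S) (t := U))
        rw [union_sdiff_of_subset hSU] at h4
        have h5 : (dg G.Adj v U : ℝ) = dg G.Adj v S + dg G.Adj v (U \ S) := by exact_mod_cast h4
        linarith [hdB v]
    · rw [hB, mem_sdiff, hW, mem_filter, not_and, not_lt] at hv
      have h1 : (dg G.Adj v S : ℝ) ≤ dg G.Adj v (S ∪ W) := by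
        exact_mod_cast dg_mono (R := G.Adj) subset_union_left
      linarith [hv.2 hv.1]
    · obtain ⟨u, hu, huW⟩ : ∃ u ∈ S', u ∉ W := by
        by_contra hcon
        push Not at hcon
        have : (S'.card : ℝ) ≤ W.card := by exact_mod_cast card_le_card hcon
        linarith
      have h1 := hSout u ((mem_union.1 (hS' hu)).resolve_right huW)
      have hTD : T ⊆ U \ S := hT.trans sdiff_subset
      have h2 : (dg G.Adj u (U \ S) : ℝ) ≤ dg G.Adj u T + ((U \ S) \ T).card := by
        have h3 := dg_le_sdiff_add (R := G.Adj) u (U \ S) ((U \ S) \ T)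
        rw [Finset.sdiff_sdiff_eq_self hTD] at h3
        exact_mod_cast h3
      have h3 : (((U \ S) \ T).card : ℝ) + T.card = (U \ S).card := by
        exact_mod_cast card_sdiff_add_card_eq_card hTD
      linarith [hSd' u hu]
  rcases le_total N (S ∪ W).card with h | h
  · rw [← hun]
    exact hmain (by omega) hnb hcard h (by linarith) (by rw [hun]; exact hdeg)
  · rw [← hun, union_comm]
    exact hmain (by omega) hnb.symm (by omega) (by omega) (by linarith)
      (by rw [union_comm, hun]; exact hdeg)

set_option maxHeartbeats 1600000 in
/-- The case of an almost disconnected graph. -/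
theorem exists_cp_of_sparse_cut (r : ℕ) (hr : 0 < r) : ∃ N0 : ℕ, ∀ {V : Type} {G : SimpleGraph V}
    {c : Sym2 V → Fin r} {U K : Finset V} {N : ℕ}, N0 ≤ N → K ⊆ U → U.card = 2 * N →
    (1 - 1 / 5000 : ℝ) * N ≤ K.card → (K.card : ℝ) ≤ (1 + 1 / 5000) * N →
    (∀ v ∈ K, (dg G.Adj v (U \ K) : ℝ) ≤ N / 5000) →
    (∀ v ∈ U, (N : ℝ) ≤ dg G.Adj v U) → CP G c ↑U (1800 * r ^ 2) := by
  obtain ⟨N1, hmain⟩ := exists_cp_of_nearClique r hr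
  refine ⟨N1 + 1, fun {V G c U K N} hN hKU hU hK1 hK2 hKd hdeg => ?_⟩
  have hNr : (0 : ℝ) < N := by exact_mod_cast (by omega : 0 < N)
  have hUK : ((U \ K).card : ℝ) + K.card = 2 * N := by
    exact_mod_cast hU ▸ card_sdiff_add_card_eq_card hKU
  have hsplit : ∀ v, (dg G.Adj v U : ℝ) = dg G.Adj v K + dg G.Adj v (U \ K) := fun v => by
    have h1 := dg_union (R := G.Adj) v (disjoint_sdiff (s := K) (t := U))
    rw [union_sdiff_of_subset hKU] at h1
    exact_mod_cast h1
  have hfew : ∀ x : ℝ, 0 < x →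
      (((U \ K).filter fun v => x * N < (dg G.Adj v K : ℝ)).card : ℝ) * x ≤
        (1 + 1 / 5000) * N / 5000 := fun x hx => by
    have h1 := card_filter_mul_le (U \ K) (fun v => (dg G.Adj v K : ℝ)) (fun _ _ => by positivity)
      (x * N)
    have h2 : ∑ v ∈ U \ K, (dg G.Adj v K : ℝ) ≤ K.card * (N / 5000) := by
      have h3 : ∑ v ∈ U \ K, (dg G.Adj v K : ℝ) = ed G.Adj K (U \ K) := by
        rw [ed_comm (fun _ _ h => h.symm)]; simp [ed]
      rw [h3, ← nsmul_eq_mul]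
      unfold ed
      push_cast
      exact sum_le_card_nsmul _ _ _ hKd
    refine le_of_mul_le_mul_right ?_ hNr
    nlinarith
  set R := (U \ K).filter fun v => 1 / 4 * N < (dg G.Adj v K : ℝ) with hR
  set E := (U \ K).filter fun v => 1 / 50 * N < (dg G.Adj v K : ℝ) with hE
  have hRU : R ⊆ U \ K := filter_subset _ _
  have hRc := hfew (1 / 4) (by norm_num)
  have hEc := hfew (1 / 50) (by norm_num)
  rw [← hR] at hRc
  rw [← hE] at hEc
  have hR0 : (0 : ℝ) ≤ R.card := by positivity
  set B := (U \ K) \ R with hB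
  have hKR : Disjoint K R := disjoint_sdiff.mono_right hRU
  have hAB : Disjoint (K ∪ R) B := by
    rw [disjoint_union_left]
    exact ⟨disjoint_sdiff.mono_right sdiff_subset, disjoint_sdiff⟩
  have hun : (K ∪ R) ∪ B = U := by
    rw [union_assoc, hB, union_sdiff_of_subset hRU, union_sdiff_of_subset hKU]
  have hcardA : ((K ∪ R).card : ℝ) = K.card + R.card := by
    exact_mod_cast card_union_of_disjoint hKR
  have hcardB : (B.card : ℝ) + R.card = (U \ K).card := by
    exact_mod_cast card_sdiff_add_card_eq_card hRU
  have hdA : ∀ v, (dg G.Adj v K : ℝ) ≤ dg G.Adj v (K ∪ R) := fun v => by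
    exact_mod_cast dg_mono (R := G.Adj) subset_union_left
  have hdB : ∀ v, (dg G.Adj v (U \ K) : ℝ) ≤ dg G.Adj v B + R.card := fun v => by
    exact_mod_cast dg_le_sdiff_add (R := G.Adj) v (U \ K) R
  have hA := hmain (c := c) (G := G) (D := K ∪ R) (E := R) (N := N) (by omega) (by linarith)
    (by linarith) (fun v hv => by
      rcases mem_union.1 hv with h | h
      · linarith [hdA v, hKd v h, hdeg v (hKU h), hsplit v]
      · linarith [hdA v, (mem_filter.1 h).2]) (by linarith) (fun v hv => by
      rw [mem_sdiff, mem_union] at hv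
      have h := hv.1.resolve_right hv.2
      linarith [hdA v, hKd v h, hdeg v (hKU h), hsplit v])
  have hB' := hmain (c := c) (G := G) (D := B) (E := E) (N := N) (by omega) (by linarith)
    (by linarith) (fun v hv => by
      rw [hB, mem_sdiff, hR, mem_filter, not_and, not_lt] at hv
      linarith [hdB v, hdeg v (sdiff_subset hv.1), hsplit v, hv.2 hv.1]) (by linarith)
    (fun v hv => by
      obtain ⟨h1, h2⟩ := mem_sdiff.1 hv
      have h1' := (mem_sdiff.1 h1).1
      rw [hE, mem_filter, not_and, not_lt] at h2
      linarith [hdB v, hdeg v (sdiff_subset h1'), hsplit v, h2 h1'])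
  have hall := hA.union hB' (by exact_mod_cast hAB)
  rw [← coe_union, hun] at hall
  exact hall.mono (by nlinarith)

end Extremal

section Main
open Finset
open scoped Classical symmDiff

variable {V : Type} {G : SimpleGraph V} {U C : Finset V} {N : ℕ} {u₀ : V}

/-- Many vertices with nearly the same neighbourhood force one of the two extremal structures. -/
lemma exists_sparse_half_or_cut (hU : U.card = 2 * N) (hdeg : ∀ v ∈ U, (N : ℝ) ≤ dg G.Adj v U)
    (hu : u₀ ∈ U) (hN : 0 < N) (hP : (dg G.Adj u₀ U : ℝ) ≤ (1 + 1 / 50000) * N) (hCU : C ⊆ U)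
    (hC : (1 - 1 / 100000 : ℝ) * N ≤ C.card)
    (hCd : ∀ v ∈ C, ((U.filter (G.Adj v) ∆ U.filter (G.Adj u₀)).card : ℝ) ≤ N / 19000) :
    (∃ S ⊆ U, (1 - 1 / 5000 : ℝ) * N ≤ S.card ∧ S.card ≤ N ∧
      ∀ v ∈ S, (dg G.Adj v S : ℝ) ≤ N / 5000) ∨
    ∃ K ⊆ U, (1 - 1 / 5000 : ℝ) * N ≤ K.card ∧ (K.card : ℝ) ≤ (1 + 1 / 5000) * N ∧
      ∀ v ∈ K, (dg G.Adj v (U \ K) : ℝ) ≤ N / 5000 := by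
  have hNr : (0 : ℝ) < N := by exact_mod_cast hN
  set P := U.filter (G.Adj u₀) with hPdef
  have hPU : P ⊆ U := filter_subset _ _
  change (P.card : ℝ) ≤ _ at hP
  have hP' : N ≤ P.card := by exact_mod_cast hdeg u₀ hu
  have hQ : ∀ v ∈ C, (dg G.Adj v (U \ P) : ℝ) ≤ N / 19000 := fun v hv => by
    refine le_trans ?_ (hCd v hv)
    exact_mod_cast card_le_card fun x hx => by
      simp only [mem_filter, mem_sdiff, mem_symmDiff] at hx ⊢
      tauto
  have hPd : ∀ v ∈ C, (C ∩ P).card ≤ dg G.Adj v (C ∩ P) + (N / 19000 : ℝ) := fun v hv => by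
    have h1 : (C ∩ P).card ≤ dg G.Adj v (C ∩ P) +
        (U.filter (G.Adj v) ∆ U.filter (G.Adj u₀)).card := by
      refine (card_le_card fun x hx => ?_).trans (card_union_le _ _)
      have := @hPU x
      simp only [mem_union, mem_inter, mem_filter, mem_symmDiff,
        hPdef] at hx this ⊢
      tauto
    have h2 : ((C ∩ P).card : ℝ) ≤ dg G.Adj v (C ∩ P) +
        (U.filter (G.Adj v) ∆ U.filter (G.Adj u₀)).card := by exact_mod_cast h1
    linarith [hCd v hv]
  have hsum : ((C ∩ P).card : ℝ) + (C \ P).card = C.card := by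
    exact_mod_cast card_inter_add_card_sdiff C P
  have hed1 : ((C \ P).card : ℝ) * ((C ∩ P).card - N / 19000) ≤ ed G.Adj (C \ P) (C ∩ P) := by
    rw [← nsmul_eq_mul]
    unfold ed
    push_cast
    exact card_nsmul_le_sum _ _ _ fun v hv => by linarith [hPd v (sdiff_subset hv)]
  have hed2 : (ed G.Adj (C \ P) (C ∩ P) : ℝ) ≤ (C ∩ P).card * (N / 19000) := by
    rw [ed_comm (fun _ _ h => h.symm), ← nsmul_eq_mul]
    unfold ed
    push_cast
    refine sum_le_card_nsmul _ _ _ fun v hv => ?_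
    refine le_trans ?_ (hQ v (inter_subset_left hv))
    exact_mod_cast dg_mono (R := G.Adj) (sdiff_subset_sdiff hCU subset_rfl)
  rcases le_or_gt ((C ∩ P).card : ℝ) (2 * (N / 19000)) with h | h
  · refine .inl ⟨C \ P, sdiff_subset.trans hCU, by linarith, ?_, fun v hv => ?_⟩
    · have h1 := card_le_card (sdiff_subset_sdiff hCU (subset_refl P))
      have h2 := card_sdiff_add_card_eq_card hPU
      omega
    · have h1 : (dg G.Adj v (C \ P) : ℝ) ≤ dg G.Adj v (U \ P) := by
        exact_mod_cast dg_mono (R := G.Adj) (sdiff_subset_sdiff hCU subset_rfl)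
      linarith [hQ v (sdiff_subset hv)]
  · have h' : ((C \ P).card : ℝ) ≤ 2 * (N / 19000) := by
      by_contra hcon
      push Not at hcon
      nlinarith
    have hCP : ((C ∩ P).card : ℝ) ≤ P.card := by
      exact_mod_cast card_le_card inter_subset_right
    refine .inr ⟨C ∩ P, inter_subset_left.trans hCU, by linarith, by linarith,
      fun v hv => ?_⟩
    have h1 : dg G.Adj v (U \ (C ∩ P)) ≤ dg G.Adj v (U \ P) + (P \ (C ∩ P)).card := by
      refine (card_le_card fun x hx => ?_).trans (card_union_le _ _)
      simp only [mem_union, mem_inter, mem_filter, mem_sdiff] at hx ⊢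
      tauto
    have h2 : ((P \ (C ∩ P)).card : ℝ) + (C ∩ P).card = P.card := by
      exact_mod_cast card_sdiff_add_card_eq_card inter_subset_right
    have h1' : (dg G.Adj v (U \ (C ∩ P)) : ℝ) ≤ dg G.Adj v (U \ P) + (P \ (C ∩ P)).card := by
      exact_mod_cast h1
    linarith [hQ v (inter_subset_left hv)]

set_option maxHeartbeats 1600000 in
/-- Either some balanced split of `U` is a core, or one of the extremal structures appears. -/
lemma exists_core_or_sparse : ∃ N0 : ℕ, ∀ {V : Type} {G : SimpleGraph V} {U : Finset V} {N : ℕ},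
    N0 ≤ N → U.card = 2 * N → (∀ v ∈ U, (N : ℝ) ≤ dg G.Adj v U) →
    (∃ A B, A ∪ B = U ∧ Core G A B (1 / 2 - 1 / 2500000) (1 / 250000) N) ∨
    (∃ S ⊆ U, (1 - 1 / 5000 : ℝ) * N ≤ S.card ∧ S.card ≤ N ∧
      ∀ v ∈ S, (dg G.Adj v S : ℝ) ≤ N / 5000) ∨
    ∃ K ⊆ U, (1 - 1 / 5000 : ℝ) * N ≤ K.card ∧ (K.card : ℝ) ≤ (1 + 1 / 5000) * N ∧
      ∀ v ∈ K, (dg G.Adj v (U \ K) : ℝ) ≤ N / 5000 := by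
  obtain ⟨N1, hsplit⟩ := exists_balanced_split (ξ := 1 / 2500000) 8 (by norm_num)
  refine ⟨N1 + 1, fun {V G U N} hN hU hdeg => ?_⟩
  have hN0 : 0 < N := by omega
  have hNr : (0 : ℝ) < N := by exact_mod_cast hN0
  let nb : V → Finset V := fun v => U.filter (G.Adj v)
  let Cl : V → Finset V := fun u => U.filter fun v => ((nb v ∆ nb u).card : ℝ) ≤ N / 19000
  obtain ⟨A, B, hAB, hABU, hA, hB, hbal⟩ := hsplit U
    (U.image nb ∪ (U ×ˢ U).image (fun p => nb p.1 ∆ nb p.2) ∪ U.image Cl) N (by omega) hU (by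
      have h1 : (U.image nb).card ≤ 2 * N := hU ▸ card_image_le
      have h2 : ((U ×ˢ U).image (fun p => nb p.1 ∆ nb p.2)).card ≤ 2 * N * (2 * N) := by
        rw [← hU, ← card_product]; exact card_image_le
      have h3 : (U.image Cl).card ≤ 2 * N := hU ▸ card_image_le
      refine (card_union_le _ _).trans ((Nat.add_le_add_right (card_union_le _ _) _
        ).trans ?_)
      nlinarith)
  have hAU : A ⊆ U := hABU ▸ subset_union_left
  have hBU : B ⊆ U := hABU ▸ subset_union_right
  have hsum : ∀ F ⊆ U, (F.card : ℝ) = (F ∩ A).card + (F ∩ B).card := fun F hF => by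
    rw [← Nat.cast_add, ← card_union_of_disjoint
      (hAB.mono inter_subset_right inter_subset_right), ← inter_union_distrib_left,
      hABU, inter_eq_left.2 hF]
  have hdAB : ∀ v ∈ U, |(dg G.Adj v A : ℝ) - dg G.Adj v B| ≤ 1 / 2500000 * N ∧
      (dg G.Adj v U : ℝ) = dg G.Adj v A + dg G.Adj v B := fun v hv => by
    have h1 := hbal (nb v) (by simp only [mem_union, mem_image]; grind)
    rw [filter_inter_of_subset _ hAU, filter_inter_of_subset _ hBU] at h1
    exact ⟨h1, by exact_mod_cast hABU ▸ dg_union (R := G.Adj) v hAB⟩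
  have hdA : ∀ v ∈ U, (1 / 2 - 1 / 2500000 : ℝ) * N ≤ dg G.Adj v A ∧
      (1 / 2 - 1 / 2500000 : ℝ) * N ≤ dg G.Adj v B := fun v hv => by
    obtain ⟨h1, h2⟩ := hdAB v hv
    rw [abs_le] at h1
    have := hdeg v hv
    constructor <;> linarith
  by_cases hdense : ∀ S ⊆ A, ∀ T ⊆ B,
      (1 / 2 - 1 / 2500000 - 1 / 250000 : ℝ) * N ≤ S.card →
      (1 / 2 - 1 / 2500000 - 1 / 250000 : ℝ) * N ≤ T.card →
      (∀ u ∈ S, (dg G.Adj u T : ℝ) ≤ 1 / 250000 * N) →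
      (∀ v ∈ T, (dg G.Adj v S : ℝ) ≤ 1 / 250000 * N) → False
  · exact .inl ⟨A, B, hABU, hAB, hA, hB, fun v hv => (hdA v (hAU hv)).2,
      fun v hv => (hdA v (hBU hv)).1, hdense⟩
  right
  push Not at hdense
  obtain ⟨S, hS, T, hT, hSc, hTc, hSd, -, -⟩ := hdense
  obtain ⟨u₀, hu₀⟩ : S.Nonempty := by
    rw [← card_pos, ← Nat.cast_pos (α := ℝ)]
    linarith
  have hu₀U := hAU (hS hu₀)
  have hBT : ((B \ T).card : ℝ) + T.card = N := by
    exact_mod_cast hB ▸ card_sdiff_add_card_eq_card hT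
  have hdBT : ∀ v, (dg G.Adj v B : ℝ) = dg G.Adj v T + dg G.Adj v (B \ T) := fun v => by
    have h1 := dg_union (R := G.Adj) v (disjoint_sdiff (s := T) (t := B))
    rw [union_sdiff_of_subset hT] at h1
    exact_mod_cast h1
  have hmiss : ∀ u ∈ S, (((B \ T).filter fun x => ¬ G.Adj u x).card : ℝ) ≤ 22 / 2500000 * N :=
    fun u hu => by
      have h1 : (dg G.Adj u (B \ T) : ℝ) + ((B \ T).filter fun x => ¬ G.Adj u x).card =
          (B \ T).card := by
        exact_mod_cast card_filter_add_card_filter_not (s := B \ T) (G.Adj u)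
      linarith [hdBT u, hSd u hu, (hdA u (hAU (hS hu))).2]
  have hclose : S ⊆ Cl u₀ ∩ A := fun u hu => by
    have huU := hAU (hS hu)
    refine mem_inter.2 ⟨mem_filter.2 ⟨huU, ?_⟩, hS hu⟩
    have h1 : ((nb u ∆ nb u₀) ∩ B).card ≤ dg G.Adj u T + dg G.Adj u₀ T +
        (((B \ T).filter fun x => ¬ G.Adj u x).card + ((B \ T).filter fun x => ¬ G.Adj u₀ x).card) := by
      refine (card_le_card (t := (T.filter (G.Adj u) ∪ T.filter (G.Adj u₀)) ∪
        (((B \ T).filter fun x => ¬ G.Adj u x) ∪ (B \ T).filter fun x => ¬ G.Adj u₀ x))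
        fun x hx => ?_).trans ((card_union_le _ _).trans
          (add_le_add (card_union_le _ _) (card_union_le _ _)))
      simp only [nb, mem_union, mem_inter, mem_filter, mem_sdiff,
        mem_symmDiff] at hx ⊢
      tauto
    have h1' : (((nb u ∆ nb u₀) ∩ B).card : ℝ) ≤ dg G.Adj u T + dg G.Adj u₀ T +
        (((B \ T).filter fun x => ¬ G.Adj u x).card + ((B \ T).filter fun x => ¬ G.Adj u₀ x).card) := by
      exact_mod_cast h1
    have h2 := hbal (nb u ∆ nb u₀) (mem_union_left _ (mem_union_right _
      (mem_image.2 ⟨(u, u₀), mem_product.2 ⟨huU, hu₀U⟩, rfl⟩)))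
    have h3 := hsum (nb u ∆ nb u₀) fun x hx => by
      simp only [nb, mem_filter, mem_symmDiff] at hx
      tauto
    rw [abs_le] at h2
    linarith [hSd u hu, hSd u₀ hu₀, hmiss u hu, hmiss u₀ hu₀]
  refine exists_sparse_half_or_cut (C := Cl u₀) hU hdeg hu₀U hN0 ?_ (filter_subset _ _) ?_
    fun v hv => (mem_filter.1 hv).2
  · obtain ⟨h1, h2⟩ := hdAB u₀ hu₀U
    rw [abs_le] at h1
    have h3 : (dg G.Adj u₀ (B \ T) : ℝ) ≤ (B \ T).card := by exact_mod_cast dg_le_card u₀ _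
    linarith [hdBT u₀, hSd u₀ hu₀]
  · have h1 := hbal (Cl u₀) (mem_union_right _ (mem_image_of_mem _ hu₀U))
    have h2 := hsum (Cl u₀) (filter_subset _ _)
    have h3 : (S.card : ℝ) ≤ (Cl u₀ ∩ A).card := by exact_mod_cast card_le_card hclose
    rw [abs_le] at h1
    linarith

/-- The even-order case. -/
theorem exists_cp_of_card_even (r : ℕ) (hr : 0 < r) : ∃ N0 : ℕ, ∀ {V : Type} {G : SimpleGraph V}
    {c : Sym2 V → Fin r} {U : Finset V} {N : ℕ}, N0 ≤ N → U.card = 2 * N →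
    (∀ v ∈ U, (N : ℝ) + 1000 * r * Real.log N ≤ dg G.Adj v U) →
    CP G c ↑U (4000026 * r ^ 2) := by
  obtain ⟨N1, hcore⟩ := Core.exists_cp (θ := 1 / 2 - 1 / 2500000) (η := 1 / 250000) r
    (4000000 * r ^ 2) (13 * r) hr (by norm_num) (by norm_num) (by norm_num)
    (by push_cast; linarith) (by push_cast; linarith)
  obtain ⟨N2, hhalf⟩ := exists_cp_of_sparse_half r hr
  obtain ⟨N3, hcut⟩ := exists_cp_of_sparse_cut r hr
  obtain ⟨N4, hcases⟩ := exists_core_or_sparse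
  refine ⟨N1 + N2 + N3 + N4, fun {V G c U N} hN hU hdeg => ?_⟩
  have hdegN : ∀ v ∈ U, (N : ℝ) ≤ dg G.Adj v U := fun v hv => by
    have h1 := hdeg v hv
    have h2 : (0 : ℝ) ≤ 1000 * r * Real.log N := by positivity
    linarith
  rcases hcases (by omega) hU hdegN with ⟨A, B, hAB, h⟩ | ⟨S, h1, h2, h3, h4⟩ | ⟨K, h1, h2, h3, h4⟩
  · rw [← hAB]
    exact (hcore (by omega) h).mono (by nlinarith)
  · exact (hhalf (by omega) h1 hU h2 h3 h4 hdeg).mono (by nlinarith)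
  · exact (hcut (by omega) h1 hU h2 h3 h4 hdegN).mono (by nlinarith)

end Main

theorem monochromatic_cycle_partition_of_min_degree (r : ℕ) (hr : 2 ≤ r) :
    ∃ n₀ : ℕ, ∀ n : ℕ, n₀ ≤ n →
      ∀ (W : Type) [Fintype W], ∀ (G : SimpleGraph W) (c : Sym2 W → Fin r),
        Fintype.card W = n →
        (∀ v : W, (n : ℝ) / 2 + 1200 * r * Real.log n ≤ ((G.neighborSet v).ncard : ℝ)) →
        MonoCyclePartition G c (10 ^ 7 * r ^ 2) := by
  classical
  obtain ⟨N1, hmain⟩ := exists_cp_of_card_even r (by omega)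
  obtain ⟨N2, hlog⟩ := exists_log_le (ε := 1) one_pos
  refine ⟨2 * N1 + 2 * N2 + 2, fun n hn W _ G c hW hdeg => ?_⟩
  obtain ⟨U, hU, hUc, hrest⟩ := exists_even_subset (G := G) (c := c) (Finset.univ : Finset W)
  rw [Finset.card_univ, hW] at hUc
  have hsd := Finset.card_sdiff_add_card_eq_card hU
  rw [Finset.card_univ, hW] at hsd
  have hcp := hmain (c := c) (G := G) (U := U) (N := n / 2) (by omega) hUc fun v _ => by
    have h1 : (G.neighborSet v).ncard = dg G.Adj v Finset.univ := by
      rw [dg, ← Set.ncard_coe_finset]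
      congr 1
      ext x
      simp
    have h2 := dg_le_sdiff_add (R := G.Adj) v Finset.univ (Finset.univ \ U)
    rw [Finset.sdiff_sdiff_eq_self hU] at h2
    have h3 : (dg G.Adj v Finset.univ : ℝ) ≤ dg G.Adj v U + 1 := by
      exact_mod_cast h2.trans (by omega)
    have h4 := hdeg v
    rw [h1] at h4
    have h5 : ((n / 2 : ℕ) : ℝ) ≤ n / 2 := Nat.cast_div_le
    have h6 := (hlog (n / 2) (by omega)).2
    have h7 : Real.log (n / 2 : ℕ) ≤ Real.log n :=
      Real.log_le_log (by exact_mod_cast (by omega : 0 < n / 2))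
        (by exact_mod_cast Nat.div_le_self n 2)
    have hr' : (2 : ℝ) ≤ r := by exact_mod_cast hr
    nlinarith
  have hall := hcp.union hrest (by exact_mod_cast Finset.disjoint_sdiff)
  rw [← Finset.coe_union, Finset.union_sdiff_of_subset hU, Finset.coe_univ] at hall
  exact (hall.mono (by nlinarith)).monoCyclePartition

end Paper
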